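/- (Bilinear estimate for the operator G) Let 0 ≤ α ≤ 1 and 1 < p,q < ∞. For all smooth space-time functions f, g ∈ S(ℝ²), ‖D_x^α G(f,g)‖_{L^p_x L^q_T} ≲ ‖D_x^{γ₁} f‖_{L^{p₁}_x L^{q₁}_T} ‖D_x^{γ₂} g‖_{L^{p₂}_x L^{q₂}_T}, where 0 ≤ γ₁,γ₂ ≤ 1, γ₁ + γ₂ = α + 1, 1 < p₁,q₁,p₂,q₂ < ∞, 1/p₁ + 1/p₂ = 1/p and 1/q₁ + 1/q₂ = 1/q. -/

import Mathlib

open MeasureTheory Real Set Filter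
open scoped FourierTransform ENNReal NNReal Topology

noncomputable section

/-- Fourier multiplier operator with symbol `m`. -/
def FMul (m : ℝ → ℂ) (f : ℝ → ℂ) : ℝ → ℂ :=
  𝓕⁻ fun ξ => m ξ * 𝓕 f ξ

/-- `D_x^α`, the Fourier multiplier with symbol `|ξ|^α`. -/
def Dop (α : ℝ) (f : ℝ → ℂ) : ℝ → ℂ :=
  FMul (fun ξ => ((|ξ| ^ α : ℝ) : ℂ)) f

/-- The free Benjamin–Ono group `V(t) = 𝓕⁻¹ e^{itξ|ξ|} 𝓕`. -/
def BOGroup (t : ℝ) (f : ℝ → ℂ) : ℝ → ℂ :=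
  FMul (fun ξ => Complex.exp (Complex.I * (t * ξ * |ξ|))) f

/-- The derivative `∂ₓ` as the Fourier multiplier with symbol `iξ`. -/
def Dx1 (f : ℝ → ℂ) : ℝ → ℂ :=
  FMul (fun ξ => Complex.I * ξ) f

/-- Projection on nonnegative frequencies. -/
def Pplus (f : ℝ → ℂ) : ℝ → ℂ :=
  FMul (fun ξ => if 0 ≤ ξ then 1 else 0) f

/-- Projection on nonpositive frequencies. -/
def Pminus (f : ℝ → ℂ) : ℝ → ℂ :=
  FMul (fun ξ => if ξ ≤ 0 then 1 else 0) f

/-- The Sobolev `H^s` norm. -/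
def HsNorm (s : ℝ) (f : ℝ → ℂ) : ℝ≥0∞ :=
  eLpNorm (fun ξ => (((1 + ξ ^ 2) ^ (s / 2) : ℝ) : ℂ) * 𝓕 f ξ) 2 volume

/-- The mixed space-time norm `L^p_x L^q_T`. -/
def LpLq (p q : ℝ≥0∞) (T : ℝ) (f : ℝ → ℝ → ℂ) : ℝ≥0∞ :=
  eLpNorm (fun x => (eLpNorm (fun t => f x t) q (volume.restrict (Ioc (0:ℝ) T))).toReal) p volume

/-- The mixed space-time norm `L^q_T L^p_x`. -/
def LqLp (q p : ℝ≥0∞) (T : ℝ) (f : ℝ → ℝ → ℂ) : ℝ≥0∞ :=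
  eLpNorm (fun t => (eLpNorm (fun x => f x t) p volume).toReal) q (volume.restrict (Ioc (0:ℝ) T))

/-- The norm `L^∞_T H^s_x`. -/
def LinfHs (s : ℝ) (T : ℝ) (f : ℝ → ℝ → ℂ) : ℝ≥0∞ :=
  eLpNorm (fun t => (HsNorm s (fun x => f x t)).toReal) ∞ (volume.restrict (Ioc (0:ℝ) T))

/-- Apply a spatial operator slice-wise in time. -/
def sliceOp (A : (ℝ → ℂ) → (ℝ → ℂ)) (f : ℝ → ℝ → ℂ) : ℝ → ℝ → ℂ :=
  fun x t => A (fun y => f y t) x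

/-- A smooth nonnegative bump `η` supported in `{1/2 ≤ |ξ| ≤ 2}` giving a dyadic
partition of unity `Σ_k η(2^{-k} ξ) = 1` for `ξ ≠ 0`. -/
structure IsLPBump (η : ℝ → ℝ) : Prop where
  smooth : ContDiff ℝ (⊤ : ℕ∞) η
  nonneg : ∀ ξ, 0 ≤ η ξ
  support : ∀ ξ, η ξ ≠ 0 → 1/2 ≤ |ξ| ∧ |ξ| ≤ 2
  partition : ∀ ξ : ℝ, ξ ≠ 0 → ∑' k : ℤ, η ((2:ℝ) ^ (-k) * ξ) = 1

/-- The low-frequency symbol `p(ξ) = Σ_{j ≤ -3} η(2^{-j} ξ)`. -/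
def lowSymbol (η : ℝ → ℝ) (ξ : ℝ) : ℝ :=
  ∑' j : ℤ, if j ≤ -3 then η ((2:ℝ) ^ (-j) * ξ) else 0

/-- The low-frequency projection `P₀`. -/
def P0 (η : ℝ → ℝ) (f : ℝ → ℂ) : ℝ → ℂ :=
  FMul (fun ξ => ((lowSymbol η ξ : ℝ) : ℂ)) f

/-- The `X^s_T` norm. -/
def XNorm (η : ℝ → ℝ) (s T : ℝ) (u : ℝ → ℝ → ℂ) : ℝ≥0∞ :=
  LinfHs s T u + LpLq ∞ 2 T (sliceOp (Dop (s + 1/2)) u)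
    + LpLq 4 ∞ T (sliceOp (Dop (s - 1/4)) u)
    + LpLq 2 ∞ T (sliceOp (P0 η) u)

/-- The Duhamel integral `∫₀ᵗ V(t-τ) f(τ) dτ`. -/
def duhamel (f : ℝ → ℝ → ℂ) : ℝ → ℝ → ℂ :=
  fun x t => ∫ τ in Ioc (0:ℝ) t, BOGroup (t - τ) (fun y => f y τ) x

/-- The bilinear operator
`G(f,g) = ∂_x⁻¹(-i P₊f_x · P₊g_x + i P₋f_x · P₋g_x)`. -/
def Gbil (f g : ℝ → ℂ) : ℝ → ℂ :=
  FMul (fun ξ => if ξ = 0 then 0 else (Complex.I * ξ)⁻¹)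
    (fun y => -Complex.I * Pplus (Dx1 f) y * Pplus (Dx1 g) y
      + Complex.I * Pminus (Dx1 f) y * Pminus (Dx1 g) y)

namespace MixedNorm

section

variable {α τ : Type*} [MeasurableSpace α] [MeasurableSpace τ]

/-- The `L^q(μ)` norm of a nonnegative function, for a real exponent. -/
def Lnorm (q : ℝ) (μ : Measure α) (f : α → ℝ≥0∞) : ℝ≥0∞ :=
  (∫⁻ x, f x ^ q ∂μ) ^ (1 / q)

/-- The mixed norm `L^p_x L^q(ν)` of a nonnegative function. -/
def mixedNorm (p q : ℝ) (ν : Measure τ) (F : ℝ → τ → ℝ≥0∞) : ℝ≥0∞ :=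
  Lnorm p volume fun x => Lnorm q ν (F x)

lemma Lnorm_rpow_self {q : ℝ} (hq : 0 < q) (μ : Measure α) (f : α → ℝ≥0∞) :
    Lnorm q μ f ^ q = ∫⁻ x, f x ^ q ∂μ := by
  rw [Lnorm, ← ENNReal.rpow_mul, one_div_mul_cancel hq.ne', ENNReal.rpow_one]

lemma Lnorm_mono_ae {q : ℝ} (hq : 0 < q) {μ : Measure α} {f g : α → ℝ≥0∞}
    (h : ∀ᵐ x ∂μ, f x ≤ g x) : Lnorm q μ f ≤ Lnorm q μ g := by
  refine ENNReal.rpow_le_rpow (lintegral_mono_ae ?_) (by positivity)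
  filter_upwards [h] with x hx
  exact ENNReal.rpow_le_rpow hx hq.le

lemma Lnorm_mono {q : ℝ} (hq : 0 < q) {μ : Measure α} {f g : α → ℝ≥0∞}
    (h : ∀ x, f x ≤ g x) : Lnorm q μ f ≤ Lnorm q μ g :=
  Lnorm_mono_ae hq (ae_of_all _ h)

lemma Lnorm_const_mul {q : ℝ} (hq : 0 < q) {μ : Measure α} (c : ℝ≥0∞) {f : α → ℝ≥0∞}
    (hf : Measurable f) : Lnorm q μ (fun x => c * f x) = c * Lnorm q μ f := by
  simp only [Lnorm, ENNReal.mul_rpow_of_nonneg _ _ hq.le]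
  rw [lintegral_const_mul _ (hf.pow_const _), ENNReal.mul_rpow_of_nonneg _ _ (by positivity),
    ← ENNReal.rpow_mul, mul_one_div_cancel hq.ne', ENNReal.rpow_one]

lemma Lnorm_add_le {q : ℝ} (hq : 1 ≤ q) {μ : Measure α} {f g : α → ℝ≥0∞}
    (hf : Measurable f) (hg : Measurable g) :
    Lnorm q μ (fun x => f x + g x) ≤ Lnorm q μ f + Lnorm q μ g :=
  ENNReal.lintegral_Lp_add_le hf.aemeasurable hg.aemeasurable hq

lemma Lnorm_zero {q : ℝ} (hq : 0 < q) {μ : Measure α} :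
    Lnorm q μ (fun _ => 0) = 0 := by
  simp [Lnorm, hq]

lemma Lnorm_iSup {q : ℝ} (hq : 0 < q) {μ : Measure α} {f : ℕ → α → ℝ≥0∞}
    (hf : ∀ n, Measurable (f n)) (hmono : Monotone f) :
    Lnorm q μ (fun x => ⨆ n, f n x) = ⨆ n, Lnorm q μ (f n) := by
  have h1 : ∀ (r : ℝ) (_ : 0 < r) (u : ℕ → ℝ≥0∞), (⨆ n, u n) ^ r = ⨆ n, u n ^ r := fun r hr u =>
    (ENNReal.orderIsoRpow r hr).map_iSup u
  simp only [Lnorm, h1 q hq]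
  rw [lintegral_iSup (fun n => (hf n).pow_const _), h1 _ (by positivity)]
  intro m n hmn x
  exact ENNReal.rpow_le_rpow (hmono hmn x) hq.le

lemma Lnorm_tsum_le {q : ℝ} (hq : 1 ≤ q) {μ : Measure α} {f : ℕ → α → ℝ≥0∞}
    (hf : ∀ n, Measurable (f n)) :
    Lnorm q μ (fun x => ∑' n, f n x) ≤ ∑' n, Lnorm q μ (f n) := by
  have hq0 : 0 < q := by linarith
  have hfin : ∀ n, Lnorm q μ (fun x => ∑ i ∈ Finset.range n, f i x)
      ≤ ∑ i ∈ Finset.range n, Lnorm q μ (f i) := by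
    intro n
    induction n with
    | zero => simp [Lnorm_zero hq0]
    | succ n ih =>
      simp only [Finset.sum_range_succ]
      refine (Lnorm_add_le hq (Finset.measurable_fun_sum _ fun i _ => hf i) (hf n)).trans ?_
      gcongr
  simp only [ENNReal.tsum_eq_iSup_nat]
  rw [Lnorm_iSup hq0 (fun n => Finset.measurable_fun_sum _ fun i _ => hf i)]
  · exact iSup_mono hfin
  · intro m n hmn x
    exact Finset.sum_le_sum_of_subset (Finset.range_mono hmn)

lemma lintegral_mul_le_Lnorm {q q' : ℝ} (hq : q.HolderConjugate q') {μ : Measure α}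
    {f g : α → ℝ≥0∞} (hf : Measurable f) (hg : Measurable g) :
    ∫⁻ x, f x * g x ∂μ ≤ Lnorm q μ f * Lnorm q' μ g :=
  ENNReal.lintegral_mul_le_Lp_mul_Lq μ hq hf.aemeasurable hg.aemeasurable

lemma Lnorm_mul_le {q q₁ q₂ : ℝ} (hq : 0 < q) (hq₁ : 0 < q₁) (hq₂ : 0 < q₂)
    (h : 1 / q₁ + 1 / q₂ = 1 / q) {μ : Measure α} {f g : α → ℝ≥0∞}
    (hf : Measurable f) (hg : Measurable g) :
    Lnorm q μ (fun x => f x * g x) ≤ Lnorm q₁ μ f * Lnorm q₂ μ g := by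
  have : q < q₁ := by
    have h2 : 0 < 1 / q₂ := by positivity
    exact (one_div_lt_one_div hq₁ hq).1 (by linarith)
  exact ENNReal.lintegral_Lp_mul_le_Lq_mul_Lr hq this h.symm μ hf.aemeasurable hg.aemeasurable

lemma Lnorm_rpow {q s : ℝ} (hs : 0 < s) {μ : Measure α} (f : α → ℝ≥0∞) :
    Lnorm q μ (fun x => f x ^ s) = Lnorm (q * s) μ f ^ s := by
  simp only [Lnorm, ← ENNReal.rpow_mul]
  rw [mul_comm s q]
  congr 1
  field_simp

lemma ae_lt_top_of_Lnorm {q : ℝ} (hq : 0 < q) {μ : Measure α} {f : α → ℝ≥0∞}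
    (hf : Measurable f) (h : Lnorm q μ f ≠ ∞) : ∀ᵐ x ∂μ, f x < ∞ := by
  have h1 : ∫⁻ x, f x ^ q ∂μ ≠ ∞ := by
    rw [← Lnorm_rpow_self hq]
    exact ENNReal.rpow_ne_top_of_nonneg hq.le h
  filter_upwards [ae_lt_top (hf.pow_const _) h1] with x hx
  exact (ENNReal.rpow_lt_top_iff_of_pos hq).1 hx

lemma measurable_Lnorm {q : ℝ} {ν : Measure τ} [SFinite ν] {F : ℝ → τ → ℝ≥0∞}
    (hF : Measurable (Function.uncurry F)) : Measurable fun x => Lnorm q ν (F x) :=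
  (Measurable.lintegral_prod_right' (f := fun z => Function.uncurry F z ^ q)
    (hF.pow_const _)).pow_const _

section Mixed

variable {p q p' q' : ℝ} {ν : Measure τ} {F G : ℝ → τ → ℝ≥0∞}

lemma mixedNorm_mono (hp : 0 < p) (hq : 0 < q) (h : ∀ x t, F x t ≤ G x t) :
    mixedNorm p q ν F ≤ mixedNorm p q ν G :=
  Lnorm_mono hp fun x => Lnorm_mono hq (h x)

lemma mixedNorm_rpow {s : ℝ} (hs : 0 < s) :
    mixedNorm p q ν (fun x t => F x t ^ s) = mixedNorm (p * s) (q * s) ν F ^ s := by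
  simp only [mixedNorm, Lnorm_rpow hs]

variable [SFinite ν]

lemma mixedNorm_const_mul (hp : 0 < p) (hq : 0 < q) (c : ℝ≥0∞)
    (hF : Measurable (Function.uncurry F)) :
    mixedNorm p q ν (fun x t => c * F x t) = c * mixedNorm p q ν F := by
  simp only [mixedNorm]
  rw [← Lnorm_const_mul hp c (measurable_Lnorm hF)]
  congr 1
  ext x
  exact Lnorm_const_mul hq c hF.of_uncurry_left

lemma mixedNorm_add_le (hp : 1 ≤ p) (hq : 1 ≤ q) (hF : Measurable (Function.uncurry F))
    (hG : Measurable (Function.uncurry G)) :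
    mixedNorm p q ν (fun x t => F x t + G x t) ≤ mixedNorm p q ν F + mixedNorm p q ν G := by
  refine le_trans (Lnorm_mono (by linarith) fun x => ?_)
    (Lnorm_add_le hp (measurable_Lnorm hF) (measurable_Lnorm hG))
  exact Lnorm_add_le hq hF.of_uncurry_left hG.of_uncurry_left

lemma mixedNorm_tsum_le (hp : 1 ≤ p) (hq : 1 ≤ q) {f : ℕ → ℝ → τ → ℝ≥0∞}
    (hf : ∀ n, Measurable (Function.uncurry (f n))) :
    mixedNorm p q ν (fun x t => ∑' n, f n x t) ≤ ∑' n, mixedNorm p q ν (f n) := by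
  refine le_trans (Lnorm_mono (by linarith) fun x => ?_)
    (Lnorm_tsum_le hp fun n => measurable_Lnorm (hf n))
  exact Lnorm_tsum_le hq fun n => (hf n).of_uncurry_left

lemma mixedNorm_iSup (hp : 0 < p) (hq : 0 < q) {f : ℕ → ℝ → τ → ℝ≥0∞}
    (hf : ∀ n, Measurable (Function.uncurry (f n))) (hmono : Monotone f) :
    mixedNorm p q ν (fun x t => ⨆ n, f n x t) = ⨆ n, mixedNorm p q ν (f n) := by
  simp only [mixedNorm]
  rw [← Lnorm_iSup hp (fun n => measurable_Lnorm (hf n))]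
  · congr 1
    ext x
    exact Lnorm_iSup hq (fun n => (hf n).of_uncurry_left) fun m n h => hmono h x
  · intro m n hmn x
    exact Lnorm_mono hq fun t => hmono hmn x t

lemma lintegral_mul_le_mixedNorm (hp : p.HolderConjugate p') (hq : q.HolderConjugate q')
    (hF : Measurable (Function.uncurry F)) (hG : Measurable (Function.uncurry G)) :
    ∫⁻ x, ∫⁻ t, F x t * G x t ∂ν ≤ mixedNorm p q ν F * mixedNorm p' q' ν G := by
  refine le_trans (lintegral_mono fun x => ?_)
    (lintegral_mul_le_Lnorm hp (measurable_Lnorm hF) (measurable_Lnorm hG))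
  exact lintegral_mul_le_Lnorm hq hF.of_uncurry_left hG.of_uncurry_left

lemma mixedNorm_mul_le {p₁ q₁ p₂ q₂ : ℝ} (hp : 0 < p) (hq : 0 < q) (hp₁ : 0 < p₁) (hq₁ : 0 < q₁)
    (hp₂ : 0 < p₂) (hq₂ : 0 < q₂) (hps : 1 / p₁ + 1 / p₂ = 1 / p) (hqs : 1 / q₁ + 1 / q₂ = 1 / q)
    (hF : Measurable (Function.uncurry F)) (hG : Measurable (Function.uncurry G)) :
    mixedNorm p q ν (fun x t => F x t * G x t)
      ≤ mixedNorm p₁ q₁ ν F * mixedNorm p₂ q₂ ν G := by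
  refine le_trans (Lnorm_mono hp fun x => ?_)
    (Lnorm_mul_le hp hp₁ hp₂ hps (measurable_Lnorm hF) (measurable_Lnorm hG))
  exact Lnorm_mul_le hq hq₁ hq₂ hqs hF.of_uncurry_left hG.of_uncurry_left

lemma ae_lt_top_of_mixedNorm (hp : 0 < p) (hq : 0 < q) (hF : Measurable (Function.uncurry F))
    (h : mixedNorm p q ν F ≠ ∞) : ∀ᵐ t ∂ν, ∀ᵐ x, F x t < ∞ := by
  have h1 := ae_lt_top_of_Lnorm hp (measurable_Lnorm hF) h
  have h2 : ∀ᵐ x, ∀ᵐ t ∂ν, F x t < ∞ := by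
    filter_upwards [h1] with x hx
    exact ae_lt_top_of_Lnorm hq hF.of_uncurry_left hx.ne
  exact (Measure.ae_ae_comm (μ := volume) (ν := ν) (p := fun x t => F x t < ∞)
    (measurableSet_lt hF measurable_const)).1 h2

/-- The part of `F` where `|x| ≤ n`, truncated at height `n`. -/
def truncAt (n : ℕ) (F : ℝ → τ → ℝ≥0∞) : ℝ → τ → ℝ≥0∞ :=
  fun x t => if |x| ≤ n then min (F x t) n else 0

end Mixed

end

section

variable {τ : Type*}

lemma truncAt_le (n : ℕ) (F : ℝ → τ → ℝ≥0∞) (x : ℝ) (t : τ) : truncAt n F x t ≤ F x t := by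
  unfold truncAt
  split_ifs
  · exact min_le_left _ _
  · exact zero_le

lemma truncAt_mono (F : ℝ → τ → ℝ≥0∞) : Monotone fun n => truncAt n F := by
  intro m n hmn x t
  have hmn' : (m : ℝ) ≤ n := by exact_mod_cast hmn
  have hmn'' : (m : ℝ≥0∞) ≤ n := by exact_mod_cast hmn
  simp only [truncAt]
  split_ifs with h1 h2
  · exact min_le_min le_rfl hmn''
  · exact absurd (h1.trans hmn') h2
  · exact zero_le
  · exact zero_le

lemma iSup_truncAt (F : ℝ → τ → ℝ≥0∞) (x : ℝ) (t : τ) : ⨆ n, truncAt n F x t = F x t := by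
  refine le_antisymm (iSup_le fun n => truncAt_le n F x t) ?_
  refine le_of_forall_lt fun c hc => ?_
  obtain ⟨m, hm⟩ := ENNReal.exists_nat_gt (ne_top_of_lt hc)
  obtain ⟨k, hk⟩ := exists_nat_ge |x|
  refine lt_of_lt_of_le ?_ (le_iSup _ (max m k))
  have h1 : |x| ≤ (max m k : ℕ) := hk.trans (by exact_mod_cast le_max_right m k)
  have h2 : (m : ℝ≥0∞) ≤ (max m k : ℕ) := by exact_mod_cast le_max_left m k
  rw [truncAt, if_pos h1]
  exact lt_min hc (hm.trans_le h2)

variable [MeasurableSpace τ]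

lemma measurable_truncAt (n : ℕ) {F : ℝ → τ → ℝ≥0∞} (hF : Measurable (Function.uncurry F)) :
    Measurable (Function.uncurry (truncAt n F)) := by
  refine Measurable.ite ?_ (hF.min measurable_const) measurable_const
  exact measurableSet_le (by fun_prop) measurable_const

lemma lintegral_lintegral_iSup {ν : Measure τ} [SFinite ν] {f : ℕ → ℝ → τ → ℝ≥0∞}
    (hf : ∀ n, Measurable (Function.uncurry (f n))) (hmono : Monotone f) :
    ∫⁻ x, ∫⁻ t, ⨆ n, f n x t ∂ν = ⨆ n, ∫⁻ x, ∫⁻ t, f n x t ∂ν := by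
  rw [← lintegral_iSup]
  · congr 1
    ext x
    rw [lintegral_iSup (fun n => (hf n).of_uncurry_left)]
    exact fun m n hmn => hmono hmn x
  · exact fun n => (hf n).lintegral_prod_right
  · exact fun m n hmn x => lintegral_mono (hmono hmn x)

lemma mixedNorm_le_of_bounded {p q p' q' : ℝ} {ν : Measure τ} [IsFiniteMeasure ν]
    (hp : p.HolderConjugate p') (hq : q.HolderConjugate q') {G : ℝ → τ → ℝ≥0∞}
    (hG : Measurable (Function.uncurry G)) {C : ℝ≥0∞} {n : ℕ} (hGn : ∀ x t, G x t ≤ n)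
    (hG0 : ∀ (x : ℝ) t, ¬ |x| ≤ n → G x t = 0)
    (h : ∀ H : ℝ → τ → ℝ≥0∞, Measurable (Function.uncurry H) →
      ∫⁻ x, ∫⁻ t, G x t * H x t ∂ν ≤ C * mixedNorm p' q' ν H) :
    mixedNorm p q ν G ≤ C := by
  have hp0 := hp.pos
  have hq0 := hq.pos
  have hp0' := hp.symm.pos
  have hq0' := hq.symm.pos
  have hq1 : 0 < q - 1 := by linarith [hq.lt]
  have hp1 : 0 < p - 1 := by linarith [hp.lt]
  set A : ℝ → ℝ≥0∞ := fun x => ∫⁻ t, G x t ^ q ∂ν with hA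
  have hAm : Measurable A := (hG.pow_const q).lintegral_prod_right'
  have hAtop : ∀ x, A x ≤ (n : ℝ≥0∞) ^ q * ν univ := fun x => by
    rw [← lintegral_const]
    exact lintegral_mono fun t => ENNReal.rpow_le_rpow (hGn x t) hq0.le
  have hAt : ∀ x, A x ≠ ∞ := fun x => ne_top_of_le_ne_top
    (ENNReal.mul_ne_top (ENNReal.rpow_ne_top_of_nonneg hq0.le (by simp)) (measure_ne_top _ _))
    (hAtop x)
  set H : ℝ → τ → ℝ≥0∞ := fun x t => A x ^ ((p - q) / q) * G x t ^ (q - 1) with hH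
  have hHm : Measurable (Function.uncurry H) :=
    ((hAm.comp measurable_fst).pow_const _).mul (hG.pow_const _)
  have h1 : ∀ x, ∫⁻ t, G x t * H x t ∂ν = A x ^ (p / q) := fun x => by
    have : ∀ t, G x t * H x t = A x ^ ((p - q) / q) * G x t ^ q := fun t => by
      have : G x t ^ q = G x t * G x t ^ (q - 1) := by
        conv_rhs => rw [← ENNReal.rpow_one (G x t)]
        rw [← ENNReal.rpow_mul, ← ENNReal.rpow_add_of_nonneg _ _ (by norm_num) (by linarith)]
        congr 1; ring
      rw [this, hH]; ring
    simp only [this]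
    rw [lintegral_const_mul _ (hG.of_uncurry_left.pow_const _)]
    by_cases h0 : A x = 0
    · change A x ^ ((p - q) / q) * A x = _
      rw [h0, mul_zero, ENNReal.zero_rpow_of_pos (by positivity)]
    · change A x ^ ((p - q) / q) * A x = _
      conv_lhs => rw [← ENNReal.rpow_one (A x)]
      rw [← ENNReal.rpow_mul, one_mul, ← ENNReal.rpow_add _ _ h0 (hAt x)]
      congr 1; field_simp; ring
  have h2 : ∀ x, Lnorm q' ν (H x) = A x ^ ((p - 1) / q) := fun x => by
    rw [hH, Lnorm_const_mul hq0' _ (hG.of_uncurry_left.pow_const _), Lnorm_rpow hq1]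
    have e1 : q' * (q - 1) = q := by
      have := hq.symm.mul_eq_add; linarith
    rw [e1, Lnorm, ← ENNReal.rpow_mul]
    change A x ^ _ * A x ^ _ = _
    by_cases h0 : A x = 0
    · rw [h0, ENNReal.zero_rpow_of_pos (y := 1 / q * (q - 1)) (by positivity), mul_zero,
        ENNReal.zero_rpow_of_pos (by positivity)]
    · rw [← ENNReal.rpow_add _ _ h0 (hAt x)]
      congr 1; field_simp; ring
  have e2 : (p - 1) * p' = p := by
    have := hp.symm.mul_eq_add; linarith
  set X := ∫⁻ x, A x ^ (p / q) with hX
  have h3 : mixedNorm p' q' ν H = X ^ (1 / p') := by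
    have : (p - 1) / q * p' = p / q := by rw [div_mul_eq_mul_div, e2]
    simp only [mixedNorm, h2]
    simp only [Lnorm, ← ENNReal.rpow_mul, this, hX]
  have h4 : mixedNorm p q ν G = X ^ (1 / p) := by
    simp only [mixedNorm, Lnorm, ← ENNReal.rpow_mul]
    have : 1 / q * p = p / q := by ring
    rw [this]
  have hXt : X ≠ ∞ := by
    refine ne_top_of_le_ne_top ?_ (lintegral_mono (g := (Icc (-(n:ℝ)) n).indicator
      fun _ => ((n : ℝ≥0∞) ^ q * ν univ) ^ (p / q)) fun x => ?_)
    · rw [lintegral_indicator measurableSet_Icc, lintegral_const]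
      refine ENNReal.mul_ne_top (ENNReal.rpow_ne_top_of_nonneg (by positivity)
        (ENNReal.mul_ne_top (ENNReal.rpow_ne_top_of_nonneg hq0.le (by simp))
          (measure_ne_top _ _))) (by simp)
    · by_cases hx : |x| ≤ n
      · rw [indicator_of_mem (show x ∈ Icc (-(n:ℝ)) n from abs_le.1 hx)]
        exact ENNReal.rpow_le_rpow (hAtop x) (by positivity)
      · have : A x = 0 := by
          simp [hA, fun t => hG0 x t hx, hq0]
        rw [this, ENNReal.zero_rpow_of_pos (by positivity)]
        exact zero_le
  have h5 : X ≤ C * X ^ (1 / p') := by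
    have := h H hHm
    simp only [h1] at this
    rwa [h3] at this
  rw [h4]
  by_cases hX0 : X = 0
  · rw [hX0, ENNReal.zero_rpow_of_pos (by positivity)]; exact zero_le
  · have e3 : 1 / p + 1 / p' = 1 := by
      have := hp.inv_add_inv_eq_one; simpa [one_div] using this
    have h6 : X ^ (1 / p) * X ^ (1 / p') = X := by
      rw [← ENNReal.rpow_add _ _ hX0 hXt, e3, ENNReal.rpow_one]
    rw [← h6] at h5
    have h8 : X ^ (1 / p') ≠ 0 := by
      intro h; rw [h, mul_zero] at h6; exact hX0 h6.symm
    have h9 : X ^ (1 / p') ≠ ∞ := ENNReal.rpow_ne_top_of_nonneg (by positivity) hXt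
    rw [h6] at h5
    nth_rewrite 1 [← h6] at h5
    exact (ENNReal.mul_le_mul_iff_left h8 h9).1 h5

/-- Converse of Hölder's inequality for the mixed norms, tested against bounded functions which
vanish for large `x`. -/
lemma mixedNorm_le_of_forall {p q p' q' : ℝ} {ν : Measure τ} [IsFiniteMeasure ν]
    (hp : p.HolderConjugate p') (hq : q.HolderConjugate q') {G : ℝ → τ → ℝ≥0∞}
    (hG : Measurable (Function.uncurry G)) {C : ℝ≥0∞}
    (h : ∀ n : ℕ, ∀ H : ℝ → τ → ℝ≥0∞, Measurable (Function.uncurry H) → (∀ x t, H x t ≤ n) →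
      (∀ (x : ℝ) t, ¬ |x| ≤ n → H x t = 0) →
      ∫⁻ x, ∫⁻ t, G x t * H x t ∂ν ≤ C * mixedNorm p' q' ν H) :
    mixedNorm p q ν G ≤ C := by
  have hp0' := hp.symm.pos
  have hq0' := hq.symm.pos
  have hall : ∀ H : ℝ → τ → ℝ≥0∞, Measurable (Function.uncurry H) →
      ∫⁻ x, ∫⁻ t, G x t * H x t ∂ν ≤ C * mixedNorm p' q' ν H := by
    intro H hH
    have e : ∀ x t, G x t * H x t = ⨆ n, G x t * truncAt n H x t := fun x t => by
      rw [← ENNReal.mul_iSup, iSup_truncAt]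
    simp only [e]
    rw [lintegral_lintegral_iSup (f := fun n x t => G x t * truncAt n H x t)
      (fun n => hG.mul (measurable_truncAt n hH))
      (fun m n hmn x t => mul_le_mul_right (truncAt_mono H hmn x t) _)]
    refine iSup_le fun n => (h n _ (measurable_truncAt n hH) (fun x t => ?_) fun x t hx => ?_).trans
      (mul_le_mul_right (mixedNorm_mono hp0' hq0' (truncAt_le n H)) _)
    · unfold truncAt
      split_ifs
      · exact min_le_right _ _
      · exact zero_le
    · simp [truncAt, hx]
  have e : G = fun x t => ⨆ n, truncAt n G x t := by
    ext x t; rw [iSup_truncAt]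
  rw [e, mixedNorm_iSup hp.pos hq.pos (fun n => measurable_truncAt n hG) (truncAt_mono G)]
  refine iSup_le fun n => mixedNorm_le_of_bounded (n := n) hp hq (measurable_truncAt n hG)
    (fun x t => ?_) (fun x t hx => by simp [truncAt, hx]) fun H hH =>
    (lintegral_mono fun x => lintegral_mono fun t => ?_).trans (hall H hH)
  · unfold truncAt
    split_ifs
    · exact min_le_right _ _
    · exact zero_le
  · exact mul_le_mul_left (truncAt_le n G x t) _

end

/-- The uncentred Hardy–Littlewood maximal function, over intervals with rational data. -/
def maxFn (φ : ℝ → ℝ≥0∞) (x : ℝ) : ℝ≥0∞ :=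
  ⨆ i : ℚ × ℚ, if 0 < i.2 ∧ |x - i.1| ≤ i.2 then
    (∫⁻ y in Metric.closedBall (i.1 : ℝ) i.2, φ y) / ENNReal.ofReal (2 * i.2) else 0

lemma setLIntegral_div_le_maxFn (φ : ℝ → ℝ≥0∞) {x : ℝ} {c r : ℚ} (hr : 0 < r) (hx : |x - c| ≤ r) :
    (∫⁻ y in Metric.closedBall (c : ℝ) r, φ y) / ENNReal.ofReal (2 * r) ≤ maxFn φ x := by
  refine le_trans ?_ (le_iSup _ ((c, r) : ℚ × ℚ))
  rw [if_pos ⟨hr, hx⟩]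

lemma setLIntegral_le_maxFn (φ : ℝ → ℝ≥0∞) {x : ℝ} {c r : ℚ} (hr : 0 < r) (hx : |x - c| ≤ r) :
    ∫⁻ y in Metric.closedBall (c : ℝ) r, φ y ≤ ENNReal.ofReal (2 * r) * maxFn φ x := by
  have h0 : (0:ℝ) < 2 * r := by positivity
  rw [mul_comm, ← ENNReal.div_le_iff (by simpa using hr) ENNReal.ofReal_ne_top]
  exact setLIntegral_div_le_maxFn φ hr hx

lemma maxFn_le_iff {φ : ℝ → ℝ≥0∞} {x : ℝ} {A : ℝ≥0∞} : maxFn φ x ≤ A ↔ ∀ c r : ℚ, 0 < r →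
    |x - c| ≤ r → ∫⁻ y in Metric.closedBall (c : ℝ) r, φ y ≤ ENNReal.ofReal (2 * r) * A := by
  constructor
  · intro h c r hr hx
    exact (setLIntegral_le_maxFn φ hr hx).trans (mul_le_mul_right h _)
  · intro h
    refine iSup_le fun i => ?_
    split_ifs with hi
    · refine (ENNReal.div_le_iff (by simpa using hi.1) ENNReal.ofReal_ne_top).2 ?_
      rw [mul_comm]
      exact h _ _ hi.1 hi.2
    · exact zero_le

lemma exists_of_lt_maxFn {φ : ℝ → ℝ≥0∞} {x : ℝ} {A : ℝ≥0∞} (h : A < maxFn φ x) :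
    ∃ c r : ℚ, 0 < r ∧ |x - c| ≤ r ∧
      ENNReal.ofReal (2 * r) * A < ∫⁻ y in Metric.closedBall (c : ℝ) r, φ y := by
  by_contra! h'
  exact absurd (maxFn_le_iff.2 h') (not_le.2 h)

lemma maxFn_mono_ae {φ ψ : ℝ → ℝ≥0∞} (h : ∀ᵐ x, φ x ≤ ψ x) (x : ℝ) : maxFn φ x ≤ maxFn ψ x :=
  maxFn_le_iff.2 fun _ _ hr hx => (lintegral_mono_ae (ae_restrict_of_ae h)).trans
    (setLIntegral_le_maxFn ψ hr hx)

lemma maxFn_mono {φ ψ : ℝ → ℝ≥0∞} (h : ∀ x, φ x ≤ ψ x) (x : ℝ) : maxFn φ x ≤ maxFn ψ x :=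
  maxFn_mono_ae (ae_of_all _ h) x

lemma maxFn_congr_ae {φ ψ : ℝ → ℝ≥0∞} (h : φ =ᵐ[volume] ψ) (x : ℝ) : maxFn φ x = maxFn ψ x :=
  le_antisymm (maxFn_mono_ae h.le x) (maxFn_mono_ae h.symm.le x)

lemma maxFn_const_le (c : ℝ≥0∞) (x : ℝ) : maxFn (fun _ => c) x ≤ c := by
  refine maxFn_le_iff.2 fun a r hr hx => ?_
  rw [lintegral_const, Measure.restrict_apply_univ, Real.volume_closedBall, mul_comm]

lemma maxFn_tsum_le {f : ℕ → ℝ → ℝ≥0∞} (hf : ∀ n, Measurable (f n)) (x : ℝ) :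
    maxFn (fun y => ∑' n, f n y) x ≤ ∑' n, maxFn (f n) x := by
  refine maxFn_le_iff.2 fun a r hr hx => ?_
  rw [lintegral_tsum (fun n => (hf n).aemeasurable), ← ENNReal.tsum_mul_left]
  exact ENNReal.tsum_le_tsum fun n => setLIntegral_le_maxFn _ hr hx

lemma maxFn_add_le {f g : ℝ → ℝ≥0∞} (hf : Measurable f) (x : ℝ) :
    maxFn (fun y => f y + g y) x ≤ maxFn f x + maxFn g x := by
  refine maxFn_le_iff.2 fun a r hr hx => ?_
  rw [lintegral_add_left hf, mul_add]
  exact add_le_add (setLIntegral_le_maxFn _ hr hx) (setLIntegral_le_maxFn _ hr hx)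

lemma maxFn_const_mul_le (c : ℝ≥0∞) {f : ℝ → ℝ≥0∞} (hf : Measurable f) (x : ℝ) :
    maxFn (fun y => c * f y) x ≤ c * maxFn f x := by
  refine maxFn_le_iff.2 fun a r hr hx => ?_
  rw [lintegral_const_mul _ hf, mul_left_comm]
  exact mul_le_mul_right (setLIntegral_le_maxFn _ hr hx) _

lemma maxFn_rpow_le {f : ℝ → ℝ≥0∞} (hf : Measurable f) {θ : ℝ} (h0 : 0 < θ) (h1 : θ < 1) (x : ℝ) :
    maxFn (fun y => f y ^ θ) x ≤ maxFn f x ^ θ := by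
  refine maxFn_le_iff.2 fun a r hr hx => ?_
  have hr' : (0:ℝ) < 2 * r := by positivity
  set B := volume.restrict (Metric.closedBall (a:ℝ) r) with hB
  have hc : (1 / θ).HolderConjugate (1 / (1 - θ)) :=
    ⟨by simp, by positivity, one_div_pos.2 (by linarith)⟩
  have := lintegral_mul_le_Lnorm hc (μ := B) (f := fun y => f y ^ θ) (g := fun _ => 1)
    (hf.pow_const _) measurable_const
  simp only [mul_one] at this
  refine this.trans ?_
  have e : θ * (1 / θ) = 1 := by field_simp
  simp only [Lnorm, ← ENNReal.rpow_mul, e, ENNReal.rpow_one, ENNReal.one_rpow, lintegral_const,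
    one_mul, one_div_one_div]
  rw [hB, Measure.restrict_apply_univ, Real.volume_closedBall]
  calc _ ≤ (ENNReal.ofReal (2 * r) * maxFn f x) ^ θ * ENNReal.ofReal (2 * r) ^ (1 - θ) := by
        gcongr; exact setLIntegral_le_maxFn _ hr hx
    _ = _ := by
        rw [ENNReal.mul_rpow_of_nonneg _ _ h0.le, mul_right_comm, ← ENNReal.rpow_add _ _
          (by simpa using hr) ENNReal.ofReal_ne_top]
        simp

lemma measurable_maxFn {τ : Type*} [MeasurableSpace τ] {F : ℝ → τ → ℝ≥0∞}
    (hF : Measurable (Function.uncurry F)) :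
    Measurable (Function.uncurry fun x t => maxFn (fun y => F y t) x) := by
  refine Measurable.iSup fun i => Measurable.ite ?_ ?_ measurable_const
  · refine (MeasurableSet.const _).inter (measurableSet_le
      (f := fun z : ℝ × τ => |z.1 - i.1|) (by fun_prop) measurable_const)
  · refine Measurable.div_const ?_ _
    have : Measurable fun t => ∫⁻ y in Metric.closedBall (i.1 : ℝ) i.2, F y t :=
      Measurable.lintegral_prod_left' (f := Function.uncurry F) hF
    exact this.comp measurable_snd

lemma measurable_maxFn' {f : ℝ → ℝ≥0∞} (hf : Measurable f) : Measurable (maxFn f) := by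
  have := measurable_maxFn (τ := Unit) (F := fun x _ => f x) (hf.comp measurable_fst)
  exact this.comp (measurable_id.prodMk (measurable_const (a := ())))

/-- Vitali covering: a domination of the measures of the dilates of a countable family of intervals
passes to the union of the family. -/
lemma mul_measure_iUnion_le (μ ρ : Measure ℝ) (c : ℝ≥0∞) (P : Set (ℚ × ℚ))
    (h : ∀ i ∈ P, 0 < i.2 ∧ c * μ (Metric.closedBall (i.1 : ℝ) (5 * i.2))
      ≤ ρ (Metric.closedBall (i.1 : ℝ) i.2)) :
    c * μ (⋃ i ∈ P, Metric.closedBall (i.1 : ℝ) i.2) ≤ ρ univ := by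
  classical
  have hfin : ∀ s : Finset (ℚ × ℚ), (∀ i ∈ s, i ∈ P) →
      c * μ (⋃ i ∈ s, Metric.closedBall (i.1 : ℝ) i.2) ≤ ρ univ := by
    intro s hs
    obtain ⟨R, hR⟩ := (s.finite_toSet.image (fun i : ℚ × ℚ => (i.2 : ℝ))).bddAbove
    obtain ⟨u, hut, hdis, hcov⟩ := Vitali.exists_disjoint_subfamily_covering_enlargement_closedBall
      (s : Set (ℚ × ℚ)) (fun i => (i.1 : ℝ)) (fun i => (i.2 : ℝ)) R
      (fun i hi => hR (mem_image_of_mem _ hi)) 5 (by norm_num)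
    have hufin : u.Finite := s.finite_toSet.subset hut
    have hsub : (⋃ i ∈ s, Metric.closedBall (i.1 : ℝ) (i.2 : ℝ))
        ⊆ ⋃ i ∈ u, Metric.closedBall (i.1 : ℝ) (5 * i.2) := by
      intro x hx
      simp only [mem_iUnion] at hx ⊢
      obtain ⟨i, hi, hxi⟩ := hx
      obtain ⟨b, hb, hb'⟩ := hcov i hi
      exact ⟨b, hb, hb' hxi⟩
    calc c * μ (⋃ i ∈ s, Metric.closedBall (i.1 : ℝ) i.2)
        ≤ c * ∑' i : u, μ (Metric.closedBall (i.1.1 : ℝ) (5 * i.1.2)) := by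
          gcongr
          exact (measure_mono hsub).trans (measure_biUnion_le μ hufin.countable _)
      _ = ∑' i : u, c * μ (Metric.closedBall (i.1.1 : ℝ) (5 * i.1.2)) := by
          rw [ENNReal.tsum_mul_left]
      _ ≤ ∑' i : u, ρ (Metric.closedBall (i.1.1 : ℝ) i.1.2) :=
          ENNReal.tsum_le_tsum fun i => (h _ (hs _ (hut i.2))).2
      _ = ρ (⋃ i ∈ u, Metric.closedBall (i.1 : ℝ) i.2) := by
          rw [measure_biUnion hufin.countable hdis fun i _ =>
            Metric.isClosed_closedBall.measurableSet]
      _ ≤ ρ univ := measure_mono (subset_univ _)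
  obtain ⟨e⟩ : Nonempty (ℕ ≃ ℚ × ℚ) := ⟨(Denumerable.eqv (ℚ × ℚ)).symm⟩
  set s : ℕ → Finset (ℚ × ℚ) := fun n => ((Finset.range n).image e).filter (· ∈ P) with hs
  have hU : (⋃ i ∈ P, Metric.closedBall (i.1 : ℝ) (i.2 : ℝ))
      = ⋃ n, ⋃ i ∈ s n, Metric.closedBall (i.1 : ℝ) (i.2 : ℝ) := by
    ext x
    simp only [mem_iUnion, hs, Finset.mem_filter, Finset.mem_image, Finset.mem_range]
    constructor
    · rintro ⟨i, hi, hx⟩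
      exact ⟨e.symm i + 1, i, ⟨⟨e.symm i, by omega, by simp⟩, hi⟩, hx⟩
    · rintro ⟨n, i, ⟨_, hi⟩, hx⟩
      exact ⟨i, hi, hx⟩
  have hmono : Monotone fun n => ⋃ i ∈ s n, Metric.closedBall (i.1 : ℝ) (i.2 : ℝ) := by
    intro m n hmn
    refine biUnion_subset_biUnion_left fun i hi => ?_
    simp only [hs, Finset.coe_filter, Finset.mem_image, Finset.mem_range, mem_ofPred_eq] at hi ⊢
    obtain ⟨⟨k, hk, rfl⟩, hi⟩ := hi
    exact ⟨⟨k, by omega, rfl⟩, hi⟩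
  rw [hU, hmono.measure_iUnion, ENNReal.mul_iSup]
  exact iSup_le fun n => hfin _ fun i hi => (Finset.mem_filter.1 hi).2

lemma mul_measure_maxFn_le {Ω φ : ℝ → ℝ≥0∞} (hΩ : Measurable Ω) (hφ : Measurable φ) {K : ℝ≥0∞}
    (hA : ∀ x, maxFn Ω x ≤ K * Ω x) (c : ℝ≥0∞) :
    c * volume.withDensity Ω {x | c < maxFn φ x} ≤ 5 * K * ∫⁻ x, φ x * Ω x := by
  have hφΩ : Measurable fun x => φ x * Ω x := hφ.mul hΩ
  set P : Set (ℚ × ℚ) := {i | 0 < i.2 ∧ ENNReal.ofReal (2 * i.2) * c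
    < ∫⁻ y in Metric.closedBall (i.1 : ℝ) i.2, φ y} with hP
  have hsub : {x | c < maxFn φ x} ⊆ ⋃ i ∈ P, Metric.closedBall (i.1 : ℝ) (i.2 : ℝ) := by
    intro x hx
    obtain ⟨a, r, hr, hxr, h⟩ := exists_of_lt_maxFn hx
    simp only [mem_iUnion]
    exact ⟨(a, r), ⟨hr, h⟩, by simpa [Real.dist_eq] using hxr⟩
  have := mul_measure_iUnion_le (volume.withDensity Ω)
    (volume.withDensity fun x => 5 * K * (φ x * Ω x)) c P fun i hi => ⟨hi.1, ?_⟩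
  · refine (mul_le_mul_right (measure_mono hsub) c).trans (this.trans ?_)
    rw [withDensity_apply _ MeasurableSet.univ, Measure.restrict_univ,
      lintegral_const_mul _ hφΩ]
  · obtain ⟨a, r⟩ := i
    obtain ⟨hr, h⟩ := hi
    have hr0 : (0 : ℝ) < r := by exact_mod_cast hr
    rw [withDensity_apply _ Metric.isClosed_closedBall.measurableSet,
      withDensity_apply _ Metric.isClosed_closedBall.measurableSet]
    dsimp only at hr h ⊢
    set B := Metric.closedBall (a:ℝ) r with hB
    set I := ∫⁻ x in Metric.closedBall (a:ℝ) (5 * r), Ω x with hI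
    have hIle : ∀ x ∈ B, I ≤ 5 * ENNReal.ofReal (2 * r) * (K * Ω x) := by
      intro x hx
      have hx' : |x - a| ≤ r := by simpa [hB, Real.dist_eq] using hx
      have h1 := setLIntegral_le_maxFn Ω (x := x) (c := a) (r := 5 * r) (by positivity)
        (by push_cast; linarith)
      push_cast at h1
      refine h1.trans ?_
      have : ENNReal.ofReal (2 * (5 * r)) = 5 * ENNReal.ofReal (2 * r) := by
        rw [show (2 * (5 * (r:ℝ))) = 5 * (2 * r) by ring, ENNReal.ofReal_mul (by norm_num)]
        norm_num
      rw [this]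
      exact mul_le_mul_right (hA x) _
    have h0 : ENNReal.ofReal (2 * r) ≠ 0 := by simpa using hr
    refine (ENNReal.mul_le_mul_iff_right h0 ENNReal.ofReal_ne_top).1 ?_
    calc ENNReal.ofReal (2 * r) * (c * I) = (ENNReal.ofReal (2 * r) * c) * I := by ring
      _ ≤ (∫⁻ y in B, φ y) * I := by gcongr
      _ = ∫⁻ y in B, φ y * I := (lintegral_mul_const _ hφ).symm
      _ ≤ ∫⁻ y in B, ENNReal.ofReal (2 * r) * (5 * K * (φ y * Ω y)) := by
          refine setLIntegral_mono' Metric.isClosed_closedBall.measurableSet fun y hy => ?_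
          refine (mul_le_mul_right (hIle y hy) _).trans (le_of_eq (by ring))
      _ = _ := by rw [lintegral_const_mul _ (hφΩ.const_mul _)]

lemma mul_measure_maxFn_div_le {Ω φ : ℝ → ℝ≥0∞} (hΩ : Measurable Ω) (hφ : Measurable φ)
    (hΩ0 : ∀ x, Ω x ≠ 0) {K : ℝ≥0∞} (hA : ∀ x, maxFn Ω x ≤ K * Ω x) (c : ℝ≥0∞) :
    c * volume.withDensity Ω {x | c < maxFn (fun y => φ y * Ω y) x / Ω x}
      ≤ 5 * K * ∫⁻ x, φ x * Ω x := by
  have hφΩ : Measurable fun x => φ x * Ω x := hφ.mul hΩ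
  set P : Set (ℚ × ℚ) := {i | 0 < i.2 ∧ c * volume.withDensity Ω (Metric.closedBall i.1 (5 * i.2))
    ≤ volume.withDensity (fun x => 5 * K * (φ x * Ω x)) (Metric.closedBall i.1 i.2)} with hP
  have hsub : {x | c < maxFn (fun y => φ y * Ω y) x / Ω x}
      ⊆ ⋃ i ∈ P, Metric.closedBall (i.1 : ℝ) (i.2 : ℝ) := by
    intro x hx
    have hxt : Ω x ≠ ∞ := by
      intro h
      simp [h] at hx
    have hx' : c * Ω x < maxFn (fun y => φ y * Ω y) x :=
      (ENNReal.lt_div_iff_mul_lt (Or.inl (hΩ0 x)) (Or.inl hxt)).1 hx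
    obtain ⟨a, r, hr, hxr, h⟩ := exists_of_lt_maxFn hx'
    have hr0 : (0 : ℝ) < r := by exact_mod_cast hr
    simp only [mem_iUnion]
    refine ⟨(a, r), ⟨hr, ?_⟩, by simpa [Real.dist_eq] using hxr⟩
    rw [withDensity_apply _ Metric.isClosed_closedBall.measurableSet,
      withDensity_apply _ Metric.isClosed_closedBall.measurableSet,
      lintegral_const_mul _ hφΩ]
    dsimp only
    have h1 := setLIntegral_le_maxFn Ω (x := x) (c := a) (r := 5 * r) (by positivity)
        (by push_cast; linarith)
    push_cast at h1
    have h2 : ENNReal.ofReal (2 * (5 * r)) = 5 * ENNReal.ofReal (2 * r) := by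
      rw [show (2 * (5 * (r:ℝ))) = 5 * (2 * r) by ring, ENNReal.ofReal_mul (by norm_num)]
      norm_num
    calc c * ∫⁻ x in Metric.closedBall (a:ℝ) (5 * r), Ω x
        ≤ c * (5 * ENNReal.ofReal (2 * r) * (K * Ω x)) := by
          rw [← h2]
          gcongr
          exact h1.trans (mul_le_mul_right (hA x) _)
      _ = 5 * K * (ENNReal.ofReal (2 * r) * (c * Ω x)) := by ring
      _ ≤ _ := mul_le_mul_right h.le _
  have := mul_measure_iUnion_le (volume.withDensity Ω)
    (volume.withDensity fun x => 5 * K * (φ x * Ω x)) c P fun i hi => hi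
  refine (mul_le_mul_right (measure_mono hsub) c).trans (this.trans ?_)
  rw [withDensity_apply _ MeasurableSet.univ, Measure.restrict_univ,
    lintegral_const_mul _ hφΩ]

lemma rpow_eq_lintegral {r : ℝ} (hr : 0 < r) (u : ℝ≥0∞) :
    u ^ r = ENNReal.ofReal r * ∫⁻ c in Ioi (0:ℝ), ENNReal.ofReal (c ^ (r - 1)) *
      (if ENNReal.ofReal c < u then 1 else 0) := by
  have key : ∀ v : ℝ, 0 ≤ v → ENNReal.ofReal v ^ r = ENNReal.ofReal r * ∫⁻ c in Ioi (0:ℝ),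
      ENNReal.ofReal (c ^ (r - 1)) * (if ENNReal.ofReal c < ENNReal.ofReal v then 1 else 0) := by
    intro v hv
    have := lintegral_rpow_eq_lintegral_meas_lt_mul (Measure.dirac (0:ℝ)) (f := fun _ => v)
      (ae_of_all _ fun _ => hv) aemeasurable_const hr
    simp only [lintegral_const, measure_univ, mul_one] at this
    rw [ENNReal.ofReal_rpow_of_nonneg hv hr.le, this]
    congr 1
    refine setLIntegral_congr_fun measurableSet_Ioi fun c hc => ?_
    simp only [mem_Ioi] at hc
    rw [mul_comm]
    congr 1
    by_cases h : c < v
    · have h2 : ENNReal.ofReal c < ENNReal.ofReal v :=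
        (ENNReal.ofReal_lt_ofReal_iff (hc.trans h)).2 h
      simp [h, h2]
    · have h2 : ¬ ENNReal.ofReal c < ENNReal.ofReal v := not_lt.2 (ENNReal.ofReal_le_ofReal
        (not_lt.1 h))
      simp [h, h2]
  by_cases hu : u = ∞
  · rw [hu, ENNReal.top_rpow_of_pos hr, eq_comm]
    refine ENNReal.eq_top_of_forall_nnreal_le fun s => ?_
    have h1 := key ((s:ℝ) ^ (1 / r)) (by positivity)
    rw [ENNReal.ofReal_rpow_of_nonneg (by positivity) hr.le, ← Real.rpow_mul (by positivity),
      one_div_mul_cancel hr.ne', Real.rpow_one, ENNReal.ofReal_coe_nnreal] at h1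
    rw [h1]
    gcongr with c
    split_ifs with h1 h2
    · exact le_rfl
    · exact absurd ENNReal.ofReal_lt_top h2
    · exact zero_le
    · exact zero_le
  · have := key u.toReal ENNReal.toReal_nonneg
    rwa [ENNReal.ofReal_toReal hu] at this

lemma lintegral_rpow_le_of_weak {α : Type*} [MeasurableSpace α] {μ : Measure α} [SFinite μ]
    {φ Φ : α → ℝ≥0∞} (hφ : Measurable φ) (hΦ : Measurable Φ) {K : ℝ≥0∞} (hK : K ≠ ∞) {q : ℝ}
    (hq : 1 < q) (hw : ∀ c : ℝ, 0 < c → ENNReal.ofReal c * μ {x | (K + 1) * ENNReal.ofReal c < Φ x}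
      ≤ K * ∫⁻ x, φ x * (if ENNReal.ofReal c < φ x then 1 else 0) ∂μ) :
    ∫⁻ x, Φ x ^ q ∂μ
      ≤ (K + 1) ^ q * (ENNReal.ofReal q * K * (ENNReal.ofReal (q - 1))⁻¹) * ∫⁻ x, φ x ^ q ∂μ := by
  have hq0 : 0 < q := by linarith
  have hq1 : 0 < q - 1 := by linarith
  have hK1 : K + 1 ≠ ∞ := by simp [hK]
  have hK0 : K + 1 ≠ 0 := by simp
  have h1 : ∀ x, Φ x ^ q = (K + 1) ^ q * (Φ x / (K + 1)) ^ q := fun x => by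
    rw [← ENNReal.mul_rpow_of_nonneg _ _ hq0.le, ENNReal.mul_div_cancel hK0 hK1]
  simp only [h1]
  rw [lintegral_const_mul _ ((hΦ.div_const _).pow_const _), mul_assoc]
  refine mul_le_mul_right ?_ _
  have hind : ∀ {f : α → ℝ≥0∞}, Measurable f → Measurable (Function.uncurry fun (x : α) (c : ℝ) =>
      (if ENNReal.ofReal c < f x then (1:ℝ≥0∞) else 0)) := fun {f} hf => by
    refine Measurable.ite ?_ measurable_const measurable_const
    exact measurableSet_lt (ENNReal.measurable_ofReal.comp measurable_snd) (hf.comp measurable_fst)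
  have hpow : ∀ s : ℝ, Measurable fun c : ℝ => ENNReal.ofReal (c ^ s) := fun s => by fun_prop
  calc ∫⁻ x, (Φ x / (K + 1)) ^ q ∂μ
      = ENNReal.ofReal q * ∫⁻ x, (∫⁻ c in Ioi (0:ℝ), ENNReal.ofReal (c ^ (q - 1)) *
          (if ENNReal.ofReal c < Φ x / (K + 1) then 1 else 0)) ∂μ := by
        simp only [rpow_eq_lintegral hq0]
        have hm : Measurable (Function.uncurry fun (x : α) (c : ℝ) => ENNReal.ofReal (c ^ (q - 1)) *
            (if ENNReal.ofReal c < Φ x / (K + 1) then (1:ℝ≥0∞) else 0)) :=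
          ((hpow _).comp measurable_snd).mul (hind (hΦ.div_const _))
        rw [lintegral_const_mul _ hm.lintegral_prod_right]
    _ = ENNReal.ofReal q * ∫⁻ c in Ioi (0:ℝ), ENNReal.ofReal (c ^ (q - 1)) *
          μ {x | (K + 1) * ENNReal.ofReal c < Φ x} := by
        rw [lintegral_lintegral_swap
          (((hpow _).comp measurable_snd).mul (hind (hΦ.div_const _))).aemeasurable]
        congr 1
        refine lintegral_congr fun c => ?_
        rw [lintegral_const_mul _ (hind (hΦ.div_const _)).of_uncurry_right]
        congr 1
        have : ∀ x, (ENNReal.ofReal c < Φ x / (K + 1)) ↔ (K + 1) * ENNReal.ofReal c < Φ x :=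
          fun x => by
            rw [ENNReal.lt_div_iff_mul_lt (Or.inl hK0) (Or.inl hK1), mul_comm]
        simp only [this]
        rw [← lintegral_indicator_one (measurableSet_lt measurable_const hΦ)]
        refine lintegral_congr fun x => ?_
        simp [indicator_apply]
    _ ≤ ENNReal.ofReal q * ∫⁻ c in Ioi (0:ℝ), K * ∫⁻ x, φ x * (ENNReal.ofReal (c ^ (q - 1 - 1)) *
          (if ENNReal.ofReal c < φ x then 1 else 0)) ∂μ := by
        refine mul_le_mul_right (setLIntegral_mono' measurableSet_Ioi fun c hc => ?_) _
        have hc : 0 < c := hc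
        have e : ∀ x, φ x * (ENNReal.ofReal (c ^ (q - 1 - 1)) *
          (if ENNReal.ofReal c < φ x then 1 else 0)) = ENNReal.ofReal (c ^ (q - 1 - 1)) *
          (φ x * (if ENNReal.ofReal c < φ x then 1 else 0)) := fun x => by ring
        simp only [e]
        have hm : Measurable fun x => φ x * (if ENNReal.ofReal c < φ x then (1:ℝ≥0∞) else 0) :=
          hφ.mul (hind hφ).of_uncurry_right
        rw [lintegral_const_mul _ hm, mul_left_comm]
        have e2 : ENNReal.ofReal (c ^ (q - 1)) = ENNReal.ofReal (c ^ (q - 1 - 1)) *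
            ENNReal.ofReal c := by
          rw [← ENNReal.ofReal_mul (by positivity)]
          congr 1
          conv_rhs => rw [← Real.rpow_one c]
          rw [← Real.rpow_mul hc.le, ← Real.rpow_add hc]
          congr 1; ring
        rw [e2, mul_assoc]
        exact mul_le_mul_right (hw c hc) _
    _ = ENNReal.ofReal q * (K * ∫⁻ x, φ x * (∫⁻ c in Ioi (0:ℝ), (ENNReal.ofReal (c ^ (q - 1 - 1)) *
          (if ENNReal.ofReal c < φ x then 1 else 0))) ∂μ) := by
        have hm : Measurable (Function.uncurry fun (x : α) (c : ℝ) => φ x *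
          (ENNReal.ofReal (c ^ (q - 1 - 1)) * (if ENNReal.ofReal c < φ x then (1:ℝ≥0∞) else 0))) :=
          (hφ.comp measurable_fst).mul (((hpow _).comp measurable_snd).mul (hind hφ))
        have hm' : ∀ x, Measurable fun c : ℝ =>
            ENNReal.ofReal (c ^ (q - 1 - 1)) * (if ENNReal.ofReal c < φ x then (1:ℝ≥0∞) else 0) :=
          fun x => (hpow _).mul (hind hφ).of_uncurry_left
        rw [lintegral_const_mul _ hm.lintegral_prod_left,
          ← lintegral_lintegral_swap hm.aemeasurable]
        congr 2
        refine lintegral_congr fun x => ?_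
        exact lintegral_const_mul _ (hm' x)
    _ = _ := by
        have e : ∀ x, φ x * ∫⁻ c in Ioi (0:ℝ), (ENNReal.ofReal (c ^ (q - 1 - 1)) *
          (if ENNReal.ofReal c < φ x then 1 else 0))
            = (ENNReal.ofReal (q - 1))⁻¹ * φ x ^ q := fun x => by
          have h2 : φ x ^ q = φ x * φ x ^ (q - 1) := by
            conv_rhs => rw [← ENNReal.rpow_one (φ x)]
            rw [← ENNReal.rpow_mul, ← ENNReal.rpow_add_of_nonneg _ _ (by norm_num) (by linarith)]
            congr 1; ring
          rw [h2, rpow_eq_lintegral hq1 (φ x), mul_left_comm, ← mul_assoc (ENNReal.ofReal _)⁻¹,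
            ENNReal.inv_mul_cancel (by simpa using hq) ENNReal.ofReal_ne_top, one_mul]
        simp only [e]
        rw [lintegral_const_mul _ (hφ.pow_const _)]
        ring

lemma mul_indicator_add_le (u v : ℝ≥0∞) : u ≤ u * (if v < u then 1 else 0) + v := by
  split_ifs with h
  · simp
  · simpa using h

/-- The constant in the weak-type interpolation below. -/
def weakConst (K : ℝ≥0) (q : ℝ) : ℝ≥0∞ :=
  (5 * K + 1 + 1) ^ q * (ENNReal.ofReal q * (5 * K + 1) * (ENNReal.ofReal (q - 1))⁻¹)

lemma weakConst_ne_top (K : ℝ≥0) {q : ℝ} (hq : 1 < q) : weakConst K q ≠ ∞ := by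
  have hK't : (5 * K + 1 : ℝ≥0∞) ≠ ∞ := by
    simp [ENNReal.mul_eq_top]
  refine ENNReal.mul_ne_top (ENNReal.rpow_ne_top_of_nonneg (by linarith) (by simp [hK't])) ?_
  refine ENNReal.mul_ne_top (ENNReal.mul_ne_top (by simp) hK't) ?_
  simpa using hq

lemma lintegral_rpow_le_of_split {Ω φ : ℝ → ℝ≥0∞} (hΩ : Measurable Ω) (hφ : Measurable φ)
    {K : ℝ≥0} {q : ℝ} (hq : 1 < q) (S : (ℝ → ℝ≥0∞) → ℝ → ℝ≥0∞)
    (hS : ∀ ψ, Measurable ψ → Measurable (S ψ))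
    (hsplit : ∀ ψ : ℝ → ℝ≥0∞, ∀ c : ℝ≥0∞, Measurable ψ → (∀ y, φ y ≤ ψ y + c) →
      ∀ x, S φ x ≤ S ψ x + (5 * K + 1) * c)
    (hw : ∀ ψ : ℝ → ℝ≥0∞, Measurable ψ → ∀ c : ℝ≥0∞,
      c * volume.withDensity Ω {x | c < S ψ x} ≤ 5 * K * ∫⁻ x, ψ x * Ω x) :
    ∫⁻ x, S φ x ^ q * Ω x ≤ weakConst K q * ∫⁻ x, φ x ^ q * Ω x := by
  have hK't : (5 * K + 1 : ℝ≥0∞) ≠ ∞ := by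
    simp [ENNReal.mul_eq_top]
  have hM := hS φ hφ
  have := lintegral_rpow_le_of_weak (μ := volume.withDensity Ω) (φ := φ) (Φ := S φ) hφ hM hK't
    hq fun c hc => ?_
  · rw [lintegral_withDensity_eq_lintegral_mul _ hΩ (hM.pow_const _),
      lintegral_withDensity_eq_lintegral_mul _ hΩ (hφ.pow_const _)] at this
    rw [weakConst]
    simpa only [Pi.mul_apply, mul_comm (Ω _)] using this
  · set ψ : ℝ → ℝ≥0∞ := fun x => φ x * (if ENNReal.ofReal c < φ x then 1 else 0) with hψ
    have hψm : Measurable ψ := hφ.mul (Measurable.ite (measurableSet_lt measurable_const hφ)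
      measurable_const measurable_const)
    have hsub : {x | ((5 * K + 1 : ℝ≥0∞) + 1) * ENNReal.ofReal c < S φ x}
        ⊆ {x | ENNReal.ofReal c < S ψ x} := by
      intro x hx
      simp only [mem_ofPred_eq] at hx ⊢
      by_contra! hcon
      refine absurd hx (not_lt.2 ((hsplit ψ (ENNReal.ofReal c) hψm
        (fun y => mul_indicator_add_le _ _) x).trans ?_))
      calc S ψ x + (5 * K + 1) * ENNReal.ofReal c
          ≤ ENNReal.ofReal c + (5 * K + 1) * ENNReal.ofReal c := by gcongr
        _ = _ := by ring
    refine (mul_le_mul_right (measure_mono hsub) _).trans ((hw ψ hψm _).trans ?_)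
    rw [lintegral_withDensity_eq_lintegral_mul _ hΩ hψm]
    simp only [Pi.mul_apply, mul_comm (Ω _)]
    exact mul_le_mul_left le_self_add _

/-- The weighted maximal inequality for an `A₁` weight. -/
lemma exists_lintegral_maxFn_rpow_mul_le (K : ℝ≥0) {q : ℝ} (hq : 1 < q) :
    ∃ C : ℝ≥0, ∀ Ω φ : ℝ → ℝ≥0∞, Measurable Ω → Measurable φ → (∀ x, maxFn Ω x ≤ K * Ω x) →
      ∫⁻ x, maxFn φ x ^ q * Ω x ≤ C * ∫⁻ x, φ x ^ q * Ω x := by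
  refine ⟨(weakConst K q).toNNReal, fun Ω φ hΩ hφ hA => ?_⟩
  rw [ENNReal.coe_toNNReal (weakConst_ne_top K hq)]
  refine lintegral_rpow_le_of_split hΩ hφ hq maxFn (fun ψ hψ => measurable_maxFn' hψ) ?_
    fun ψ hψ c => mul_measure_maxFn_le hΩ hψ hA c
  intro ψ c hψ h x
  refine (maxFn_mono h x).trans ((maxFn_add_le hψ x).trans (add_le_add le_rfl ?_))
  refine (maxFn_const_le c x).trans ?_
  rw [add_mul, one_mul]
  exact le_add_self

/-- The dual weighted maximal inequality for an `A₁` weight. -/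
lemma exists_lintegral_maxFn_rpow_mul_le' (K : ℝ≥0) {q : ℝ} (hq : 1 < q) :
    ∃ C : ℝ≥0, ∀ Ω f : ℝ → ℝ≥0∞, Measurable Ω → Measurable f → (∀ x, Ω x ≠ 0) →
      (∀ᵐ x, Ω x ≠ ∞) → (∀ x, maxFn Ω x ≤ K * Ω x) →
      ∫⁻ x, maxFn f x ^ q * Ω x ^ (1 - q) ≤ C * ∫⁻ x, f x ^ q * Ω x ^ (1 - q) := by
  refine ⟨(weakConst K q).toNNReal, fun Ω f hΩ hf hΩ0 hΩt hA => ?_⟩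
  rw [ENNReal.coe_toNNReal (weakConst_ne_top K hq)]
  have hq0 : 0 < q := by linarith
  have := lintegral_rpow_le_of_split (φ := fun x => f x / Ω x) hΩ (hf.div hΩ) hq
    (K := K) (fun ψ x => maxFn (fun y => ψ y * Ω y) x / Ω x)
    (fun ψ hψ => (measurable_maxFn' (hψ.mul hΩ)).div hΩ) ?_
    fun ψ hψ c => mul_measure_maxFn_div_le hΩ hψ hΩ0 hA c
  · have e1 : ∀ u w : ℝ≥0∞, w ≠ 0 → w ≠ ∞ → (u / w) ^ q * w = u ^ q * w ^ (1 - q) := by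
      intro u w h0 ht
      rw [ENNReal.div_rpow_of_nonneg _ _ hq0.le, ENNReal.div_eq_inv_mul, ← ENNReal.rpow_neg,
        sub_eq_add_neg, ENNReal.rpow_add _ _ h0 ht, ENNReal.rpow_one]
      ring
    have e2 : (fun y => f y / Ω y * Ω y) =ᵐ[volume] f := by
      filter_upwards [hΩt] with x hx
      rw [ENNReal.div_mul_cancel (hΩ0 x) hx]
    simp only [maxFn_congr_ae e2] at this
    refine le_of_eq_of_le (lintegral_congr_ae ?_) (this.trans (le_of_eq (congrArg _
      (lintegral_congr_ae ?_))))
    · filter_upwards [hΩt] with x hx using (e1 _ _ (hΩ0 x) hx).symm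
    · filter_upwards [hΩt] with x hx using e1 _ _ (hΩ0 x) hx
  · intro ψ c hψ h x
    have h1 : maxFn (fun y => f y / Ω y * Ω y) x
        ≤ maxFn (fun y => ψ y * Ω y) x + c * (K * Ω x) := by
      refine (maxFn_mono (ψ := fun y => ψ y * Ω y + c * Ω y) (fun y => ?_) x).trans
        ((maxFn_add_le (hψ.mul hΩ) x).trans (add_le_add le_rfl ?_))
      · rw [← add_mul]
        exact mul_le_mul_left (h y) _
      · exact (maxFn_const_mul_le c hΩ x).trans (mul_le_mul_right (hA x) _)
    refine (ENNReal.div_le_div_right h1 _).trans ?_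
    rw [ENNReal.add_div]
    refine add_le_add le_rfl ?_
    refine ENNReal.div_le_of_le_mul ?_
    calc c * (K * Ω x) = K * c * Ω x := by ring
      _ ≤ (5 * K + 1) * c * Ω x := by
        gcongr
        calc (K : ℝ≥0∞) = 1 * K := (one_mul _).symm
          _ ≤ 5 * K := by gcongr; norm_num
          _ ≤ 5 * K + 1 := le_self_add

section MaximalMixed

variable {τ : Type*}

/-- The maximal function in the first variable. -/
def maxX (F : ℝ → τ → ℝ≥0∞) : ℝ → τ → ℝ≥0∞ := fun x t => maxFn (fun y => F y t) x

variable [MeasurableSpace τ]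

lemma measurable_maxX {F : ℝ → τ → ℝ≥0∞} (hF : Measurable (Function.uncurry F)) :
    Measurable (Function.uncurry (maxX F)) := measurable_maxFn hF

/-- Rubio de Francia's construction of an `A₁` majorant. -/
lemma exists_majorant_of_bound {p q : ℝ} {ν : Measure τ} [SFinite ν] (hp : 1 ≤ p) (hq : 1 ≤ q)
    {A : ℝ≥0} (hA : A ≠ 0) (hM : ∀ F : ℝ → τ → ℝ≥0∞, Measurable (Function.uncurry F) →
      mixedNorm p q ν (maxX F) ≤ A * mixedNorm p q ν F) {h : ℝ → τ → ℝ≥0∞}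
    (hh : Measurable (Function.uncurry h)) :
    ∃ Ω : ℝ → τ → ℝ≥0∞, Measurable (Function.uncurry Ω) ∧ (∀ x t, h x t ≤ Ω x t) ∧
      (∀ t x, maxFn (fun y => Ω y t) x ≤ (2 * A : ℝ≥0) * Ω x t) ∧
      mixedNorm p q ν Ω ≤ 2 * mixedNorm p q ν h := by
  have hp0 : 0 < p := by linarith
  have hq0 : 0 < q := by linarith
  set F : ℕ → ℝ → τ → ℝ≥0∞ := fun k => maxX^[k] h with hF
  have hFs : ∀ k, F (k + 1) = maxX (F k) := fun k => Function.iterate_succ_apply' _ _ _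
  have hFm : ∀ k, Measurable (Function.uncurry (F k)) := by
    intro k
    induction k with
    | zero => exact hh
    | succ k ih => rw [hFs]; exact measurable_maxX ih
  have hFN : ∀ k, mixedNorm p q ν (F k) ≤ (A : ℝ≥0∞) ^ k * mixedNorm p q ν h := by
    intro k
    induction k with
    | zero => simp [hF]
    | succ k ih =>
      rw [hFs, pow_succ, mul_comm ((A : ℝ≥0∞) ^ k), mul_assoc]
      exact (hM _ (hFm k)).trans (mul_le_mul_right ih _)
  set c : ℝ≥0∞ := ((2 * A : ℝ≥0) : ℝ≥0∞) with hc
  have hc0 : c ≠ 0 := by simp [hc, hA]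
  have hct : c ≠ ∞ := ENNReal.coe_ne_top
  have hmul : ∀ k, Measurable (Function.uncurry fun x t => (c⁻¹) ^ k * F k x t) :=
    fun k => (hFm k).const_mul _
  refine ⟨fun x t => ∑' k, (c⁻¹) ^ k * F k x t, Measurable.tsum hmul, fun x t => ?_,
    fun t x => ?_, ?_⟩
  · refine le_trans ?_ (ENNReal.le_tsum 0)
    simp [hF]
  · refine (maxFn_tsum_le (fun k => ((hmul k).comp measurable_prodMk_right :
      Measurable fun y => (c⁻¹) ^ k * F k y t)) x).trans ?_
    have h1 : ∀ k, maxFn (fun y => (c⁻¹) ^ k * F k y t) x ≤ c * ((c⁻¹) ^ (k + 1) * F (k + 1) x t) :=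
      fun k => by
        refine (maxFn_const_mul_le _ (hFm k).of_uncurry_right x).trans (le_of_eq ?_)
        rw [hFs, pow_succ, ← mul_assoc, mul_left_comm, ENNReal.mul_inv_cancel hc0 hct, mul_one]
        rfl
    refine (ENNReal.tsum_le_tsum h1).trans ?_
    rw [ENNReal.tsum_mul_left]
    refine mul_le_mul_right ?_ _
    exact ENNReal.tsum_comp_le_tsum_of_injective (add_left_injective 1)
      (fun k => (c⁻¹) ^ k * F k x t)
  · refine (mixedNorm_tsum_le hp hq hmul).trans ?_
    have h1 : ∀ k, mixedNorm p q ν (fun x t => (c⁻¹) ^ k * F k x t)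
        ≤ (2⁻¹ : ℝ≥0∞) ^ k * mixedNorm p q ν h := fun k => by
      rw [mixedNorm_const_mul hp0 hq0 _ (hFm k)]
      refine (mul_le_mul_right (hFN k) _).trans (le_of_eq ?_)
      rw [← mul_assoc, ← mul_pow]
      congr 2
      rw [hc, ENNReal.coe_mul, ENNReal.mul_inv (by simp) (by simp), mul_assoc,
        ENNReal.inv_mul_cancel (by simpa using hA) (by simp)]
      simp
    refine (ENNReal.tsum_le_tsum h1).trans ?_
    rw [ENNReal.tsum_mul_right, ENNReal.tsum_geometric, ENNReal.one_sub_inv_two, inv_inv]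

lemma exists_lintegral_maxFn_rpow_le {q : ℝ} (hq : 1 < q) :
    ∃ C : ℝ≥0, ∀ φ : ℝ → ℝ≥0∞, Measurable φ →
      ∫⁻ x, maxFn φ x ^ q ≤ C * ∫⁻ x, φ x ^ q := by
  obtain ⟨C, hC⟩ := exists_lintegral_maxFn_rpow_mul_le 1 hq
  refine ⟨C, fun φ hφ => ?_⟩
  have := hC (fun _ => 1) φ measurable_const hφ fun x => by
    simpa using maxFn_const_le 1 x
  simpa using this

lemma mixedNorm_dirac {p q : ℝ} (hq : 0 < q) (f : ℝ → ℝ≥0∞) :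
    mixedNorm p q (Measure.dirac ()) (fun x _ => f x) = Lnorm p volume f := by
  simp only [mixedNorm]
  congr 1
  ext x
  simp [Lnorm, ← ENNReal.rpow_mul, hq.ne']

lemma Lnorm_le_of_forall {p p' : ℝ} (hp : p.HolderConjugate p') {G : ℝ → ℝ≥0∞}
    (hG : Measurable G) {C : ℝ≥0∞} (h : ∀ H : ℝ → ℝ≥0∞, Measurable H →
      ∫⁻ x, G x * H x ≤ C * Lnorm p' volume H) : Lnorm p volume G ≤ C := by
  rw [← mixedNorm_dirac (q := 2) two_pos]
  have hGm : Measurable (Function.uncurry fun (x : ℝ) (_ : Unit) => G x) := hG.comp measurable_fst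
  refine mixedNorm_le_of_forall (q' := 2) hp .two_two hGm fun n H hH _ _ => ?_
  have e : H = fun x _ => H x () := by
    ext x t; rfl
  have hHm : Measurable fun x => H x () := hH.of_uncurry_right
  have := h (fun x => H x ()) hHm
  rw [← mixedNorm_dirac (q := 2) two_pos, ← e] at this
  simpa using this

lemma exists_A1_majorant {p : ℝ} (hp : 1 < p) :
    ∃ A : ℝ≥0, ∀ h : ℝ → ℝ≥0∞, Measurable h → ∃ Ω : ℝ → ℝ≥0∞, Measurable Ω ∧ (∀ x, h x ≤ Ω x) ∧
      (∀ x, maxFn Ω x ≤ A * Ω x) ∧ Lnorm p volume Ω ≤ 2 * Lnorm p volume h := by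
  have hp0 : 0 < p := by linarith
  obtain ⟨C, hC⟩ := exists_lintegral_maxFn_rpow_le hp
  set B : ℝ≥0 := max 1 (C ^ (1 / p)) with hB
  have hB0 : B ≠ 0 := (lt_of_lt_of_le one_pos (le_max_left _ _)).ne'
  have hM : ∀ F : ℝ → Unit → ℝ≥0∞, Measurable (Function.uncurry F) →
      mixedNorm p 2 (Measure.dirac ()) (maxX F) ≤ B * mixedNorm p 2 (Measure.dirac ()) F := by
    intro F hF
    have e : F = fun x _ => F x () := by
      ext x t; rfl
    have e' : maxX F = fun x _ => maxFn (fun y => F y ()) x := by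
      ext x t; rfl
    rw [e', e, mixedNorm_dirac two_pos, mixedNorm_dirac two_pos]
    calc Lnorm p volume (maxFn fun y => F y ())
        ≤ (C * ∫⁻ x, F x () ^ p) ^ (1 / p) :=
          ENNReal.rpow_le_rpow (hC _ hF.of_uncurry_right) (by positivity)
      _ = (C : ℝ≥0∞) ^ (1 / p) * Lnorm p volume fun x => F x () := by
          rw [ENNReal.mul_rpow_of_nonneg _ _ (by positivity)]; rfl
      _ ≤ _ := by
          gcongr
          rw [← ENNReal.coe_rpow_of_nonneg _ (by positivity)]
          exact_mod_cast le_max_right _ _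
  refine ⟨2 * B, fun h hh => ?_⟩
  obtain ⟨Ω, h1, h2, h3, h4⟩ := exists_majorant_of_bound hp.le one_le_two hB0 hM
    (h := fun x _ => h x) (hh.comp measurable_fst)
  refine ⟨fun x => Ω x (), h1.of_uncurry_right, fun x => h2 x (), fun x => h3 () x, ?_⟩
  rw [mixedNorm_dirac two_pos] at h4
  rwa [← mixedNorm_dirac (q := 2) two_pos]

/-- A strictly positive function lying in every `L^p`, `1 ≤ p < ∞`. -/
def bump (x : ℝ) : ℝ≥0∞ := ENNReal.ofReal (1 + x ^ 2)⁻¹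

lemma measurable_bump : Measurable bump := by unfold bump; fun_prop

lemma bump_ne_zero (x : ℝ) : bump x ≠ 0 := by
  simp only [bump, ne_eq, ENNReal.ofReal_eq_zero, not_le]; positivity

lemma bump_le_one (x : ℝ) : bump x ≤ 1 := by
  rw [bump, ENNReal.ofReal_le_one]
  exact inv_le_one_of_one_le₀ (by nlinarith [sq_nonneg x])

lemma lintegral_bump_ne_top : ∫⁻ x, bump x ≠ ∞ :=
  (integrable_inv_one_add_sq.lintegral_lt_top).ne

lemma Lnorm_bump_ne_top {p : ℝ} (hp : 1 ≤ p) : Lnorm p volume bump ≠ ∞ := by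
  refine ENNReal.rpow_ne_top_of_nonneg (by positivity)
    (ne_top_of_le_ne_top lintegral_bump_ne_top (lintegral_mono fun x => ?_))
  exact (ENNReal.rpow_le_rpow_of_exponent_ge (bump_le_one x) hp).trans_eq (ENNReal.rpow_one _)

lemma exists_mixedNorm_maxX_le_of_lt {p q : ℝ} (hq : 1 < q) (hpq : q < p) :
    ∃ C : ℝ≥0, ∀ (ν : Measure τ) [IsFiniteMeasure ν] (F : ℝ → τ → ℝ≥0∞),
      Measurable (Function.uncurry F) → mixedNorm p q ν (maxX F) ≤ C * mixedNorm p q ν F := by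
  have hq0 : 0 < q := by linarith
  have hp0 : 0 < p := by linarith
  have hs : 1 < p / q := (one_lt_div hq0).2 hpq
  set s := p / q with hs'
  have hc : s.HolderConjugate (Real.conjExponent s) := Real.HolderConjugate.conjExponent hs
  set s' := Real.conjExponent s
  obtain ⟨A, hA⟩ := exists_A1_majorant hc.symm.lt
  obtain ⟨C, hC⟩ := exists_lintegral_maxFn_rpow_mul_le A hq
  refine ⟨(C * 2) ^ (1 / q), fun ν _ F hF => ?_⟩
  have hMF := measurable_maxX hF
  have e : ∀ G : ℝ → τ → ℝ≥0∞, Lnorm s volume (fun x => ∫⁻ t, G x t ^ q ∂ν)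
      = mixedNorm p q ν G ^ q := fun G => by
    simp only [mixedNorm, ← Lnorm_rpow_self hq0]
    rw [Lnorm_rpow hq0, hs', div_mul_cancel₀ _ hq0.ne']
  have key : Lnorm s volume (fun x => ∫⁻ t, maxX F x t ^ q ∂ν)
      ≤ C * 2 * Lnorm s volume (fun x => ∫⁻ t, F x t ^ q ∂ν) := by
    refine Lnorm_le_of_forall hc (hMF.pow_const q).lintegral_prod_right' fun w hw => ?_
    obtain ⟨Ω, h1, h2, h3, h4⟩ := hA w hw
    have hV : Measurable fun x => ∫⁻ t, F x t ^ q ∂ν := (hF.pow_const q).lintegral_prod_right'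
    have hm1 : ∀ G : ℝ → τ → ℝ≥0∞, Measurable (Function.uncurry G) →
        Measurable (Function.uncurry fun x t => G x t ^ q * Ω x) := fun G hG =>
      (hG.pow_const q).mul (h1.comp measurable_fst)
    have hsw : ∀ G : ℝ → τ → ℝ≥0∞, Measurable (Function.uncurry G) →
        ∫⁻ x, (∫⁻ t, G x t ^ q ∂ν) * Ω x = ∫⁻ t, (∫⁻ x, G x t ^ q * Ω x) ∂ν := fun G hG => by
      rw [← lintegral_lintegral_swap (hm1 G hG).aemeasurable]
      refine lintegral_congr fun x => ?_
      rw [lintegral_mul_const _ (hG.of_uncurry_left.pow_const _)]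
    calc ∫⁻ x, (∫⁻ t, maxX F x t ^ q ∂ν) * w x
        ≤ ∫⁻ x, (∫⁻ t, maxX F x t ^ q ∂ν) * Ω x :=
          lintegral_mono fun x => mul_le_mul_right (h2 x) _
      _ = ∫⁻ t, (∫⁻ x, maxX F x t ^ q * Ω x) ∂ν := hsw _ hMF
      _ ≤ ∫⁻ t, C * (∫⁻ x, F x t ^ q * Ω x) ∂ν :=
          lintegral_mono fun t => hC Ω (fun x => F x t) h1 hF.of_uncurry_right h3
      _ = C * ∫⁻ x, (∫⁻ t, F x t ^ q ∂ν) * Ω x := by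
          have hm2 : Measurable fun t => ∫⁻ x, F x t ^ q * Ω x := (hm1 F hF).lintegral_prod_left'
          rw [hsw _ hF, lintegral_const_mul _ hm2]
      _ ≤ C * (Lnorm s volume (fun x => ∫⁻ t, F x t ^ q ∂ν) * (2 * Lnorm s' volume w)) := by
          gcongr
          exact (lintegral_mul_le_Lnorm hc hV h1).trans (by gcongr)
      _ = _ := by ring
  rw [e, e] at key
  have := ENNReal.rpow_le_rpow key (z := 1 / q) (by positivity)
  rw [← ENNReal.rpow_mul, mul_one_div_cancel hq0.ne', ENNReal.rpow_one,
    ENNReal.mul_rpow_of_nonneg _ _ (by positivity), ← ENNReal.rpow_mul,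
    mul_one_div_cancel hq0.ne', ENNReal.rpow_one] at this
  rw [ENNReal.coe_rpow_of_nonneg _ (by positivity)]
  simpa using this

lemma le_mul_of_forall_le_mul_add {a b c D : ℝ≥0∞} (hc : c ≠ ∞) (hD : D ≠ ∞)
    (h : ∀ ε : ℝ≥0, 0 < ε → a ≤ D * (b + ε * c)) : a ≤ D * b := by
  have h1 : Tendsto (fun ε : ℝ≥0 => D * (b + (ε : ℝ≥0∞) * c)) (𝓝[>] 0)
      (𝓝 (D * (b + (0:ℝ≥0) * c))) := by
    refine Tendsto.mono_left ?_ nhdsWithin_le_nhds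
    refine ENNReal.Tendsto.const_mul (tendsto_const_nhds.add ?_) (Or.inr hD)
    exact ENNReal.Tendsto.mul_const (ENNReal.tendsto_coe.2 tendsto_id) (Or.inr hc)
  simp only [ENNReal.coe_zero, zero_mul, add_zero] at h1
  exact ge_of_tendsto h1 (by filter_upwards [self_mem_nhdsWithin] with ε hε using h ε hε)

lemma exists_mixedNorm_maxX_le_of_gt {p q : ℝ} (hp : 1 < p) (hpq : p < q) :
    ∃ C : ℝ≥0, ∀ (ν : Measure τ) [IsFiniteMeasure ν] (F : ℝ → τ → ℝ≥0∞),
      Measurable (Function.uncurry F) → mixedNorm p q ν (maxX F) ≤ C * mixedNorm p q ν F := by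
  have hp0 : 0 < p := by linarith
  have hq1 : 0 < q - 1 := by linarith
  have hq0 : 0 < q := by linarith
  have hqp : 0 < q - p := by linarith
  obtain ⟨A, hA⟩ := exists_A1_majorant hp
  set θ := (q - p) / (q - 1) with hθ
  have hθ0 : 0 < θ := div_pos (by linarith) hq1
  have hθ1 : θ < 1 := (div_lt_one hq1).2 (by linarith)
  have hθq : θ * (1 - q) = p - q := by
    rw [hθ, div_mul_eq_mul_div, div_eq_iff hq1.ne']; ring
  obtain ⟨C, hC⟩ := exists_lintegral_maxFn_rpow_mul_le' (A ^ θ) (q := q) (by linarith)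
  set D : ℝ≥0 := (C + 1) ^ (1 / q) * 2 with hD
  have hD0 : D ≠ 0 := by
    have : 0 < D := by positivity
    exact this.ne'
  refine ⟨D, fun ν _ F hF => ?_⟩
  have hMF := measurable_maxX hF
  by_cases htop : mixedNorm p q ν F = ∞
  · rw [htop, ENNReal.mul_top (by simpa using hD0)]; exact le_top
  refine le_mul_of_forall_le_mul_add (Lnorm_bump_ne_top hp.le) ENNReal.coe_ne_top fun ε hε => ?_
  have hε0 : (ε : ℝ≥0∞) ≠ 0 := by simpa using hε.ne'
  have hLm := measurable_Lnorm (q := q) (ν := ν) hF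
  set w : ℝ → ℝ≥0∞ := fun x => Lnorm q ν (F x) + ε * bump x with hw
  have hwm : Measurable w := hLm.add (measurable_bump.const_mul _)
  have hwN : Lnorm p volume w ≤ mixedNorm p q ν F + ε * Lnorm p volume bump := by
    refine (Lnorm_add_le hp.le hLm (measurable_bump.const_mul _)).trans (le_of_eq ?_)
    rw [Lnorm_const_mul hp0 _ measurable_bump]; rfl
  have hwt : Lnorm p volume w ≠ ∞ := ne_top_of_le_ne_top (ENNReal.add_ne_top.2
    ⟨htop, ENNReal.mul_ne_top ENNReal.coe_ne_top (Lnorm_bump_ne_top hp.le)⟩) hwN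
  obtain ⟨Ω, h1, h2, h3, h4⟩ := hA w hwm
  have hΩ0 : ∀ x, Ω x ≠ 0 := fun x h => by
    have := h2 x
    rw [h] at this
    simp only [hw, nonpos_iff_eq_zero, add_eq_zero, mul_eq_zero, hε0, bump_ne_zero, or_self,
      and_false] at this
  have hΩt : ∀ᵐ x, Ω x ≠ ∞ := by
    have : Lnorm p volume Ω ≠ ∞ := ne_top_of_le_ne_top (ENNReal.mul_ne_top (by simp) hwt) h4
    filter_upwards [ae_lt_top_of_Lnorm hp0 h1 this] with x hx using hx.ne
  have hU := fun t => hC (fun x => Ω x ^ θ) (fun x => F x t) (h1.pow_const _) hF.of_uncurry_right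
    (fun x => by simp [ENNReal.rpow_eq_zero_iff, hΩ0 x, hθ0.le, not_lt])
    (by filter_upwards [hΩt] with x hx using ENNReal.rpow_ne_top_of_nonneg hθ0.le hx)
    (fun x => by
      refine (maxFn_rpow_le h1 hθ0 hθ1 x).trans ((ENNReal.rpow_le_rpow (h3 x) hθ0.le).trans_eq ?_)
      rw [ENNReal.mul_rpow_of_nonneg _ _ hθ0.le, ENNReal.coe_rpow_of_nonneg _ hθ0.le])
  simp only [← ENNReal.rpow_mul, hθq] at hU
  have hm1 : ∀ G : ℝ → τ → ℝ≥0∞, Measurable (Function.uncurry G) →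
      Measurable (Function.uncurry fun x t => G x t ^ q * Ω x ^ (p - q)) := fun G hG =>
    (hG.pow_const q).mul ((h1.comp measurable_fst).pow_const _)
  have hsw : ∀ G : ℝ → τ → ℝ≥0∞, Measurable (Function.uncurry G) →
      ∫⁻ x, Lnorm q ν (G x) ^ q * Ω x ^ (p - q)
        = ∫⁻ t, (∫⁻ x, G x t ^ q * Ω x ^ (p - q)) ∂ν := fun G hG => by
    rw [← lintegral_lintegral_swap (hm1 G hG).aemeasurable]
    refine lintegral_congr fun x => ?_
    rw [lintegral_mul_const _ (hG.of_uncurry_left.pow_const _), Lnorm_rpow_self hq0]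
  have key : ∫⁻ x, Lnorm q ν (maxX F x) ^ q * Ω x ^ (p - q) ≤ C * ∫⁻ x, Ω x ^ p :=
    calc ∫⁻ x, Lnorm q ν (maxX F x) ^ q * Ω x ^ (p - q)
        ≤ ∫⁻ t, C * (∫⁻ x, F x t ^ q * Ω x ^ (p - q)) ∂ν := by
          rw [hsw _ hMF]
          exact lintegral_mono fun t => hU t
      _ = C * ∫⁻ x, Lnorm q ν (F x) ^ q * Ω x ^ (p - q) := by
          have hm2 : Measurable fun t => ∫⁻ x, F x t ^ q * Ω x ^ (p - q) :=
            (hm1 F hF).lintegral_prod_left'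
          rw [hsw _ hF, lintegral_const_mul _ hm2]
      _ ≤ C * ∫⁻ x, Ω x ^ p := by
          refine mul_le_mul_right (lintegral_mono_ae ?_) _
          filter_upwards [hΩt] with x hx
          calc Lnorm q ν (F x) ^ q * Ω x ^ (p - q) ≤ Ω x ^ q * Ω x ^ (p - q) := by
                gcongr
                exact le_self_add.trans (h2 x)
            _ = Ω x ^ p := by
                rw [← ENNReal.rpow_add _ _ (hΩ0 x) hx]; congr 1; ring
  set r := p * q / (q - p) with hr
  have hr0 : 0 < r := by positivity
  have hWm := measurable_Lnorm (q := q) (ν := ν) hMF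
  calc mixedNorm p q ν (maxX F)
      ≤ Lnorm p volume (fun x => (Lnorm q ν (maxX F x) * Ω x ^ ((p - q) / q)) *
          Ω x ^ ((q - p) / q)) := by
        refine Lnorm_mono_ae hp0 ?_
        filter_upwards [hΩt] with x hx
        rw [mul_assoc, ← ENNReal.rpow_add _ _ (hΩ0 x) hx]
        have : (p - q) / q + (q - p) / q = 0 := by ring
        rw [this, ENNReal.rpow_zero, mul_one]
    _ ≤ Lnorm q volume (fun x => Lnorm q ν (maxX F x) * Ω x ^ ((p - q) / q)) *
          Lnorm r volume (fun x => Ω x ^ ((q - p) / q)) := by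
        refine Lnorm_mul_le hp0 hq0 hr0 ?_ (hWm.mul (h1.pow_const _)) (h1.pow_const _)
        rw [hr]; field_simp; ring
    _ ≤ (C * ∫⁻ x, Ω x ^ p) ^ (1 / q) * Lnorm p volume Ω ^ ((q - p) / q) := by
        have e : r * ((q - p) / q) = p := by rw [hr]; field_simp
        rw [Lnorm_rpow (by positivity), e]
        gcongr
        refine ENNReal.rpow_le_rpow (le_trans (le_of_eq ?_) key) (by positivity)
        refine lintegral_congr fun x => ?_
        rw [ENNReal.mul_rpow_of_nonneg _ _ hq0.le, ← ENNReal.rpow_mul, div_mul_cancel₀ _ hq0.ne']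
    _ = (C : ℝ≥0∞) ^ (1 / q) * Lnorm p volume Ω := by
        rw [← Lnorm_rpow_self hp0, ENNReal.mul_rpow_of_nonneg _ _ (by positivity), mul_assoc,
          ← ENNReal.rpow_mul, ← ENNReal.rpow_add_of_nonneg _ _ (by positivity) (by positivity)]
        have : p * (1 / q) + (q - p) / q = 1 := by field_simp; ring
        rw [this, ENNReal.rpow_one]
    _ ≤ ((C + 1 : ℝ≥0) : ℝ≥0∞) ^ (1 / q) * (2 * Lnorm p volume w) := by
        gcongr
        exact_mod_cast le_self_add
    _ ≤ D * (mixedNorm p q ν F + ε * Lnorm p volume bump) := by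
        rw [hD, ENNReal.coe_mul, ENNReal.coe_rpow_of_nonneg _ (by positivity), mul_assoc]
        gcongr
        simp

/-- The maximal function is bounded on the mixed-norm spaces. -/
theorem exists_mixedNorm_maxX_le {p q : ℝ} (hp : 1 < p) (hq : 1 < q) :
    ∃ C : ℝ≥0, C ≠ 0 ∧ ∀ (ν : Measure τ) [IsFiniteMeasure ν] (F : ℝ → τ → ℝ≥0∞),
      Measurable (Function.uncurry F) → mixedNorm p q ν (maxX F) ≤ C * mixedNorm p q ν F := by
  suffices h : ∃ C : ℝ≥0, ∀ (ν : Measure τ) [IsFiniteMeasure ν] (F : ℝ → τ → ℝ≥0∞),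
      Measurable (Function.uncurry F) → mixedNorm p q ν (maxX F) ≤ C * mixedNorm p q ν F by
    obtain ⟨C, hC⟩ := h
    refine ⟨C + 1, by positivity, fun ν _ F hF => (hC ν F hF).trans ?_⟩
    gcongr
    simp
  rcases lt_trichotomy p q with h | rfl | h
  · exact exists_mixedNorm_maxX_le_of_gt hp h
  · have hp0 : 0 < p := by linarith
    obtain ⟨C, hC⟩ := exists_lintegral_maxFn_rpow_le hp
    refine ⟨C ^ (1 / p), fun ν _ F hF => ?_⟩
    have e : ∀ G : ℝ → τ → ℝ≥0∞, Measurable (Function.uncurry G) →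
        mixedNorm p p ν G = (∫⁻ t, (∫⁻ x, G x t ^ p) ∂ν) ^ (1 / p) := fun G hG => by
      rw [mixedNorm, Lnorm]
      simp only [Lnorm_rpow_self hp0]
      rw [lintegral_lintegral_swap (hG.pow_const p).aemeasurable]
    rw [e _ (measurable_maxX hF), e _ hF, ENNReal.coe_rpow_of_nonneg _ (by positivity),
      ← ENNReal.mul_rpow_of_nonneg _ _ (by positivity)]
    refine ENNReal.rpow_le_rpow ?_ (by positivity)
    have hm2 : Measurable fun t => ∫⁻ x, F x t ^ p := (hF.pow_const p).lintegral_prod_left'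
    rw [← lintegral_const_mul _ hm2]
    exact lintegral_mono fun t => hC _ hF.of_uncurry_right
  · exact exists_mixedNorm_maxX_le_of_lt hq h

/-- `A₁` majorants in mixed-norm spaces. -/
theorem exists_A1_majorant_mixed {p q : ℝ} (hp : 1 < p) (hq : 1 < q) :
    ∃ A : ℝ≥0, ∀ (ν : Measure τ) [IsFiniteMeasure ν] (h : ℝ → τ → ℝ≥0∞),
      Measurable (Function.uncurry h) → ∃ Ω : ℝ → τ → ℝ≥0∞, Measurable (Function.uncurry Ω) ∧
      (∀ x t, h x t ≤ Ω x t) ∧ (∀ t x, maxFn (fun y => Ω y t) x ≤ A * Ω x t) ∧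
      mixedNorm p q ν Ω ≤ 2 * mixedNorm p q ν h := by
  obtain ⟨C, hC0, hC⟩ := exists_mixedNorm_maxX_le (τ := τ) hp hq
  exact ⟨2 * C, fun ν _ h hh => exists_majorant_of_bound hp.le hq.le hC0 (hC ν) hh⟩

end MaximalMixed

/-- The additive character `t ↦ exp (2πit)`. -/
def ep (t : ℝ) : ℂ := Complex.exp ((2 * π * t : ℝ) * Complex.I)

lemma ep_add (s t : ℝ) : ep (s + t) = ep s * ep t := by
  rw [ep, ep, ep, ← Complex.exp_add]; congr 1; push_cast; ring

lemma norm_ep (t : ℝ) : ‖ep t‖ = 1 := by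
  rw [ep, Complex.norm_exp_ofReal_mul_I]

@[simp] lemma ep_zero : ep 0 = 1 := by simp [ep]

lemma continuous_ep : Continuous ep := by unfold ep; fun_prop

lemma fourierInv_eq_ep (f : ℝ → ℂ) (x : ℝ) : 𝓕⁻ f x = ∫ v, ep (v * x) * f v := by
  rw [Real.fourierInv_eq']
  refine integral_congr_ae (.of_forall fun v => ?_)
  simp only [smul_eq_mul, ep]
  congr 2
  simp
  ring_nf

lemma fourier_eq_ep (f : ℝ → ℂ) (w : ℝ) : 𝓕 f w = ∫ v, ep (-(v * w)) * f v := by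
  rw [Real.fourier_eq']
  refine integral_congr_ae (.of_forall fun v => ?_)
  simp only [smul_eq_mul, ep]
  congr 2
  simp
  ring_nf

/-- The Poisson kernel of the upper half plane. -/
def poisK (y x : ℝ) : ℝ := π⁻¹ * (y / (x ^ 2 + y ^ 2))

/-- The derivative kernel `(2π (y - ix)²)⁻¹`. -/
def cauK (y x : ℝ) : ℂ := (2 * π * (y - Complex.I * x) ^ 2)⁻¹

/-- The Fourier transform of the Poisson kernel. -/
def poisS (y η : ℝ) : ℝ := Real.exp (-(2 * π * y * |η|))

/-- The Fourier transform of the derivative kernel. -/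
def cauS (y η : ℝ) : ℝ := 2 * π * max η 0 * Real.exp (-(2 * π * y * |η|))

lemma measurable_poisK : Measurable (Function.uncurry poisK) := by
  unfold poisK Function.uncurry; fun_prop

lemma measurable_cauK : Measurable (Function.uncurry cauK) := by
  unfold cauK Function.uncurry; fun_prop

lemma measurable_cauS : Measurable (Function.uncurry cauS) := by
  unfold cauS Function.uncurry; fun_prop

lemma poisK_nonneg {y : ℝ} (hy : 0 ≤ y) (x : ℝ) : 0 ≤ poisK y x := by
  unfold poisK; positivity

lemma poisK_pos {y : ℝ} (hy : 0 < y) (x : ℝ) : 0 < poisK y x := by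
  unfold poisK; positivity

lemma poisK_neg (y x : ℝ) : poisK y (-x) = poisK y x := by simp [poisK]

lemma poisK_sub_comm (y x z : ℝ) : poisK y (x - z) = poisK y (z - x) := by
  rw [← poisK_neg, neg_sub]

lemma norm_cauK {y : ℝ} (hy : 0 < y) (x : ℝ) : ‖cauK y x‖ = poisK y x / (2 * y) := by
  have h1 : ‖(y : ℂ) - Complex.I * x‖ ^ 2 = x ^ 2 + y ^ 2 := by
    rw [← Complex.normSq_eq_norm_sq, Complex.normSq_apply]; simp; ring
  rw [cauK, norm_inv, norm_mul, norm_pow, h1, poisK]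
  have : ‖(2 * π : ℂ)‖ = 2 * π := by
    rw [norm_mul, Complex.norm_real, Complex.norm_ofNat, Real.norm_of_nonneg pi_pos.le]
  rw [this]
  field_simp

lemma integrable_poisK {y : ℝ} (hy : 0 < y) : Integrable (poisK y) := by
  have h := (integrable_inv_one_add_sq.comp_div hy.ne').const_mul (π⁻¹ * y⁻¹)
  refine h.congr (.of_forall fun x => ?_)
  simp only [poisK]
  field_simp
  ring

lemma integrable_cauK {y : ℝ} (hy : 0 < y) : Integrable (cauK y) := by
  refine ((integrable_poisK hy).div_const (2 * y)).mono'
    (measurable_cauK.of_uncurry_left).aestronglyMeasurable (.of_forall fun x => ?_)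
  rw [norm_cauK hy]

lemma continuous_poisS (y : ℝ) : Continuous (poisS y) := by unfold poisS; fun_prop

lemma continuous_cauS (y : ℝ) : Continuous (cauS y) := by unfold cauS; fun_prop

lemma poisS_nonneg (y η : ℝ) : 0 ≤ poisS y η := by unfold poisS; positivity

lemma cauS_nonneg (y η : ℝ) : 0 ≤ cauS y η := by unfold cauS; positivity

lemma poisS_mul (h y η : ℝ) : poisS h η * poisS y η = poisS (y + h) η := by
  unfold poisS; rw [← Real.exp_add]; congr 1; ring

lemma cauS_mul_poisS (h y η : ℝ) : cauS h η * poisS y η = cauS (y + h) η := by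
  unfold cauS poisS; rw [mul_assoc, ← Real.exp_add]; congr 2; ring

lemma integrableOn_exp {a : ℝ} (ha : 0 < a) :
    IntegrableOn (fun x => Real.exp (-(a * x))) (Ioi 0) := by
  simpa [neg_mul] using integrableOn_exp_mul_Ioi (a := -a) (by linarith) 0

lemma integrableOn_mul_exp {a : ℝ} (ha : 0 < a) :
    IntegrableOn (fun x => x * Real.exp (-(a * x))) (Ioi 0) := by
  have := integrableOn_rpow_mul_exp_neg_mul_rpow (p := 1) (s := 1) (b := a) (by norm_num)
    (by norm_num) ha
  simpa [neg_mul] using this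

lemma integrable_of_even {f : ℝ → ℝ} (hf : ∀ x, f (-x) = f x) (h : IntegrableOn f (Ioi 0)) :
    Integrable f := by
  rw [← integrableOn_univ, ← Iic_union_Ioi (a := (0 : ℝ))]
  refine IntegrableOn.union ?_ h
  rw [integrableOn_Iic_iff_integrableOn_Iio]
  have h1 := (Measure.measurePreserving_neg (volume : Measure ℝ)).integrableOn_comp_preimage
    (Homeomorph.neg ℝ).measurableEmbedding (f := f) (s := Iio 0)
  rw [← h1]
  refine (integrableOn_congr_fun (fun x _ => hf x) ?_).mpr ?_
  · exact measurable_neg measurableSet_Iio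
  · simpa using h

lemma integrable_poisS {y : ℝ} (hy : 0 < y) : Integrable (poisS y) := by
  have hpi := pi_pos
  refine integrable_of_even (fun x => by simp [poisS]) ?_
  refine (integrableOn_exp (a := 2 * π * y) (by positivity)).congr_fun (fun x hx => ?_)
    measurableSet_Ioi
  simp only [poisS, abs_of_pos (mem_Ioi.mp hx)]

lemma cauS_of_nonpos {y η : ℝ} (h : η ≤ 0) : cauS y η = 0 := by simp [cauS, max_eq_right h]

lemma cauS_of_pos {y η : ℝ} (h : 0 < η) :
    cauS y η = 2 * π * η * Real.exp (-(2 * π * y * η)) := by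
  simp [cauS, max_eq_left h.le, abs_of_pos h]

lemma cauS_eq_indicator (y : ℝ) : cauS y =
    (Ioi 0).indicator fun η => 2 * π * η * Real.exp (-(2 * π * y * η)) := by
  ext η
  by_cases h : 0 < η
  · rw [indicator_of_mem (mem_Ioi.mpr h), cauS_of_pos h]
  · rw [indicator_of_notMem (by simpa using h), cauS_of_nonpos (by simpa using h)]

lemma integrable_cauS {y : ℝ} (hy : 0 < y) : Integrable (cauS y) := by
  have hpi := pi_pos
  rw [cauS_eq_indicator, integrable_indicator_iff measurableSet_Ioi]
  refine ((integrableOn_mul_exp (a := 2 * π * y) (by positivity)).const_mul (2 * π)).congr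
    (.of_forall fun x => ?_)
  simp only; ring

lemma integral_mul_exp {a : ℂ} (ha : a.re < 0) :
    ∫ x in Ioi (0 : ℝ), (x : ℂ) * Complex.exp (a * x) = (a ^ 2)⁻¹ := by
  have ha0 : a ≠ 0 := by rintro rfl; simp at ha
  have hd : ∀ x ∈ Ici (0 : ℝ), HasDerivAt
      (fun x : ℝ => ((x : ℂ) / a - 1 / a ^ 2) * Complex.exp (a * x))
      (x * Complex.exp (a * x)) x := by
    intro x _
    have h1 : HasDerivAt (fun x : ℝ => (x : ℂ)) 1 x := Complex.ofRealCLM.hasDerivAt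
    have h2 := ((h1.div_const a).sub_const (1 / a ^ 2)).mul ((h1.const_mul a).cexp)
    convert! h2 using 1
    field_simp
    ring
  have hn : ∀ x : ℝ, ‖Complex.exp (a * x)‖ = Real.exp (-(-a.re * x)) := by
    intro x; rw [Complex.norm_exp]; simp
  have hi : IntegrableOn (fun x : ℝ => (x : ℂ) * Complex.exp (a * x)) (Ioi 0) := by
    refine Integrable.mono' (integrableOn_mul_exp (a := -a.re) (by linarith))
      (by fun_prop) ?_
    filter_upwards [ae_restrict_mem measurableSet_Ioi] with x hx
    rw [norm_mul, hn, Complex.norm_real, Real.norm_of_nonneg (mem_Ioi.mp hx).le]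
  have ht : Tendsto (fun x : ℝ => ((x : ℂ) / a - 1 / a ^ 2) * Complex.exp (a * x)) atTop (𝓝 0) := by
    rw [tendsto_zero_iff_norm_tendsto_zero]
    have e1 : Tendsto (fun x : ℝ => x * Real.exp (-(-a.re * x))) atTop (𝓝 0) := by
      have := tendsto_rpow_mul_exp_neg_mul_atTop_nhds_zero 1 (-a.re) (by linarith)
      simpa using this
    have e2 : Tendsto (fun x : ℝ => Real.exp (-(-a.re * x))) atTop (𝓝 0) := by
      have := tendsto_rpow_mul_exp_neg_mul_atTop_nhds_zero 0 (-a.re) (by linarith)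
      simpa using this
    have e3 := (e1.const_mul (‖a‖⁻¹)).add (e2.const_mul (‖a ^ 2‖⁻¹))
    simp only [mul_zero, add_zero] at e3
    refine tendsto_of_tendsto_of_tendsto_of_le_of_le' tendsto_const_nhds e3
      (.of_forall fun _ => norm_nonneg _) ?_
    filter_upwards [eventually_ge_atTop 0] with x hx
    rw [norm_mul, hn, ← mul_assoc, ← add_mul]
    refine mul_le_mul_of_nonneg_right ((norm_sub_le _ _).trans (le_of_eq ?_)) (Real.exp_pos _).le
    rw [norm_div, norm_div, Complex.norm_real, Real.norm_of_nonneg hx, norm_one]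
    field_simp
  rw [integral_Ioi_of_hasDerivAt_of_tendsto' hd hi ht]
  simp

lemma fourierInv_cauS {y : ℝ} (hy : 0 < y) (x : ℝ) :
    𝓕⁻ (fun η => (cauS y η : ℂ)) x = cauK y x := by
  have hpi := pi_pos
  have hr : (-(2 * π * ((y : ℂ) - Complex.I * x))).re < 0 := by
    simp; positivity
  rw [fourierInv_eq_ep]
  have : ∀ v : ℝ, ep (v * x) * (cauS y v : ℂ) = (Ioi 0).indicator (fun v : ℝ =>
      2 * π * ((v : ℂ) * Complex.exp (-(2 * π * ((y : ℂ) - Complex.I * x)) * v))) v := by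
    intro v
    by_cases h : 0 < v
    · rw [indicator_of_mem (mem_Ioi.mpr h), cauS_of_pos h, ep]
      push_cast
      have : Complex.exp (-(2 * π * ((y : ℂ) - Complex.I * x)) * v) =
        Complex.exp (2 * π * (v * x) * Complex.I) * Complex.exp (-(2 * π * y * v)) := by
        rw [← Complex.exp_add]; congr 1; ring
      rw [this]; ring
    · rw [indicator_of_notMem (by simpa using h), cauS_of_nonpos (by simpa using h)]; simp
  simp_rw [this]
  rw [integral_indicator measurableSet_Ioi, integral_const_mul, integral_mul_exp hr, cauK]
  have : (π : ℂ) ≠ 0 := by exact_mod_cast hpi.ne'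
  rw [neg_sq, mul_pow, mul_inv, mul_inv]
  field_simp

lemma fourierInv_poisS {y : ℝ} (hy : 0 < y) (x : ℝ) :
    𝓕⁻ (fun η => (poisS y η : ℂ)) x = poisK y x := by
  have hpi := pi_pos
  have hpi' : (π : ℂ) ≠ 0 := by exact_mod_cast hpi.ne'
  have hr : (-(2 * π * ((y : ℂ) - Complex.I * x))).re < 0 := by
    simp; positivity
  have hr' : 0 < ((2 * π * ((y : ℂ) + Complex.I * x))).re := by
    simp; positivity
  have hI : Integrable fun v : ℝ => ep (v * x) * (poisS y v : ℂ) := by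
    refine (integrable_poisS hy).ofReal.mono' ?_ (.of_forall fun v => ?_)
    · exact ((continuous_ep.comp (by fun_prop)).mul
        (Complex.continuous_ofReal.comp (continuous_poisS y))).aestronglyMeasurable
    · simp [norm_ep, abs_of_nonneg (poisS_nonneg y v)]
  rw [fourierInv_eq_ep, ← intervalIntegral.integral_Iic_add_Ioi (b := 0) hI.integrableOn
    hI.integrableOn]
  have e1 : ∫ v in Ioi (0 : ℝ), ep (v * x) * (poisS y v : ℂ) =
      ∫ v in Ioi (0 : ℝ), Complex.exp (-(2 * π * ((y : ℂ) - Complex.I * x)) * v) := by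
    refine setIntegral_congr_fun measurableSet_Ioi fun v hv => ?_
    simp only [ep, poisS, abs_of_pos (mem_Ioi.mp hv)]
    push_cast
    rw [← Complex.exp_add]; congr 1; ring
  have e2 : ∫ v in Iic (0 : ℝ), ep (v * x) * (poisS y v : ℂ) =
      ∫ v in Iic (0 : ℝ), Complex.exp ((2 * π * ((y : ℂ) + Complex.I * x)) * v) := by
    refine setIntegral_congr_fun measurableSet_Iic fun v hv => ?_
    simp only [ep, poisS, abs_of_nonpos (mem_Iic.mp hv)]
    push_cast
    rw [← Complex.exp_add]; congr 1; ring
  rw [e1, e2, integral_exp_mul_complex_Ioi hr, integral_exp_mul_complex_Iic hr', poisK]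
  have h1 : (y : ℂ) - Complex.I * x ≠ 0 := by
    intro h; have := congrArg Complex.re h; simp at this; linarith
  have h2 : (y : ℂ) + Complex.I * x ≠ 0 := by
    intro h; have := congrArg Complex.re h; simp at this; linarith
  have h3 : (x : ℂ) ^ 2 + y ^ 2 = (y - Complex.I * x) * (y + Complex.I * x) := by
    ring_nf; simp
  push_cast
  rw [h3]
  simp only [mul_zero, Complex.exp_zero]
  field_simp
  ring

/-- A convolution kernel acts on characters through its Fourier transform. -/
lemma integral_kernel_mul_ep {κ : ℝ → ℂ} (hc : Continuous κ) (hi : Integrable κ)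
    {K : ℝ → ℂ} (hK : ∀ x, 𝓕⁻ κ x = K x) (hKi : Integrable K) (η x : ℝ) :
    ∫ z, K (x - z) * ep (z * η) = κ η * ep (x * η) := by
  have hK' : 𝓕⁻ κ = K := funext hK
  have h1 : 𝓕 K = κ := by
    rw [← hK']
    refine hc.fourier_fourierInv_eq hi ?_
    have : 𝓕 κ = fun w => K (-w) := by
      funext w
      rw [← hK, Real.fourierInv_eq_fourier_neg, neg_neg]
    rw [this]
    exact hKi.comp_neg
  rw [← integral_sub_left_eq_self _ volume x, ← h1, fourier_eq_ep, ← integral_mul_const]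
  refine integral_congr_ae (.of_forall fun v => ?_)
  simp only [sub_sub_cancel]
  rw [sub_mul, sub_eq_add_neg, add_comm, ep_add]
  ring

lemma integral_poisK_mul_ep {y : ℝ} (hy : 0 < y) (η x : ℝ) :
    ∫ z, (poisK y (x - z) : ℂ) * ep (z * η) = poisS y η * ep (x * η) :=
  integral_kernel_mul_ep (κ := fun η => (poisS y η : ℂ)) (K := fun x => (poisK y x : ℂ))
    (Complex.continuous_ofReal.comp (continuous_poisS y)) (integrable_poisS hy).ofReal
    (fourierInv_poisS hy) (integrable_poisK hy).ofReal η x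

lemma integral_cauK_mul_ep {y : ℝ} (hy : 0 < y) (η x : ℝ) :
    ∫ z, cauK y (x - z) * ep (z * η) = cauS y η * ep (x * η) :=
  integral_kernel_mul_ep (κ := fun η => (cauS y η : ℂ))
    (Complex.continuous_ofReal.comp (continuous_cauS y)) (integrable_cauS hy).ofReal
    (fourierInv_cauS hy) (integrable_cauK hy) η x

lemma integral_poisK_sub {y : ℝ} (hy : 0 < y) (x : ℝ) : ∫ z, poisK y (x - z) = 1 := by
  have := integral_poisK_mul_ep hy 0 x
  simp only [mul_zero, ep_zero, mul_one, poisS, abs_zero, neg_zero, Real.exp_zero] at this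
  rw [integral_complex_ofReal] at this
  exact_mod_cast this

lemma integral_cauK_sub {y : ℝ} (hy : 0 < y) (x : ℝ) : ∫ z, cauK y (x - z) = 0 := by
  have := integral_cauK_mul_ep hy 0 x
  simpa [cauS] using this

/-- A convolution kernel acts on superpositions of characters through its Fourier transform. -/
lemma integral_kernel_mul_superposition {β : Type*} [MeasurableSpace β] {μ : Measure β} [SFinite μ]
    {K κ : ℝ → ℂ} (hKm : Measurable K) (hKi : Integrable K)
    (hK : ∀ η x, ∫ z, K (x - z) * ep (z * η) = κ η * ep (x * η))
    {η : β → ℝ} (hη : Measurable η) {c : β → ℂ} (hc : Integrable c μ) (x : ℝ) :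
    ∫ z, K (x - z) * ∫ w, ep (z * η w) * c w ∂μ = ∫ w, ep (x * η w) * (κ (η w) * c w) ∂μ := by
  have h_int : Integrable (Function.uncurry fun z w => K (x - z) * (ep (z * η w) * c w))
      (volume.prod μ) := by
    have h1 : Integrable (fun z => K (x - z)) := hKi.comp_sub_left x
    have h2 := h1.mul_prod hc
    refine h2.mono ?_ (.of_forall fun p => ?_)
    · have e : Measurable fun p : ℝ × β => ep (p.1 * η p.2) :=
        continuous_ep.measurable.comp (measurable_fst.mul (hη.comp measurable_snd))
      have e1 : AEStronglyMeasurable (fun p : ℝ × β => K (x - p.1)) (volume.prod μ) :=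
        (hKm.comp (measurable_const.sub measurable_fst)).aestronglyMeasurable
      exact e1.mul (e.aestronglyMeasurable.mul hc.aestronglyMeasurable.comp_snd)
    · simp [Function.uncurry, norm_ep]
  calc ∫ z, K (x - z) * ∫ w, ep (z * η w) * c w ∂μ
      = ∫ z, ∫ w, K (x - z) * (ep (z * η w) * c w) ∂μ := by simp_rw [integral_const_mul]
    _ = ∫ w, (∫ z, K (x - z) * (ep (z * η w) * c w)) ∂μ := integral_integral_swap h_int
    _ = _ := by
        refine integral_congr_ae (.of_forall fun w => ?_)
        simp only
        calc ∫ z, K (x - z) * (ep (z * η w) * c w) = ∫ z, K (x - z) * ep (z * η w) * c w := by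
              simp_rw [mul_assoc]
          _ = _ := by rw [integral_mul_const, hK]; ring

lemma measurable_uncurry_comp {α β γ δ : Type*} [MeasurableSpace α] [MeasurableSpace β]
    [MeasurableSpace γ] [MeasurableSpace δ] {F : β → γ → δ} (hF : Measurable (Function.uncurry F))
    {f : α → β} {g : α → γ} (hf : Measurable f) (hg : Measurable g) :
    Measurable fun a => F (f a) (g a) := hF.comp (hf.prodMk hg)

lemma integral_kernel_mul_kernel {K₁ K₂ K₃ κ₁ κ₂ κ₃ : ℝ → ℂ} (hm₁ : Measurable K₁)
    (hi₁ : Integrable K₁) (hK₁ : ∀ η x, ∫ z, K₁ (x - z) * ep (z * η) = κ₁ η * ep (x * η))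
    (hκ₂ : Integrable κ₂) (hK₂ : ∀ x, 𝓕⁻ κ₂ x = K₂ x) (hK₃ : ∀ x, 𝓕⁻ κ₃ x = K₃ x)
    (h : ∀ η, κ₁ η * κ₂ η = κ₃ η) (x : ℝ) : ∫ z, K₁ (x - z) * K₂ z = K₃ x := by
  have := integral_kernel_mul_superposition hm₁ hi₁ hK₁ measurable_id hκ₂ x
  simp only [id, h] at this
  have e : ∀ (κ : ℝ → ℂ) z, 𝓕⁻ κ z = ∫ w, ep (z * w) * κ w := by
    intro κ z
    rw [fourierInv_eq_ep]
    exact integral_congr_ae (.of_forall fun w => by simp only [mul_comm w z])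
  rw [← hK₃, e, ← this]
  simp_rw [← hK₂, e]

lemma integral_kernel_mul_integral {K₁ K₂ K₃ : ℝ → ℂ} (hm₁ : Measurable K₁)
    (hi₁ : Integrable K₁) (hm₂ : Measurable K₂) (hi₂ : Integrable K₂)
    (h : ∀ x, ∫ z, K₁ (x - z) * K₂ z = K₃ x) {φ : ℝ → ℂ} (hφ : Measurable φ) {M : ℝ}
    (hM : ∀ x, ‖φ x‖ ≤ M) (x : ℝ) :
    ∫ z, K₁ (x - z) * ∫ w, K₂ (z - w) * φ w = ∫ w, K₃ (x - w) * φ w := by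
  have h_int : Integrable (Function.uncurry fun z w => K₁ (x - z) * (K₂ (z - w) * φ w))
      (volume.prod volume) := by
    have h1 : Integrable (fun p : ℝ × ℝ => K₁ (x - p.1) * K₂ (p.1 - p.2))
        (volume.prod volume) := by
      have e1 : AEStronglyMeasurable (fun p : ℝ × ℝ => K₁ (x - p.1) * K₂ (p.1 - p.2))
          (volume.prod volume) :=
        ((hm₁.comp (measurable_const.sub measurable_fst)).mul
          (hm₂.comp (measurable_fst.sub measurable_snd))).aestronglyMeasurable
      rw [integrable_prod_iff e1]
      refine ⟨.of_forall fun z => (hi₂.comp_sub_left z).const_mul (K₁ (x - z)), ?_⟩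
      simp_rw [norm_mul, integral_const_mul]
      have : ∀ z : ℝ, ∫ w, ‖K₂ (z - w)‖ = ∫ w, ‖K₂ w‖ := fun z =>
        integral_sub_left_eq_self (fun w => ‖K₂ w‖) volume z
      simp_rw [this]
      exact (hi₁.comp_sub_left x).norm.mul_const _
    refine (h1.mul_bdd (c := M) ((hφ.comp measurable_snd).aestronglyMeasurable)
      (.of_forall fun p => hM p.2)).congr (.of_forall fun p => ?_)
    simp [Function.uncurry, mul_assoc]
  calc ∫ z, K₁ (x - z) * ∫ w, K₂ (z - w) * φ w
      = ∫ z, ∫ w, K₁ (x - z) * (K₂ (z - w) * φ w) := by simp_rw [integral_const_mul]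
    _ = ∫ w, ∫ z, K₁ (x - z) * (K₂ (z - w) * φ w) := integral_integral_swap h_int
    _ = ∫ w, (∫ z, K₁ (x - z) * K₂ (z - w)) * φ w := by
        simp_rw [← mul_assoc, integral_mul_const]
    _ = _ := by
        congr 1; ext w
        rw [← h (x - w), ← integral_add_right_eq_self _ w]
        congr 2; ext z
        rw [add_sub_cancel_right, sub_add_eq_sub_sub_swap]

/-- The Poisson extension of a function. -/
def pois (y : ℝ) (φ : ℝ → ℂ) (x : ℝ) : ℂ := ∫ z, (poisK y (x - z) : ℂ) * φ z

/-- The action of the derivative kernel. -/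
def cau (y : ℝ) (φ : ℝ → ℂ) (x : ℝ) : ℂ := ∫ z, cauK y (x - z) * φ z

/-- The Poisson extension of a nonnegative function. -/
def lpois (y : ℝ) (φ : ℝ → ℝ≥0∞) (x : ℝ) : ℝ≥0∞ := ∫⁻ z, ENNReal.ofReal (poisK y (x - z)) * φ z

lemma measurable_poisK_left (y : ℝ) : Measurable (poisK y) := measurable_poisK.of_uncurry_left

lemma measurable_cauK_left (y : ℝ) : Measurable (cauK y) := measurable_cauK.of_uncurry_left

section

variable {φ : ℝ → ℂ} {M h y : ℝ}

lemma integral_poisK_mul_poisK (hh : 0 < h) (hy : 0 < y) (x : ℝ) :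
    ∫ z, (poisK h (x - z) : ℂ) * poisK y z = (poisK (y + h) x : ℂ) :=
  integral_kernel_mul_kernel (K₁ := fun x => (poisK h x : ℂ)) (K₂ := fun x => (poisK y x : ℂ))
    (K₃ := fun x => (poisK (y + h) x : ℂ))
    (measurable_poisK_left h).complex_ofReal (integrable_poisK hh).ofReal
    (integral_poisK_mul_ep hh) (integrable_poisS hy).ofReal (fourierInv_poisS hy)
    (fourierInv_poisS (by linarith)) (fun η => by rw [← poisS_mul]; push_cast; rfl) x

lemma pois_pois (hh : 0 < h) (hy : 0 < y) (hφ : Measurable φ) (hM : ∀ x, ‖φ x‖ ≤ M) (x : ℝ) :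
    pois h (pois y φ) x = pois (y + h) φ x :=
  integral_kernel_mul_integral (K₁ := fun x => (poisK h x : ℂ)) (K₂ := fun x => (poisK y x : ℂ))
    (K₃ := fun x => (poisK (y + h) x : ℂ))
    (measurable_poisK_left h).complex_ofReal (integrable_poisK hh).ofReal
    (measurable_poisK_left y).complex_ofReal (integrable_poisK hy).ofReal
    (integral_poisK_mul_poisK hh hy) hφ hM x

lemma cau_pois (hh : 0 < h) (hy : 0 < y) (hφ : Measurable φ) (hM : ∀ x, ‖φ x‖ ≤ M) (x : ℝ) :
    cau h (pois y φ) x = cau (y + h) φ x :=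
  integral_kernel_mul_integral (K₁ := cauK h) (K₂ := fun x => (poisK y x : ℂ))
    (K₃ := cauK (y + h)) (measurable_cauK_left h) (integrable_cauK hh)
    (measurable_poisK_left y).complex_ofReal (integrable_poisK hy).ofReal
    (integral_kernel_mul_kernel (measurable_cauK_left h) (integrable_cauK hh)
    (integral_cauK_mul_ep hh) (integrable_poisS hy).ofReal (fourierInv_poisS hy)
    (fourierInv_cauS (by linarith)) (fun η => by rw [← cauS_mul_poisS]; push_cast; rfl)) hφ hM x

lemma pois_cau (hh : 0 < h) (hy : 0 < y) (hφ : Measurable φ) (hM : ∀ x, ‖φ x‖ ≤ M) (x : ℝ) :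
    pois h (cau y φ) x = cau (y + h) φ x :=
  integral_kernel_mul_integral (K₁ := fun x => (poisK h x : ℂ)) (K₂ := cauK y)
    (K₃ := cauK (y + h)) (measurable_poisK_left h).complex_ofReal (integrable_poisK hh).ofReal
    (measurable_cauK_left y) (integrable_cauK hy)
    (integral_kernel_mul_kernel (K₁ := fun x => (poisK h x : ℂ))
    (measurable_poisK_left h).complex_ofReal (integrable_poisK hh).ofReal
    (integral_poisK_mul_ep hh) (integrable_cauS hy).ofReal (fourierInv_cauS hy)
    (fourierInv_cauS (by linarith))
    (fun η => by rw [add_comm y h, ← cauS_mul_poisS]; push_cast; exact mul_comm _ _)) hφ hM x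

lemma lintegral_poisK_sub (hy : 0 < y) (x : ℝ) :
    ∫⁻ z, ENNReal.ofReal (poisK y (x - z)) = 1 := by
  rw [← ofReal_integral_eq_lintegral_ofReal ((integrable_poisK hy).comp_sub_left x)
    (.of_forall fun z => poisK_nonneg hy.le _), integral_poisK_sub hy, ENNReal.ofReal_one]

lemma norm_pois_le (hy : 0 < y) (hM : ∀ x, ‖φ x‖ ≤ M) (x : ℝ) : ‖pois y φ x‖ ≤ M := by
  have := norm_integral_le_of_norm_le (f := fun z => (poisK y (x - z) : ℂ) * φ z)
    (((integrable_poisK hy).comp_sub_left x).mul_const M) (.of_forall fun z => by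
      rw [norm_mul, Complex.norm_real, Real.norm_of_nonneg (poisK_nonneg hy.le _)]
      exact mul_le_mul_of_nonneg_left (hM z) (poisK_nonneg hy.le _))
  rwa [integral_mul_const, integral_poisK_sub hy, one_mul] at this

lemma norm_cau_le (hy : 0 < y) (hM : ∀ x, ‖φ x‖ ≤ M) (x : ℝ) : ‖cau y φ x‖ ≤ M / (2 * y) := by
  have := norm_integral_le_of_norm_le (f := fun z => cauK y (x - z) * φ z)
    (((integrable_poisK hy).comp_sub_left x).mul_const (M / (2 * y))) (.of_forall fun z => by
      rw [norm_mul, norm_cauK hy, div_mul_eq_mul_div, mul_div_assoc]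
      have := poisK_nonneg hy.le (x - z)
      have := hM z
      gcongr)
  rwa [integral_mul_const, integral_poisK_sub hy, one_mul] at this

lemma enorm_pois_le (hy : 0 < y) (x : ℝ) : ‖pois y φ x‖ₑ ≤ lpois y (fun z => ‖φ z‖ₑ) x := by
  refine (enorm_integral_le_lintegral_enorm _).trans (lintegral_mono fun z => ?_)
  rw [enorm_mul, ← ofReal_norm (poisK y (x - z) : ℂ), Complex.norm_real,
    Real.norm_of_nonneg (poisK_nonneg hy.le _)]

lemma enorm_cau_le (hy : 0 < y) (x : ℝ) :
    ENNReal.ofReal (2 * y) * ‖cau y φ x‖ₑ ≤ lpois y (fun z => ‖φ z‖ₑ) x := by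
  have hy2 : ENNReal.ofReal (2 * y) ≠ ∞ := ENNReal.ofReal_ne_top
  calc ENNReal.ofReal (2 * y) * ‖cau y φ x‖ₑ
      ≤ ENNReal.ofReal (2 * y) * ∫⁻ z, ‖cauK y (x - z) * φ z‖ₑ :=
        mul_le_mul_right (enorm_integral_le_lintegral_enorm _) _
    _ = ∫⁻ z, ENNReal.ofReal (2 * y) * ‖cauK y (x - z) * φ z‖ₑ :=
        (lintegral_const_mul' _ _ hy2).symm
    _ = _ := by
        refine lintegral_congr fun z => ?_
        rw [enorm_mul, ← mul_assoc, ← ofReal_norm (cauK y (x - z)), norm_cauK hy,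
          ← ENNReal.ofReal_mul (by positivity), mul_div_cancel₀ _ (by positivity)]

end

section

variable {τ : Type*} [MeasurableSpace τ]

lemma measurable_pois_param {φ : ℝ → τ → ℂ} (hφ : Measurable (Function.uncurry φ)) :
    Measurable fun p : ℝ × ℝ × τ => pois p.1 (fun z => φ z p.2.2) p.2.1 := by
  have : StronglyMeasurable (Function.uncurry fun (p : ℝ × ℝ × τ) (z : ℝ) =>
      (poisK p.1 (p.2.1 - z) : ℂ) * φ z p.2.2) := by
    refine Measurable.stronglyMeasurable ?_
    have h1 : Measurable fun q : (ℝ × ℝ × τ) × ℝ => poisK q.1.1 (q.1.2.1 - q.2) :=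
      measurable_uncurry_comp measurable_poisK (by fun_prop) (by fun_prop)
    have h2 : Measurable fun q : (ℝ × ℝ × τ) × ℝ => φ q.2 q.1.2.2 :=
      measurable_uncurry_comp hφ (by fun_prop) (by fun_prop)
    exact h1.complex_ofReal.mul h2
  exact this.integral_prod_right.measurable

lemma measurable_cau_param {φ : ℝ → τ → ℂ} (hφ : Measurable (Function.uncurry φ)) :
    Measurable fun p : ℝ × ℝ × τ => cau p.1 (fun z => φ z p.2.2) p.2.1 := by
  have : StronglyMeasurable (Function.uncurry fun (p : ℝ × ℝ × τ) (z : ℝ) =>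
      cauK p.1 (p.2.1 - z) * φ z p.2.2) := by
    refine Measurable.stronglyMeasurable ?_
    have h1 : Measurable fun q : (ℝ × ℝ × τ) × ℝ => cauK q.1.1 (q.1.2.1 - q.2) :=
      measurable_uncurry_comp measurable_cauK (by fun_prop) (by fun_prop)
    have h2 : Measurable fun q : (ℝ × ℝ × τ) × ℝ => φ q.2 q.1.2.2 :=
      measurable_uncurry_comp hφ (by fun_prop) (by fun_prop)
    exact h1.mul h2
  exact this.integral_prod_right.measurable

lemma measurable_pois {φ : ℝ → ℂ} (hφ : Measurable φ) :
    Measurable (Function.uncurry fun y x => pois y φ x) := by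
  have h1 : Measurable fun p : ℝ × ℝ => ((p.1, p.2, ()) : ℝ × ℝ × Unit) := by fun_prop
  have h2 : Measurable (Function.uncurry fun (z : ℝ) (_ : Unit) => φ z) :=
    hφ.comp measurable_fst
  have h3 := (measurable_pois_param h2).comp h1
  simpa only [Function.comp_def, Function.uncurry_def] using h3

lemma measurable_cau {φ : ℝ → ℂ} (hφ : Measurable φ) :
    Measurable (Function.uncurry fun y x => cau y φ x) := by
  have h1 : Measurable fun p : ℝ × ℝ => ((p.1, p.2, ()) : ℝ × ℝ × Unit) := by fun_prop
  have h2 : Measurable (Function.uncurry fun (z : ℝ) (_ : Unit) => φ z) :=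
    hφ.comp measurable_fst
  have h3 := (measurable_cau_param h2).comp h1
  simpa only [Function.comp_def, Function.uncurry_def] using h3

lemma measurable_lpois {φ : ℝ → ℝ≥0∞} (hφ : Measurable φ) :
    Measurable (Function.uncurry fun y x => lpois y φ x) := by
  have h1 : Measurable fun q : (ℝ × ℝ) × ℝ => poisK q.1.1 (q.1.2 - q.2) :=
    measurable_uncurry_comp measurable_poisK (by fun_prop) (by fun_prop)
  have : Measurable (Function.uncurry fun (p : ℝ × ℝ) (z : ℝ) =>
      ENNReal.ofReal (poisK p.1 (p.2 - z)) * φ z) :=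
    h1.ennreal_ofReal.mul (hφ.comp measurable_snd)
  exact this.lintegral_prod_right'

end

section

variable {y h : ℝ} {φ ψ : ℝ → ℝ≥0∞}

lemma measurable_ofReal_poisK_sub (y x : ℝ) :
    Measurable fun z => ENNReal.ofReal (poisK y (x - z)) :=
  ((measurable_poisK_left y).comp (measurable_const.sub measurable_id)).ennreal_ofReal

lemma measurable_ofReal_poisK_sub' (y x : ℝ) :
    Measurable fun z => ENNReal.ofReal (poisK y (z - x)) :=
  ((measurable_poisK_left y).comp (measurable_id.sub measurable_const)).ennreal_ofReal

lemma measurable_ofReal_poisK_sub_prod (y : ℝ) :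
    Measurable fun p : ℝ × ℝ => ENNReal.ofReal (poisK y (p.1 - p.2)) :=
  ((measurable_poisK_left y).comp (measurable_fst.sub measurable_snd)).ennreal_ofReal

lemma lintegral_lpois_mul (hφ : Measurable φ) (hψ : Measurable ψ) :
    ∫⁻ x, lpois y φ x * ψ x = ∫⁻ x, φ x * lpois y ψ x := by
  have hm : Measurable (Function.uncurry fun x z =>
      ENNReal.ofReal (poisK y (x - z)) * φ z * ψ x) :=
    ((measurable_ofReal_poisK_sub_prod y).mul (hφ.comp measurable_snd)).mul
      (hψ.comp measurable_fst)
  calc ∫⁻ x, lpois y φ x * ψ x = ∫⁻ x, ∫⁻ z, ENNReal.ofReal (poisK y (x - z)) * φ z * ψ x := by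
        refine lintegral_congr fun x => ?_
        have : Measurable fun z => ENNReal.ofReal (poisK y (x - z)) * φ z :=
          (measurable_ofReal_poisK_sub y x).mul hφ
        rw [lpois, lintegral_mul_const _ this]
    _ = ∫⁻ z, ∫⁻ x, ENNReal.ofReal (poisK y (x - z)) * φ z * ψ x :=
        lintegral_lintegral_swap hm.aemeasurable
    _ = _ := by
        refine lintegral_congr fun z => ?_
        have : Measurable fun x => ENNReal.ofReal (poisK y (z - x)) * ψ x :=
          (measurable_ofReal_poisK_sub y z).mul hψ
        rw [lpois, ← lintegral_const_mul _ this]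
        refine lintegral_congr fun x => ?_
        rw [poisK_sub_comm]; ring

lemma lintegral_lpois (hy : 0 < y) (hφ : Measurable φ) : ∫⁻ x, lpois y φ x = ∫⁻ x, φ x := by
  have := lintegral_lpois_mul (y := y) hφ (measurable_const (a := (1 : ℝ≥0∞)))
  simpa [lpois, lintegral_poisK_sub hy] using this

lemma lpois_lpois (hh : 0 < h) (hy : 0 < y) (hφ : Measurable φ) (x : ℝ) :
    lpois h (lpois y φ) x = lpois (y + h) φ x := by
  have key : ∀ w, ∫⁻ z, ENNReal.ofReal (poisK h (x - z)) * ENNReal.ofReal (poisK y (z - w)) =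
      ENNReal.ofReal (poisK (y + h) (x - w)) := by
    intro w
    have h1 := integral_poisK_mul_poisK hh hy (x - w)
    rw [← integral_sub_right_eq_self _ w] at h1
    have h2 : ∫ z, poisK h (x - z) * poisK y (z - w) = poisK (y + h) (x - w) := by
      have : ∀ z, (poisK h (x - w - (z - w)) : ℂ) * poisK y (z - w) =
          ((poisK h (x - z) * poisK y (z - w) : ℝ) : ℂ) := by
        intro z; rw [sub_sub_sub_cancel_right]; push_cast; rfl
      simp_rw [this] at h1
      rw [integral_complex_ofReal] at h1
      exact_mod_cast h1
    have h_int : Integrable fun z => poisK h (x - z) * poisK y (z - w) := by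
      by_contra hc
      rw [integral_undef hc] at h2
      exact (poisK_pos (by linarith) _).ne h2
    rw [← h2, ofReal_integral_eq_lintegral_ofReal h_int (.of_forall fun z =>
      mul_nonneg (poisK_nonneg hh.le _) (poisK_nonneg hy.le _))]
    exact lintegral_congr fun z => (ENNReal.ofReal_mul (poisK_nonneg hh.le _)).symm
  have hm : Measurable (Function.uncurry fun z w => ENNReal.ofReal (poisK h (x - z)) *
      (ENNReal.ofReal (poisK y (z - w)) * φ w)) :=
    ((measurable_ofReal_poisK_sub h x).comp measurable_fst).mul
      ((measurable_ofReal_poisK_sub_prod y).mul (hφ.comp measurable_snd))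
  calc lpois h (lpois y φ) x = ∫⁻ z, ∫⁻ w, ENNReal.ofReal (poisK h (x - z)) *
      (ENNReal.ofReal (poisK y (z - w)) * φ w) := by
        refine lintegral_congr fun z => ?_
        rw [lpois, lintegral_const_mul' _ _ ENNReal.ofReal_ne_top]
    _ = ∫⁻ w, ∫⁻ z, ENNReal.ofReal (poisK h (x - z)) *
      (ENNReal.ofReal (poisK y (z - w)) * φ w) := lintegral_lintegral_swap hm.aemeasurable
    _ = _ := by
        refine lintegral_congr fun w => ?_
        rw [← key w]
        have : Measurable fun z =>
            ENNReal.ofReal (poisK h (x - z)) * ENNReal.ofReal (poisK y (z - w)) :=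
          (measurable_ofReal_poisK_sub h x).mul (measurable_ofReal_poisK_sub' y w)
        rw [← lintegral_mul_const _ this]
        simp_rw [mul_assoc]

end

section

variable {α : Type*} [MeasurableSpace α] {μ : Measure α}

lemma sq_integral_mul_le {f g : α → ℝ} (hf : 0 ≤ f) (hg : 0 ≤ g) (hfm : Measurable f)
    (hgm : Measurable g) (hf2 : Integrable (fun x => f x ^ 2) μ)
    (hg2 : Integrable (fun x => g x ^ 2) μ) :
    (∫ x, f x * g x ∂μ) ^ 2 ≤ (∫ x, f x ^ 2 ∂μ) * ∫ x, g x ^ 2 ∂μ := by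
  have h := integral_mul_le_Lp_mul_Lq_of_nonneg (μ := μ) Real.HolderConjugate.two_two
    (.of_forall hf) (.of_forall hg)
    (by simpa using (memLp_two_iff_integrable_sq hfm.aestronglyMeasurable).mpr hf2)
    (by simpa using (memLp_two_iff_integrable_sq hgm.aestronglyMeasurable).mpr hg2)
  simp only [Real.rpow_two, ← Real.sqrt_eq_rpow] at h
  have h0 : 0 ≤ ∫ x, f x * g x ∂μ := integral_nonneg fun x => mul_nonneg (hf x) (hg x)
  have h1 : 0 ≤ ∫ x, f x ^ 2 ∂μ := integral_nonneg fun x => sq_nonneg _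
  have h2 : 0 ≤ ∫ x, g x ^ 2 ∂μ := integral_nonneg fun x => sq_nonneg _
  calc (∫ x, f x * g x ∂μ) ^ 2 ≤ (√(∫ x, f x ^ 2 ∂μ) * √(∫ x, g x ^ 2 ∂μ)) ^ 2 :=
        pow_le_pow_left₀ h0 h 2
    _ = _ := by rw [mul_pow, Real.sq_sqrt h1, Real.sq_sqrt h2]

lemma rpow_ge_tangent_add {z m : ℝ} (hz : 0 < z) (hm : 1 ≤ m) :
    1 + m * (z - 1) + (m - 1) * (√z - 1) ^ 2 ≤ z ^ m := by
  have h1 : z ^ m = z * Real.exp ((m - 1) * Real.log z) := by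
    rw [Real.rpow_def_of_pos hz]
    nth_rewrite 2 [← Real.exp_log hz]
    rw [← Real.exp_add]; congr 1; ring
  have hs : 0 < √z := Real.sqrt_pos.mpr hz
  have h2 : 1 - (√z)⁻¹ ≤ Real.log (√z) := Real.one_sub_inv_le_log_of_pos hs
  have h3 : Real.log (√z) = Real.log z / 2 := Real.log_sqrt hz.le
  have h4 : (m - 1) * Real.log z + 1 ≤ Real.exp ((m - 1) * Real.log z) := Real.add_one_le_exp _
  have h5 : (m - 1) * (2 * (1 - (√z)⁻¹)) ≤ (m - 1) * Real.log z :=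
    mul_le_mul_of_nonneg_left (by linarith) (by linarith)
  have h6 : z * (√z)⁻¹ = √z := by
    nth_rewrite 1 [← Real.mul_self_sqrt hz.le]
    field_simp
  rw [h1]
  calc 1 + m * (z - 1) + (m - 1) * (√z - 1) ^ 2
      = z * ((m - 1) * (2 * (1 - (√z)⁻¹)) + 1) := by
        have := Real.sq_sqrt hz.le
        linear_combination (m - 1) * this + (m - 1) * 2 * h6
    _ ≤ _ := mul_le_mul_of_nonneg_left (by linarith) hz.le

variable [IsProbabilityMeasure μ]

/-- Quantitative Jensen inequality for a normalised positive function. -/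
lemma one_add_le_integral_rpow {z : α → ℝ} {m : ℝ} (hz : ∀ x, 0 < z x) (hzm : Measurable z)
    (hm : 1 < m) (hm2 : m ≤ 2) (h1 : ∫ x, z x ∂μ = 1)
    (hi : Integrable (fun x => z x ^ m) μ) :
    1 + (m - 1) / 12 * (∫ x, |z x - 1| ∂μ) ^ 2 ≤ (∫ x, z x ^ m ∂μ) ^ (1 / m) := by
  have hzi : Integrable z μ := by
    by_contra h; rw [integral_undef h] at h1; exact zero_ne_one h1
  set τ := ∫ x, |z x - 1| ∂μ with hτ
  have hτ0 : 0 ≤ τ := integral_nonneg fun x => abs_nonneg _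
  have hτ2 : τ ≤ 2 := by
    calc τ ≤ ∫ x, (z x + 1) ∂μ := integral_mono (hzi.sub (integrable_const 1)).abs
          (hzi.add (integrable_const 1)) fun x => by
            refine abs_le.mpr ⟨?_, ?_⟩ <;> have := hz x <;> simp only <;> linarith
      _ = 2 := by
        rw [integral_add hzi (integrable_const 1), h1]; simp; norm_num
  have hsm : Measurable fun x => √(z x) := hzm.sqrt
  have bd : ∀ x, (√(z x) - 1) ^ 2 ≤ 2 * (z x + 1) := fun x => by
    have := Real.sq_sqrt (hz x).le
    nlinarith [sq_nonneg (√(z x) + 1)]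
  have bd' : ∀ x, (√(z x) + 1) ^ 2 ≤ 2 * (z x + 1) := fun x => by
    have := Real.sq_sqrt (hz x).le
    nlinarith [sq_nonneg (√(z x) - 1)]
  have hI : Integrable (fun x => 2 * (z x + 1)) μ := (hzi.add (integrable_const 1)).const_mul 2
  have i1 : Integrable (fun x => (√(z x) - 1) ^ 2) μ :=
    hI.mono' (by fun_prop) (.of_forall fun x => by
      rw [Real.norm_of_nonneg (sq_nonneg _)]; exact bd x)
  have i2 : Integrable (fun x => (√(z x) + 1) ^ 2) μ :=
    hI.mono' (by fun_prop) (.of_forall fun x => by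
      rw [Real.norm_of_nonneg (sq_nonneg _)]; exact bd' x)
  have hD : τ ^ 2 ≤ 4 * ∫ x, (√(z x) - 1) ^ 2 ∂μ := by
    have := sq_integral_mul_le (μ := μ) (f := fun x => |√(z x) - 1|) (g := fun x => √(z x) + 1)
      (fun x => abs_nonneg _) (fun x => by positivity) (by fun_prop) (by fun_prop)
      (by simpa only [sq_abs] using i1) i2
    simp only [sq_abs] at this
    have e : ∀ x, |√(z x) - 1| * (√(z x) + 1) = |z x - 1| := fun x => by
      rw [← abs_of_nonneg (by positivity : 0 ≤ √(z x) + 1), ← abs_mul]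
      congr 1
      nlinarith [Real.sq_sqrt (hz x).le]
    simp_rw [e] at this
    have h4 : ∫ x, (√(z x) + 1) ^ 2 ∂μ ≤ 4 := by
      refine (integral_mono i2 hI bd').trans ?_
      rw [integral_const_mul, integral_add hzi (integrable_const 1), h1]; simp; norm_num
    have h5 : 0 ≤ ∫ x, (√(z x) - 1) ^ 2 ∂μ := integral_nonneg fun x => sq_nonneg _
    nlinarith
  have hlow : 1 + (m - 1) / 4 * τ ^ 2 ≤ ∫ x, z x ^ m ∂μ := by
    have e : ∫ x, (1 + m * (z x - 1) + (m - 1) * (√(z x) - 1) ^ 2) ∂μ =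
        1 + (m - 1) * ∫ x, (√(z x) - 1) ^ 2 ∂μ := by
      have j1 : Integrable (fun x => m * (z x - 1)) μ := (hzi.sub (integrable_const 1)).const_mul m
      have j2 : Integrable (fun x => 1 + m * (z x - 1)) μ := (integrable_const (1 : ℝ)).add j1
      rw [integral_add j2 (i1.const_mul _),
        integral_add (integrable_const (1 : ℝ)) j1, integral_const_mul, integral_const_mul,
        integral_sub hzi (integrable_const 1), h1]
      simp
    have j1 : Integrable (fun x => m * (z x - 1)) μ := (hzi.sub (integrable_const 1)).const_mul m
    have := integral_mono (((integrable_const (1 : ℝ)).add j1).add (i1.const_mul (m - 1))) hi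
      fun x => rpow_ge_tangent_add (hz x) hm.le
    have h2 : 1 + (m - 1) * ∫ x, (√(z x) - 1) ^ 2 ∂μ ≤ ∫ x, z x ^ m ∂μ := by
      rw [← e]; exact this
    nlinarith
  have hbase : (1 : ℝ) ≤ 1 + (m - 1) / 4 * τ ^ 2 := by
    have : 0 ≤ (m - 1) / 4 * τ ^ 2 := mul_nonneg (by linarith) (sq_nonneg _)
    linarith
  calc 1 + (m - 1) / 12 * τ ^ 2 ≤ √(1 + (m - 1) / 4 * τ ^ 2) := by
        refine Real.le_sqrt_of_sq_le ?_
        have h1 : 0 ≤ (m - 1) * τ ^ 2 := mul_nonneg (by linarith) (sq_nonneg _)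
        have h2 : (m - 1) * τ ^ 2 ≤ 4 := by nlinarith
        nlinarith
    _ = (1 + (m - 1) / 4 * τ ^ 2) ^ (1 / 2 : ℝ) := Real.sqrt_eq_rpow _
    _ ≤ (1 + (m - 1) / 4 * τ ^ 2) ^ (1 / m) :=
        Real.rpow_le_rpow_of_exponent_le hbase (one_div_le_one_div_of_le (by linarith) hm2)
    _ ≤ _ := Real.rpow_le_rpow (by linarith) hlow (by positivity)

/-- Weighted Jensen inequality for a complex function, with a defect measuring its
mean oscillation. -/
lemma weighted_jensen_defect {Z : α → ℝ} {m : ℝ} (hZ : ∀ x, 0 < Z x) (hZm : Measurable Z)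
    (hm : 1 < m) (hm2 : m ≤ 2) (hi : Integrable (fun x => Z x ^ m) μ)
    {u : α → ℂ} (hu : Measurable u) (hui : Integrable u μ)
    (hQ : Integrable (fun x => ‖u x‖ ^ 2 / Z x) μ) :
    ‖∫ x, u x ∂μ‖ ^ 2 + (m - 1) / 24 * (∫ x, ‖u x - ∫ x, u x ∂μ‖ ∂μ) ^ 2 ≤
      (∫ x, Z x ^ m ∂μ) ^ (1 / m) * ∫ x, ‖u x‖ ^ 2 / Z x ∂μ := by
  have hZi : Integrable Z μ := by
    refine ((integrable_const (1 : ℝ)).add hi).mono' hZm.aestronglyMeasurable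
      (.of_forall fun x => ?_)
    rw [Real.norm_of_nonneg (hZ x).le]
    simp only [Pi.add_apply]
    by_cases h : Z x ≤ 1
    · have := Real.rpow_nonneg (hZ x).le m; linarith
    · have := Real.rpow_le_rpow_of_exponent_le (not_le.mp h).le hm.le
      rw [Real.rpow_one] at this; linarith
  set s := ∫ x, Z x ∂μ with hs
  have hs0 : 0 < s := by
    rw [hs, integral_pos_iff_support_of_nonneg (fun x => (hZ x).le) hZi]
    have : Function.support Z = univ := by ext x; simp [(hZ x).ne']
    rw [this]; simp
  set z : α → ℝ := fun x => Z x / s with hz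
  have hz0 : ∀ x, 0 < z x := fun x => div_pos (hZ x) hs0
  have hzm : Measurable z := hZm.div_const s
  have hz1 : ∫ x, z x ∂μ = 1 := by
    simp only [hz]; rw [integral_div, ← hs, div_self hs0.ne']
  have hzi : Integrable z μ := hZi.div_const s
  have ezm : ∀ x, z x ^ m = Z x ^ m / s ^ m := fun x => Real.div_rpow (hZ x).le hs0.le m
  have hzmi : Integrable (fun x => z x ^ m) μ := by simp_rw [ezm]; exact hi.div_const _
  have hJ := one_add_le_integral_rpow hz0 hzm hm hm2 hz1 hzmi
  have hB : (∫ x, Z x ^ m ∂μ) ^ (1 / m) = s * (∫ x, z x ^ m ∂μ) ^ (1 / m) := by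
    simp_rw [ezm]
    rw [integral_div, Real.div_rpow (integral_nonneg fun x => (Real.rpow_nonneg (hZ x).le m))
      (by positivity), ← Real.rpow_mul hs0.le, mul_one_div_cancel (by linarith), Real.rpow_one]
    field_simp
  set a := ∫ x, u x ∂μ with ha
  set τ := ∫ x, |z x - 1| ∂μ with hτ
  have hτ0 : 0 ≤ τ := integral_nonneg fun x => abs_nonneg _
  set Q := ∫ x, ‖u x‖ ^ 2 / Z x ∂μ with hQd
  have hQz : Integrable (fun x => ‖u x‖ ^ 2 / z x) μ := by
    refine (hQ.const_mul s).congr (.of_forall fun x => ?_)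
    simp only [hz]; field_simp
  have epoint : ∀ x, ‖u x - a * z x‖ ^ 2 / z x =
      ‖u x‖ ^ 2 / z x - 2 * (u x * (starRingEnd ℂ) a).re + ‖a‖ ^ 2 * z x := fun x => by
    have h0 := (hz0 x).ne'
    have : ‖u x - a * z x‖ ^ 2 =
        ‖u x‖ ^ 2 - 2 * (u x * (starRingEnd ℂ) a).re * z x + ‖a‖ ^ 2 * z x ^ 2 := by
      simp only [← Complex.normSq_eq_norm_sq, Complex.normSq_apply]
      simp
      ring
    rw [this]; field_simp
  have hre : Integrable (fun x => 2 * (u x * (starRingEnd ℂ) a).re) μ :=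
    ((hui.mul_const _).re).const_mul 2
  have hδi : Integrable (fun x => ‖u x - a * z x‖ ^ 2 / z x) μ := by
    simp_rw [epoint]
    exact (hQz.sub hre).add (hzi.const_mul _)
  set δ := ∫ x, ‖u x - a * z x‖ ^ 2 / z x ∂μ with hδ
  have hδQ : s * Q = ‖a‖ ^ 2 + δ := by
    have h1 : ∫ x, ‖u x‖ ^ 2 / z x ∂μ = s * Q := by
      rw [hQd, ← integral_const_mul]
      refine integral_congr_ae (.of_forall fun x => ?_)
      simp only [hz]; field_simp
    have h2 : ∫ x, (u x * (starRingEnd ℂ) a).re ∂μ = ‖a‖ ^ 2 := by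
      have := integral_re (hui.mul_const ((starRingEnd ℂ) a))
      simp only [RCLike.re_to_complex] at this
      rw [this, integral_mul_const, ← ha, Complex.mul_conj, Complex.ofReal_re,
        Complex.normSq_eq_norm_sq]
    rw [hδ]
    simp_rw [epoint]
    have j2 : Integrable (fun x => ‖u x‖ ^ 2 / z x - 2 * (u x * (starRingEnd ℂ) a).re) μ :=
      hQz.sub hre
    rw [integral_add j2 (hzi.const_mul _), integral_sub hQz hre, integral_const_mul,
      integral_const_mul, h1, h2, hz1]
    ring
  have hδ0 : 0 ≤ δ := integral_nonneg fun x => div_nonneg (sq_nonneg _) (hz0 x).le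
  have hcz : Measurable fun x => (z x : ℂ) := hzm.complex_ofReal
  have huz : Integrable (fun x => u x - a * z x) μ := hui.sub (hzi.ofReal.const_mul a)
  have hL1 : (∫ x, ‖u x - a * z x‖ ∂μ) ^ 2 ≤ δ := by
    have := sq_integral_mul_le (μ := μ) (f := fun x => ‖u x - a * z x‖ / √(z x))
      (g := fun x => √(z x)) (fun x => by positivity) (fun x => by positivity)
      (by fun_prop) (by fun_prop)
      (by
        refine hδi.congr (.of_forall fun x => ?_)
        simp only; rw [div_pow, Real.sq_sqrt (hz0 x).le])
      (by
        refine hzi.congr (.of_forall fun x => ?_)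
        simp only; rw [Real.sq_sqrt (hz0 x).le])
    have e1 : ∀ x, ‖u x - a * z x‖ / √(z x) * √(z x) = ‖u x - a * z x‖ := fun x =>
      div_mul_cancel₀ _ (Real.sqrt_pos.mpr (hz0 x)).ne'
    have e2 : ∀ x, √(z x) ^ 2 = z x := fun x => Real.sq_sqrt (hz0 x).le
    simp_rw [e1, div_pow, e2, hz1, mul_one] at this
    exact this
  have hL : ∫ x, ‖u x - a‖ ∂μ ≤ (∫ x, ‖u x - a * z x‖ ∂μ) + ‖a‖ * τ := by
    have j2 : Integrable (fun x => ‖a‖ * |z x - 1|) μ :=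
      (hzi.sub (integrable_const 1)).abs.const_mul _
    rw [hτ, ← integral_const_mul, ← integral_add huz.norm j2]
    refine integral_mono (hui.sub (integrable_const a)).norm (huz.norm.add j2) fun x => ?_
    have : u x - a = (u x - a * z x) + a * ((z x - 1 : ℝ) : ℂ) := by push_cast; ring
    simp only
    rw [this]
    refine (norm_add_le _ _).trans (le_of_eq ?_)
    rw [norm_mul, Complex.norm_real, Real.norm_eq_abs]
  have hL0 : 0 ≤ ∫ x, ‖u x - a‖ ∂μ := integral_nonneg fun x => norm_nonneg _
  have hL2 : (∫ x, ‖u x - a‖ ∂μ) ^ 2 ≤ 2 * δ + 2 * (‖a‖ ^ 2 * τ ^ 2) := by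
    have h1 := pow_le_pow_left₀ hL0 hL 2
    nlinarith [sq_nonneg ((∫ x, ‖u x - a * z x‖ ∂μ) - ‖a‖ * τ)]
  have hsq : 0 ≤ s * Q := by rw [hδQ]; positivity
  rw [hB]
  calc ‖a‖ ^ 2 + (m - 1) / 24 * (∫ x, ‖u x - a‖ ∂μ) ^ 2
      ≤ ‖a‖ ^ 2 + (m - 1) / 24 * (2 * δ + 2 * (‖a‖ ^ 2 * τ ^ 2)) := by
        have : 0 ≤ (m - 1) / 24 := by linarith
        gcongr
    _ ≤ (1 + (m - 1) / 12 * τ ^ 2) * (s * Q) := by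
        rw [hδQ]
        have h1 : 0 ≤ (m - 1) / 12 * τ ^ 2 * δ :=
          mul_nonneg (mul_nonneg (by linarith) (sq_nonneg _)) hδ0
        have h2 : (m - 1) / 12 * δ ≤ δ := by
          have : (m - 1) / 12 ≤ 1 := by linarith
          nlinarith
        nlinarith
    _ ≤ (∫ x, z x ^ m ∂μ) ^ (1 / m) * (s * Q) := mul_le_mul_of_nonneg_right hJ hsq
    _ = _ := by ring

end

section

variable {h y k M : ℝ} {φ u : ℝ → ℂ} {V : ℝ → ℝ≥0∞}

/-- The probability measure with density `z ↦ P_h(x - z)`. -/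
def poisMeasure (h x : ℝ) : Measure ℝ :=
  volume.withDensity fun z => ENNReal.ofReal (poisK h (x - z))

lemma isProbabilityMeasure_poisMeasure (hh : 0 < h) (x : ℝ) :
    IsProbabilityMeasure (poisMeasure h x) := by
  constructor
  rw [poisMeasure, withDensity_apply _ MeasurableSet.univ, setLIntegral_univ,
    lintegral_poisK_sub hh]

lemma lintegral_poisMeasure {f : ℝ → ℝ≥0∞} (hf : Measurable f) (x : ℝ) :
    ∫⁻ z, f z ∂(poisMeasure h x) = lpois h f x := by
  rw [poisMeasure, lintegral_withDensity_eq_lintegral_mul _ (measurable_ofReal_poisK_sub h x) hf]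
  rfl

lemma integral_poisMeasure (hh : 0 < h) (f : ℝ → ℂ) (x : ℝ) :
    ∫ z, f z ∂(poisMeasure h x) = pois h f x := by
  rw [poisMeasure, integral_withDensity_eq_integral_toReal_smul (measurable_ofReal_poisK_sub h x)
    (.of_forall fun z => ENNReal.ofReal_lt_top)]
  refine integral_congr_ae (.of_forall fun z => ?_)
  simp only [ENNReal.toReal_ofReal (poisK_nonneg hh.le _), Complex.real_smul]

lemma lpois_pos (hh : 0 < h) (hV : Measurable V) (hV0 : ∀ x, V x ≠ 0) (x : ℝ) :
    lpois h V x ≠ 0 := by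
  intro h0
  have hm : Measurable fun z => ENNReal.ofReal (poisK h (x - z)) * V z :=
    (measurable_ofReal_poisK_sub h x).mul hV
  rw [lpois, lintegral_eq_zero_iff hm] at h0
  have : ∀ᵐ z : ℝ, False := by
    filter_upwards [h0] with z hz
    simp only [Pi.zero_apply, mul_eq_zero, ENNReal.ofReal_eq_zero] at hz
    rcases hz with hz | hz
    · exact (poisK_pos hh _).not_ge hz
    · exact hV0 z hz
  exact this.exists.elim fun _ h => h

lemma integral_eq_toReal_lintegral_of_nonneg {α : Type*} [MeasurableSpace α] {μ : Measure α}
    {f : α → ℝ} (hf : ∀ x, 0 ≤ f x) (hm : Measurable f) :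
    ∫ x, f x ∂μ = (∫⁻ x, ENNReal.ofReal (f x) ∂μ).toReal :=
  integral_eq_lintegral_of_nonneg_ae (.of_forall hf) hm.aestronglyMeasurable

lemma integrable_of_lintegral_ofReal_ne_top {α : Type*} [MeasurableSpace α] {μ : Measure α}
    {f : α → ℝ} (hf : ∀ x, 0 ≤ f x) (hm : Measurable f)
    (h : ∫⁻ x, ENNReal.ofReal (f x) ∂μ ≠ ∞) : Integrable f μ := by
  refine ⟨hm.aestronglyMeasurable, ?_⟩
  rw [hasFiniteIntegral_iff_ofReal (.of_forall hf)]
  exact h.lt_top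

lemma pois_weighted_jensen (hh : 0 < h) (hk : 1 / 2 ≤ k) (hk1 : k < 1) (hu : Measurable u)
    (hM : ∀ x, ‖u x‖ ≤ M) (hV : Measurable V) (hV0 : ∀ x, V x ≠ 0) (hVt : ∀ x, V x ≠ ∞) (x : ℝ)
    (hx : lpois h V x ≠ ∞) :
    ‖pois h u x‖ₑ ^ (2 : ℝ) + ENNReal.ofReal ((1 / k - 1) / 24) *
      lpois h (fun z => ‖u z - pois h u x‖ₑ) x ^ (2 : ℝ) ≤
      lpois h V x ^ k * lpois h (fun z => ‖u z‖ₑ ^ (2 : ℝ) * V z ^ (-k)) x := by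
  have hk0 : 0 < k := by linarith
  by_cases hQ : lpois h (fun z => ‖u z‖ₑ ^ (2 : ℝ) * V z ^ (-k)) x = ∞
  · rw [hQ, ENNReal.mul_top]
    · exact le_top
    · exact (ENNReal.rpow_pos (pos_iff_ne_zero.mpr (lpois_pos hh hV hV0 x)) hx).ne'
  have := isProbabilityMeasure_poisMeasure hh x
  set μ := poisMeasure h x with hμ
  set Z : ℝ → ℝ := fun z => (V z).toReal ^ k with hZ
  have hZ0 : ∀ z, 0 < Z z := fun z =>
    Real.rpow_pos_of_pos (ENNReal.toReal_pos (hV0 z) (hVt z)) k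
  have hZm : Measurable Z := hV.ennreal_toReal.pow_const k
  have e1 : ∀ z, ENNReal.ofReal (Z z ^ (1 / k)) = V z := fun z => by
    simp only [hZ]
    rw [← Real.rpow_mul ENNReal.toReal_nonneg, mul_one_div_cancel hk0.ne', Real.rpow_one,
      ENNReal.ofReal_toReal (hVt z)]
  have e2 : ∀ z, ENNReal.ofReal (‖u z‖ ^ 2 / Z z) = ‖u z‖ₑ ^ (2 : ℝ) * V z ^ (-k) := fun z => by
    rw [div_eq_mul_inv, ENNReal.ofReal_mul (by positivity), ENNReal.ofReal_inv_of_pos (hZ0 z),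
      ENNReal.ofReal_pow (norm_nonneg _), ofReal_norm, ENNReal.rpow_two, ENNReal.rpow_neg]
    simp only [hZ]
    rw [← ENNReal.ofReal_rpow_of_nonneg ENNReal.toReal_nonneg hk0.le, ENNReal.ofReal_toReal (hVt z)]
  have m1 : Measurable fun z => Z z ^ (1 / k) := hZm.pow_const _
  have m2 : Measurable fun z => ‖u z‖ ^ 2 / Z z := by fun_prop
  have m3 : Measurable fun z => ‖u z‖ₑ ^ (2 : ℝ) * V z ^ (-k) := by fun_prop
  have hi1 : Integrable (fun z => Z z ^ (1 / k)) μ := by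
    refine integrable_of_lintegral_ofReal_ne_top
      (fun z => Real.rpow_nonneg (hZ0 z).le _) m1 ?_
    simp_rw [e1]; rwa [hμ, lintegral_poisMeasure hV]
  have hi2 : Integrable (fun z => ‖u z‖ ^ 2 / Z z) μ := by
    refine integrable_of_lintegral_ofReal_ne_top
      (fun z => div_nonneg (sq_nonneg _) (hZ0 z).le) m2 ?_
    simp_rw [e2]; rwa [hμ, lintegral_poisMeasure m3]
  have hui : Integrable u μ := (integrable_const M).mono' hu.aestronglyMeasurable (.of_forall hM)
  have key := weighted_jensen_defect hZ0 hZm (one_lt_one_div hk0 hk1)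
    (by rw [div_le_iff₀ hk0]; linarith) hi1 hu hui hi2
  rw [integral_poisMeasure hh, integral_eq_toReal_lintegral_of_nonneg
    (fun z => Real.rpow_nonneg (hZ0 z).le _) m1, integral_eq_toReal_lintegral_of_nonneg
    (fun z => div_nonneg (sq_nonneg _) (hZ0 z).le) m2, integral_eq_toReal_lintegral_of_nonneg
    (fun z => norm_nonneg _) (by fun_prop)] at key
  simp_rw [e1, e2, ofReal_norm] at key
  rw [lintegral_poisMeasure hV, lintegral_poisMeasure m3,
    lintegral_poisMeasure (by fun_prop)] at key
  have hL : lpois h (fun z => ‖u z - pois h u x‖ₑ) x ≠ ∞ := by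
    rw [← lintegral_poisMeasure (by fun_prop)]
    exact (hui.sub (integrable_const _)).2.ne
  have hc : 0 ≤ (1 / k - 1) / 24 := by
    have := one_lt_one_div hk0 hk1; linarith
  have := ENNReal.ofReal_le_ofReal key
  rw [ENNReal.ofReal_add (by positivity) (by positivity), ENNReal.ofReal_mul hc,
    ENNReal.ofReal_mul (by positivity), ENNReal.ofReal_pow (norm_nonneg _), ofReal_norm,
    ENNReal.ofReal_pow ENNReal.toReal_nonneg, ENNReal.ofReal_toReal hL,
    ENNReal.ofReal_toReal hQ, one_div_one_div,
    ← ENNReal.ofReal_rpow_of_nonneg ENNReal.toReal_nonneg hk0.le, ENNReal.ofReal_toReal hx] at this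
  simpa only [ENNReal.rpow_two] using this

lemma cau_sub_const (hh : 0 < h) (hu : Measurable u) (hM : ∀ x, ‖u x‖ ≤ M) (a : ℂ) (x : ℝ) :
    cau h (fun z => u z - a) x = cau h u x := by
  unfold cau
  simp_rw [mul_sub]
  rw [integral_sub, integral_mul_const, integral_cauK_sub hh, zero_mul, sub_zero]
  · exact ((integrable_cauK hh).comp_sub_left x).mul_bdd (c := M) hu.aestronglyMeasurable
      (.of_forall hM)
  · exact ((integrable_cauK hh).comp_sub_left x).mul_const a

/-- One step of the weighted energy inequality. -/
lemma lintegral_energy_step (hh : 0 < h) (hk : 1 / 2 ≤ k) (hk1 : k < 1) (hu : Measurable u)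
    (hM : ∀ x, ‖u x‖ ≤ M) (hV : Measurable V) (hV0 : ∀ x, V x ≠ 0) (hVt : ∀ x, V x ≠ ∞)
    (hx : ∀ x, lpois h V x ≠ ∞) :
    (∫⁻ x, ‖pois h u x‖ₑ ^ (2 : ℝ) * lpois h V x ^ (-k)) +
      ENNReal.ofReal ((1 / k - 1) / 6) * ENNReal.ofReal h ^ (2 : ℝ) *
        (∫⁻ x, ‖cau h u x‖ₑ ^ (2 : ℝ) * lpois h V x ^ (-k)) ≤
      ∫⁻ x, ‖u x‖ₑ ^ (2 : ℝ) * V x ^ (-k) := by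
  have m3 : Measurable fun z => ‖u z‖ₑ ^ (2 : ℝ) * V z ^ (-k) := by fun_prop
  have mp : Measurable fun x => lpois h V x := (measurable_lpois hV).of_uncurry_left
  have mu : Measurable fun x => pois h u x := (measurable_pois hu).of_uncurry_left
  have mc : Measurable fun x => cau h u x := (measurable_cau hu).of_uncurry_left
  have m4 : Measurable fun x => ‖pois h u x‖ₑ ^ (2 : ℝ) * lpois h V x ^ (-k) := by fun_prop
  have m5 : Measurable fun x => ‖cau h u x‖ₑ ^ (2 : ℝ) * lpois h V x ^ (-k) := by fun_prop
  have hc : 0 ≤ (1 / k - 1) / 24 := by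
    have := one_lt_one_div (by linarith) hk1; linarith
  rw [← lintegral_const_mul _ m5, ← lintegral_add_left m4, ← lintegral_lpois hh m3]
  refine lintegral_mono fun x => ?_
  have h1 := pois_weighted_jensen hh hk hk1 hu hM hV hV0 hVt x (hx x)
  have h2 : ENNReal.ofReal (2 * h) * ‖cau h u x‖ₑ ≤ lpois h (fun z => ‖u z - pois h u x‖ₑ) x := by
    rw [← cau_sub_const hh hu hM (pois h u x) x]
    exact enorm_cau_le hh x
  have hne := (lpois_pos hh hV hV0 x)
  have h3 : lpois h V x ^ k * lpois h V x ^ (-k) = 1 := by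
    rw [← ENNReal.rpow_add _ _ hne (hx x), add_neg_cancel, ENNReal.rpow_zero]
  have e4 : ENNReal.ofReal ((1 / k - 1) / 6) * ENNReal.ofReal h ^ (2 : ℝ) =
      ENNReal.ofReal ((1 / k - 1) / 24) * ENNReal.ofReal (2 * h) ^ (2 : ℝ) := by
    rw [ENNReal.rpow_two, ENNReal.rpow_two, ← ENNReal.ofReal_pow hh.le,
      ← ENNReal.ofReal_pow (by positivity), ← ENNReal.ofReal_mul (by linarith),
      ← ENNReal.ofReal_mul hc]
    congr 1; ring
  calc ‖pois h u x‖ₑ ^ (2 : ℝ) * lpois h V x ^ (-k) + ENNReal.ofReal ((1 / k - 1) / 6) *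
        ENNReal.ofReal h ^ (2 : ℝ) * (‖cau h u x‖ₑ ^ (2 : ℝ) * lpois h V x ^ (-k))
      = (‖pois h u x‖ₑ ^ (2 : ℝ) + ENNReal.ofReal ((1 / k - 1) / 24) *
        (ENNReal.ofReal (2 * h) * ‖cau h u x‖ₑ) ^ (2 : ℝ)) * lpois h V x ^ (-k) := by
        rw [e4, ENNReal.mul_rpow_of_nonneg _ _ (by norm_num)]; ring
    _ ≤ (lpois h V x ^ k * lpois h (fun z => ‖u z‖ₑ ^ (2 : ℝ) * V z ^ (-k)) x) *
        lpois h V x ^ (-k) := by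
        refine mul_le_mul_left (le_trans ?_ h1) _
        gcongr
    _ = lpois h V x ^ k * lpois h V x ^ (-k) *
        lpois h (fun z => ‖u z‖ₑ ^ (2 : ℝ) * V z ^ (-k)) x := by ring
    _ = _ := by rw [h3, one_mul]

end

lemma lintegral_Ioi_comp_mul_left {f : ℝ → ℝ≥0∞} (hf : Measurable f) {a : ℝ} (ha : 0 < a) (b : ℝ) :
    ∫⁻ y in Ioi (a * b), f y = ENNReal.ofReal a * ∫⁻ y in Ioi b, f (a * y) := by
  nth_rewrite 1 [← Real.smul_map_volume_mul_left ha.ne']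
  rw [abs_of_pos ha, Measure.restrict_smul, lintegral_smul_measure, smul_eq_mul,
    setLIntegral_map measurableSet_Ioi hf (measurable_const_mul a)]
  congr 3
  ext y
  simp [mul_lt_mul_iff_right₀ ha]

lemma lintegral_Icc_comp_mul_left {f : ℝ → ℝ≥0∞} (hf : Measurable f) {a : ℝ} (ha : 0 < a)
    (b c : ℝ) :
    ∫⁻ y in Icc (a * b) (a * c), f y = ENNReal.ofReal a * ∫⁻ y in Icc b c, f (a * y) := by
  nth_rewrite 1 [← Real.smul_map_volume_mul_left ha.ne']
  rw [abs_of_pos ha, Measure.restrict_smul, lintegral_smul_measure, smul_eq_mul,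
    setLIntegral_map measurableSet_Icc hf (measurable_const_mul a)]
  congr 3
  ext y
  simp [mul_le_mul_iff_right₀ ha]

lemma lintegral_Ioi_zero_le {f : ℝ → ℝ≥0∞} {B : ℝ≥0∞}
    (h : ∀ ε : ℝ, 0 < ε → ∫⁻ y in Ioi ε, f y ≤ B) : ∫⁻ y in Ioi (0 : ℝ), f y ≤ B := by
  have e : Ioi (0 : ℝ) = ⋃ n : ℕ, Ioi (1 / ((n : ℝ) + 1)) := by
    ext y
    simp only [mem_iUnion, mem_Ioi]
    exact ⟨fun hy => exists_nat_one_div_lt hy, fun ⟨n, hn⟩ => lt_trans (by positivity) hn⟩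
  have hd : Monotone fun n : ℕ => Ioi (1 / ((n : ℝ) + 1)) := fun m n hmn =>
    Ioi_subset_Ioi (one_div_le_one_div_of_le (by positivity) (by gcongr))
  rw [e, setLIntegral_iUnion_of_directed _ hd.directed_le]
  exact iSup_le fun n => h _ (by positivity)

/-- A dyadic summation criterion for integrals over the half line. -/
lemma lintegral_Ioi_le_of_dyadic {f : ℝ → ℝ≥0∞} (hf : Measurable f) {B : ℝ≥0∞}
    (h : ∀ s : ℝ, 0 < s → ∑' n : ℕ, ENNReal.ofReal (2 ^ n * s) * f (2 ^ n * s) ≤ B) :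
    ∫⁻ y in Ioi (0 : ℝ), f y ≤ B := by
  refine lintegral_Ioi_zero_le fun ε hε => ?_
  have hsub : Ioi ε ⊆ ⋃ n : ℕ, Icc (2 ^ n * ε) (2 ^ n * (2 * ε)) := by
    intro y hy
    have hy' : 1 < y / ε := (one_lt_div hε).mpr hy
    obtain ⟨n, h1, h2⟩ := exists_nat_pow_near hy'.le (by norm_num : (1 : ℝ) < 2)
    rw [le_div_iff₀ hε] at h1
    rw [div_lt_iff₀ hε, pow_succ, mul_assoc] at h2
    exact mem_iUnion.mpr ⟨n, h1, h2.le⟩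
  calc ∫⁻ y in Ioi ε, f y ≤ ∫⁻ y in ⋃ n : ℕ, Icc (2 ^ n * ε) (2 ^ n * (2 * ε)), f y :=
        lintegral_mono_set hsub
    _ ≤ ∑' n : ℕ, ∫⁻ y in Icc (2 ^ n * ε) (2 ^ n * (2 * ε)), f y := lintegral_iUnion_le _ _
    _ = ∑' n : ℕ, ∫⁻ s in Icc ε (2 * ε), ENNReal.ofReal (2 ^ n) * f (2 ^ n * s) := by
        congr 1; ext n
        rw [lintegral_Icc_comp_mul_left hf (by positivity), lintegral_const_mul]
        exact hf.comp (measurable_const_mul _)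
    _ = ∫⁻ s in Icc ε (2 * ε), ∑' n : ℕ, ENNReal.ofReal (2 ^ n) * f (2 ^ n * s) := by
        rw [lintegral_tsum]
        exact fun n => ((hf.comp (measurable_const_mul _)).const_mul _).aemeasurable
    _ ≤ ∫⁻ s in Icc ε (2 * ε), ENNReal.ofReal ε⁻¹ * B := by
        refine setLIntegral_mono' measurableSet_Icc fun s hs => ?_
        have hs0 : 0 < s := hε.trans_le hs.1
        calc ∑' n : ℕ, ENNReal.ofReal (2 ^ n) * f (2 ^ n * s)
            = ∑' n : ℕ, ENNReal.ofReal s⁻¹ * (ENNReal.ofReal (2 ^ n * s) * f (2 ^ n * s)) := by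
              congr 1; ext n
              rw [← mul_assoc, ← ENNReal.ofReal_mul (by positivity)]
              congr 2; field_simp
          _ = ENNReal.ofReal s⁻¹ * ∑' n : ℕ, ENNReal.ofReal (2 ^ n * s) * f (2 ^ n * s) :=
              ENNReal.tsum_mul_left
          _ ≤ ENNReal.ofReal ε⁻¹ * B := by
              gcongr
              · exact hs.1
              · exact h s hs0
    _ = B := by
        rw [setLIntegral_const, Real.volume_Icc, mul_right_comm,
          ← ENNReal.ofReal_mul (by positivity)]
        have : ε⁻¹ * (2 * ε - ε) = 1 := by field_simp; ring
        rw [this, ENNReal.ofReal_one, one_mul]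

section

variable {k M : ℝ} {φ : ℝ → ℂ} {σ w : ℝ → ℝ≥0∞}

/-- Weighted square function estimate, first form. -/
lemma lintegral_square_weighted_pois (hk : 1 / 2 ≤ k) (hk1 : k < 1) (hφ : Measurable φ)
    (hM : ∀ x, ‖φ x‖ ≤ M) (hσ : Measurable σ) (hσ0 : ∀ x, σ x ≠ 0) (hσt : ∀ x, σ x ≠ ∞)
    (hx : ∀ y, 0 < y → ∀ x, lpois y σ x ≠ ∞) :
    ENNReal.ofReal ((1 / k - 1) / 6) * ∫⁻ y in Ioi (0 : ℝ), ENNReal.ofReal y *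
      ∫⁻ x, ‖cau (2 * y) φ x‖ₑ ^ (2 : ℝ) * lpois (2 * y) σ x ^ (-k) ≤
      ∫⁻ x, ‖φ x‖ₑ ^ (2 : ℝ) * σ x ^ (-k) := by
  set c := ENNReal.ofReal ((1 / k - 1) / 6) with hc
  set E : ℝ → ℝ≥0∞ := fun y => ∫⁻ x, ‖cau y φ x‖ₑ ^ (2 : ℝ) * lpois y σ x ^ (-k) with hE
  set Φ : ℝ → ℝ≥0∞ := fun y => ∫⁻ x, ‖pois y φ x‖ₑ ^ (2 : ℝ) * lpois y σ x ^ (-k) with hΦ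
  have hEm : Measurable E := by
    have : Measurable (Function.uncurry fun y x =>
        ‖cau y φ x‖ₑ ^ (2 : ℝ) * lpois y σ x ^ (-k)) :=
      ((measurable_cau hφ).enorm.pow_const _).mul ((measurable_lpois hσ).pow_const _)
    exact this.lintegral_prod_right
  have hstep : ∀ y, 0 < y → Φ (2 * y) + c * ENNReal.ofReal y ^ (2 : ℝ) * E (2 * y) ≤ Φ y := by
    intro y hy
    have := lintegral_energy_step (u := pois y φ) (V := lpois y σ) hy hk hk1
      (measurable_pois hφ).of_uncurry_left
      (norm_pois_le hy hM) (measurable_lpois hσ).of_uncurry_left (lpois_pos hy hσ hσ0) (hx y hy)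
      (fun x => by rw [lpois_lpois hy hy hσ]; exact hx _ (by linarith) x)
    simp_rw [lpois_lpois hy hy hσ, pois_pois hy hy hφ hM, cau_pois hy hy hφ hM, ← two_mul] at this
    exact this
  have hstart : ∀ y, 0 < y → Φ y ≤ ∫⁻ x, ‖φ x‖ₑ ^ (2 : ℝ) * σ x ^ (-k) := fun y hy =>
    le_self_add.trans (lintegral_energy_step hy hk hk1 hφ hM hσ hσ0 hσt (hx y hy))
  have hEm2 : Measurable fun y => ENNReal.ofReal y * E (2 * y) :=
    ENNReal.measurable_ofReal.mul (hEm.comp (measurable_const_mul 2))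
  rw [← lintegral_const_mul _ hEm2]
  refine lintegral_Ioi_le_of_dyadic (hEm2.const_mul c) fun s hs => ?_
  have hsum : ∀ N : ℕ, Φ (2 ^ N * s) + ∑ n ∈ Finset.range N,
      c * ENNReal.ofReal (2 ^ n * s) ^ (2 : ℝ) * E (2 * (2 ^ n * s)) ≤ Φ s := by
    intro N
    induction N with
    | zero => simp
    | succ N ih =>
      refine le_trans ?_ ih
      rw [Finset.sum_range_succ, add_comm (Finset.sum _ _), ← add_assoc]
      gcongr
      have := hstep (2 ^ N * s) (by positivity)
      rwa [pow_succ', mul_assoc]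
  refine ENNReal.tsum_le_of_sum_range_le fun N => ?_
  refine le_trans (le_of_eq ?_) ((le_add_self.trans (hsum N)).trans (hstart s hs))
  refine Finset.sum_congr rfl fun n _ => ?_
  rw [ENNReal.rpow_two]; ring

/-- Weighted square function estimate. -/
lemma lintegral_square_weighted {K : ℝ≥0∞} (hK : K ≠ ∞) (hk : 1 / 2 ≤ k) (hk1 : k < 1)
    (hφ : Measurable φ)
    (hM : ∀ x, ‖φ x‖ ≤ M) (hσ : Measurable σ) (hσ0 : ∀ x, σ x ≠ 0) (hσt : ∀ x, σ x ≠ ∞)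
    (hw : Measurable w) (hw0 : ∀ x, w x ≠ 0)
    (h : ∀ y, 0 < y → ∀ x, lpois y w x * lpois y σ x ^ k ≤ K) :
    ENNReal.ofReal ((1 / k - 1) / 6) * ∫⁻ y in Ioi (0 : ℝ), ENNReal.ofReal y *
      ∫⁻ x, ‖cau y φ x‖ₑ ^ (2 : ℝ) * w x ≤
      16 * K * ∫⁻ x, ‖φ x‖ₑ ^ (2 : ℝ) * σ x ^ (-k) := by
  have hk0 : 0 < k := by linarith
  have hx : ∀ y, 0 < y → ∀ x, lpois y σ x ≠ ∞ := by
    intro y hy x hx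
    have := h y hy x
    rw [hx, ENNReal.top_rpow_of_pos hk0, ENNReal.mul_top (lpois_pos hy hw hw0 x)] at this
    exact hK (top_le_iff.mp this)
  have hmc : Measurable (Function.uncurry fun y x => ‖cau y φ x‖ₑ ^ (2 : ℝ)) :=
    (measurable_cau hφ).enorm.pow_const _
  have scale : ∀ G : ℝ → ℝ≥0∞, Measurable G → ∫⁻ y in Ioi (0 : ℝ), ENNReal.ofReal y * G y =
      4 * ∫⁻ y in Ioi (0 : ℝ), ENNReal.ofReal y * G (2 * y) := by
    intro G hG
    have := lintegral_Ioi_comp_mul_left (ENNReal.measurable_ofReal.mul hG) two_pos 0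
    simp only [mul_zero, Pi.mul_apply] at this
    rw [this, ← lintegral_const_mul _ (by fun_prop), ← lintegral_const_mul _ (by fun_prop)]
    refine lintegral_congr fun y => ?_
    rw [ENNReal.ofReal_mul (by norm_num), ENNReal.ofReal_ofNat]; ring
  set E : ℝ → ℝ≥0∞ := fun y => ∫⁻ x, ‖cau y φ x‖ₑ ^ (2 : ℝ) * lpois y σ x ^ (-k) with hE
  have hEm : Measurable E := by
    have : Measurable (Function.uncurry fun y x =>
        ‖cau y φ x‖ₑ ^ (2 : ℝ) * lpois y σ x ^ (-k)) :=
      hmc.mul ((measurable_lpois hσ).pow_const _)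
    exact this.lintegral_prod_right
  set W : ℝ → ℝ≥0∞ := fun y => ∫⁻ x, ‖cau y φ x‖ₑ ^ (2 : ℝ) * w x with hW
  have hWm : Measurable W := by
    have : Measurable (Function.uncurry fun y x => ‖cau y φ x‖ₑ ^ (2 : ℝ) * w x) :=
      hmc.mul (hw.comp measurable_snd)
    exact this.lintegral_prod_right
  have h1 := lintegral_square_weighted_pois hk hk1 hφ hM hσ hσ0 hσt hx
  have h2 : ∀ y, 0 < y → W (2 * y) ≤ K * E y := by
    intro y hy
    have m1 : Measurable fun x => ‖cau y φ x‖ₑ ^ (2 : ℝ) := hmc.of_uncurry_left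
    have m2 : Measurable fun x => ‖cau y φ x‖ₑ ^ (2 : ℝ) * lpois y σ x ^ (-k) :=
      m1.mul ((measurable_lpois hσ).of_uncurry_left.pow_const _)
    calc W (2 * y) ≤ ∫⁻ x, lpois y (fun z => ‖cau y φ z‖ₑ ^ (2 : ℝ)) x * w x := by
          refine lintegral_mono fun x => mul_le_mul_left ?_ _
          have := pois_weighted_jensen (u := cau y φ) (V := fun _ => 1) hy hk hk1
            (measurable_cau hφ).of_uncurry_left (norm_cau_le hy hM) measurable_const
            (fun _ => one_ne_zero) (fun _ => ENNReal.one_ne_top) x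
            (by simp [lpois, lintegral_poisK_sub hy])
          rw [pois_cau hy hy hφ hM, ← two_mul] at this
          refine (le_self_add.trans this).trans (le_of_eq ?_)
          have e : lpois y (fun _ => 1) x = 1 := by simp [lpois, lintegral_poisK_sub hy]
          rw [e, ENNReal.one_rpow, one_mul]
          simp only [ENNReal.one_rpow, mul_one]
      _ = ∫⁻ x, ‖cau y φ x‖ₑ ^ (2 : ℝ) * lpois y w x := lintegral_lpois_mul m1 hw
      _ ≤ ∫⁻ x, K * (‖cau y φ x‖ₑ ^ (2 : ℝ) * lpois y σ x ^ (-k)) := by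
          refine lintegral_mono fun x => ?_
          rw [mul_left_comm]
          refine mul_le_mul_right ?_ _
          rw [ENNReal.rpow_neg, ← div_eq_mul_inv]
          refine (ENNReal.le_div_iff_mul_le (.inl ?_) (.inl ?_)).mpr (h y hy x)
          · exact (ENNReal.rpow_pos (pos_iff_ne_zero.mpr (lpois_pos hy hσ hσ0 x)) (hx y hy x)).ne'
          · exact ENNReal.rpow_ne_top_of_nonneg hk0.le (hx y hy x)
      _ = K * E y := lintegral_const_mul _ m2
  have h3 : ∫⁻ y in Ioi (0 : ℝ), ENNReal.ofReal y * W y ≤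
      16 * K * ∫⁻ y in Ioi (0 : ℝ), ENNReal.ofReal y * E (2 * y) :=
    calc ∫⁻ y in Ioi (0 : ℝ), ENNReal.ofReal y * W y
        = 4 * ∫⁻ y in Ioi (0 : ℝ), ENNReal.ofReal y * W (2 * y) := scale _ hWm
      _ ≤ 4 * ∫⁻ y in Ioi (0 : ℝ), K * (ENNReal.ofReal y * E y) := by
          gcongr 4 * ?_
          refine setLIntegral_mono' measurableSet_Ioi fun y hy => ?_
          rw [mul_left_comm]
          exact mul_le_mul_right (h2 y hy) _
      _ = 4 * (K * (4 * ∫⁻ y in Ioi (0 : ℝ), ENNReal.ofReal y * E (2 * y))) := by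
          have m : Measurable fun y => ENNReal.ofReal y * E y := ENNReal.measurable_ofReal.mul hEm
          rw [lintegral_const_mul _ m, scale _ hEm]
      _ = _ := by ring
  calc _ ≤ ENNReal.ofReal ((1 / k - 1) / 6) *
        (16 * K * ∫⁻ y in Ioi (0 : ℝ), ENNReal.ofReal y * E (2 * y)) := by gcongr
    _ = 16 * K * (ENNReal.ofReal ((1 / k - 1) / 6) *
        ∫⁻ y in Ioi (0 : ℝ), ENNReal.ofReal y * E (2 * y)) := by ring
    _ ≤ _ := by gcongr

end

lemma setLIntegral_closedBall_le_maxFn (φ : ℝ → ℝ≥0∞) {x x' s : ℝ} (hs : 0 < s)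
    (h : |x' - x| ≤ s) :
    ∫⁻ z in Metric.closedBall x s, φ z ≤ ENNReal.ofReal (8 * s) * maxFn φ x' := by
  obtain ⟨c, hc1, hc2⟩ := exists_rat_btwn (show x - s / 2 < x + s / 2 by linarith)
  obtain ⟨r, hr1, hr2⟩ := exists_rat_btwn (show 2 * s < 4 * s by linarith)
  have hr : 0 < r := by
    have : (0 : ℝ) < r := by linarith
    exact_mod_cast this
  have hxc : |x - c| ≤ s / 2 := abs_le.mpr ⟨by linarith, by linarith⟩
  have hx' : |x' - c| ≤ r := (abs_sub_le x' x c).trans (by linarith)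
  calc ∫⁻ z in Metric.closedBall x s, φ z ≤ ∫⁻ z in Metric.closedBall (c : ℝ) r, φ z := by
        refine lintegral_mono_set (Metric.closedBall_subset_closedBall' ?_)
        rw [Real.dist_eq]; linarith
    _ ≤ ENNReal.ofReal (2 * r) * maxFn φ x' := setLIntegral_le_maxFn φ hr hx'
    _ ≤ _ := by gcongr ENNReal.ofReal ?_ * _; linarith

/-- Power-type approximate identity. -/
def powK (ρ y u : ℝ) : ℝ := y⁻¹ * (y / (y + |u|)) ^ (2 - ρ)

lemma measurable_powK_sub (ρ y x : ℝ) : Measurable fun z => ENNReal.ofReal (powK ρ y (x - z)) := by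
  unfold powK; fun_prop

lemma exists_pow_le_of_pos {y : ℝ} (hy : 0 < y) (u : ℝ) :
    ∃ n : ℕ, |u| ≤ 2 ^ n * y ∧ 2 ^ n * y ≤ 2 * (y + |u|) := by
  rcases le_total |u| y with h | h
  · exact ⟨0, by simpa using h, by have := abs_nonneg u; simp; linarith⟩
  · obtain ⟨n, h1, h2⟩ := exists_nat_pow_near ((one_le_div hy).mpr h) (by norm_num : (1 : ℝ) < 2)
    rw [le_div_iff₀ hy] at h1
    rw [div_lt_iff₀ hy] at h2
    exact ⟨n + 1, h2.le, by rw [pow_succ']; linarith⟩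

lemma powK_le_tsum {ρ y : ℝ} (hρ0 : 0 ≤ ρ) (hρ : ρ < 1) (hy : 0 < y) (x z : ℝ) :
    ENNReal.ofReal (powK ρ y (x - z)) ≤
      ∑' n : ℕ, ENNReal.ofReal (4 * y⁻¹ * ((2 : ℝ) ^ (ρ - 2)) ^ n) *
        (Metric.closedBall x (2 ^ n * y)).indicator 1 z := by
  obtain ⟨n, h1, h2⟩ := exists_pow_le_of_pos hy (x - z)
  refine le_trans ?_ (ENNReal.le_tsum n)
  have hz : z ∈ Metric.closedBall x (2 ^ n * y) := by
    rwa [Metric.mem_closedBall, Real.dist_eq, abs_sub_comm]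
  rw [indicator_of_mem hz, Pi.one_apply, mul_one]
  refine ENNReal.ofReal_le_ofReal ?_
  have hpos : 0 < y + |x - z| := by positivity
  have e : y / (y + |x - z|) ≤ 2 * ((2 : ℝ) ^ n)⁻¹ := by
    rw [div_le_iff₀ hpos, mul_assoc, inv_mul_eq_div, mul_div_assoc', le_div_iff₀ (by positivity)]
    linarith
  have h4 : (2 : ℝ) ^ (2 - ρ) ≤ 4 :=
    (Real.rpow_le_rpow_of_exponent_le (by norm_num) (by linarith : 2 - ρ ≤ 2)).trans
      (by norm_num)
  calc powK ρ y (x - z) ≤ y⁻¹ * (2 * ((2 : ℝ) ^ n)⁻¹) ^ (2 - ρ) := by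
        unfold powK
        gcongr
        linarith
    _ = 2 ^ (2 - ρ) * y⁻¹ * ((2 : ℝ) ^ (ρ - 2)) ^ n := by
        rw [Real.mul_rpow (by norm_num) (by positivity), ← Real.rpow_natCast,
          ← Real.rpow_neg (by norm_num), ← Real.rpow_mul (by norm_num), ← Real.rpow_natCast,
          ← Real.rpow_mul (by norm_num)]
        ring_nf
    _ ≤ _ := by gcongr

/-- Averages against the power kernels are controlled by the maximal function. -/
lemma exists_lintegral_powK_le_maxFn {ρ : ℝ} (hρ0 : 0 ≤ ρ) (hρ : ρ < 1) :
    ∃ C : ℝ≥0∞, C ≠ ∞ ∧ ∀ {y : ℝ}, 0 < y → ∀ {φ : ℝ → ℝ≥0∞}, Measurable φ → ∀ x,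
      ∫⁻ z, ENNReal.ofReal (powK ρ y (x - z)) * φ z ≤ C * maxFn φ x := by
  have hr0 : (0 : ℝ) ≤ 2 ^ (ρ - 1) := by positivity
  have hr1 : (2 : ℝ) ^ (ρ - 1) < 1 := Real.rpow_lt_one_of_one_lt_of_neg (by norm_num) (by linarith)
  refine ⟨∑' n : ℕ, ENNReal.ofReal (32 * ((2 : ℝ) ^ (ρ - 1)) ^ n), ?_, ?_⟩
  · rw [← ENNReal.ofReal_tsum_of_nonneg (fun n => by positivity)
      ((summable_geometric_of_lt_one hr0 hr1).mul_left _)]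
    exact ENNReal.ofReal_ne_top
  intro y hy φ hφ x
  have hm : ∀ n : ℕ, Measurable fun z => ENNReal.ofReal (4 * y⁻¹ * ((2 : ℝ) ^ (ρ - 2)) ^ n) *
        (Metric.closedBall x (2 ^ n * y)).indicator (1 : ℝ → ℝ≥0∞) z * φ z := fun n =>
    ((measurable_const.indicator measurableSet_closedBall).const_mul _).mul hφ
  calc ∫⁻ z, ENNReal.ofReal (powK ρ y (x - z)) * φ z
      ≤ ∫⁻ z, ∑' n : ℕ, ENNReal.ofReal (4 * y⁻¹ * ((2 : ℝ) ^ (ρ - 2)) ^ n) *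
        (Metric.closedBall x (2 ^ n * y)).indicator 1 z * φ z := by
        refine lintegral_mono fun z => ?_
        rw [ENNReal.tsum_mul_right]
        gcongr
        exact powK_le_tsum hρ0 hρ hy x z
    _ = ∑' n : ℕ, ENNReal.ofReal (4 * y⁻¹ * ((2 : ℝ) ^ (ρ - 2)) ^ n) *
        ∫⁻ z in Metric.closedBall x (2 ^ n * y), φ z := by
        rw [lintegral_tsum fun n => (hm n).aemeasurable]
        congr 1; ext n
        rw [← lintegral_indicator measurableSet_closedBall, ← lintegral_const_mul]
        · refine lintegral_congr fun z => ?_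
          rw [mul_assoc]
          by_cases hz : z ∈ Metric.closedBall x (2 ^ n * y) <;> simp [hz]
        · exact hφ.indicator measurableSet_closedBall
    _ ≤ ∑' n : ℕ, ENNReal.ofReal (32 * ((2 : ℝ) ^ (ρ - 1)) ^ n) * maxFn φ x := by
        refine ENNReal.tsum_le_tsum fun n => ?_
        have h := setLIntegral_closedBall_le_maxFn φ (x := x) (x' := x) (s := 2 ^ n * y)
          (by positivity) (by simp; positivity)
        refine (mul_le_mul_right h _).trans (le_of_eq ?_)
        rw [← mul_assoc, ← ENNReal.ofReal_mul (by positivity)]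
        congr 2
        have e : (2 : ℝ) ^ (ρ - 1) = 2 ^ (ρ - 2) * 2 := by
          rw [show ρ - 1 = ρ - 2 + 1 by ring, Real.rpow_add_one (by norm_num)]
        rw [e, mul_pow]
        field_simp
        ring
    _ = _ := ENNReal.tsum_mul_right

lemma poisK_mul_rpow_le {ρ y : ℝ} (hy : 0 < y) (u : ℝ) :
    poisK y u * (y + |u|) ^ ρ ≤ y ^ ρ * powK ρ y u := by
  have hs : 0 < y + |u| := by positivity
  have h1 : poisK y u ≤ y⁻¹ * (y / (y + |u|)) ^ (2 : ℝ) := by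
    rw [poisK, Real.rpow_two, div_pow, inv_mul_eq_div, inv_mul_eq_div, div_div, div_div,
      div_le_div_iff₀ (by positivity) (by positivity)]
    have h3 : (y + |u|) ^ 2 ≤ 3 * (u ^ 2 + y ^ 2) := by
      nlinarith [sq_nonneg (y - |u|), sq_abs u]
    have h4 : (y + |u|) ^ 2 ≤ (u ^ 2 + y ^ 2) * π := by
      nlinarith [Real.pi_gt_three, sq_nonneg u, sq_nonneg y]
    nlinarith [sq_nonneg y, mul_nonneg (sq_nonneg y) (sub_nonneg.mpr h4)]
  calc poisK y u * (y + |u|) ^ ρ ≤ y⁻¹ * (y / (y + |u|)) ^ (2 : ℝ) * (y + |u|) ^ ρ := by gcongr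
    _ = _ := by
      rw [powK, Real.rpow_sub (by positivity), Real.div_rpow hy.le hs.le ρ]
      have : y ^ ρ ≠ 0 := (Real.rpow_pos_of_pos hy _).ne'
      have : (y + |u|) ^ ρ ≠ 0 := (Real.rpow_pos_of_pos hs _).ne'
      field_simp

/-- Poisson averages are controlled by the maximal function. -/
lemma exists_lpois_le_maxFn : ∃ C : ℝ≥0∞, C ≠ ∞ ∧ ∀ {y : ℝ}, 0 < y → ∀ {φ : ℝ → ℝ≥0∞},
    Measurable φ → ∀ x, lpois y φ x ≤ C * maxFn φ x := by
  obtain ⟨C, hC, h⟩ := exists_lintegral_powK_le_maxFn le_rfl zero_lt_one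
  refine ⟨C, hC, fun {y} hy {φ} hφ x => le_trans (lintegral_mono fun z => ?_) (h hy hφ x)⟩
  have := poisK_mul_rpow_le (ρ := 0) hy (x - z)
  simp only [Real.rpow_zero, mul_one, one_mul] at this
  gcongr

lemma powK_le_of_abs_sub_le {ρ y x x' : ℝ} (hρ0 : 0 ≤ ρ) (hρ : ρ < 1) (hy : 0 < y)
    (h : |x' - x| ≤ y) (z : ℝ) : powK ρ y (x - z) ≤ 4 * powK ρ y (x' - z) := by
  have h4 : (2 : ℝ) ^ (2 - ρ) ≤ 4 :=
    (Real.rpow_le_rpow_of_exponent_le (by norm_num) (by linarith : 2 - ρ ≤ 2)).trans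
      (by norm_num)
  have e : y / (y + |x - z|) ≤ 2 * (y / (y + |x' - z|)) := by
    rw [mul_div_assoc', div_le_div_iff₀ (by positivity) (by positivity)]
    have := abs_sub_le x' x z
    nlinarith [abs_nonneg (x - z)]
  calc powK ρ y (x - z) ≤ y⁻¹ * (2 * (y / (y + |x' - z|))) ^ (2 - ρ) := by
        unfold powK; gcongr; linarith
    _ = 2 ^ (2 - ρ) * (y⁻¹ * (y / (y + |x' - z|)) ^ (2 - ρ)) := by
        rw [Real.mul_rpow (by norm_num) (by positivity)]; ring
    _ ≤ 4 * powK ρ y (x' - z) := by unfold powK; gcongr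

section

variable {A : ℝ≥0∞} {Ω Ω₁ Ω₂ : ℝ → ℝ≥0∞}

lemma setLIntegral_closedBall_ne_zero (hΩ : Measurable Ω) (h0 : ∀ x, Ω x ≠ 0) {y : ℝ} (hy : 0 < y)
    (x : ℝ) : ∫⁻ z in Metric.closedBall x y, Ω z ≠ 0 := by
  intro h
  rw [lintegral_eq_zero_iff hΩ] at h
  have hv : volume (Metric.closedBall x y) = 0 := by
    have : ∀ᵐ z ∂volume.restrict (Metric.closedBall x y), False := h.mono fun z hz => h0 z hz
    rw [ae_iff] at this
    simpa using this
  rw [Real.volume_closedBall, ENNReal.ofReal_eq_zero] at hv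
  linarith

lemma ae_closedBall_neBot {y : ℝ} (hy : 0 < y) (x : ℝ) :
    (ae (volume.restrict (Metric.closedBall x y))).NeBot := by
  rw [ae_neBot, Ne, Measure.restrict_eq_zero, Real.volume_closedBall, ENNReal.ofReal_eq_zero]
  linarith

lemma setLIntegral_closedBall_ne_top (hA : A ≠ ∞) (ht : ∀ x, Ω x ≠ ∞)
    (h : ∀ᵐ x, maxFn Ω x ≤ A * Ω x) {y : ℝ} (hy : 0 < y) (x : ℝ) :
    ∫⁻ z in Metric.closedBall x y, Ω z ≠ ∞ := by
  have := ae_closedBall_neBot hy x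
  obtain ⟨x', h1, h2⟩ := ((ae_restrict_of_ae h).and
    (ae_restrict_mem (μ := volume) (measurableSet_closedBall (x := x) (ε := y)))).exists
  rw [Metric.mem_closedBall, Real.dist_eq] at h2
  refine ne_top_of_le_ne_top ?_ (setLIntegral_closedBall_le_maxFn Ω hy h2)
  exact ENNReal.mul_ne_top ENNReal.ofReal_ne_top
    (ne_top_of_le_ne_top (ENNReal.mul_ne_top hA (ht x')) h1)

lemma lintegral_powK_le_setLIntegral {ρ : ℝ} (hρ0 : 0 ≤ ρ) (hρ : ρ < 1) {C : ℝ≥0∞}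
    (hC : ∀ {y : ℝ}, 0 < y → ∀ {φ : ℝ → ℝ≥0∞}, Measurable φ → ∀ x,
      ∫⁻ z, ENNReal.ofReal (powK ρ y (x - z)) * φ z ≤ C * maxFn φ x)
    (hΩ : Measurable Ω) (h : ∀ᵐ x, maxFn Ω x ≤ A * Ω x) {y : ℝ} (hy : 0 < y) (x : ℝ) :
    (∫⁻ z, ENNReal.ofReal (powK ρ y (x - z)) * Ω z) * ENNReal.ofReal (2 * y) ≤
      4 * C * A * ∫⁻ z in Metric.closedBall x y, Ω z := by
  rw [← Real.volume_closedBall, ← setLIntegral_const, ← lintegral_const_mul _ hΩ]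
  refine lintegral_mono_ae ?_
  filter_upwards [ae_restrict_of_ae h, ae_restrict_mem measurableSet_closedBall] with x' h1 h2
  rw [Metric.mem_closedBall, Real.dist_eq] at h2
  have hm : Measurable fun z => ENNReal.ofReal (powK ρ y (x' - z)) * Ω z :=
    (measurable_powK_sub ρ y x').mul hΩ
  calc ∫⁻ z, ENNReal.ofReal (powK ρ y (x - z)) * Ω z
      ≤ ∫⁻ z, 4 * (ENNReal.ofReal (powK ρ y (x' - z)) * Ω z) := by
        refine lintegral_mono fun z => ?_
        rw [← mul_assoc]
        gcongr
        refine (ENNReal.ofReal_le_ofReal (powK_le_of_abs_sub_le hρ0 hρ hy h2 z)).trans ?_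
        rw [ENNReal.ofReal_mul (by norm_num), ENNReal.ofReal_ofNat]
    _ = 4 * ∫⁻ z, ENNReal.ofReal (powK ρ y (x' - z)) * Ω z := lintegral_const_mul _ hm
    _ ≤ 4 * (C * (A * Ω x')) := by gcongr; exact (hC hy hΩ x').trans (by gcongr)
    _ = _ := by ring

/-- Poisson averages of a power of a ratio of `A₁` weights. -/
lemma exists_lpois_ratio_le {ρ : ℝ} (hρ0 : 0 < ρ) (hρ : ρ < 1) (hA : A ≠ ∞) :
    ∃ K : ℝ≥0∞, K ≠ ∞ ∧ ∀ Ω₁ Ω₂ : ℝ → ℝ≥0∞, Measurable Ω₁ → Measurable Ω₂ →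
      (∀ x, Ω₂ x ≠ 0) → (∀ x, Ω₂ x ≠ ∞) →
      (∀ᵐ x, maxFn Ω₁ x ≤ A * Ω₁ x) → (∀ᵐ x, maxFn Ω₂ x ≤ A * Ω₂ x) → ∀ {y : ℝ}, 0 < y → ∀ x,
      lpois y (fun z => (Ω₁ z / Ω₂ z) ^ ρ) x ≤ K * ((∫⁻ z in Metric.closedBall x y, Ω₁ z) /
        ∫⁻ z in Metric.closedBall x y, Ω₂ z) ^ ρ := by
  obtain ⟨C, hCt, hC⟩ := exists_lintegral_powK_le_maxFn hρ0.le hρ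
  refine ⟨(8 * A) ^ ρ * C ^ (1 - ρ) * (2 * C * A) ^ ρ, ?_, ?_⟩
  · refine ENNReal.mul_ne_top (ENNReal.mul_ne_top ?_ ?_) ?_ <;>
      refine ENNReal.rpow_ne_top_of_nonneg (by linarith) ?_
    · exact ENNReal.mul_ne_top (by simp) hA
    · exact hCt
    · exact ENNReal.mul_ne_top (ENNReal.mul_ne_top (by simp) hCt) hA
  intro Ω₁ Ω₂ hm1 hm2 h0 ht h1 h2 y hy x
  set I₁ := ∫⁻ z in Metric.closedBall x y, Ω₁ z
  set I₂ := ∫⁻ z in Metric.closedBall x y, Ω₂ z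
  have hI0 : I₂ ≠ 0 := setLIntegral_closedBall_ne_zero hm2 h0 hy x
  have hIt : I₂ ≠ ∞ := setLIntegral_closedBall_ne_top hA ht h2 hy x
  have hy0 : ENNReal.ofReal y ≠ 0 := by simpa using hy
  set q : ℝ → ℝ≥0∞ := fun z => ENNReal.ofReal (powK ρ y (x - z)) with hq
  have hqm : Measurable q := measurable_powK_sub ρ y x
  have step1 : ∀ᵐ z, ENNReal.ofReal (poisK y (x - z)) * (Ω₁ z / Ω₂ z) ^ ρ ≤
      (8 * A / I₂) ^ ρ * ENNReal.ofReal y ^ ρ * (q z * Ω₁ z ^ ρ) := by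
    filter_upwards [h2] with z hz
    set s := y + |x - z| with hs
    have hs0 : 0 < s := by positivity
    have h3 : I₂ ≤ ENNReal.ofReal (8 * s) * A * Ω₂ z := by
      calc I₂ ≤ ∫⁻ z in Metric.closedBall x s, Ω₂ z :=
            lintegral_mono_set (Metric.closedBall_subset_closedBall (by
              rw [hs]; linarith [abs_nonneg (x - z)]))
        _ ≤ ENNReal.ofReal (8 * s) * maxFn Ω₂ z :=
            setLIntegral_closedBall_le_maxFn Ω₂ hs0 (by rw [abs_sub_comm, hs]; linarith)
        _ ≤ _ := by rw [mul_assoc]; gcongr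
    have h4 : (Ω₂ z)⁻¹ ≤ ENNReal.ofReal s * (8 * A / I₂) := by
      rw [mul_div_assoc', ENNReal.le_div_iff_mul_le (.inl hI0) (.inl hIt), mul_comm,
        ← div_eq_mul_inv]
      refine ENNReal.div_le_of_le_mul (h3.trans (le_of_eq ?_))
      rw [ENNReal.ofReal_mul (by norm_num), ENNReal.ofReal_ofNat]; ring
    calc ENNReal.ofReal (poisK y (x - z)) * (Ω₁ z / Ω₂ z) ^ ρ
        ≤ ENNReal.ofReal (poisK y (x - z)) * (Ω₁ z * (ENNReal.ofReal s * (8 * A / I₂))) ^ ρ := by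
          rw [div_eq_mul_inv]; gcongr
      _ = (8 * A / I₂) ^ ρ * (ENNReal.ofReal (poisK y (x - z)) * ENNReal.ofReal s ^ ρ) *
          Ω₁ z ^ ρ := by
          rw [ENNReal.mul_rpow_of_nonneg _ _ hρ0.le, ENNReal.mul_rpow_of_nonneg _ _ hρ0.le]; ring
      _ ≤ (8 * A / I₂) ^ ρ * (ENNReal.ofReal y ^ ρ * q z) * Ω₁ z ^ ρ := by
          gcongr _ * ?_ * _
          rw [ENNReal.ofReal_rpow_of_pos hs0, ENNReal.ofReal_rpow_of_pos hy,
            ← ENNReal.ofReal_mul (poisK_nonneg hy.le _), ← ENNReal.ofReal_mul (by positivity)]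
          exact ENNReal.ofReal_le_ofReal (poisK_mul_rpow_le hy _)
      _ = _ := by ring
  have step2 : ∫⁻ z, q z * Ω₁ z ^ ρ ≤ C ^ (1 - ρ) * (∫⁻ z, q z * Ω₁ z) ^ ρ := by
    have hqt : ∀ z, q z ≠ ∞ := fun z => ENNReal.ofReal_ne_top
    calc ∫⁻ z, q z * Ω₁ z ^ ρ = ∫⁻ z, q z ^ (1 - ρ) * (q z * Ω₁ z) ^ ρ := by
          refine lintegral_congr fun z => ?_
          rw [ENNReal.mul_rpow_of_nonneg _ _ hρ0.le, ← mul_assoc,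
            ← ENNReal.rpow_add_of_nonneg _ _ (by linarith) hρ0.le, sub_add_cancel,
            ENNReal.rpow_one]
      _ ≤ (∫⁻ z, q z) ^ (1 - ρ) * (∫⁻ z, q z * Ω₁ z) ^ ρ :=
          ENNReal.lintegral_mul_norm_pow_le hqm.aemeasurable (hqm.mul hm1).aemeasurable
            (by linarith) hρ0.le (by ring)
      _ ≤ _ := by
          gcongr
          · have := hC hy (measurable_const (a := (1 : ℝ≥0∞))) x
            simp only [mul_one] at this
            refine this.trans ?_
            calc C * maxFn (fun _ => 1) x ≤ C * 1 := by gcongr; exact maxFn_const_le 1 x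
              _ = C := mul_one C
  have step3 : ENNReal.ofReal y * ∫⁻ z, q z * Ω₁ z ≤ 2 * C * A * I₁ := by
    have := lintegral_powK_le_setLIntegral hρ0.le hρ hC hm1 h1 hy x
    rw [ENNReal.ofReal_mul (by norm_num), ENNReal.ofReal_ofNat] at this
    refine (ENNReal.mul_le_mul_iff_right (a := 2) (by simp) (by simp)).mp ?_
    calc _ = (∫⁻ z, q z * Ω₁ z) * (2 * ENNReal.ofReal y) := by ring
      _ ≤ _ := this
      _ = _ := by ring
  have hqΩ : Measurable fun z => q z * Ω₁ z ^ ρ := hqm.mul (hm1.pow_const _)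
  calc lpois y (fun z => (Ω₁ z / Ω₂ z) ^ ρ) x
      ≤ ∫⁻ z, (8 * A / I₂) ^ ρ * ENNReal.ofReal y ^ ρ * (q z * Ω₁ z ^ ρ) :=
        lintegral_mono_ae step1
    _ = (8 * A / I₂) ^ ρ * ENNReal.ofReal y ^ ρ * ∫⁻ z, q z * Ω₁ z ^ ρ :=
        lintegral_const_mul _ hqΩ
    _ ≤ (8 * A / I₂) ^ ρ * ENNReal.ofReal y ^ ρ * (C ^ (1 - ρ) * (∫⁻ z, q z * Ω₁ z) ^ ρ) := by
        gcongr
    _ = (8 * A / I₂) ^ ρ * C ^ (1 - ρ) * (ENNReal.ofReal y * ∫⁻ z, q z * Ω₁ z) ^ ρ := by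
        rw [ENNReal.mul_rpow_of_nonneg _ _ hρ0.le]; ring
    _ ≤ (8 * A / I₂) ^ ρ * C ^ (1 - ρ) * (2 * C * A * I₁) ^ ρ := by gcongr
    _ = _ := by
        simp only [div_eq_mul_inv, ENNReal.mul_rpow_of_nonneg _ _ hρ0.le]; ring

/-- A Muckenhoupt type condition, in Poisson form, for a ratio of `A₁` weights. -/
lemma exists_lpois_ratio_mul_le {ρ k : ℝ} (hρ0 : 0 < ρ) (hρ : ρ < 1) (hk0 : 0 < k) (hk : k < 1)
    (hA : A ≠ ∞) :
    ∃ K : ℝ≥0∞, K ≠ ∞ ∧ ∀ Ω₁ Ω₂ : ℝ → ℝ≥0∞, Measurable Ω₁ → Measurable Ω₂ →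
      (∀ x, Ω₁ x ≠ 0) → (∀ x, Ω₁ x ≠ ∞) → (∀ x, Ω₂ x ≠ 0) → (∀ x, Ω₂ x ≠ ∞) →
      (∀ᵐ x, maxFn Ω₁ x ≤ A * Ω₁ x) → (∀ᵐ x, maxFn Ω₂ x ≤ A * Ω₂ x) → ∀ {y : ℝ}, 0 < y → ∀ x,
      lpois y (fun z => (Ω₁ z / Ω₂ z) ^ (ρ * k)) x * lpois y (fun z => (Ω₂ z / Ω₁ z) ^ ρ) x ^ k
        ≤ K := by
  obtain ⟨K, hK, h⟩ := exists_lpois_ratio_le (A := A) hρ0 hρ hA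
  refine ⟨K ^ k * K ^ k, ENNReal.mul_ne_top (ENNReal.rpow_ne_top_of_nonneg hk0.le hK)
    (ENNReal.rpow_ne_top_of_nonneg hk0.le hK), ?_⟩
  intro Ω₁ Ω₂ hm1 hm2 h10 h1t h20 h2t h1 h2 y hy x
  have a1 := h Ω₁ Ω₂ hm1 hm2 h20 h2t h1 h2 hy x
  have a2 := h Ω₂ Ω₁ hm2 hm1 h10 h1t h2 h1 hy x
  set I₁ := ∫⁻ z in Metric.closedBall x y, Ω₁ z
  set I₂ := ∫⁻ z in Metric.closedBall x y, Ω₂ z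
  have h10 : I₁ ≠ 0 := setLIntegral_closedBall_ne_zero hm1 h10 hy x
  have h1t : I₁ ≠ ∞ := setLIntegral_closedBall_ne_top hA h1t h1 hy x
  have h20 : I₂ ≠ 0 := setLIntegral_closedBall_ne_zero hm2 h20 hy x
  have h2t : I₂ ≠ ∞ := setLIntegral_closedBall_ne_top hA h2t h2 hy x
  have jensen : lpois y (fun z => (Ω₁ z / Ω₂ z) ^ (ρ * k)) x ≤
      lpois y (fun z => (Ω₁ z / Ω₂ z) ^ ρ) x ^ k := by
    have hpm := measurable_ofReal_poisK_sub y x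
    have hm : Measurable fun z => (Ω₁ z / Ω₂ z) ^ ρ := (hm1.div hm2).pow_const _
    calc lpois y (fun z => (Ω₁ z / Ω₂ z) ^ (ρ * k)) x
        = ∫⁻ z, ENNReal.ofReal (poisK y (x - z)) ^ (1 - k) *
          (ENNReal.ofReal (poisK y (x - z)) * (Ω₁ z / Ω₂ z) ^ ρ) ^ k := by
          refine lintegral_congr fun z => ?_
          rw [ENNReal.mul_rpow_of_nonneg _ _ hk0.le, ← mul_assoc,
            ← ENNReal.rpow_add_of_nonneg _ _ (by linarith) hk0.le, sub_add_cancel,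
            ENNReal.rpow_one, ← ENNReal.rpow_mul]
      _ ≤ (∫⁻ z, ENNReal.ofReal (poisK y (x - z))) ^ (1 - k) *
          (∫⁻ z, ENNReal.ofReal (poisK y (x - z)) * (Ω₁ z / Ω₂ z) ^ ρ) ^ k :=
          ENNReal.lintegral_mul_norm_pow_le hpm.aemeasurable (hpm.mul hm).aemeasurable
            (by linarith) hk0.le (by ring)
      _ = _ := by rw [lintegral_poisK_sub hy, ENNReal.one_rpow, one_mul]; rfl
  calc _ ≤ (K * (I₁ / I₂) ^ ρ) ^ k * (K * (I₂ / I₁) ^ ρ) ^ k := by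
        gcongr
        exact jensen.trans (by gcongr)
    _ = K ^ k * K ^ k * ((I₁ / I₂ * (I₂ / I₁)) ^ ρ) ^ k := by
        simp only [ENNReal.mul_rpow_of_nonneg _ _ hk0.le, ENNReal.mul_rpow_of_nonneg _ _ hρ0.le]
        ring
    _ = K ^ k * K ^ k := by
        rw [← ENNReal.inv_div (.inl h1t) (.inl h10), ENNReal.inv_mul_cancel
          (ENNReal.div_ne_zero.mpr ⟨h20, h1t⟩) (ENNReal.div_ne_top h2t h10), ENNReal.one_rpow,
          ENNReal.one_rpow, mul_one]

end

section SquareFunction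

/-- The square of the square function attached to the derivative of the Poisson extension of the
positive frequency part. -/
def sqFn (φ : ℝ → ℂ) (x : ℝ) : ℝ≥0∞ :=
  ∫⁻ y in Ioi (0 : ℝ), ENNReal.ofReal y * ‖cau y φ x‖ₑ ^ (2 : ℝ)

variable {τ : Type*} [MeasurableSpace τ]

lemma measurable_sqFn {φ : ℝ → τ → ℂ} (hφ : Measurable (Function.uncurry φ)) :
    Measurable (Function.uncurry fun x t => sqFn (fun z => φ z t) x) := by
  have h1 : Measurable fun p : (ℝ × τ) × ℝ => cau p.2 (fun z => φ z p.1.2) p.1.1 :=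
    measurable_uncurry_comp (F := fun (y : ℝ) (q : ℝ × τ) => cau y (fun z => φ z q.2) q.1)
      (measurable_cau_param hφ) measurable_snd measurable_fst
  have h2 : Measurable (Function.uncurry fun (p : ℝ × τ) (y : ℝ) =>
      ENNReal.ofReal y * ‖cau y (fun z => φ z p.2) p.1‖ₑ ^ (2 : ℝ)) :=
    (ENNReal.measurable_ofReal.comp measurable_snd).mul (h1.enorm.pow_const _)
  exact h2.lintegral_prod_right

lemma lintegral_sqFn_mul {φ : ℝ → ℂ} (hφ : Measurable φ) {w : ℝ → ℝ≥0∞} (hw : Measurable w) :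
    ∫⁻ x, sqFn φ x * w x =
      ∫⁻ y in Ioi (0 : ℝ), ENNReal.ofReal y * ∫⁻ x, ‖cau y φ x‖ₑ ^ (2 : ℝ) * w x := by
  have hc : Measurable (Function.uncurry fun y x => ‖cau y φ x‖ₑ ^ (2 : ℝ)) :=
    (measurable_cau hφ).enorm.pow_const _
  have h1 : ∀ x, sqFn φ x * w x = ∫⁻ y in Ioi (0 : ℝ),
      ENNReal.ofReal y * (‖cau y φ x‖ₑ ^ (2 : ℝ) * w x) := fun x => by
    have m : Measurable fun y => ENNReal.ofReal y * ‖cau y φ x‖ₑ ^ (2 : ℝ) :=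
      ENNReal.measurable_ofReal.mul hc.of_uncurry_right
    rw [sqFn, ← lintegral_mul_const _ m]
    simp_rw [mul_assoc]
  simp_rw [h1]
  have m2 : Measurable (Function.uncurry fun (x : ℝ) (y : ℝ) =>
      ENNReal.ofReal y * (‖cau y φ x‖ₑ ^ (2 : ℝ) * w x)) :=
    (ENNReal.measurable_ofReal.comp measurable_snd).mul
      ((hc.comp measurable_swap).mul (hw.comp measurable_fst))
  rw [lintegral_lintegral_swap m2.aemeasurable]
  refine lintegral_congr fun y => ?_
  have m : Measurable fun x => ‖cau y φ x‖ₑ ^ (2 : ℝ) * w x := hc.of_uncurry_left.mul hw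
  exact lintegral_const_mul _ m

lemma exists_lintegral_sqFn_weighted {r : ℝ} (hr : 1 < r) (hr2 : r < 2) {A : ℝ≥0∞} (hA : A ≠ ∞) :
    ∃ C : ℝ≥0∞, C ≠ ∞ ∧ ∀ Ω₁ Ω₂ : ℝ → ℝ≥0∞, Measurable Ω₁ → Measurable Ω₂ →
      (∀ x, Ω₁ x ≠ 0) → (∀ x, Ω₁ x ≠ ∞) → (∀ x, Ω₂ x ≠ 0) → (∀ x, Ω₂ x ≠ ∞) →
      (∀ᵐ x, maxFn Ω₁ x ≤ A * Ω₁ x) → (∀ᵐ x, maxFn Ω₂ x ≤ A * Ω₂ x) →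
      ∀ (φ : ℝ → ℂ) (M : ℝ), Measurable φ → (∀ x, ‖φ x‖ ≤ M) →
      (∀ᵐ x, ‖φ x‖ₑ ≤ Ω₂ x ^ (1 / r)) →
      ∫⁻ x, sqFn φ x * (Ω₁ x / Ω₂ x) ^ (1 / r) ≤ C * ∫⁻ x, Ω₁ x ^ (1 / r) * Ω₂ x ^ (1 / r) := by
  have hr0 : 0 < r := by linarith
  set ρ := (r + 1) / (2 * r) with hρ
  set k := 2 / (r + 1) with hk
  have hρk : ρ * k = 1 / r := by rw [hρ, hk]; field_simp
  have hρ0 : 0 < ρ := by positivity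
  have hρ1 : ρ < 1 := by rw [hρ, div_lt_one (by positivity)]; linarith
  have hk0 : 0 < k := by positivity
  have hk1 : k < 1 := by rw [hk, div_lt_one (by positivity)]; linarith
  have hk2 : 1 / 2 ≤ k := by rw [hk, div_le_div_iff₀ (by positivity) (by positivity)]; linarith
  obtain ⟨K, hK, h⟩ := exists_lpois_ratio_mul_le (A := A) hρ0 hρ1 hk0 hk1 hA
  set c := ENNReal.ofReal ((1 / k - 1) / 6) with hc
  have hc0 : c ≠ 0 := by
    have : 1 < 1 / k := (one_lt_div hk0).mpr hk1
    simp only [hc, ne_eq, ENNReal.ofReal_eq_zero, not_le]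
    linarith
  have hct : c ≠ ∞ := ENNReal.ofReal_ne_top
  refine ⟨c⁻¹ * (16 * K), ENNReal.mul_ne_top (ENNReal.inv_ne_top.mpr hc0)
    (ENNReal.mul_ne_top (by simp) hK), ?_⟩
  intro Ω₁ Ω₂ m1 m2 h10 h1t h20 h2t h1 h2 φ M hφ hM hle
  have hr0' : (0 : ℝ) < 1 / r := by positivity
  have ratio0 : ∀ {a b : ℝ≥0∞} (s : ℝ), a ≠ 0 → a ≠ ∞ → b ≠ 0 → b ≠ ∞ → (a / b) ^ s ≠ 0 :=
    fun {a b} s ha hat hb hbt => (ENNReal.rpow_pos (pos_iff_ne_zero.mpr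
      (ENNReal.div_ne_zero.mpr ⟨ha, hbt⟩)) (ENNReal.div_ne_top hat hb)).ne'
  set w : ℝ → ℝ≥0∞ := fun x => (Ω₁ x / Ω₂ x) ^ (1 / r) with hw
  set σ : ℝ → ℝ≥0∞ := fun x => (Ω₂ x / Ω₁ x) ^ ρ with hσ
  have hwm : Measurable w := (m1.div m2).pow_const _
  have key := lintegral_square_weighted (σ := σ) (w := w) hK hk2 hk1 hφ hM
    ((m2.div m1).pow_const _) (fun x => ratio0 _ (h20 x) (h2t x) (h10 x) (h1t x))
    (fun x => ENNReal.rpow_ne_top_of_nonneg hρ0.le (ENNReal.div_ne_top (h2t x) (h10 x)))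
    hwm (fun x => ratio0 _ (h10 x) (h1t x) (h20 x) (h2t x))
    (fun y hy x => by
      have := h Ω₁ Ω₂ m1 m2 h10 h1t h20 h2t h1 h2 hy x
      rwa [hρk] at this)
  rw [← hc, ← lintegral_sqFn_mul hφ hwm] at key
  have hle2 : ∫⁻ x, ‖φ x‖ₑ ^ (2 : ℝ) * σ x ^ (-k) ≤ ∫⁻ x, Ω₁ x ^ (1 / r) * Ω₂ x ^ (1 / r) := by
    refine lintegral_mono_ae ?_
    filter_upwards [hle] with x hx
    have e : σ x ^ (-k) = Ω₁ x ^ (1 / r) * (Ω₂ x ^ (1 / r))⁻¹ := by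
      rw [hσ]
      simp only
      rw [← ENNReal.rpow_mul, mul_neg, hρk, ENNReal.rpow_neg, ← ENNReal.inv_rpow,
        ENNReal.inv_div (.inl (h1t x)) (.inl (h10 x)), ENNReal.div_rpow_of_nonneg _ _ hr0'.le,
        div_eq_mul_inv]
    have hV0 : Ω₂ x ^ (1 / r) ≠ 0 :=
      (ENNReal.rpow_pos (pos_iff_ne_zero.mpr (h20 x)) (h2t x)).ne'
    have hVt : Ω₂ x ^ (1 / r) ≠ ∞ := ENNReal.rpow_ne_top_of_nonneg hr0'.le (h2t x)
    calc ‖φ x‖ₑ ^ (2 : ℝ) * σ x ^ (-k)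
        ≤ (Ω₂ x ^ (1 / r)) ^ (2 : ℝ) * (Ω₁ x ^ (1 / r) * (Ω₂ x ^ (1 / r))⁻¹) := by
          rw [e]; gcongr
      _ = Ω₁ x ^ (1 / r) * Ω₂ x ^ (1 / r) * (Ω₂ x ^ (1 / r) * (Ω₂ x ^ (1 / r))⁻¹) := by
          rw [ENNReal.rpow_two]; ring
      _ = _ := by rw [ENNReal.mul_inv_cancel hV0 hVt, mul_one]
  calc ∫⁻ x, sqFn φ x * w x = c⁻¹ * (c * ∫⁻ x, sqFn φ x * w x) := by
        rw [← mul_assoc, ENNReal.inv_mul_cancel hc0 hct, one_mul]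
    _ ≤ c⁻¹ * (16 * K * ∫⁻ x, Ω₁ x ^ (1 / r) * Ω₂ x ^ (1 / r)) := by
        gcongr c⁻¹ * ?_
        exact key.trans (by gcongr)
    _ = _ := by ring

/-- Everywhere positive and finite `A₁` majorants. -/
lemma exists_A1_weight {p q : ℝ} (hp : 1 < p) (hq : 1 < q) :
    ∃ A : ℝ≥0, ∀ (ν : Measure τ) [IsFiniteMeasure ν] (h : ℝ → τ → ℝ≥0∞),
      Measurable (Function.uncurry h) → (∀ x t, h x t ≠ 0) → mixedNorm p q ν h ≠ ∞ →
      ∃ Ω : ℝ → τ → ℝ≥0∞, Measurable (Function.uncurry Ω) ∧ (∀ x t, Ω x t ≠ 0) ∧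
      (∀ x t, Ω x t ≠ ∞) ∧ (∀ᵐ t ∂ν, ∀ᵐ x, h x t ≤ Ω x t) ∧
      (∀ᵐ t ∂ν, ∀ᵐ x, maxFn (fun y => Ω y t) x ≤ A * Ω x t) ∧
      mixedNorm p q ν Ω ≤ 2 * mixedNorm p q ν h := by
  obtain ⟨A, hA⟩ := exists_A1_majorant_mixed (τ := τ) hp hq
  refine ⟨A, fun ν _ h hh h0 hfin => ?_⟩
  obtain ⟨Ω, m, hle, hmax, hN⟩ := hA ν h hh
  have hfin' : mixedNorm p q ν Ω ≠ ∞ :=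
    ne_top_of_le_ne_top (ENNReal.mul_ne_top (by simp) hfin) hN
  have hae := ae_lt_top_of_mixedNorm (by linarith) (by linarith) m hfin'
  set Ω' : ℝ → τ → ℝ≥0∞ := fun x t => if Ω x t = ∞ then 1 else Ω x t with hΩ'
  have heq : ∀ᵐ t ∂ν, ∀ᵐ x, Ω' x t = Ω x t := by
    filter_upwards [hae] with t ht
    filter_upwards [ht] with x hx
    simp [hΩ', hx.ne]
  refine ⟨Ω', Measurable.ite (m (measurableSet_singleton _)) measurable_const m, ?_, ?_, ?_, ?_, ?_⟩
  · intro x t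
    simp only [hΩ']
    split_ifs
    · exact one_ne_zero
    · exact fun h1 => h0 x t (le_zero_iff.mp (h1 ▸ hle x t))
  · intro x t
    simp only [hΩ']
    split_ifs with h1
    · exact ENNReal.one_ne_top
    · exact h1
  · filter_upwards [heq] with t ht
    filter_upwards [ht] with x hx
    rw [hx]; exact hle x t
  · filter_upwards [heq] with t ht
    filter_upwards [ht] with x hx
    rw [hx, maxFn_congr_ae ht]
    exact hmax t x
  · refine (mixedNorm_mono (by linarith) (by linarith) fun x t => ?_).trans hN
    simp only [hΩ']
    split_ifs with h1
    · simp [h1]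
    · exact le_rfl

lemma lintegral_lintegral_sqrt_mul_le {α β : Type*} [MeasurableSpace α] [MeasurableSpace β]
    {μ : Measure α} {ν : Measure β} [SFinite ν] {a b : α → β → ℝ≥0∞}
    (ha : Measurable (Function.uncurry a)) (hb : Measurable (Function.uncurry b)) :
    ∫⁻ x, ∫⁻ y, a x y ^ (1 / 2 : ℝ) * b x y ^ (1 / 2 : ℝ) ∂ν ∂μ ≤
      (∫⁻ x, ∫⁻ y, a x y ∂ν ∂μ) ^ (1 / 2 : ℝ) * (∫⁻ x, ∫⁻ y, b x y ∂ν ∂μ) ^ (1 / 2 : ℝ) := by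
  refine le_trans (lintegral_mono fun x => ?_) (ENNReal.lintegral_mul_norm_pow_le
    (Measurable.lintegral_prod_right ha).aemeasurable
    (Measurable.lintegral_prod_right hb).aemeasurable
    (by norm_num) (by norm_num) (by norm_num))
  exact ENNReal.lintegral_mul_norm_pow_le ha.of_uncurry_left.aemeasurable
    hb.of_uncurry_left.aemeasurable (by norm_num) (by norm_num) (by norm_num)

lemma mixedNorm_bump_ne_top {p q : ℝ} (hp : 1 ≤ p) (hq : 1 ≤ q) (ν : Measure τ)
    [IsFiniteMeasure ν] : mixedNorm p q ν (fun x _ => bump x) ≠ ∞ := by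
  have e : ∀ x, Lnorm q ν (fun _ => bump x) = ν univ ^ (1 / q) * bump x := fun x => by
    rw [Lnorm, lintegral_const, ENNReal.mul_rpow_of_nonneg _ _ (by positivity),
      ← ENNReal.rpow_mul, mul_one_div_cancel (by linarith), ENNReal.rpow_one, mul_comm]
  simp only [mixedNorm, e]
  rw [Lnorm_const_mul (by linarith) _ measurable_bump]
  exact ENNReal.mul_ne_top (ENNReal.rpow_ne_top_of_nonneg (by positivity) (measure_ne_top _ _))
    (Lnorm_bump_ne_top hp)

/-- Positive `A₁` majorants of powers: a function of finite mixed norm is dominated by a power of an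
`A₁` weight. -/
lemma exists_rpow_A1_weight {p q r : ℝ} (hr : 0 < r) (hp : r < p) (hq : r < q) :
    ∃ A : ℝ≥0, ∀ (ν : Measure τ) [IsFiniteMeasure ν] (h : ℝ → τ → ℝ≥0∞),
      Measurable (Function.uncurry h) → (∀ x t, h x t ≠ 0) → mixedNorm p q ν h ≠ ∞ →
      ∃ Ω : ℝ → τ → ℝ≥0∞, Measurable (Function.uncurry Ω) ∧ (∀ x t, Ω x t ≠ 0) ∧
      (∀ x t, Ω x t ≠ ∞) ∧ (∀ᵐ t ∂ν, ∀ᵐ x, h x t ≤ Ω x t ^ (1 / r)) ∧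
      (∀ᵐ t ∂ν, ∀ᵐ x, maxFn (fun y => Ω y t) x ≤ A * Ω x t) ∧
      mixedNorm p q ν (fun x t => Ω x t ^ (1 / r)) ≤ 2 ^ (1 / r) * mixedNorm p q ν h := by
  have hp0 : 0 < p := hr.trans hp
  obtain ⟨A, hA⟩ := exists_A1_weight (τ := τ) ((one_lt_div hr).2 hp) ((one_lt_div hr).2 hq)
  refine ⟨A, fun ν _ h hh h0 hfin => ?_⟩
  have hN : mixedNorm (p / r) (q / r) ν (fun x t => h x t ^ r) = mixedNorm p q ν h ^ r := by
    rw [mixedNorm_rpow hr, div_mul_cancel₀ _ hr.ne', div_mul_cancel₀ _ hr.ne']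
  obtain ⟨Ω, m, h1, h2, h3, h4, h5⟩ := hA ν (fun x t => h x t ^ r) (hh.pow_const _)
    (fun x t h1 => by
      rcases ENNReal.rpow_eq_zero_iff.mp h1 with h1 | h1
      · exact h0 x t h1.1
      · linarith [h1.2])
    (by rw [hN]; exact ENNReal.rpow_ne_top_of_nonneg hr.le hfin)
  refine ⟨Ω, m, h1, h2, ?_, h4, ?_⟩
  · filter_upwards [h3] with t ht
    filter_upwards [ht] with x hx
    rwa [one_div, ENNReal.le_rpow_inv_iff hr]
  · rw [mixedNorm_rpow (by positivity), mul_one_div, mul_one_div]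
    refine (ENNReal.rpow_le_rpow (h5.trans_eq (by rw [hN])) (by positivity)).trans_eq ?_
    rw [ENNReal.mul_rpow_of_nonneg _ _ (by positivity), ← ENNReal.rpow_mul,
      mul_one_div_cancel hr.ne', ENNReal.rpow_one]

lemma exists_lintegral_sqrt_sqFn_mul_le {p q p' q' : ℝ} (hp : p.HolderConjugate p')
    (hq : q.HolderConjugate q') :
    ∃ C : ℝ≥0∞, C ≠ ∞ ∧ ∀ (ν : Measure τ) [IsFiniteMeasure ν] (φ : ℝ → τ → ℂ) (M : ℝ)
      (f h : ℝ → τ → ℝ≥0∞), Measurable (Function.uncurry φ) → (∀ x t, ‖φ x t‖ ≤ M) →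
      (∀ x t, ‖φ x t‖ₑ ≤ f x t) → Measurable (Function.uncurry f) →
      Measurable (Function.uncurry h) → (∀ x t, f x t ≠ 0) → (∀ x t, h x t ≠ 0) →
      mixedNorm p q ν f ≠ ∞ → mixedNorm p' q' ν h ≠ ∞ →
      ∫⁻ x, ∫⁻ t, sqFn (fun z => φ z t) x ^ (1 / 2 : ℝ) * h x t ∂ν ≤
        C * (mixedNorm p q ν f * mixedNorm p' q' ν h) := by
  obtain ⟨r, hr1, hr⟩ := exists_between (show 1 < min (min (min p q) (min p' q')) 2 by
    simp [hp.lt, hq.lt, hp.symm.lt, hq.symm.lt])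
  simp only [lt_min_iff] at hr
  obtain ⟨⟨⟨hrp, hrq⟩, hrp', hrq'⟩, hr2⟩ := hr
  have hr0 : 0 < r := by linarith
  obtain ⟨A₁, hA₁⟩ := exists_rpow_A1_weight (τ := τ) hr0 hrp' hrq'
  obtain ⟨A₂, hA₂⟩ := exists_rpow_A1_weight (τ := τ) hr0 hrp hrq
  obtain ⟨C, hC, hw⟩ := exists_lintegral_sqFn_weighted hr1 hr2
    (A := max A₁ A₂) (by simp)
  refine ⟨C ^ (1 / 2 : ℝ) * (2 ^ (1 / r) * 2 ^ (1 / r)), ?_, ?_⟩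
  · exact ENNReal.mul_ne_top (ENNReal.rpow_ne_top_of_nonneg (by norm_num) hC)
      (ENNReal.mul_ne_top (ENNReal.rpow_ne_top_of_nonneg (by positivity) (by simp))
        (ENNReal.rpow_ne_top_of_nonneg (by positivity) (by simp)))
  intro ν _ φ M f h hφ hM hφf hf hh hf0 hh0 hfN hhN
  obtain ⟨Ω₁, m1, h10, h1t, h1le, h1A, h1N⟩ := hA₁ ν h hh hh0 hhN
  obtain ⟨Ω₂, m2, h20, h2t, h2le, h2A, h2N⟩ := hA₂ ν f hf hf0 hfN
  set S : ℝ → τ → ℝ≥0∞ := fun x t => sqFn (fun z => φ z t) x with hS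
  have hSm : Measurable (Function.uncurry S) := measurable_sqFn hφ
  set W₁ : ℝ → τ → ℝ≥0∞ := fun x t => Ω₁ x t ^ (1 / r) with hW₁
  set W₂ : ℝ → τ → ℝ≥0∞ := fun x t => Ω₂ x t ^ (1 / r) with hW₂
  have hW₁m : Measurable (Function.uncurry W₁) := m1.pow_const _
  have hW₂m : Measurable (Function.uncurry W₂) := m2.pow_const _
  have hr' : (0 : ℝ) < 1 / r := by positivity
  have ham : Measurable (Function.uncurry fun t x => S x t * (Ω₁ x t / Ω₂ x t) ^ (1 / r)) :=
    (hSm.comp measurable_swap).mul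
      (((m1.comp measurable_swap).div (m2.comp measurable_swap)).pow_const _)
  have hbm : Measurable (Function.uncurry fun t x => W₁ x t * W₂ x t) :=
    (hW₁m.comp measurable_swap).mul (hW₂m.comp measurable_swap)
  have hSh : Measurable (Function.uncurry fun x t => S x t ^ (1 / 2 : ℝ) * h x t) :=
    (hSm.pow_const _).mul hh
  have hslice : ∀ᵐ t ∂ν, ∫⁻ x, S x t * (Ω₁ x t / Ω₂ x t) ^ (1 / r) ≤
      C * ∫⁻ x, W₁ x t * W₂ x t := by
    filter_upwards [h1A, h2A, h2le] with t a1 a2 a3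
    refine hw (fun x => Ω₁ x t) (fun x => Ω₂ x t) m1.of_uncurry_right m2.of_uncurry_right
      (fun x => h10 x t) (fun x => h1t x t) (fun x => h20 x t) (fun x => h2t x t) ?_ ?_
      (fun z => φ z t) M hφ.of_uncurry_right (fun x => hM x t) ?_
    · filter_upwards [a1] with x hx
      refine hx.trans ?_
      gcongr; exact le_max_left _ _
    · filter_upwards [a2] with x hx
      refine hx.trans ?_
      gcongr; exact le_max_right _ _
    · filter_upwards [a3] with x hx
      exact (hφf x t).trans hx
  calc ∫⁻ x, ∫⁻ t, S x t ^ (1 / 2 : ℝ) * h x t ∂ν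
      = ∫⁻ t, ∫⁻ x, S x t ^ (1 / 2 : ℝ) * h x t ∂volume ∂ν :=
        lintegral_lintegral_swap hSh.aemeasurable
    _ ≤ ∫⁻ t, ∫⁻ x, (S x t * (Ω₁ x t / Ω₂ x t) ^ (1 / r)) ^ (1 / 2 : ℝ) *
          (W₁ x t * W₂ x t) ^ (1 / 2 : ℝ) ∂volume ∂ν := by
        refine lintegral_mono_ae ?_
        filter_upwards [h1le] with t ht
        refine lintegral_mono_ae ?_
        filter_upwards [ht] with x hx
        have e : (Ω₁ x t / Ω₂ x t) ^ (1 / r) * (W₁ x t * W₂ x t) = W₁ x t ^ (2 : ℝ) := by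
          have hV0 : W₂ x t ≠ 0 := (ENNReal.rpow_pos (pos_iff_ne_zero.mpr (h20 x t)) (h2t x t)).ne'
          have hVt : W₂ x t ≠ ∞ := ENNReal.rpow_ne_top_of_nonneg hr'.le (h2t x t)
          rw [ENNReal.div_rpow_of_nonneg _ _ hr'.le, ENNReal.rpow_two, div_eq_mul_inv]
          calc W₁ x t * (W₂ x t)⁻¹ * (W₁ x t * W₂ x t)
              = W₁ x t ^ 2 * (W₂ x t * (W₂ x t)⁻¹) := by ring
            _ = _ := by rw [ENNReal.mul_inv_cancel hV0 hVt, mul_one]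
        rw [← ENNReal.mul_rpow_of_nonneg _ _ (by norm_num), mul_assoc, e,
          ENNReal.mul_rpow_of_nonneg _ _ (by norm_num), ← ENNReal.rpow_mul]
        norm_num
        gcongr
    _ ≤ (∫⁻ t, ∫⁻ x, S x t * (Ω₁ x t / Ω₂ x t) ^ (1 / r) ∂volume ∂ν) ^ (1 / 2 : ℝ) *
          (∫⁻ t, ∫⁻ x, W₁ x t * W₂ x t ∂volume ∂ν) ^ (1 / 2 : ℝ) :=
        lintegral_lintegral_sqrt_mul_le ham hbm
    _ ≤ (C * ∫⁻ t, ∫⁻ x, W₁ x t * W₂ x t ∂volume ∂ν) ^ (1 / 2 : ℝ) *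
          (∫⁻ t, ∫⁻ x, W₁ x t * W₂ x t ∂volume ∂ν) ^ (1 / 2 : ℝ) := by
        gcongr
        rw [← lintegral_const_mul _ (Measurable.lintegral_prod_right hbm)]
        exact lintegral_mono_ae hslice
    _ = C ^ (1 / 2 : ℝ) * ∫⁻ t, ∫⁻ x, W₁ x t * W₂ x t ∂volume ∂ν := by
        rw [ENNReal.mul_rpow_of_nonneg _ _ (by norm_num), mul_assoc,
          ← ENNReal.rpow_add_of_nonneg _ _ (by norm_num) (by norm_num)]
        norm_num
    _ = C ^ (1 / 2 : ℝ) * ∫⁻ x, ∫⁻ t, W₂ x t * W₁ x t ∂ν := by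
        rw [lintegral_lintegral_swap hbm.aemeasurable]
        simp_rw [mul_comm (W₁ _ _)]
    _ ≤ C ^ (1 / 2 : ℝ) * (mixedNorm p q ν W₂ * mixedNorm p' q' ν W₁) := by
        gcongr
        exact lintegral_mul_le_mixedNorm hp hq hW₂m hW₁m
    _ ≤ C ^ (1 / 2 : ℝ) * (2 ^ (1 / r) * mixedNorm p q ν f * (2 ^ (1 / r) *
          mixedNorm p' q' ν h)) := by gcongr
    _ = _ := by ring

/-- The square function is bounded in mixed-norm spaces. -/
theorem exists_mixedNorm_sqFn_le {p q : ℝ} (hp : 1 < p) (hq : 1 < q) :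
    ∃ C : ℝ≥0∞, C ≠ ∞ ∧ ∀ (ν : Measure τ) [IsFiniteMeasure ν] (φ : ℝ → τ → ℂ) (M : ℝ),
      Measurable (Function.uncurry φ) → (∀ x t, ‖φ x t‖ ≤ M) →
      mixedNorm p q ν (fun x t => sqFn (fun z => φ z t) x ^ (1 / 2 : ℝ)) ≤
        C * mixedNorm p q ν (fun x t => ‖φ x t‖ₑ) := by
  have hpc : p.HolderConjugate p.conjExponent := Real.HolderConjugate.conjExponent hp
  have hqc : q.HolderConjugate q.conjExponent := Real.HolderConjugate.conjExponent hq
  obtain ⟨C, hC, h⟩ := exists_lintegral_sqrt_sqFn_mul_le (τ := τ) hpc hqc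
  refine ⟨C + 1, by simp [hC], fun ν _ φ M hφ hM => ?_⟩
  set f : ℝ → τ → ℝ≥0∞ := fun x t => ‖φ x t‖ₑ with hf
  have hfm : Measurable (Function.uncurry f) := hφ.enorm
  by_cases hfin : mixedNorm p q ν f = ∞
  · rw [hfin, ENNReal.mul_top (by simp)]; exact le_top
  refine le_trans ?_ (mul_le_mul_left (le_add_right (le_refl C)) _)
  refine mixedNorm_le_of_forall hpc hqc ((measurable_sqFn hφ).pow_const _) fun n H hH hHn hH0 => ?_
  have hb : ∀ ε : ℝ≥0, Measurable (Function.uncurry fun (x : ℝ) (_ : τ) => (ε : ℝ≥0∞) * bump x) :=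
    fun ε => (measurable_bump.comp measurable_fst).const_mul _
  have hb1 : Measurable (Function.uncurry fun (x : ℝ) (_ : τ) => bump x) :=
    measurable_bump.comp measurable_fst
  have hbp := mixedNorm_bump_ne_top hp.le hq.le ν
  have hbp' := mixedNorm_bump_ne_top hpc.symm.lt.le hqc.symm.lt.le ν
  have hp0 := hpc.pos
  have hq0 := hqc.pos
  have hp0' := hpc.symm.pos
  have hq0' := hqc.symm.pos
  have hHfin : mixedNorm p.conjExponent q.conjExponent ν H ≠ ∞ := by
    refine ne_top_of_le_ne_top (ENNReal.mul_ne_top (ENNReal.mul_ne_top (ENNReal.natCast_ne_top n)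
      (ENNReal.ofReal_ne_top (r := 1 + (n : ℝ) ^ 2))) hbp') ?_
    rw [← mixedNorm_const_mul hp0' hq0' _ hb1]
    refine mixedNorm_mono hp0' hq0' fun x t => ?_
    by_cases hx : |x| ≤ n
    · rw [mul_assoc, bump, ← ENNReal.ofReal_mul (by positivity)]
      refine (hHn x t).trans (le_mul_of_one_le_right' ?_)
      rw [ENNReal.one_le_ofReal, ← div_eq_mul_inv, one_le_div (by positivity)]
      have := pow_le_pow_left₀ (abs_nonneg x) hx 2
      rw [sq_abs] at this
      linarith
    · rw [hH0 x t hx]; exact zero_le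
  have main : ∀ ε : ℝ≥0, 0 < ε → ∀ δ : ℝ≥0, 0 < δ →
      ∫⁻ x, ∫⁻ t, sqFn (fun z => φ z t) x ^ (1 / 2 : ℝ) * H x t ∂ν ≤
      C * ((mixedNorm p q ν f + ε * mixedNorm p q ν (fun x _ => bump x)) *
        (mixedNorm p.conjExponent q.conjExponent ν H +
          δ * mixedNorm p.conjExponent q.conjExponent ν (fun x _ => bump x))) := by
    intro ε hε δ hδ
    have hε0 : (ε : ℝ≥0∞) ≠ 0 := by simpa using hε.ne'
    have hδ0 : (δ : ℝ≥0∞) ≠ 0 := by simpa using hδ.ne'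
    have n1 : mixedNorm p q ν (fun x t => f x t + ε * bump x) ≤
        mixedNorm p q ν f + ε * mixedNorm p q ν (fun x _ => bump x) := by
      rw [← mixedNorm_const_mul hp0 hq0 _ hb1]
      exact mixedNorm_add_le hp.le hq.le hfm (hb ε)
    have n2 : mixedNorm p.conjExponent q.conjExponent ν (fun x t => H x t + δ * bump x) ≤
        mixedNorm p.conjExponent q.conjExponent ν H +
          δ * mixedNorm p.conjExponent q.conjExponent ν (fun x _ => bump x) := by
      rw [← mixedNorm_const_mul hp0' hq0' _ hb1]
      exact mixedNorm_add_le hpc.symm.lt.le hqc.symm.lt.le hH (hb δ)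
    calc _ ≤ ∫⁻ x, ∫⁻ t, sqFn (fun z => φ z t) x ^ (1 / 2 : ℝ) * (H x t + δ * bump x) ∂ν := by
          gcongr; exact le_self_add
      _ ≤ C * (mixedNorm p q ν (fun x t => f x t + ε * bump x) *
          mixedNorm p.conjExponent q.conjExponent ν (fun x t => H x t + δ * bump x)) := by
          refine h ν φ M _ _ hφ hM (fun x t => le_self_add) (hfm.add (hb ε)) (hH.add (hb δ))
            (fun x t => ?_) (fun x t => ?_) ?_ ?_
          · simp [hε.ne', bump_ne_zero]
          · simp [hδ.ne', bump_ne_zero]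
          · exact ne_top_of_le_ne_top (ENNReal.add_ne_top.mpr
              ⟨hfin, ENNReal.mul_ne_top (by simp) hbp⟩) n1
          · exact ne_top_of_le_ne_top (ENNReal.add_ne_top.mpr
              ⟨hHfin, ENNReal.mul_ne_top (by simp) hbp'⟩) n2
      _ ≤ _ := by gcongr
  refine le_mul_of_forall_le_mul_add hbp' (ENNReal.mul_ne_top hC hfin) fun δ hδ => ?_
  have hfinδ : mixedNorm p.conjExponent q.conjExponent ν H +
      δ * mixedNorm p.conjExponent q.conjExponent ν (fun x _ => bump x) ≠ ∞ :=
    ENNReal.add_ne_top.mpr ⟨hHfin, ENNReal.mul_ne_top (by simp) hbp'⟩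
  rw [mul_assoc, mul_comm (mixedNorm p q ν f), ← mul_assoc]
  refine le_mul_of_forall_le_mul_add hbp (ENNReal.mul_ne_top hC hfinδ) fun ε hε => ?_
  refine (main ε hε δ hδ).trans (le_of_eq (by ring))

end SquareFunction

section Pairing

lemma conj_cauK (y u : ℝ) : (starRingEnd ℂ) (cauK y u) = cauK y (-u) := by
  unfold cauK
  simp only [map_inv₀, map_mul, map_pow, map_sub, Complex.conj_ofReal, Complex.conj_I, map_ofNat]
  push_cast
  ring_nf

lemma enorm_integral_cau_mul_le {y : ℝ} (hy : 0 < y) {B h : ℝ → ℂ} {β : ℝ} (hB : Measurable B)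
    (hβ : ∀ x, ‖B x‖ ≤ β) (hh : Integrable h) :
    ‖∫ x, cau y B x * h x‖ₑ ≤ ∫⁻ z, ‖B z‖ₑ * ‖cau y (fun x => (starRingEnd ℂ) (h x)) z‖ₑ := by
  have hconv : Integrable (fun p : ℝ × ℝ => h p.2 * cauK y (-(p.1 - p.2)))
      (volume.prod volume) := by
    have hc : Integrable fun u => cauK y (-u) := (integrable_cauK hy).comp_neg
    have h1 := Integrable.convolution_integrand (ContinuousLinearMap.mul ℝ ℂ) hh hc
    simpa only [ContinuousLinearMap.mul_apply'] using h1
  have h_int : Integrable (Function.uncurry fun z x => B z * (cauK y (x - z) * h x))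
      (volume.prod volume) := by
    have := hconv.bdd_mul (c := β) (f := fun p : ℝ × ℝ => B p.1)
      (hB.comp measurable_fst).aestronglyMeasurable (.of_forall fun p => hβ p.1)
    refine this.congr (.of_forall fun p => ?_)
    simp only [Function.uncurry, neg_sub]
    ring
  have e : ∫ x, cau y B x * h x = ∫ z, B z * ∫ x, cauK y (x - z) * h x := by
    simp only [cau, ← integral_mul_const, ← integral_const_mul]
    rw [integral_integral_swap h_int]
    refine integral_congr_ae (.of_forall fun x => integral_congr_ae (.of_forall fun z => ?_))
    simp only []
    ring
  rw [e]
  refine (enorm_integral_le_lintegral_enorm _).trans_eq (lintegral_congr fun z => ?_)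
  rw [enorm_mul]
  congr 1
  have : cau y (fun x => (starRingEnd ℂ) (h x)) z =
      (starRingEnd ℂ) (∫ x, cauK y (x - z) * h x) := by
    rw [← integral_conj]
    refine integral_congr_ae (.of_forall fun x => ?_)
    simp only [map_mul, conj_cauK, neg_sub]
  rw [this, ← ofReal_norm, ← ofReal_norm, RCLike.norm_conj]

end Pairing

section Superposition

variable {Ω τ : Type*} [MeasurableSpace Ω] [MeasurableSpace τ]

/-- The damped superposition `∫ e^{2πixη} η^s e^{-2πyη} c dμ` of plane waves. -/
def lapInt (μ : Measure Ω) (η : Ω → ℝ) (s : ℝ) (c : Ω → ℂ) (y x : ℝ) : ℂ :=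
  ∫ w, ep (x * η w) * ((η w ^ s * Real.exp (-(2 * π * y * η w)) : ℝ) * c w) ∂μ

lemma lapInt_zero_zero (μ : Measure Ω) (η : Ω → ℝ) (c : Ω → ℂ) (x : ℝ) :
    lapInt μ η 0 c 0 x = ∫ w, ep (x * η w) * c w ∂μ := by
  simp [lapInt]

lemma rpow_mul_exp_le {s a η : ℝ} (hs : 0 ≤ s) (hs1 : s ≤ 1) (ha : 0 < a) (hη : 0 < η) :
    η ^ s * Real.exp (-(a * η)) ≤ 1 + a⁻¹ := by
  have h1 : η ^ s ≤ 1 + η := by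
    rcases le_total η 1 with h | h
    · exact (Real.rpow_le_one hη.le h hs).trans (by linarith)
    · exact (Real.rpow_le_rpow_of_exponent_le h hs1).trans (by rw [Real.rpow_one]; linarith)
  have h2 : 1 + a * η ≤ Real.exp (a * η) := by linarith [Real.add_one_le_exp (a * η)]
  have h3 : 1 ≤ Real.exp (a * η) := Real.one_le_exp (by positivity)
  rw [Real.exp_neg, ← div_eq_mul_inv, div_le_iff₀ (Real.exp_pos _)]
  refine h1.trans ?_
  have h4 : a⁻¹ * (1 + a * η) ≤ a⁻¹ * Real.exp (a * η) := by gcongr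
  have h5 : a⁻¹ * (1 + a * η) = a⁻¹ + η := by field_simp
  have : 0 < a⁻¹ := by positivity
  nlinarith

/-- The constant `∫_0^∞ 2π y^s e^{-4πy} dy`. -/
def superC (s : ℝ) : ℝ := 2 * π * ((4 * π)⁻¹ ^ (s + 1) * Real.Gamma (s + 1))

lemma superC_pos {s : ℝ} (hs : 0 ≤ s) : 0 < superC s := by
  have := Real.Gamma_pos_of_pos (show 0 < s + 1 by linarith)
  unfold superC
  positivity

lemma superW_eq {s η : ℝ} (hη : 0 < η) (y : ℝ) :
    y ^ s * (cauS y η * (η ^ s * Real.exp (-(2 * π * y * η)))) =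
      2 * π * η ^ (s + 1) * (y ^ (s + 1 - 1) * Real.exp (-(4 * π * η * y))) := by
  rw [cauS_of_pos hη, Real.rpow_add_one hη.ne', add_sub_cancel_right,
    show -(4 * π * η * y) = -(2 * π * y * η) + -(2 * π * y * η) by ring, Real.exp_add]
  ring

lemma integrableOn_superW {s η : ℝ} (hs : 0 ≤ s) (hη : 0 < η) :
    IntegrableOn (fun y => y ^ s * (cauS y η * (η ^ s * Real.exp (-(2 * π * y * η))))) (Ioi 0) := by
  simp only [superW_eq hη]
  have := integrableOn_rpow_mul_exp_neg_mul_rpow (s := s + 1 - 1) (p := 1) (by linarith) zero_lt_one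
    (show 0 < 4 * π * η by positivity)
  simp only [Real.rpow_one, neg_mul] at this
  refine Integrable.const_mul ?_ _
  refine this.congr (.of_forall fun y => ?_)
  simp only

lemma integral_superW {s η : ℝ} (hs : 0 ≤ s) (hη : 0 < η) :
    ∫ y in Ioi 0, y ^ s * (cauS y η * (η ^ s * Real.exp (-(2 * π * y * η)))) = superC s := by
  simp only [superW_eq hη]
  rw [integral_const_mul, Real.integral_rpow_mul_exp_neg_mul_Ioi (by linarith) (by positivity),
    superC, one_div, mul_inv, Real.mul_rpow (by positivity) (by positivity),
    Real.inv_rpow hη.le (s + 1)]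
  have : η ^ (s + 1) ≠ 0 := (Real.rpow_pos_of_pos hη _).ne'
  field_simp

end Superposition

section Superposition

variable {Ω τ : Type*} [MeasurableSpace Ω] [MeasurableSpace τ]

lemma measurable_lapInt_param (μ : Measure Ω) [SFinite μ] {η : Ω → ℝ} (hη : Measurable η) (s : ℝ)
    {c : Ω → τ → ℂ} (hc : Measurable (Function.uncurry c)) :
    Measurable fun p : ℝ × ℝ × τ => lapInt μ η s (fun w => c w p.2.2) p.1 p.2.1 := by
  have : StronglyMeasurable (Function.uncurry fun (p : ℝ × ℝ × τ) (w : Ω) =>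
      ep (p.2.1 * η w) * ((η w ^ s * Real.exp (-(2 * π * p.1 * η w)) : ℝ) * c w p.2.2)) := by
    refine Measurable.stronglyMeasurable ?_
    have h0 : Measurable fun q : (ℝ × ℝ × τ) × Ω => η q.2 := hη.comp measurable_snd
    have h1 : Measurable fun q : (ℝ × ℝ × τ) × Ω => ep (q.1.2.1 * η q.2) :=
      continuous_ep.measurable.comp ((by fun_prop : Measurable fun q : (ℝ × ℝ × τ) × Ω =>
        q.1.2.1).mul h0)
    have h2 : Measurable fun q : (ℝ × ℝ × τ) × Ω => c q.2 q.1.2.2 :=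
      measurable_uncurry_comp hc (by fun_prop) (by fun_prop)
    have h3 : Measurable fun q : (ℝ × ℝ × τ) × Ω =>
        ((η q.2 ^ s * Real.exp (-(2 * π * q.1.1 * η q.2)) : ℝ) : ℂ) := by
      have h4 : Measurable fun q : (ℝ × ℝ × τ) × Ω => q.1.1 := by fun_prop
      exact Complex.measurable_ofReal.comp
        ((h0.pow_const s).mul (Real.measurable_exp.comp ((h4.const_mul (2 * π)).mul h0).neg))
    exact h1.mul (h3.mul h2)
  exact this.integral_prod_right.measurable

lemma measurable_lapInt (μ : Measure Ω) [SFinite μ] {η : Ω → ℝ} (hη : Measurable η) (s : ℝ)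
    {c : Ω → ℂ} (hc : Measurable c) :
    Measurable (Function.uncurry fun y x => lapInt μ η s c y x) := by
  have h1 : Measurable fun p : ℝ × ℝ => ((p.1, p.2, ()) : ℝ × ℝ × Unit) := by fun_prop
  have h2 : Measurable (Function.uncurry fun (z : Ω) (_ : Unit) => c z) :=
    hc.comp measurable_fst
  have h3 := (measurable_lapInt_param μ hη s h2).comp h1
  simpa only [Function.comp_def, Function.uncurry_def] using h3

section Fixed

variable {μ : Measure Ω} [SFinite μ] {η : Ω → ℝ} {c : Ω → ℂ} {s y : ℝ}

lemma measurable_damping (hη : Measurable η) (s y : ℝ) :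
    Measurable fun w => ((η w ^ s * Real.exp (-(2 * π * y * η w)) : ℝ) : ℂ) :=
  Complex.measurable_ofReal.comp
    ((hη.pow_const s).mul (Real.measurable_exp.comp (hη.const_mul (2 * π * y)).neg))

lemma norm_damping_mul_le (hpos : ∀ᵐ w ∂μ, 0 < η w) (hs : 0 ≤ s) (hs1 : s ≤ 1) (hy : 0 < y) :
    ∀ᵐ w ∂μ, ‖((η w ^ s * Real.exp (-(2 * π * y * η w)) : ℝ) : ℂ)‖ ≤ 1 + (2 * π * y)⁻¹ := by
  filter_upwards [hpos] with w hw
  rw [Complex.norm_real, Real.norm_of_nonneg (by positivity)]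
  exact rpow_mul_exp_le hs hs1 (by positivity) hw

lemma integrable_damping_mul (hη : Measurable η) (hpos : ∀ᵐ w ∂μ, 0 < η w) (hc : Integrable c μ)
    (hs : 0 ≤ s) (hs1 : s ≤ 1) (hy : 0 < y) :
    Integrable (fun w => ((η w ^ s * Real.exp (-(2 * π * y * η w)) : ℝ) : ℂ) * c w) μ :=
  hc.bdd_mul (measurable_damping hη s y).aestronglyMeasurable
    (norm_damping_mul_le hpos hs hs1 hy)

lemma norm_lapInt_le (hpos : ∀ᵐ w ∂μ, 0 < η w) (hc : Integrable c μ)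
    (hs : 0 ≤ s) (hs1 : s ≤ 1) (hy : 0 < y) (x : ℝ) :
    ‖lapInt μ η s c y x‖ ≤ (1 + (2 * π * y)⁻¹) * ∫ w, ‖c w‖ ∂μ := by
  rw [← integral_const_mul]
  refine norm_integral_le_of_norm_le (hc.norm.const_mul _) ?_
  filter_upwards [norm_damping_mul_le hpos hs hs1 hy] with w hw
  rw [norm_mul, norm_mul, norm_ep, one_mul]
  gcongr

lemma cau_lapInt (hη : Measurable η) (hpos : ∀ᵐ w ∂μ, 0 < η w) (hc : Integrable c μ)
    (hs : 0 ≤ s) (hs1 : s ≤ 1) (hy : 0 < y) (x : ℝ) :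
    cau y (lapInt μ η s c y) x = ∫ w, ep (x * η w) * ((cauS y (η w) : ℂ) *
      (((η w ^ s * Real.exp (-(2 * π * y * η w)) : ℝ) : ℂ) * c w)) ∂μ :=
  integral_kernel_mul_superposition (κ := fun η => (cauS y η : ℂ)) (measurable_cauK_left y)
    (integrable_cauK hy) (integral_cauK_mul_ep hy) hη
    (integrable_damping_mul hη hpos hc hs hs1 hy) x

/-- The reproducing density used to recover a superposition from its damped versions. -/
def superW (s : ℝ) (η : Ω → ℝ) (c : Ω → ℂ) (w : Ω) (y : ℝ) : ℂ :=
  ((y ^ s * (cauS y (η w) * (η w ^ s * Real.exp (-(2 * π * y * η w)))) : ℝ) : ℂ) * c w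

lemma integrable_superW (hη : Measurable η) (hpos : ∀ᵐ w ∂μ, 0 < η w) (hc : Integrable c μ)
    (hs : 0 ≤ s) :
    Integrable (Function.uncurry (superW s η c)) (μ.prod (volume.restrict (Ioi 0))) := by
  have hm : AEStronglyMeasurable (Function.uncurry (superW s η c))
      (μ.prod (volume.restrict (Ioi 0))) := by
    have h0 : Measurable fun p : Ω × ℝ => η p.1 := hη.comp measurable_fst
    have h1 : Measurable fun p : Ω × ℝ => cauS p.2 (η p.1) :=
      measurable_uncurry_comp measurable_cauS measurable_snd h0
    have h2 : Measurable fun p : Ω × ℝ => η p.1 ^ s * Real.exp (-(2 * π * p.2 * η p.1)) :=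
      (h0.pow_const s).mul
        (Real.measurable_exp.comp ((measurable_snd.const_mul (2 * π)).mul h0).neg)
    have h3 := Complex.measurable_ofReal.comp ((measurable_snd.pow_const s).mul (h1.mul h2))
    exact (h3.aestronglyMeasurable).mul hc.aestronglyMeasurable.comp_fst
  refine (integrable_prod_iff hm).2 ⟨?_, ?_⟩
  · filter_upwards [hpos] with w hw
    exact ((integrableOn_superW hs hw).ofReal).mul_const (c w)
  · refine (hc.norm.const_mul (superC s)).congr ?_
    filter_upwards [hpos] with w hw
    rw [← integral_superW hs hw, ← integral_mul_const]
    refine setIntegral_congr_fun measurableSet_Ioi fun y hy => ?_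
    have hy : 0 < y := hy
    have := cauS_nonneg y (η w)
    simp only [Function.uncurry, superW]
    rw [norm_mul, Complex.norm_real, Real.norm_of_nonneg (by positivity)]

lemma integral_superW_mul (hpos : ∀ᵐ w ∂μ, 0 < η w) (hs : 0 ≤ s) :
    ∀ᵐ w ∂μ, ∫ y in Ioi 0, superW s η c w y = superC s * c w := by
  filter_upwards [hpos] with w hw
  simp only [superW]
  rw [integral_mul_const, integral_complex_ofReal, integral_superW hs hw]

/-- A superposition paired with `h` is recovered from the Cauchy kernel applied to its damped
versions. -/
lemma enorm_integral_superposition_mul_le (hη : Measurable η) (hpos : ∀ᵐ w ∂μ, 0 < η w)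
    (hcm : Measurable c) (hc : Integrable c μ)
    (hs : 0 ≤ s) (hs1 : s ≤ 1) {h : ℝ → ℂ} (hh : Integrable h) :
    ENNReal.ofReal (superC s) * ‖∫ x, lapInt μ η 0 c 0 x * h x‖ₑ ≤
      ∫⁻ y in Ioi (0 : ℝ), ENNReal.ofReal (y ^ s) *
        ∫⁻ z, ‖lapInt μ η s c y z‖ₑ * ‖cau y (fun x => (starRingEnd ℂ) (h x)) z‖ₑ := by
  have hE := integrable_superW hη hpos hc hs
  have hEx : ∀ x, Integrable (Function.uncurry fun w y => ep (x * η w) * superW s η c w y)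
      (μ.prod (volume.restrict (Ioi 0))) := fun x => by
    refine hE.bdd_mul (c := 1) (f := fun p : Ω × ℝ => ep (x * η p.1)) ?_ ?_
    · exact (continuous_ep.measurable.comp
        ((hη.comp measurable_fst).const_mul x)).aestronglyMeasurable
    · exact .of_forall fun p => (norm_ep _).le
  have h1 : ∀ x, (superC s : ℂ) * lapInt μ η 0 c 0 x =
      ∫ y in Ioi (0 : ℝ), ∫ w, ep (x * η w) * superW s η c w y ∂μ := fun x => by
    rw [← integral_integral_swap (hEx x), lapInt_zero_zero, ← integral_const_mul]
    refine integral_congr_ae ?_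
    filter_upwards [integral_superW_mul (c := c) hpos hs] with w hw
    rw [integral_const_mul, hw]
    ring
  have h2 : ∀ y ∈ Ioi (0 : ℝ), ∀ x, ∫ w, ep (x * η w) * superW s η c w y ∂μ =
      ((y ^ s : ℝ) : ℂ) * cau y (lapInt μ η s c y) x := fun y hy x => by
    rw [cau_lapInt hη hpos hc hs hs1 hy, ← integral_const_mul]
    refine integral_congr_ae (.of_forall fun w => ?_)
    simp only [superW]
    push_cast
    ring
  have hF : Integrable (Function.uncurry fun x y =>
      (∫ w, ep (x * η w) * superW s η c w y ∂μ) * h x)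
      (volume.prod (volume.restrict (Ioi 0))) := by
    have hN : Integrable (fun y => ∫ w, ‖superW s η c w y‖ ∂μ) (volume.restrict (Ioi 0)) :=
      hE.integral_norm_prod_right
    have hdom := hh.norm.mul_prod hN
    refine hdom.mono' ?_ ?_
    · have hmE : AEStronglyMeasurable (Function.uncurry fun (p : ℝ × ℝ) (w : Ω) =>
          ep (p.1 * η w) * superW s η c w p.2)
          ((volume.prod (volume.restrict (Ioi 0))).prod μ) := by
        refine Measurable.aestronglyMeasurable ?_
        have h0 : Measurable fun q : (ℝ × ℝ) × Ω => η q.2 := hη.comp measurable_snd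
        have hy : Measurable fun q : (ℝ × ℝ) × Ω => q.1.2 := by fun_prop
        have g1 : Measurable fun q : (ℝ × ℝ) × Ω => ep (q.1.1 * η q.2) :=
          continuous_ep.measurable.comp ((by fun_prop : Measurable fun q : (ℝ × ℝ) × Ω =>
            q.1.1).mul h0)
        have g2 : Measurable fun q : (ℝ × ℝ) × Ω => cauS q.1.2 (η q.2) :=
          measurable_uncurry_comp measurable_cauS hy h0
        have g3 : Measurable fun q : (ℝ × ℝ) × Ω =>
            η q.2 ^ s * Real.exp (-(2 * π * q.1.2 * η q.2)) :=
          (h0.pow_const s).mul (Real.measurable_exp.comp ((hy.const_mul (2 * π)).mul h0).neg)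
        exact g1.mul ((Complex.measurable_ofReal.comp ((hy.pow_const s).mul (g2.mul g3))).mul
          (hcm.comp measurable_snd))
      exact hmE.integral_prod_right'.mul hh.aestronglyMeasurable.comp_fst
    · refine .of_forall fun p => ?_
      simp only [Function.uncurry]
      rw [norm_mul, mul_comm]
      gcongr
      refine (norm_integral_le_integral_norm _).trans_eq ?_
      simp only [norm_mul, norm_ep, one_mul]
  have h3 : (superC s : ℂ) * ∫ x, lapInt μ η 0 c 0 x * h x =
      ∫ y in Ioi (0 : ℝ), ((y ^ s : ℝ) : ℂ) * ∫ x, cau y (lapInt μ η s c y) x * h x := by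
    rw [← integral_const_mul]
    have e : ∀ x, (superC s : ℂ) * (lapInt μ η 0 c 0 x * h x) = ∫ y in Ioi (0 : ℝ),
        (∫ w, ep (x * η w) * superW s η c w y ∂μ) * h x := fun x => by
      rw [← mul_assoc, h1, integral_mul_const]
    simp only [e]
    rw [integral_integral_swap hF]
    refine setIntegral_congr_fun measurableSet_Ioi fun y hy => ?_
    simp only [h2 y hy, mul_assoc]
    exact integral_const_mul _ _
  have h4 : ENNReal.ofReal (superC s) * ‖∫ x, lapInt μ η 0 c 0 x * h x‖ₑ =
      ‖(superC s : ℂ) * ∫ x, lapInt μ η 0 c 0 x * h x‖ₑ := by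
    rw [enorm_mul, ← ofReal_norm (superC s : ℂ), Complex.norm_real,
      Real.norm_of_nonneg (superC_pos hs).le]
  rw [h4, h3]
  refine (enorm_integral_le_lintegral_enorm _).trans
    (setLIntegral_mono_ae' measurableSet_Ioi (.of_forall fun y hy => ?_))
  have hy : 0 < y := hy
  rw [enorm_mul, ← ofReal_norm ((y ^ s : ℝ) : ℂ), Complex.norm_real,
    Real.norm_of_nonneg (by positivity)]
  refine mul_le_mul_right (enorm_integral_cau_mul_le hy ?_
    (norm_lapInt_le hpos hc hs hs1 hy) hh) _
  exact (measurable_lapInt μ hη s hcm).of_uncurry_left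

end Fixed

end Superposition

section Superposition

variable {Ω τ : Type*} [MeasurableSpace Ω] [MeasurableSpace τ]

/-- The square of the vertical square function of the damped superpositions. -/
def sqLap (μ : Measure Ω) (η : Ω → ℝ) (s : ℝ) (c : Ω → ℂ) (x : ℝ) : ℝ≥0∞ :=
  ∫⁻ y in Ioi (0 : ℝ), ENNReal.ofReal (y ^ (2 * s - 1)) * ‖lapInt μ η s c y x‖ₑ ^ (2 : ℝ)

variable (μ : Measure Ω) [SFinite μ] {η : Ω → ℝ} {c : Ω → τ → ℂ}

lemma measurable_lapInt_slice (hη : Measurable η) (s y : ℝ)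
    (hc : Measurable (Function.uncurry c)) :
    Measurable (Function.uncurry fun x t => lapInt μ η s (fun w => c w t) y x) := by
  have h1 : Measurable fun p : ℝ × τ => (y, p.1, p.2) := by fun_prop
  have h2 := (measurable_lapInt_param μ hη s hc).comp h1
  simpa only [Function.comp_def, Function.uncurry_def] using h2

lemma measurable_sqLap_integrand (hη : Measurable η) (s : ℝ)
    (hc : Measurable (Function.uncurry c)) :
    Measurable (Function.uncurry fun (p : ℝ × τ) (y : ℝ) => ENNReal.ofReal (y ^ (2 * s - 1)) *
      ‖lapInt μ η s (fun w => c w p.2) y p.1‖ₑ ^ (2 : ℝ)) := by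
  have h1 : Measurable fun p : (ℝ × τ) × ℝ => lapInt μ η s (fun w => c w p.1.2) p.2 p.1.1 :=
    measurable_uncurry_comp
      (F := fun (y : ℝ) (q : ℝ × τ) => lapInt μ η s (fun w => c w q.2) y q.1)
      (measurable_lapInt_param μ hη s hc) measurable_snd measurable_fst
  exact (ENNReal.measurable_ofReal.comp (measurable_snd.pow_const _)).mul (h1.enorm.pow_const _)

lemma measurable_sqLap (hη : Measurable η) (s : ℝ) (hc : Measurable (Function.uncurry c)) :
    Measurable (Function.uncurry fun x t => sqLap μ η s (fun w => c w t) x) :=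
  (measurable_sqLap_integrand μ hη s hc).lintegral_prod_right

lemma lintegral_mul_cau_le_sqLap_mul_sqFn (hη : Measurable η) (s : ℝ) {c : Ω → ℂ}
    (hc : Measurable c) {φ : ℝ → ℂ} (hφ : Measurable φ) :
    ∫⁻ y in Ioi (0 : ℝ), ENNReal.ofReal (y ^ s) * ∫⁻ z, ‖lapInt μ η s c y z‖ₑ * ‖cau y φ z‖ₑ ≤
      ∫⁻ z, sqLap μ η s c z ^ (1 / 2 : ℝ) * sqFn φ z ^ (1 / 2 : ℝ) := by
  have hB := measurable_lapInt μ hη s hc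
  have hC := measurable_cau hφ
  have hb : ∀ z, Measurable fun y => lapInt μ η s c y z := fun z => hB.of_uncurry_right
  have hcz : ∀ z, Measurable fun y => cau y φ z := fun z => hC.of_uncurry_right
  have e : ∀ y, ENNReal.ofReal (y ^ s) * ∫⁻ z, ‖lapInt μ η s c y z‖ₑ * ‖cau y φ z‖ₑ =
      ∫⁻ z, ENNReal.ofReal (y ^ s) * (‖lapInt μ η s c y z‖ₑ * ‖cau y φ z‖ₑ) := fun y =>
    (lintegral_const_mul' _ _ ENNReal.ofReal_ne_top).symm
  simp only [e]
  rw [lintegral_lintegral_swap]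
  · refine lintegral_mono fun z => ?_
    refine le_trans (setLIntegral_mono_ae' measurableSet_Ioi (.of_forall fun y hy => ?_))
      (ENNReal.lintegral_mul_norm_pow_le (p := 1 / 2) (q := 1 / 2)
      (f := fun y => ENNReal.ofReal (y ^ (2 * s - 1)) * ‖lapInt μ η s c y z‖ₑ ^ (2 : ℝ))
      (g := fun y => ENNReal.ofReal y * ‖cau y φ z‖ₑ ^ (2 : ℝ)) ?_ ?_
      (by norm_num) (by norm_num) (by norm_num))
    · have hy : 0 < y := hy
      rw [ENNReal.mul_rpow_of_nonneg _ _ (by norm_num),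
          ENNReal.mul_rpow_of_nonneg _ _ (by norm_num),
        ← ENNReal.rpow_mul, ← ENNReal.rpow_mul, ENNReal.ofReal_rpow_of_nonneg (by positivity)
        (by norm_num), ENNReal.ofReal_rpow_of_nonneg hy.le (by norm_num), ← Real.rpow_mul hy.le,
        show (2 : ℝ) * (1 / 2) = 1 by norm_num, ENNReal.rpow_one, ENNReal.rpow_one,
          mul_mul_mul_comm,
        ← ENNReal.ofReal_mul (by positivity), ← Real.rpow_add hy,
        show (2 * s - 1) * (1 / 2) + 1 / 2 = s by ring]
    · exact ((ENNReal.measurable_ofReal.comp (measurable_id.pow_const _)).mul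
        ((hb z).enorm.pow_const _)).aemeasurable
    · exact (ENNReal.measurable_ofReal.mul ((hcz z).enorm.pow_const _)).aemeasurable
  · exact ((ENNReal.measurable_ofReal.comp (measurable_fst.pow_const s)).mul
      (hB.enorm.mul hC.enorm)).aemeasurable

lemma lintegral_enorm_mul_eq {D : ℝ → ℂ} {H : ℝ → ℝ≥0∞} (hD : Measurable D) (hH : Measurable H)
    {M : ℝ} (hM : ∀ x, ‖D x‖ ≤ M) (n : ℕ) (hn : ∀ x, H x ≤ n) (hs : ∀ x : ℝ, ¬ |x| ≤ n → H x = 0) :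
    ∃ h : ℝ → ℂ, Integrable h ∧ (∀ x, (starRingEnd ℂ) (h x) = (H x).toReal * (D x / ‖D x‖)) ∧
      ∫⁻ x, ‖D x‖ₑ * H x = ‖∫ x, D x * h x‖ₑ := by
  have hHt : ∀ x, H x ≠ ∞ := fun x => ((hn x).trans_lt (ENNReal.natCast_lt_top n)).ne
  have hHn : ∀ x, (H x).toReal ≤ n := fun x => by
    simpa using ENNReal.toReal_mono (ENNReal.natCast_ne_top n) (hn x)
  have hHi : Integrable fun x => (H x).toReal := by
    have hi : Integrable ((Icc (-(n : ℝ)) n).indicator fun _ => (n : ℝ)) :=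
      (integrable_indicator_iff measurableSet_Icc).2 (integrableOn_const (by simp) (by simp))
    refine hi.mono' hH.ennreal_toReal.aestronglyMeasurable (.of_forall fun x => ?_)
    rw [Real.norm_of_nonneg ENNReal.toReal_nonneg]
    by_cases hx : |x| ≤ n
    · rw [indicator_of_mem (show x ∈ Icc (-(n : ℝ)) n from abs_le.1 hx)]
      exact hHn x
    · have hx' : x ∉ Icc (-(n : ℝ)) n := fun h => hx (abs_le.2 h)
      rw [hs x hx, indicator_of_notMem hx', ENNReal.toReal_zero]
  have hsgn : Measurable fun x => (starRingEnd ℂ) (D x / ‖D x‖) :=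
    Complex.continuous_conj.measurable.comp
      (hD.div (Complex.measurable_ofReal.comp hD.norm))
  have hsgn1 : ∀ x, ‖(starRingEnd ℂ) (D x / ‖D x‖)‖ ≤ 1 := fun x => by
    rw [RCLike.norm_conj, norm_div, Complex.norm_real, norm_norm]
    exact div_self_le_one _
  have h_int : Integrable fun x => ((H x).toReal : ℂ) * (starRingEnd ℂ) (D x / ‖D x‖) :=
    (hHi.ofReal.bdd_mul hsgn.aestronglyMeasurable (.of_forall hsgn1)).congr
      (.of_forall fun x => mul_comm _ _)
  refine ⟨_, h_int, fun x => ?_, ?_⟩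
  · rw [map_mul, Complex.conj_ofReal, Complex.conj_conj]
  · have e : ∀ x, D x * (((H x).toReal : ℂ) * (starRingEnd ℂ) (D x / ‖D x‖)) =
        ((‖D x‖ * (H x).toReal : ℝ) : ℂ) := fun x => by
      by_cases h0 : D x = 0
      · simp [h0]
      · have hn0 : (‖D x‖ : ℂ) ≠ 0 := by simpa using h0
        rw [map_div₀, Complex.conj_ofReal, mul_left_comm, mul_div_assoc', Complex.mul_conj,
          Complex.normSq_eq_norm_sq]
        push_cast
        field_simp
    have hi : Integrable fun x => ‖D x‖ * (H x).toReal :=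
      hHi.bdd_mul hD.norm.aestronglyMeasurable (.of_forall fun x => by simpa using hM x)
    simp only [e]
    rw [integral_complex_ofReal, ← ofReal_norm, Complex.norm_real, Real.norm_of_nonneg
      (integral_nonneg fun x => by positivity), ofReal_integral_eq_lintegral_ofReal hi
      (.of_forall fun x => by positivity)]
    refine lintegral_congr fun x => ?_
    rw [ENNReal.ofReal_mul (norm_nonneg _), ofReal_norm, ENNReal.ofReal_toReal (hHt x)]

/-- A superposition of plane waves of positive frequency is controlled, in mixed norm, by the
vertical square function of its damped versions. -/
theorem exists_mixedNorm_superposition_le {p q s : ℝ} (hp : 1 < p) (hq : 1 < q) (hs : 0 ≤ s)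
    (hs1 : s ≤ 1) (hη : Measurable η) (hpos : ∀ᵐ w ∂μ, 0 < η w) :
    ∃ C : ℝ≥0∞, C ≠ ∞ ∧ ∀ (ν : Measure τ) [IsFiniteMeasure ν] (c : Ω → τ → ℂ),
      Measurable (Function.uncurry c) → (∀ t, Integrable (fun w => c w t) μ) →
      mixedNorm p q ν (fun x t => ‖∫ w, ep (x * η w) * c w t ∂μ‖ₑ) ≤
        C * mixedNorm p q ν (fun x t => sqLap μ η s (fun w => c w t) x ^ (1 / 2 : ℝ)) := by
  have hpp := Real.HolderConjugate.conjExponent hp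
  have hqq := Real.HolderConjugate.conjExponent hq
  set p' := p.conjExponent
  set q' := q.conjExponent
  obtain ⟨C, hC, hsq⟩ := exists_mixedNorm_sqFn_le (τ := τ) hpp.symm.lt hqq.symm.lt
  have hA : ENNReal.ofReal (superC s) ≠ 0 := by simpa using superC_pos hs
  refine ⟨(ENNReal.ofReal (superC s))⁻¹ * C,
    ENNReal.mul_ne_top (ENNReal.inv_ne_top.2 hA) hC, fun ν _ c hcm hci => ?_⟩
  have hDm := measurable_lapInt_slice μ hη 0 0 hcm
  simp only [← lapInt_zero_zero]
  refine mixedNorm_le_of_forall hpp hqq hDm.enorm fun n H hH hHn hHs => ?_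
  set φ : ℝ → τ → ℂ := fun x t => (H x t).toReal *
    (lapInt μ η 0 (fun w => c w t) 0 x / ‖lapInt μ η 0 (fun w => c w t) 0 x‖) with hφ
  have hφm : Measurable (Function.uncurry φ) :=
    (Complex.measurable_ofReal.comp hH.ennreal_toReal).mul
      (hDm.div (Complex.measurable_ofReal.comp hDm.norm))
  have hφH : ∀ x t, ‖φ x t‖ ≤ (H x t).toReal := fun x t => by
    rw [hφ]
    simp only []
    rw [norm_mul, norm_div, Complex.norm_real, Complex.norm_real, norm_norm,
      Real.norm_of_nonneg ENNReal.toReal_nonneg]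
    exact mul_le_of_le_one_right ENNReal.toReal_nonneg (div_self_le_one _)
  have hφe : ∀ x t, ‖φ x t‖ₑ ≤ H x t := fun x t => by
    rw [← ofReal_norm]
    exact (ENNReal.ofReal_le_ofReal (hφH x t)).trans ENNReal.ofReal_toReal_le
  have hφn : ∀ x t, ‖φ x t‖ ≤ n := fun x t => (hφH x t).trans <| by
    simpa using ENNReal.toReal_mono (ENNReal.natCast_ne_top n) (hHn x t)
  have hDb : ∀ t x, ‖lapInt μ η 0 (fun w => c w t) 0 x‖ ≤ ∫ w, ‖c w t‖ ∂μ := fun t x => by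
    rw [lapInt_zero_zero]
    refine (norm_integral_le_integral_norm _).trans_eq ?_
    simp only [norm_mul, norm_ep, one_mul]
  have key : ∀ t, ∫⁻ x, ‖lapInt μ η 0 (fun w => c w t) 0 x‖ₑ * H x t ≤
      (ENNReal.ofReal (superC s))⁻¹ *
        ∫⁻ x, sqLap μ η s (fun w => c w t) x ^ (1 / 2 : ℝ) * sqFn (φ · t) x ^ (1 / 2 : ℝ) := by
    intro t
    obtain ⟨h, hh, hconj, he⟩ := lintegral_enorm_mul_eq
      (D := fun x => lapInt μ η 0 (fun w => c w t) 0 x) (H := fun x => H x t)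
      hDm.of_uncurry_right hH.of_uncurry_right (hDb t) n (hHn · t) (hHs · t)
    have h1 := enorm_integral_superposition_mul_le hη hpos hcm.of_uncurry_right (hci t) hs hs1 hh
    simp only [hconj] at h1
    have h2 := h1.trans (lintegral_mul_cau_le_sqLap_mul_sqFn μ hη s hcm.of_uncurry_right
      (φ := (φ · t)) hφm.of_uncurry_right)
    rw [he, ← ENNReal.div_eq_inv_mul, ENNReal.le_div_iff_mul_le (.inl hA)
      (.inl ENNReal.ofReal_ne_top), mul_comm]
    exact h2
  have hS := (measurable_sqLap μ hη s hcm).pow_const (1 / 2 : ℝ)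
  have hQ := (measurable_sqFn hφm).pow_const (1 / 2 : ℝ)
  have hSQ : Measurable (Function.uncurry fun x t =>
      sqLap μ η s (fun w => c w t) x ^ (1 / 2 : ℝ) * sqFn (φ · t) x ^ (1 / 2 : ℝ)) := hS.mul hQ
  calc ∫⁻ x, ∫⁻ t, ‖lapInt μ η 0 (fun w => c w t) 0 x‖ₑ * H x t ∂ν
      = ∫⁻ t, (∫⁻ x, ‖lapInt μ η 0 (fun w => c w t) 0 x‖ₑ * H x t) ∂ν :=
        lintegral_lintegral_swap (hDm.enorm.mul hH).aemeasurable
    _ ≤ ∫⁻ t, ((ENNReal.ofReal (superC s))⁻¹ * ∫⁻ x,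
          sqLap μ η s (fun w => c w t) x ^ (1 / 2 : ℝ) * sqFn (φ · t) x ^ (1 / 2 : ℝ)) ∂ν :=
        lintegral_mono key
    _ = (ENNReal.ofReal (superC s))⁻¹ * ∫⁻ x, ∫⁻ t,
          sqLap μ η s (fun w => c w t) x ^ (1 / 2 : ℝ) * sqFn (φ · t) x ^ (1 / 2 : ℝ) ∂ν := by
        rw [lintegral_const_mul' _ _ (ENNReal.inv_ne_top.2 hA),
          lintegral_lintegral_swap hSQ.aemeasurable]
    _ ≤ (ENNReal.ofReal (superC s))⁻¹ * (mixedNorm p q ν (fun x t =>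
          sqLap μ η s (fun w => c w t) x ^ (1 / 2 : ℝ)) *
          mixedNorm p' q' ν (fun x t => sqFn (φ · t) x ^ (1 / 2 : ℝ))) :=
        mul_le_mul_right (lintegral_mul_le_mixedNorm hpp hqq hS hQ) _
    _ ≤ (ENNReal.ofReal (superC s))⁻¹ * (mixedNorm p q ν (fun x t =>
          sqLap μ η s (fun w => c w t) x ^ (1 / 2 : ℝ)) * (C * mixedNorm p' q' ν H)) := by
        gcongr
        exact (hsq ν φ n hφm hφn).trans (mul_le_mul_right
          (mixedNorm_mono hpp.symm.pos hqq.symm.pos hφe) _)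
    _ = _ := by ring

end Superposition

section Laplace

/-- The damped inverse Fourier integral of `ξ^a k` over the positive frequencies. -/
abbrev lap (a : ℝ) (k : ℝ → ℂ) (y x : ℝ) : ℂ :=
  lapInt (volume.restrict (Ioi (0 : ℝ))) (fun ξ => ξ) a k y x

/-- The superposition of plane waves with density `k`. -/
def wave (k : ℝ → ℂ) (x : ℝ) : ℂ := ∫ ξ, ep (x * ξ) * k ξ

/-- The superposition of plane waves of positive frequency with density `k`. -/
def wavePos (k : ℝ → ℂ) (x : ℝ) : ℂ := ∫ ξ in Ioi (0 : ℝ), ep (x * ξ) * k ξ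

lemma ae_pos_Ioi : ∀ᵐ ξ ∂(volume.restrict (Ioi (0 : ℝ))), 0 < ξ :=
  ae_restrict_mem measurableSet_Ioi

variable {k : ℝ → ℂ} {a b y : ℝ}

lemma norm_wave_le (k : ℝ → ℂ) (x : ℝ) : ‖wave k x‖ ≤ ∫ ξ, ‖k ξ‖ := by
  refine (norm_integral_le_integral_norm _).trans_eq ?_
  simp only [norm_mul, norm_ep, one_mul]

lemma measurable_wave_param {τ : Type*} [MeasurableSpace τ] {k : ℝ → τ → ℂ}
    (hk : Measurable (Function.uncurry k)) :
    Measurable (Function.uncurry fun x t => wave (fun ξ => k ξ t) x) := by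
  have := measurable_lapInt_slice volume (η := fun ξ : ℝ => ξ) measurable_id 0 0 hk
  simpa only [lapInt_zero_zero, wave] using this

lemma measurable_wavePos_param {τ : Type*} [MeasurableSpace τ] {k : ℝ → τ → ℂ}
    (hk : Measurable (Function.uncurry k)) :
    Measurable (Function.uncurry fun x t => wavePos (fun ξ => k ξ t) x) := by
  have := measurable_lapInt_slice (volume.restrict (Ioi (0 : ℝ))) (η := fun ξ : ℝ => ξ)
    measurable_id 0 0 hk
  simpa only [lapInt_zero_zero, wavePos] using this

lemma measurable_wavePos (hk : Measurable k) : Measurable (wavePos k) := by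
  have := (measurable_lapInt (volume.restrict (Ioi (0 : ℝ))) (η := fun ξ : ℝ => ξ)
    measurable_id 0 hk).of_uncurry_left (x := 0)
  simp only [lapInt_zero_zero] at this
  exact this

lemma cau_wavePos (hk : Integrable k) (hy : 0 < y) (x : ℝ) :
    cau y (wavePos k) x = 2 * π * lap 1 k y x := by
  have h := integral_kernel_mul_superposition (μ := volume.restrict (Ioi (0 : ℝ)))
    (κ := fun η => (cauS y η : ℂ)) (measurable_cauK_left y)
    (integrable_cauK hy) (integral_cauK_mul_ep hy) measurable_id (hk.restrict (s := Ioi 0)) x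
  refine h.trans ?_
  rw [lap, lapInt, ← integral_const_mul]
  refine setIntegral_congr_fun measurableSet_Ioi fun ξ hξ => ?_
  simp only [id, Real.rpow_one]
  rw [cauS_of_pos hξ]
  push_cast
  ring

lemma cau_wave (hk : Integrable k) (hy : 0 < y) (x : ℝ) :
    cau y (wave k) x = 2 * π * lap 1 k y x := by
  have h := integral_kernel_mul_superposition (μ := volume)
    (κ := fun η => (cauS y η : ℂ)) (measurable_cauK_left y)
    (integrable_cauK hy) (integral_cauK_mul_ep hy) measurable_id hk x
  refine h.trans ?_
  rw [lap, lapInt, ← integral_const_mul, ← integral_indicator measurableSet_Ioi]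
  refine integral_congr_ae (.of_forall fun ξ => ?_)
  simp only [id, Real.rpow_one]
  by_cases hξ : ξ ∈ Ioi (0 : ℝ)
  · rw [indicator_of_mem hξ, cauS_of_pos hξ]
    push_cast
    ring
  · rw [indicator_of_notMem hξ, cauS_of_nonpos (not_lt.1 hξ)]
    simp

lemma pois_wavePos (hk : Integrable k) (hy : 0 < y) (x : ℝ) :
    pois y (wavePos k) x = lap 0 k y x := by
  have h := integral_kernel_mul_superposition (μ := volume.restrict (Ioi (0 : ℝ)))
    (K := fun u => (poisK y u : ℂ)) (κ := fun η => (poisS y η : ℂ))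
    (Complex.measurable_ofReal.comp (measurable_poisK_left y))
    (integrable_poisK hy).ofReal (integral_poisK_mul_ep hy) measurable_id
    (hk.restrict (s := Ioi 0)) x
  refine h.trans (setIntegral_congr_fun measurableSet_Ioi fun ξ hξ => ?_)
  have hξ : 0 < ξ := hξ
  simp only [id, Real.rpow_zero, one_mul, poisS, abs_of_pos hξ]

lemma sqLap_one (hk : Integrable k) (x : ℝ) :
    sqLap (volume.restrict (Ioi (0 : ℝ))) (fun ξ => ξ) 1 k x ≤ sqFn (wave k) x := by
  refine setLIntegral_mono_ae' measurableSet_Ioi (.of_forall fun y hy => ?_)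
  rw [cau_wave hk hy, show (2 : ℝ) * 1 - 1 = 1 by norm_num, Real.rpow_one]
  gcongr
  rw [← ofReal_norm, ← ofReal_norm]
  refine ENNReal.ofReal_le_ofReal ?_
  rw [norm_mul]
  refine le_mul_of_one_le_left (norm_nonneg _) ?_
  rw [norm_mul, Complex.norm_real, Real.norm_of_nonneg pi_pos.le, Complex.norm_ofNat]
  linarith [Real.pi_gt_three]

lemma lintegral_rpow_div_one_add_lt_top (ha : 0 < a) (ha1 : a < 1) :
    ∫⁻ w in Ioi (0 : ℝ), ENNReal.ofReal (w ^ (-a) * (1 + w)⁻¹) < ∞ := by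
  have h1 : IntegrableOn (fun w : ℝ => w ^ (-a)) (Ioc 0 1) :=
    (intervalIntegrable_iff_integrableOn_Ioc_of_le zero_le_one).1
      (intervalIntegral.intervalIntegrable_rpow' (by linarith))
  have h2 : IntegrableOn (fun w : ℝ => w ^ (-a - 1)) (Ioi 1) :=
    integrableOn_Ioi_rpow_of_lt (by linarith) one_pos
  rw [← Ioc_union_Ioi_eq_Ioi zero_le_one]
  refine (lintegral_union_le _ _ _).trans_lt (ENNReal.add_lt_top.2 ⟨?_, ?_⟩)
  · refine lt_of_le_of_lt (setLIntegral_mono_ae' measurableSet_Ioc (.of_forall fun w hw => ?_))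
      h1.lintegral_lt_top
    refine ENNReal.ofReal_le_ofReal (mul_le_of_le_one_right (Real.rpow_nonneg hw.1.le _) ?_)
    exact inv_le_one_of_one_le₀ (by linarith [hw.1])
  · refine lt_of_le_of_lt (setLIntegral_mono_ae' measurableSet_Ioi (.of_forall fun w hw => ?_))
      h2.lintegral_lt_top
    have hw : 1 < w := hw
    refine ENNReal.ofReal_le_ofReal ?_
    rw [Real.rpow_sub_one (by positivity), div_eq_mul_inv]
    gcongr
    linarith

/-- The constant in the subordination formula. -/
def subC (a : ℝ) : ℝ := (2 * π) ^ (1 - a) / Real.Gamma (1 - a)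

lemma subC_pos (ha1 : a < 1) : 0 < subC a := by
  have := Real.Gamma_pos_of_pos (show 0 < 1 - a by linarith)
  unfold subC
  positivity

lemma subordination_integrand {ξ : ℝ} (w : ℝ) :
    w ^ (-a) * (ξ ^ (1 : ℝ) * Real.exp (-(2 * π * (y * (1 + w)) * ξ))) =
      ξ * Real.exp (-(2 * π * y * ξ)) * (w ^ (1 - a - 1) * Real.exp (-(2 * π * y * ξ * w))) := by
  rw [show -(2 * π * (y * (1 + w)) * ξ) = -(2 * π * y * ξ) + -(2 * π * y * ξ * w) by ring,
    Real.exp_add, Real.rpow_one, show 1 - a - 1 = -a by ring]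
  ring

lemma integrableOn_subordination {ξ : ℝ} (ha1 : a < 1) (hy : 0 < y) (hξ : 0 < ξ) :
    IntegrableOn (fun w => w ^ (-a) * (ξ ^ (1 : ℝ) * Real.exp (-(2 * π * (y * (1 + w)) * ξ))))
      (Ioi 0) := by
  simp only [subordination_integrand]
  have := integrableOn_rpow_mul_exp_neg_mul_rpow (s := 1 - a - 1) (p := 1) (by linarith) zero_lt_one
    (show 0 < 2 * π * y * ξ by positivity)
  simp only [Real.rpow_one, neg_mul] at this
  refine Integrable.const_mul ?_ _
  refine this.congr (.of_forall fun y => ?_)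
  simp only

lemma integral_subordination {ξ : ℝ} (ha1 : a < 1) (hy : 0 < y) (hξ : 0 < ξ) :
    subC a * y ^ (1 - a) *
      ∫ w in Ioi 0, w ^ (-a) * (ξ ^ (1 : ℝ) * Real.exp (-(2 * π * (y * (1 + w)) * ξ))) =
    ξ ^ a * Real.exp (-(2 * π * y * ξ)) := by
  simp only [subordination_integrand]
  have hG := Real.Gamma_pos_of_pos (show 0 < 1 - a by linarith)
  rw [integral_const_mul, Real.integral_rpow_mul_exp_neg_mul_Ioi (by linarith) (by positivity),
    one_div, Real.inv_rpow (by positivity), Real.mul_rpow (by positivity) (by positivity),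
    Real.mul_rpow (by positivity) (by positivity), subC]
  have h1 : ξ ^ a * ξ ^ (1 - a) = ξ := by
    rw [← Real.rpow_add hξ, add_sub_cancel, Real.rpow_one]
  have h2 : 0 < ξ ^ (1 - a) := Real.rpow_pos_of_pos hξ _
  have h3 : 0 < y ^ (1 - a) := Real.rpow_pos_of_pos hy _
  have h4 : 0 < (2 * π) ^ (1 - a) := Real.rpow_pos_of_pos (by positivity) _
  field_simp
  linear_combination (-1 : ℝ) * h1

/-- Subordination of fractional powers to the first power. -/
lemma enorm_lap_le (hkm : Measurable k) (hk : Integrable k) (ha : 0 ≤ a) (ha1 : a < 1) (hy : 0 < y)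
    (x : ℝ) : ‖lap a k y x‖ₑ ≤ ENNReal.ofReal (subC a * y ^ (1 - a)) *
      ∫⁻ w in Ioi (0 : ℝ), ENNReal.ofReal (w ^ (-a)) * ‖lap 1 k (y * (1 + w)) x‖ₑ := by
  set ρ := volume.restrict (Ioi (0 : ℝ)) with hρ
  set c : ℝ := subC a * y ^ (1 - a) with hc
  have hc0 : 0 < c := by have := subC_pos ha1; positivity
  set E : ℝ → ℝ → ℂ := fun ξ w => ep (x * ξ) *
    (((w ^ (-a) * (ξ ^ (1 : ℝ) * Real.exp (-(2 * π * (y * (1 + w)) * ξ))) : ℝ) : ℂ) * k ξ) with hE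
  have hEi : Integrable (Function.uncurry E) (ρ.prod ρ) := by
    have hm : Measurable (Function.uncurry E) := by
      have g1 : Measurable fun p : ℝ × ℝ => ep (x * p.1) :=
        continuous_ep.measurable.comp (measurable_fst.const_mul x)
      have g2 : Measurable fun p : ℝ × ℝ =>
          p.2 ^ (-a) * (p.1 ^ (1 : ℝ) * Real.exp (-(2 * π * (y * (1 + p.2)) * p.1))) := by
        fun_prop
      exact g1.mul ((Complex.measurable_ofReal.comp g2).mul (hkm.comp measurable_fst))
    refine (integrable_prod_iff hm.aestronglyMeasurable).2 ⟨?_, ?_⟩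
    · filter_upwards [ae_pos_Ioi] with ξ hξ
      exact (((integrableOn_subordination ha1 hy hξ).ofReal).mul_const (k ξ)).const_mul (ep (x * ξ))
    · refine ((integrable_damping_mul (μ := ρ) measurable_id ae_pos_Ioi (hk.restrict (s := Ioi 0))
        ha ha1.le hy).norm.const_mul c⁻¹).congr ?_
      filter_upwards [ae_pos_Ioi] with ξ hξ
      simp only [id, Function.uncurry, hE]
      rw [norm_mul, Complex.norm_real, Real.norm_of_nonneg (by positivity),
        ← integral_subordination ha1 hy hξ, ← hc, mul_assoc c, inv_mul_cancel_left₀ hc0.ne',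
        ← integral_mul_const]
      refine setIntegral_congr_fun measurableSet_Ioi fun w hw => ?_
      have hw : 0 < w := hw
      rw [norm_mul, norm_mul, norm_ep, one_mul, Complex.norm_real,
        Real.norm_of_nonneg (by positivity)]
  have h1 : lap a k y x = (c : ℂ) * ∫ w in Ioi (0 : ℝ), ((w ^ (-a) : ℝ) : ℂ) *
      lap 1 k (y * (1 + w)) x := by
    have e1 : ∀ w, ((w ^ (-a) : ℝ) : ℂ) * lap 1 k (y * (1 + w)) x = ∫ ξ, E ξ w ∂ρ := fun w => by
      rw [lap, lapInt, ← integral_const_mul]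
      refine integral_congr_ae (.of_forall fun ξ => ?_)
      simp only [hE]
      push_cast
      ring
    simp only [e1]
    rw [← hρ, ← integral_integral_swap hEi, ← integral_const_mul, lap, lapInt]
    refine integral_congr_ae ?_
    filter_upwards [ae_pos_Ioi] with ξ hξ
    simp only [hE]
    rw [integral_const_mul, integral_mul_const, integral_complex_ofReal,
      ← integral_subordination ha1 hy hξ, ← hc, ← hρ]
    push_cast
    ring
  rw [h1, enorm_mul, ← ofReal_norm (c : ℂ), Complex.norm_real, Real.norm_of_nonneg hc0.le]
  refine mul_le_mul_right ((enorm_integral_le_lintegral_enorm _).trans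
    (setLIntegral_mono_ae' measurableSet_Ioi (.of_forall fun w hw => ?_))) _
  rw [enorm_mul, ← ofReal_norm ((w ^ (-a) : ℝ) : ℂ), Complex.norm_real,
    Real.norm_of_nonneg (Real.rpow_nonneg (le_of_lt hw) _)]

end Laplace

section Laplace

variable {k : ℝ → ℂ} {a b y : ℝ}

lemma exists_enorm_lap_le_maxFn (ha : 0 ≤ a) (ha1 : a < 1) :
    ∃ C : ℝ≥0∞, C ≠ ∞ ∧ ∀ {k : ℝ → ℂ}, Measurable k → Integrable k → ∀ {y : ℝ}, 0 < y → ∀ x,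
      ENNReal.ofReal (y ^ a) * ‖lap a k y x‖ₑ ≤ C * maxFn (fun z => ‖wavePos k z‖ₑ) x := by
  obtain ⟨C, hC, h⟩ := exists_lpois_le_maxFn
  rcases ha.eq_or_lt with rfl | ha
  · refine ⟨C, hC, fun {k} hkm hk {y} hy x => ?_⟩
    rw [Real.rpow_zero, ENNReal.ofReal_one, one_mul, ← pois_wavePos hk hy]
    exact (enorm_pois_le hy x).trans (h hy (measurable_wavePos hkm).enorm x)
  set J := ∫⁻ w in Ioi (0 : ℝ), ENNReal.ofReal (w ^ (-a) * (1 + w)⁻¹) with hJ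
  have hJt : J ≠ ∞ := (lintegral_rpow_div_one_add_lt_top ha ha1).ne
  refine ⟨ENNReal.ofReal (subC a) * (J * C),
    ENNReal.mul_ne_top ENNReal.ofReal_ne_top (ENNReal.mul_ne_top hJt hC),
    fun {k} hkm hk {y} hy x => ?_⟩
  set m := maxFn (fun z => ‖wavePos k z‖ₑ) x with hm
  have h1 : ∀ {u : ℝ}, 0 < u → ‖lap 1 k u x‖ₑ ≤ ENNReal.ofReal u⁻¹ * (C * m) := fun {u} hu => by
    have e : ENNReal.ofReal u * ‖lap 1 k u x‖ₑ ≤ C * m := by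
      refine le_trans ?_ ((enorm_cau_le hu x).trans (h hu (measurable_wavePos hkm).enorm x))
      rw [cau_wavePos hk hu]
      refine mul_le_mul' (ENNReal.ofReal_le_ofReal (by linarith)) ?_
      rw [← ofReal_norm, ← ofReal_norm]
      refine ENNReal.ofReal_le_ofReal ?_
      rw [norm_mul]
      refine le_mul_of_one_le_left (norm_nonneg _) ?_
      rw [norm_mul, Complex.norm_real, Real.norm_of_nonneg pi_pos.le, Complex.norm_ofNat]
      linarith [Real.pi_gt_three]
    calc ‖lap 1 k u x‖ₑ = ENNReal.ofReal u⁻¹ * (ENNReal.ofReal u * ‖lap 1 k u x‖ₑ) := by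
          rw [← mul_assoc, ← ENNReal.ofReal_mul (by positivity), inv_mul_cancel₀ hu.ne',
            ENNReal.ofReal_one, one_mul]
      _ ≤ _ := mul_le_mul_right e _
  calc ENNReal.ofReal (y ^ a) * ‖lap a k y x‖ₑ
      ≤ ENNReal.ofReal (y ^ a) * (ENNReal.ofReal (subC a * y ^ (1 - a)) *
        ∫⁻ w in Ioi (0 : ℝ), ENNReal.ofReal (w ^ (-a)) * ‖lap 1 k (y * (1 + w)) x‖ₑ) :=
        mul_le_mul_right (enorm_lap_le hkm hk ha.le ha1 hy x) _
    _ ≤ ENNReal.ofReal (y ^ a) * (ENNReal.ofReal (subC a * y ^ (1 - a)) *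
        ∫⁻ w in Ioi (0 : ℝ), ENNReal.ofReal (w ^ (-a) * (1 + w)⁻¹) *
          (ENNReal.ofReal y⁻¹ * (C * m))) := by
        gcongr ENNReal.ofReal (y ^ a) * (ENNReal.ofReal (subC a * y ^ (1 - a)) * ?_)
        refine setLIntegral_mono_ae' measurableSet_Ioi (.of_forall fun w hw => ?_)
        have hw : 0 < w := hw
        refine (mul_le_mul_right (h1 (by positivity)) _).trans_eq ?_
        rw [← mul_assoc, ← mul_assoc (ENNReal.ofReal _) (ENNReal.ofReal y⁻¹) (C * m),
          ← ENNReal.ofReal_mul (by positivity), ← ENNReal.ofReal_mul (by positivity), mul_inv]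
        congr 2
        ring
    _ = ENNReal.ofReal (subC a) * (J * C) * m := by
        have hs := subC_pos ha1
        rw [lintegral_mul_const _ (by fun_prop), ← hJ]
        rw [show ENNReal.ofReal (y ^ a) * (ENNReal.ofReal (subC a * y ^ (1 - a)) *
          (J * (ENNReal.ofReal y⁻¹ * (C * m)))) = (ENNReal.ofReal (y ^ a) *
          ENNReal.ofReal (subC a * y ^ (1 - a)) * ENNReal.ofReal y⁻¹) * (J * C) * m by ring,
          ← ENNReal.ofReal_mul (by positivity), ← ENNReal.ofReal_mul (by positivity)]
        congr 3
        have : y ^ a * y ^ (1 - a) = y := by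
          rw [← Real.rpow_add hy, add_sub_cancel, Real.rpow_one]
        calc y ^ a * (subC a * y ^ (1 - a)) * y⁻¹ = subC a * (y ^ a * y ^ (1 - a)) * y⁻¹ := by ring
          _ = subC a := by rw [this, mul_inv_cancel_right₀ hy.ne']

lemma lintegral_scaled_sq {f : ℝ → ℝ≥0∞} (hf : Measurable f) {r : ℝ} (hr : 0 < r) :
    ∫⁻ y in Ioi (0 : ℝ), ENNReal.ofReal y * f (y * r) ^ (2 : ℝ) =
      ENNReal.ofReal (r⁻¹ ^ 2) * ∫⁻ y in Ioi (0 : ℝ), ENNReal.ofReal y * f y ^ (2 : ℝ) := by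
  have hg : Measurable fun y => ENNReal.ofReal y * f (y * r) ^ (2 : ℝ) :=
    ENNReal.measurable_ofReal.mul ((hf.comp (measurable_id.mul_const r)).pow_const _)
  have := lintegral_Ioi_comp_mul_left hg (inv_pos.2 hr) 0
  rw [mul_zero] at this
  rw [this, sq, ENNReal.ofReal_mul (by positivity), mul_assoc,
    ← lintegral_const_mul' (ENNReal.ofReal r⁻¹) (fun y => ENNReal.ofReal y * f y ^ (2 : ℝ))
      ENNReal.ofReal_ne_top]
  congr 1
  refine lintegral_congr fun y => ?_
  rw [ENNReal.ofReal_mul (by positivity), mul_assoc, mul_comm r⁻¹ y, mul_assoc,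
    inv_mul_cancel₀ hr.ne', mul_one]

lemma exists_sqLap_le_sqFn (hb : 0 < b) (hb1 : b ≤ 1) :
    ∃ C : ℝ≥0∞, C ≠ ∞ ∧ ∀ {k : ℝ → ℂ}, Measurable k → Integrable k → ∀ x,
      sqLap (volume.restrict (Ioi (0 : ℝ))) (fun ξ => ξ) b k x ≤ C * sqFn (wave k) x := by
  rcases hb1.eq_or_lt with rfl | hb1
  · exact ⟨1, ENNReal.one_ne_top, fun {k} hkm hk x => (sqLap_one hk x).trans_eq (one_mul _).symm⟩
  set J := ∫⁻ w in Ioi (0 : ℝ), ENNReal.ofReal (w ^ (-b) * (1 + w)⁻¹) with hJ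
  have hJt : J ≠ ∞ := (lintegral_rpow_div_one_add_lt_top hb hb1).ne
  refine ⟨ENNReal.ofReal (subC b ^ 2) * J * J, ENNReal.mul_ne_top
    (ENNReal.mul_ne_top ENNReal.ofReal_ne_top hJt) hJt, fun {k} hkm hk x => ?_⟩
  set L : ℝ → ℝ≥0∞ := fun y => ‖lap 1 k y x‖ₑ with hL
  have hLm : Measurable L := by
    have := (measurable_lapInt (volume.restrict (Ioi (0 : ℝ))) (η := fun ξ : ℝ => ξ)
      measurable_id 1 hkm).of_uncurry_right (y := x)
    exact this.enorm
  have hsc := subC_pos hb1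
  have hpt : ∀ y ∈ Ioi (0 : ℝ), ENNReal.ofReal (y ^ (2 * b - 1)) * ‖lap b k y x‖ₑ ^ (2 : ℝ) ≤
      ENNReal.ofReal (subC b ^ 2) * J * ∫⁻ w in Ioi (0 : ℝ),
        ENNReal.ofReal (w ^ (-b) * (1 + w)) * (ENNReal.ofReal y * L (y * (1 + w)) ^ (2 : ℝ)) := by
    intro y hy
    have hy : 0 < y := hy
    have hcs : (∫⁻ w in Ioi (0 : ℝ), ENNReal.ofReal (w ^ (-b)) * L (y * (1 + w))) ^ (2 : ℝ) ≤
        J * ∫⁻ w in Ioi (0 : ℝ), ENNReal.ofReal (w ^ (-b) * (1 + w)) *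
          L (y * (1 + w)) ^ (2 : ℝ) := by
      have hf : Measurable fun w : ℝ => ENNReal.ofReal (w ^ (-b) * (1 + w)⁻¹) := by fun_prop
      have hg : Measurable fun w : ℝ =>
          ENNReal.ofReal (w ^ (-b) * (1 + w)) * L (y * (1 + w)) ^ (2 : ℝ) :=
        (by fun_prop : Measurable fun w : ℝ => ENNReal.ofReal (w ^ (-b) * (1 + w))).mul
          ((hLm.comp (by fun_prop)).pow_const _)
      have h0 := ENNReal.lintegral_mul_norm_pow_le (p := 1 / 2) (q := 1 / 2)
        (μ := volume.restrict (Ioi 0)) hf.aemeasurable hg.aemeasurable (by norm_num) (by norm_num)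
        (by norm_num)
      have h1 : ∫⁻ w in Ioi (0 : ℝ), ENNReal.ofReal (w ^ (-b)) * L (y * (1 + w)) ≤
          J ^ (1 / 2 : ℝ) * (∫⁻ w in Ioi (0 : ℝ), ENNReal.ofReal (w ^ (-b) * (1 + w)) *
            L (y * (1 + w)) ^ (2 : ℝ)) ^ (1 / 2 : ℝ) := by
        refine le_trans (setLIntegral_mono_ae' measurableSet_Ioi (.of_forall fun w hw => ?_)) h0
        have hw : 0 < w := hw
        rw [ENNReal.mul_rpow_of_nonneg _ _ (by norm_num), ← ENNReal.rpow_mul,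
          show (2 : ℝ) * (1 / 2) = 1 by norm_num, ENNReal.rpow_one, ← mul_assoc,
          ← ENNReal.mul_rpow_of_nonneg _ _ (by norm_num), ← ENNReal.ofReal_mul (by positivity),
          ENNReal.ofReal_rpow_of_nonneg (by positivity) (by norm_num),
          show w ^ (-b) * (1 + w)⁻¹ * (w ^ (-b) * (1 + w)) = (w ^ (-b)) ^ (2 : ℝ) by
            rw [Real.rpow_two]; field_simp,
          ← Real.rpow_mul (by positivity), show (2 : ℝ) * (1 / 2) = 1 by norm_num, Real.rpow_one]
      refine (ENNReal.rpow_le_rpow h1 (by norm_num)).trans_eq ?_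
      rw [ENNReal.mul_rpow_of_nonneg _ _ (by norm_num), ← ENNReal.rpow_mul, ← ENNReal.rpow_mul,
        show (1 / 2 : ℝ) * 2 = 1 by norm_num, ENNReal.rpow_one, ENNReal.rpow_one]
    calc ENNReal.ofReal (y ^ (2 * b - 1)) * ‖lap b k y x‖ₑ ^ (2 : ℝ)
        ≤ ENNReal.ofReal (y ^ (2 * b - 1)) * (ENNReal.ofReal (subC b * y ^ (1 - b)) *
          ∫⁻ w in Ioi (0 : ℝ), ENNReal.ofReal (w ^ (-b)) * L (y * (1 + w))) ^ (2 : ℝ) :=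
          mul_le_mul_right (ENNReal.rpow_le_rpow (enorm_lap_le hkm hk hb.le hb1 hy x)
            (by norm_num)) _
      _ ≤ ENNReal.ofReal (y ^ (2 * b - 1)) * (ENNReal.ofReal (subC b * y ^ (1 - b)) ^ (2 : ℝ) *
          (J * ∫⁻ w in Ioi (0 : ℝ), ENNReal.ofReal (w ^ (-b) * (1 + w)) *
          L (y * (1 + w)) ^ (2 : ℝ))) := by
          rw [ENNReal.mul_rpow_of_nonneg _ _ (by norm_num)]
          gcongr
      _ = ENNReal.ofReal (subC b ^ 2 * y) * (J * ∫⁻ w in Ioi (0 : ℝ),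
          ENNReal.ofReal (w ^ (-b) * (1 + w)) * L (y * (1 + w)) ^ (2 : ℝ)) := by
          rw [← mul_assoc, ENNReal.ofReal_rpow_of_nonneg (by positivity) (by norm_num),
            ← ENNReal.ofReal_mul (by positivity)]
          congr 2
          rw [Real.mul_rpow (by positivity) (by positivity), ← Real.rpow_mul hy.le, Real.rpow_two,
            mul_left_comm, ← Real.rpow_add hy,
            show 2 * b - 1 + (1 - b) * 2 = 1 by ring, Real.rpow_one]
      _ = _ := by
          rw [ENNReal.ofReal_mul (by positivity), show ∀ A B D E : ℝ≥0∞,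
            A * B * (D * E) = A * D * (B * E) from fun A B D E => by ring,
            ← lintegral_const_mul' (ENNReal.ofReal y) _ ENNReal.ofReal_ne_top]
          congr 1
          exact lintegral_congr fun w => mul_left_comm _ _ _
  have hG : Measurable (Function.uncurry fun y w : ℝ => ENNReal.ofReal (w ^ (-b) * (1 + w)) *
      (ENNReal.ofReal y * L (y * (1 + w)) ^ (2 : ℝ))) := by
    have g1 : Measurable fun p : ℝ × ℝ => ENNReal.ofReal (p.2 ^ (-b) * (1 + p.2)) := by fun_prop
    have g2 : Measurable fun p : ℝ × ℝ => L (p.1 * (1 + p.2)) := hLm.comp (by fun_prop)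
    exact g1.mul ((ENNReal.measurable_ofReal.comp measurable_fst).mul (g2.pow_const _))
  calc sqLap (volume.restrict (Ioi (0 : ℝ))) (fun ξ => ξ) b k x
      ≤ ∫⁻ y in Ioi (0 : ℝ), (ENNReal.ofReal (subC b ^ 2) * J * ∫⁻ w in Ioi (0 : ℝ),
        ENNReal.ofReal (w ^ (-b) * (1 + w)) * (ENNReal.ofReal y * L (y * (1 + w)) ^ (2 : ℝ))) :=
        setLIntegral_mono_ae' measurableSet_Ioi (.of_forall hpt)
    _ = ENNReal.ofReal (subC b ^ 2) * J * ∫⁻ w in Ioi (0 : ℝ), ∫⁻ y in Ioi (0 : ℝ),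
        ENNReal.ofReal (w ^ (-b) * (1 + w)) * (ENNReal.ofReal y * L (y * (1 + w)) ^ (2 : ℝ)) := by
        rw [lintegral_const_mul' _ _ (ENNReal.mul_ne_top ENNReal.ofReal_ne_top hJt),
          lintegral_lintegral_swap hG.aemeasurable]
    _ ≤ ENNReal.ofReal (subC b ^ 2) * J * ∫⁻ w in Ioi (0 : ℝ),
        ENNReal.ofReal (w ^ (-b) * (1 + w)⁻¹) * sqFn (wave k) x := by
        gcongr ENNReal.ofReal (subC b ^ 2) * J * ?_
        refine setLIntegral_mono_ae' measurableSet_Ioi (.of_forall fun w hw => ?_)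
        have hw : 0 < w := hw
        rw [lintegral_const_mul' _ _ ENNReal.ofReal_ne_top, lintegral_scaled_sq hLm (by positivity),
          ← mul_assoc, ← ENNReal.ofReal_mul (by positivity),
          show w ^ (-b) * (1 + w) * (1 + w)⁻¹ ^ 2 = w ^ (-b) * (1 + w)⁻¹ by field_simp]
        have h1 := sqLap_one hk x
        simp only [sqLap, show (2 : ℝ) * 1 - 1 = 1 by norm_num, Real.rpow_one] at h1
        exact mul_le_mul_right h1 _
    _ = _ := by
        rw [lintegral_mul_const _ (by fun_prop), ← hJ]
        ring

end Laplace

section Bilinear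

variable {τ : Type*} [MeasurableSpace τ]

/-- A measurable family of densities with uniformly bounded `L¹` norms. -/
structure Density (k : ℝ → τ → ℂ) (M : ℝ) : Prop where
  meas : Measurable (Function.uncurry k)
  int : ∀ t, Integrable fun ξ => k ξ t
  bound : ∀ t, ∫ ξ, ‖k ξ t‖ ≤ M

lemma exists_mixedNorm_wavePos_le {p q : ℝ} (hp : 1 < p) (hq : 1 < q) :
    ∃ C : ℝ≥0∞, C ≠ ∞ ∧ ∀ (ν : Measure τ) [IsFiniteMeasure ν] (k : ℝ → τ → ℂ) (M : ℝ),
      Density k M → mixedNorm p q ν (fun x t => ‖wavePos (fun ξ => k ξ t) x‖ₑ) ≤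
        C * mixedNorm p q ν (fun x t => ‖wave (fun ξ => k ξ t) x‖ₑ) := by
  obtain ⟨C₁, hC₁, h₁⟩ := exists_mixedNorm_superposition_le (τ := τ)
    (volume.restrict (Ioi (0 : ℝ))) (η := fun ξ => ξ) hp hq zero_le_one le_rfl measurable_id
    ae_pos_Ioi
  obtain ⟨C₂, hC₂, h₂⟩ := exists_mixedNorm_sqFn_le (τ := τ) hp hq
  refine ⟨C₁ * C₂, ENNReal.mul_ne_top hC₁ hC₂, fun ν _ k M hk => ?_⟩
  refine (h₁ ν k hk.meas fun t => (hk.int t).restrict).trans ?_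
  rw [mul_assoc]
  refine mul_le_mul_right (le_trans ?_ (h₂ ν (fun x t => wave (fun ξ => k ξ t) x) M
    (measurable_wave_param hk.meas) fun x t => (norm_wave_le _ x).trans (hk.bound t))) _
  refine mixedNorm_mono (by linarith) (by linarith) fun x t => ?_
  exact ENNReal.rpow_le_rpow (sqLap_one (hk.int t) x) (by norm_num)

/-- The product Lebesgue measure on the quadrant of positive frequencies. -/
abbrev quadrant : Measure (ℝ × ℝ) :=
  (volume.restrict (Ioi (0 : ℝ))).prod (volume.restrict (Ioi (0 : ℝ)))

/-- The density `(ξ₁ + ξ₂)^{-(a+b)} ξ₁^a ξ₂^b k₁(ξ₁) k₂(ξ₂)`. -/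
def bilDensity (a b : ℝ) (k₁ k₂ : ℝ → τ → ℂ) (w : ℝ × ℝ) (t : τ) : ℂ :=
  (((w.1 + w.2) ^ (-(a + b)) * (w.1 ^ a * w.2 ^ b) : ℝ) : ℂ) * (k₁ w.1 t * k₂ w.2 t)

/-- The bilinear superposition with density `bilDensity`. -/
def bilWave (a b : ℝ) (k₁ k₂ : ℝ → τ → ℂ) (x : ℝ) (t : τ) : ℂ :=
  ∫ w, ep (x * (w.1 + w.2)) * bilDensity a b k₁ k₂ w t ∂quadrant

lemma ae_quadrant : ∀ᵐ w ∂quadrant, 0 < w.1 ∧ 0 < w.2 := by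
  have h1 : ∀ᵐ w ∂quadrant, 0 < w.1 :=
    Measure.quasiMeasurePreserving_fst.ae ae_pos_Ioi
  have h2 : ∀ᵐ w ∂quadrant, 0 < w.2 :=
    Measure.quasiMeasurePreserving_snd.ae ae_pos_Ioi
  exact h1.and h2

variable {a b : ℝ} {k₁ k₂ : ℝ → τ → ℂ} {M₁ M₂ : ℝ}

lemma bilWave_swap (a b : ℝ) (k₁ k₂ : ℝ → τ → ℂ) (x : ℝ) (t : τ) :
    bilWave a b k₁ k₂ x t = bilWave b a k₂ k₁ x t := by
  unfold bilWave
  rw [← integral_prod_swap]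
  refine integral_congr_ae (.of_forall fun w => ?_)
  simp only [bilDensity, Prod.fst_swap, Prod.snd_swap]
  rw [add_comm w.2 w.1, add_comm a b, mul_comm (w.2 ^ a), mul_comm (k₁ _ _)]

lemma measurable_bilDensity (a b : ℝ) (hk₁ : Measurable (Function.uncurry k₁))
    (hk₂ : Measurable (Function.uncurry k₂)) :
    Measurable (Function.uncurry (bilDensity a b k₁ k₂)) := by
  have h1 : Measurable fun p : (ℝ × ℝ) × τ => k₁ p.1.1 p.2 :=
    measurable_uncurry_comp hk₁ (by fun_prop) (by fun_prop)
  have h2 : Measurable fun p : (ℝ × ℝ) × τ => k₂ p.1.2 p.2 :=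
    measurable_uncurry_comp hk₂ (by fun_prop) (by fun_prop)
  have h3 : Measurable fun p : (ℝ × ℝ) × τ =>
      (p.1.1 + p.1.2) ^ (-(a + b)) * (p.1.1 ^ a * p.1.2 ^ b) := by fun_prop
  exact (Complex.measurable_ofReal.comp h3).mul (h1.mul h2)

lemma weight_le_one (ha : 0 ≤ a) (hb : 0 ≤ b) {u v : ℝ} (hu : 0 < u) (hv : 0 < v) :
    (u + v) ^ (-(a + b)) * (u ^ a * v ^ b) ≤ 1 := by
  have h1 : u ^ a * v ^ b ≤ (u + v) ^ (a + b) := by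
    rw [Real.rpow_add (by positivity)]
    gcongr <;> linarith
  rw [Real.rpow_neg (by positivity), inv_mul_le_iff₀ (by positivity), mul_one]
  exact h1

lemma integrable_bilDensity (ha : 0 ≤ a) (hb : 0 ≤ b) (hk₁ : Density k₁ M₁) (hk₂ : Density k₂ M₂)
    (t : τ) : Integrable (fun w => bilDensity a b k₁ k₂ w t) quadrant := by
  have h := ((hk₁.int t).restrict (s := Ioi 0)).mul_prod ((hk₂.int t).restrict (s := Ioi 0))
  refine h.mono (measurable_bilDensity a b hk₁.meas hk₂.meas).of_uncurry_right.aestronglyMeasurable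
    ?_
  filter_upwards [ae_quadrant] with w hw
  rw [bilDensity, norm_mul, Complex.norm_real, Real.norm_of_nonneg
    (by have := hw.1; have := hw.2; positivity)]
  exact mul_le_of_le_one_left (norm_nonneg _) (weight_le_one ha hb hw.1 hw.2)

lemma lapInt_bilDensity (t : τ) (y x : ℝ) :
    lapInt quadrant (fun w => w.1 + w.2) (a + b) (fun w => bilDensity a b k₁ k₂ w t) y x =
      lap a (fun ξ => k₁ ξ t) y x * lap b (fun ξ => k₂ ξ t) y x := by
  simp only [lap, lapInt]
  rw [← integral_prod_mul]
  refine integral_congr_ae ?_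
  filter_upwards [ae_quadrant] with w hw
  have h0 : 0 < w.1 + w.2 := add_pos hw.1 hw.2
  have h1 : (w.1 + w.2) ^ (a + b) * (w.1 + w.2) ^ (-(a + b)) = 1 := by
    rw [← Real.rpow_add h0, add_neg_cancel, Real.rpow_zero]
  have h2 : (((w.1 + w.2) ^ (a + b) : ℝ) : ℂ) * (((w.1 + w.2) ^ (-(a + b)) : ℝ) : ℂ) = 1 := by
    exact_mod_cast h1
  simp only [bilDensity]
  rw [mul_add x, ep_add, show -(2 * π * y * (w.1 + w.2)) = -(2 * π * y * w.1) + -(2 * π * y * w.2)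
    by ring, Real.exp_add]
  push_cast
  linear_combination (ep (x * w.1) * ep (x * w.2) * Complex.exp (-(2 * π * y * w.1)) *
    Complex.exp (-(2 * π * y * w.2)) * (((w.1 ^ a : ℝ) : ℂ) * ((w.2 ^ b : ℝ) : ℂ)) *
    (k₁ w.1 t * k₂ w.2 t)) * h2

variable {p q p₁ q₁ p₂ q₂ : ℝ}

lemma exists_mixedNorm_bilWave_le_of_pos (hp : 1 < p) (hq : 1 < q) (hp₁ : 1 < p₁) (hq₁ : 1 < q₁)
    (hp₂ : 1 < p₂) (hq₂ : 1 < q₂) (hps : 1 / p₁ + 1 / p₂ = 1 / p) (hqs : 1 / q₁ + 1 / q₂ = 1 / q)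
    (ha : 0 ≤ a) (hb : 0 < b) (hab : a + b ≤ 1) :
    ∃ C : ℝ≥0∞, C ≠ ∞ ∧ ∀ (ν : Measure τ) [IsFiniteMeasure ν] (k₁ k₂ : ℝ → τ → ℂ) (M₁ M₂ : ℝ),
      Density k₁ M₁ → Density k₂ M₂ →
      mixedNorm p q ν (fun x t => ‖bilWave a b k₁ k₂ x t‖ₑ) ≤
        C * (mixedNorm p₁ q₁ ν (fun x t => ‖wave (fun ξ => k₁ ξ t) x‖ₑ) *
          mixedNorm p₂ q₂ ν (fun x t => ‖wave (fun ξ => k₂ ξ t) x‖ₑ)) := by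
  obtain ⟨C₀, hC₀, h₀⟩ := exists_mixedNorm_superposition_le (τ := τ) quadrant
    (η := fun w => w.1 + w.2) (s := a + b) hp hq (by linarith) hab (by fun_prop)
    (ae_quadrant.mono fun w hw => add_pos hw.1 hw.2)
  obtain ⟨C₁, hC₁, h₁⟩ := exists_enorm_lap_le_maxFn ha (show a < 1 by linarith)
  obtain ⟨C₂, hC₂, h₂⟩ := exists_sqLap_le_sqFn hb (show b ≤ 1 by linarith)
  obtain ⟨C₃, -, h₃⟩ := exists_mixedNorm_maxX_le (τ := τ) hp₁ hq₁
  obtain ⟨C₄, hC₄, h₄⟩ := exists_mixedNorm_wavePos_le (τ := τ) hp₁ hq₁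
  obtain ⟨C₅, hC₅, h₅⟩ := exists_mixedNorm_sqFn_le (τ := τ) hp₂ hq₂
  have hC₂' : C₂ ^ (1 / 2 : ℝ) ≠ ∞ := ENNReal.rpow_ne_top_of_nonneg (by norm_num) hC₂
  refine ⟨C₀ * (C₁ * C₂ ^ (1 / 2 : ℝ)) * (C₃ * C₄ * C₅), ENNReal.mul_ne_top
    (ENNReal.mul_ne_top hC₀ (ENNReal.mul_ne_top hC₁ hC₂')) (ENNReal.mul_ne_top
    (ENNReal.mul_ne_top ENNReal.coe_ne_top hC₄) hC₅), fun ν _ k₁ k₂ M₁ M₂ hk₁ hk₂ => ?_⟩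
  set F : ℝ → τ → ℝ≥0∞ := fun x t => ‖wavePos (fun ξ => k₁ ξ t) x‖ₑ with hF
  have hFm : Measurable (Function.uncurry F) := (measurable_wavePos_param hk₁.meas).enorm
  set S : ℝ → τ → ℝ≥0∞ := fun x t => sqFn (wave fun ξ => k₂ ξ t) x ^ (1 / 2 : ℝ) with hS
  have hW₂ := measurable_wave_param hk₂.meas
  have hSm : Measurable (Function.uncurry S) := (measurable_sqFn hW₂).pow_const _
  have hMm : Measurable (Function.uncurry (maxX F)) := measurable_maxX hFm
  have hpt : ∀ x t, sqLap quadrant (fun w => w.1 + w.2) (a + b)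
      (fun w => bilDensity a b k₁ k₂ w t) x ^ (1 / 2 : ℝ) ≤
        C₁ * C₂ ^ (1 / 2 : ℝ) * (maxX F x t * S x t) := fun x t => by
    have hm₁ : Measurable fun ξ => k₁ ξ t := hk₁.meas.of_uncurry_right
    have hm₂ : Measurable fun ξ => k₂ ξ t := hk₂.meas.of_uncurry_right
    have hLm : Measurable fun y => lap b (fun ξ => k₂ ξ t) y x :=
      (measurable_lapInt (volume.restrict (Ioi (0 : ℝ))) (η := fun ξ : ℝ => ξ)
        measurable_id b hm₂).of_uncurry_right (y := x)
    have e : sqLap quadrant (fun w => w.1 + w.2) (a + b) (fun w => bilDensity a b k₁ k₂ w t) x ≤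
        (C₁ * maxX F x t) ^ (2 : ℝ) * (C₂ * sqFn (wave fun ξ => k₂ ξ t) x) := by
      refine le_trans ?_ (mul_le_mul_right (h₂ hm₂ (hk₂.int t) x) _)
      have hg : Measurable fun y => ENNReal.ofReal (y ^ (2 * b - 1)) *
          ‖lap b (fun ξ => k₂ ξ t) y x‖ₑ ^ (2 : ℝ) :=
        (ENNReal.measurable_ofReal.comp (measurable_id.pow_const _)).mul (hLm.enorm.pow_const _)
      rw [sqLap, sqLap, ← lintegral_const_mul _ hg]
      refine setLIntegral_mono_ae' measurableSet_Ioi (.of_forall fun y hy => ?_)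
      have hy : 0 < y := hy
      have h := ENNReal.rpow_le_rpow (h₁ hm₁ (hk₁.int t) hy x) (zero_le_two : (0 : ℝ) ≤ 2)
      rw [lapInt_bilDensity, enorm_mul, ENNReal.mul_rpow_of_nonneg _ _ zero_le_two]
      refine le_trans (le_of_eq ?_) (mul_le_mul_left h _)
      rw [ENNReal.mul_rpow_of_nonneg _ _ zero_le_two, ENNReal.ofReal_rpow_of_nonneg
        (by positivity) zero_le_two, ← Real.rpow_mul hy.le, mul_mul_mul_comm,
        ← ENNReal.ofReal_mul (by positivity), ← Real.rpow_add hy,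
        show 2 * (a + b) - 1 = a * 2 + (2 * b - 1) by ring]
    refine (ENNReal.rpow_le_rpow e (by norm_num)).trans_eq ?_
    rw [ENNReal.mul_rpow_of_nonneg _ _ (by norm_num), ← ENNReal.rpow_mul,
      show (2 : ℝ) * (1 / 2) = 1 by norm_num, ENNReal.rpow_one,
      ENNReal.mul_rpow_of_nonneg _ _ (by norm_num)]
    ring
  have hp0 : 0 < p := by linarith
  have hq0 : 0 < q := by linarith
  calc mixedNorm p q ν (fun x t => ‖bilWave a b k₁ k₂ x t‖ₑ)
      ≤ C₀ * mixedNorm p q ν (fun x t => sqLap quadrant (fun w => w.1 + w.2) (a + b)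
          (fun w => bilDensity a b k₁ k₂ w t) x ^ (1 / 2 : ℝ)) :=
        h₀ ν _ (measurable_bilDensity a b hk₁.meas hk₂.meas)
          fun t => integrable_bilDensity ha hb.le hk₁ hk₂ t
    _ ≤ C₀ * (C₁ * C₂ ^ (1 / 2 : ℝ) * mixedNorm p q ν (fun x t => maxX F x t * S x t)) := by
        refine mul_le_mul_right ((mixedNorm_mono hp0 hq0 hpt).trans_eq ?_) _
        exact mixedNorm_const_mul hp0 hq0 _ (hMm.mul hSm)
    _ ≤ C₀ * (C₁ * C₂ ^ (1 / 2 : ℝ) * ((C₃ * (C₄ *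
          mixedNorm p₁ q₁ ν (fun x t => ‖wave (fun ξ => k₁ ξ t) x‖ₑ))) *
          (C₅ * mixedNorm p₂ q₂ ν (fun x t => ‖wave (fun ξ => k₂ ξ t) x‖ₑ)))) := by
        refine mul_le_mul_right (mul_le_mul_right ((mixedNorm_mul_le hp0 hq0 (by linarith)
          (by linarith) (by linarith) (by linarith) hps hqs hMm hSm).trans
          (mul_le_mul' ?_ ?_)) _) _
        · exact (h₃ ν F hFm).trans (mul_le_mul_right (h₄ ν k₁ M₁ hk₁) _)
        · exact h₅ ν _ M₂ hW₂ fun x t => (norm_wave_le _ x).trans (hk₂.bound t)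
    _ = _ := by ring

lemma bilWave_zero_zero (x : ℝ) (t : τ) :
    bilWave 0 0 k₁ k₂ x t = wavePos (fun ξ => k₁ ξ t) x * wavePos (fun ξ => k₂ ξ t) x := by
  unfold bilWave wavePos
  rw [← integral_prod_mul]
  refine integral_congr_ae (.of_forall fun w => ?_)
  simp only [bilDensity, mul_add x, ep_add, add_zero, neg_zero, Real.rpow_zero, mul_one,
    Complex.ofReal_one, one_mul]
  ring

/-- The bilinear estimate for superpositions of plane waves of positive frequency. -/
theorem exists_mixedNorm_bilWave_le (hp : 1 < p) (hq : 1 < q) (hp₁ : 1 < p₁) (hq₁ : 1 < q₁)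
    (hp₂ : 1 < p₂) (hq₂ : 1 < q₂) (hps : 1 / p₁ + 1 / p₂ = 1 / p) (hqs : 1 / q₁ + 1 / q₂ = 1 / q)
    (ha : 0 ≤ a) (hb : 0 ≤ b) (hab : a + b ≤ 1) :
    ∃ C : ℝ≥0∞, C ≠ ∞ ∧ ∀ (ν : Measure τ) [IsFiniteMeasure ν] (k₁ k₂ : ℝ → τ → ℂ) (M₁ M₂ : ℝ),
      Density k₁ M₁ → Density k₂ M₂ →
      mixedNorm p q ν (fun x t => ‖bilWave a b k₁ k₂ x t‖ₑ) ≤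
        C * (mixedNorm p₁ q₁ ν (fun x t => ‖wave (fun ξ => k₁ ξ t) x‖ₑ) *
          mixedNorm p₂ q₂ ν (fun x t => ‖wave (fun ξ => k₂ ξ t) x‖ₑ)) := by
  rcases hb.eq_or_lt with rfl | hb
  · rcases ha.eq_or_lt with rfl | ha
    · obtain ⟨C₁, hC₁, h₁⟩ := exists_mixedNorm_wavePos_le (τ := τ) hp₁ hq₁
      obtain ⟨C₂, hC₂, h₂⟩ := exists_mixedNorm_wavePos_le (τ := τ) hp₂ hq₂
      refine ⟨C₁ * C₂, ENNReal.mul_ne_top hC₁ hC₂, fun ν _ k₁ k₂ M₁ M₂ hk₁ hk₂ => ?_⟩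
      simp only [bilWave_zero_zero, enorm_mul]
      rw [mul_mul_mul_comm]
      exact (mixedNorm_mul_le (by linarith) (by linarith) (by linarith) (by linarith)
        (by linarith) (by linarith) hps hqs (measurable_wavePos_param hk₁.meas).enorm
        (measurable_wavePos_param hk₂.meas).enorm).trans
        (mul_le_mul' (h₁ ν k₁ M₁ hk₁) (h₂ ν k₂ M₂ hk₂))
    · obtain ⟨C, hC, h⟩ := exists_mixedNorm_bilWave_le_of_pos (τ := τ) hp hq hp₂ hq₂ hp₁ hq₁
        (by rw [add_comm, hps]) (by rw [add_comm, hqs]) le_rfl ha (by linarith)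
      refine ⟨C, hC, fun ν _ k₁ k₂ M₁ M₂ hk₁ hk₂ => ?_⟩
      simp only [bilWave_swap a 0]
      exact (h ν k₂ k₁ M₂ M₁ hk₂ hk₁).trans_eq (by rw [mul_comm (mixedNorm p₂ q₂ ν _)])
  · exact exists_mixedNorm_bilWave_le_of_pos hp hq hp₁ hq₁ hp₂ hq₂ hps hqs ha hb hab

end Bilinear

section FourierInversion

lemma integral_fourier_mul_eq_of_integrable {f g : ℝ → ℂ} (hf : Integrable f) (hg : Integrable g) :
    ∫ ξ, 𝓕 f ξ * g ξ = ∫ x, f x * 𝓕 g x := by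
  simpa using! VectorFourier.integral_fourierIntegral_smul_eq_flip (L := innerₗ ℝ)
    continuous_fourierChar continuous_inner hf hg

lemma continuous_fourier_of_integrable {f : ℝ → ℂ} (hf : Integrable f) : Continuous (𝓕 f) :=
  VectorFourier.fourierIntegral_continuous continuous_fourierChar
    (by exact continuous_inner) hf

/-- Fourier inversion almost everywhere for integrable functions. -/
theorem fourier_fourierInv_ae_eq {k : ℝ → ℂ} (hk : Integrable k) (hK : Integrable (𝓕⁻ k)) :
    𝓕 (𝓕⁻ k) =ᵐ[volume] k := by
  refine ae_eq_of_integral_contDiff_smul_eq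
    (continuous_fourier_of_integrable hK).locallyIntegrable hk.locallyIntegrable
    fun g hg hgc => ?_
  have hgs : HasCompactSupport fun x => (g x : ℂ) := hgc.comp_left (g := fun y : ℝ => (y : ℂ)) rfl
  let G : SchwartzMap ℝ ℂ := hgs.toSchwartzMap (Complex.ofRealCLM.contDiff.comp hg)
  have hG : ∀ x, G x = (g x : ℂ) := fun x => rfl
  have e1 : ∀ u : ℝ → ℂ, ∫ x, g x • u x = ∫ x, u x * G x := fun u => by
    refine integral_congr_ae (.of_forall fun x => ?_)
    simp only [hG, Complex.real_smul, mul_comm]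
  rw [e1, e1, integral_fourier_mul_eq_of_integrable hK G.integrable]
  have e2 : ∫ x, 𝓕⁻ k x * 𝓕 (G : ℝ → ℂ) x = ∫ x, 𝓕 k x * (𝓕⁻ G : SchwartzMap ℝ ℂ) x := by
    rw [← integral_neg_eq_self]
    refine integral_congr_ae (.of_forall fun x => ?_)
    simp only [SchwartzMap.fourierInv_coe, fourierInv_eq_fourier_neg, neg_neg]
  rw [e2, integral_fourier_mul_eq_of_integrable hk (𝓕⁻ G : SchwartzMap ℝ ℂ).integrable]
  rw [← SchwartzMap.fourier_coe, FourierTransform.fourier_fourierInv_eq]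

end FourierInversion

section QuadrantWave

/-- The image of a density on the quadrant under `(ξ₁, ξ₂) ↦ ξ₁ + ξ₂`. -/
def sumKernel (κ : ℝ × ℝ → ℂ) (ξ : ℝ) : ℂ :=
  ∫ s, (Ioi (0 : ℝ) ×ˢ Ioi (0 : ℝ)).indicator κ (s, -s + ξ)

/-- The superposition of plane waves of frequency `ξ₁ + ξ₂` with density `κ`. -/
def quadWave (κ : ℝ × ℝ → ℂ) (x : ℝ) : ℂ := ∫ w, ep (x * (w.1 + w.2)) * κ w ∂quadrant

variable {κ κ₁ κ₂ : ℝ × ℝ → ℂ}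

lemma quadrant_eq_restrict :
    quadrant = (volume : Measure (ℝ × ℝ)).restrict (Ioi (0 : ℝ) ×ˢ Ioi (0 : ℝ)) := by
  rw [quadrant, Measure.prod_restrict, Measure.volume_eq_prod]

lemma integrable_sumKernel_prod (hκ : Integrable κ quadrant) :
    Integrable (fun z : ℝ × ℝ => (Ioi (0 : ℝ) ×ˢ Ioi (0 : ℝ)).indicator κ (z.1, -z.1 + z.2))
      (volume.prod volume) := by
  rw [quadrant_eq_restrict, ← IntegrableOn,
    ← integrable_indicator_iff (measurableSet_Ioi.prod measurableSet_Ioi),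
    Measure.volume_eq_prod] at hκ
  exact (measurePreserving_prod_neg_add (volume : Measure ℝ) volume).integrable_comp_of_integrable
    hκ

lemma integrable_sumKernel (hκ : Integrable κ quadrant) : Integrable (sumKernel κ) :=
  (integrable_sumKernel_prod hκ).integral_prod_right

lemma integral_sumKernel (hκ : Integrable κ quadrant) :
    ∫ ξ, sumKernel κ ξ = ∫ w, κ w ∂quadrant := by
  have h := integrable_sumKernel_prod hκ
  have e := integral_prod_symm _ h
  simp only [sumKernel]
  rw [← e, quadrant_eq_restrict, ← integral_indicator (measurableSet_Ioi.prod measurableSet_Ioi),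
    Measure.volume_eq_prod]
  exact (measurePreserving_prod_neg_add (volume : Measure ℝ) volume).integral_comp
    (MeasurableEquiv.shearAddRight ℝ).symm.measurableEmbedding _

lemma mul_sumKernel (m : ℝ → ℂ) (κ : ℝ × ℝ → ℂ) (ξ : ℝ) :
    m ξ * sumKernel κ ξ = sumKernel (fun w => m (w.1 + w.2) * κ w) ξ := by
  rw [sumKernel, sumKernel, ← integral_const_mul]
  refine integral_congr_ae (.of_forall fun s => ?_)
  simp only [indicator_apply]
  split_ifs
  · simp only [add_neg_cancel_left]
  · simp

lemma norm_ep_mul_integrable (hκ : Integrable κ quadrant) (x : ℝ) :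
    Integrable (fun w : ℝ × ℝ => ep (x * (w.1 + w.2)) * κ w) quadrant :=
  hκ.bdd_mul (c := 1) (continuous_ep.comp (by fun_prop)).aestronglyMeasurable
    (.of_forall fun w => (norm_ep _).le)

lemma integral_ep_mul_sumKernel (hκ : Integrable κ quadrant) (x : ℝ) :
    ∫ ξ, ep (ξ * x) * sumKernel κ ξ = quadWave κ x := by
  simp only [mul_sumKernel (fun ξ => ep (ξ * x))]
  simp only [mul_comm _ x]
  exact integral_sumKernel (norm_ep_mul_integrable hκ x)

lemma fourierInv_sumKernel_add (h₁ : Integrable κ₁ quadrant) (h₂ : Integrable κ₂ quadrant)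
    (x : ℝ) : 𝓕⁻ (fun ξ => sumKernel κ₁ ξ + sumKernel κ₂ (-ξ)) x =
      quadWave κ₁ x + quadWave κ₂ (-x) := by
  have hb : ∀ {k : ℝ → ℂ}, Integrable k → Integrable fun ξ => ep (ξ * x) * k ξ := fun hk =>
    hk.bdd_mul (c := 1) (continuous_ep.comp (by fun_prop)).aestronglyMeasurable
      (.of_forall fun w => (norm_ep _).le)
  have i1 := hb (integrable_sumKernel h₁)
  have i2 := hb (integrable_sumKernel h₂).comp_neg
  rw [fourierInv_eq_ep]
  simp only [mul_add]
  rw [integral_add i1 i2, integral_ep_mul_sumKernel h₁, ← integral_ep_mul_sumKernel h₂]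
  congr 1
  rw [← integral_neg_eq_self]
  simp only [neg_neg, neg_mul, mul_neg]

/-- The action of a Fourier multiplier on a two-sided superposition of plane waves. -/
theorem FMul_quadWave_add (m : ℝ → ℂ) (h₁ : Integrable κ₁ quadrant) (h₂ : Integrable κ₂ quadrant)
    (hm₁ : Integrable (fun w : ℝ × ℝ => m (w.1 + w.2) * κ₁ w) quadrant)
    (hm₂ : Integrable (fun w : ℝ × ℝ => m (-(w.1 + w.2)) * κ₂ w) quadrant)
    (hW₁ : Integrable (quadWave κ₁)) (hW₂ : Integrable (quadWave κ₂)) (x : ℝ) :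
    FMul m (fun x => quadWave κ₁ x + quadWave κ₂ (-x)) x =
      quadWave (fun w => m (w.1 + w.2) * κ₁ w) x +
        quadWave (fun w => m (-(w.1 + w.2)) * κ₂ w) (-x) := by
  set k : ℝ → ℂ := fun ξ => sumKernel κ₁ ξ + sumKernel κ₂ (-ξ) with hk
  have hki : Integrable k := (integrable_sumKernel h₁).add (integrable_sumKernel h₂).comp_neg
  have hK : 𝓕⁻ k = fun x => quadWave κ₁ x + quadWave κ₂ (-x) :=
    funext fun x => fourierInv_sumKernel_add h₁ h₂ x
  have hKi : Integrable (𝓕⁻ k) := by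
    rw [hK]
    exact hW₁.add hW₂.comp_neg
  rw [FMul, ← hK, ← fourierInv_sumKernel_add hm₁ hm₂]
  refine fourierInv_congr_ae ?_ x
  filter_upwards [fourier_fourierInv_ae_eq hki hKi] with ξ hξ
  rw [hξ, hk]
  simp only [mul_add]
  rw [mul_sumKernel, ← mul_sumKernel (fun s => m (-s)) κ₂ (-ξ), neg_neg]

end QuadrantWave

section Decay

lemma norm_cexp_mul_le_one {z : ℂ} (hz : z.re ≤ 0) {ξ : ℝ} (hξ : 0 ≤ ξ) :
    ‖Complex.exp (z * ξ)‖ ≤ 1 := by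
  rw [Complex.norm_exp, Real.exp_le_one_iff]
  simpa using mul_nonpos_of_nonpos_of_nonneg hz hξ

lemma integrableOn_schwartz_mul_cexp (h : SchwartzMap ℝ ℂ) {z : ℂ} (hz : z.re ≤ 0) :
    IntegrableOn (fun ξ : ℝ => h ξ * Complex.exp (z * ξ)) (Ioi 0) := by
  have := (h.integrable (μ := volume)).integrableOn (s := Ioi (0 : ℝ))
  refine this.mul_bdd (c := 1) (by fun_prop) ?_
  filter_upwards [ae_pos_Ioi] with ξ hξ using norm_cexp_mul_le_one hz hξ.le

lemma norm_integral_schwartz_mul_cexp_le (h : SchwartzMap ℝ ℂ) {z : ℂ} (hz : z.re ≤ 0) :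
    ‖∫ ξ in Ioi (0 : ℝ), h ξ * Complex.exp (z * ξ)‖ ≤ ∫ ξ, ‖h ξ‖ := by
  refine (norm_integral_le_integral_norm _).trans (le_trans ?_
    (setIntegral_le_integral (s := Ioi (0 : ℝ)) h.integrable.norm
      (.of_forall fun _ => norm_nonneg _)))
  refine setIntegral_mono_on (integrableOn_schwartz_mul_cexp h hz).norm
    h.integrable.norm.integrableOn measurableSet_Ioi fun ξ hξ => ?_
  rw [norm_mul]
  exact mul_le_of_le_one_right (norm_nonneg _) (norm_cexp_mul_le_one hz (le_of_lt hξ))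

/-- Two integrations by parts. -/
lemma sq_mul_integral_schwartz_mul_cexp (h : SchwartzMap ℝ ℂ) (h0 : h 0 = 0) {z : ℂ}
    (hz : z.re ≤ 0) :
    z ^ 2 * ∫ ξ in Ioi (0 : ℝ), h ξ * Complex.exp (z * ξ) =
      SchwartzMap.derivCLM ℂ ℂ h 0 + ∫ ξ in Ioi (0 : ℝ),
        SchwartzMap.derivCLM ℂ ℂ (SchwartzMap.derivCLM ℂ ℂ h) ξ * Complex.exp (z * ξ) := by
  set h₁ := SchwartzMap.derivCLM ℂ ℂ h with hh₁
  set h₂ := SchwartzMap.derivCLM ℂ ℂ h₁ with hh₂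
  have d1 : ∀ x, HasDerivAt h (h₁ x) x := fun x => h.differentiableAt.hasDerivAt
  have d2 : ∀ x, HasDerivAt h₁ (h₂ x) x := fun x => h₁.differentiableAt.hasDerivAt
  have i1 := integrableOn_schwartz_mul_cexp h hz
  have i2 := integrableOn_schwartz_mul_cexp h₂ hz
  have de : ∀ x : ℝ, HasDerivAt (fun ξ : ℝ => Complex.exp (z * ξ)) (Complex.exp (z * x) * z) x :=
    fun x => by
      have : HasDerivAt (fun ξ : ℝ => z * (ξ : ℂ)) z x := by
        simpa using (Complex.ofRealCLM.hasDerivAt (x := x)).const_mul z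
      exact this.cexp
  have dΦ : ∀ x : ℝ, HasDerivAt (fun ξ : ℝ => (z * h ξ - h₁ ξ) * Complex.exp (z * ξ))
      (z ^ 2 * (h x * Complex.exp (z * x)) - h₂ x * Complex.exp (z * x)) x := fun x => by
    refine ((((d1 x).const_mul z).sub (d2 x)).mul (de x)).congr_deriv ?_
    simp only [Pi.sub_apply]
    ring
  have lim : Tendsto (fun ξ : ℝ => (z * h ξ - h₁ ξ) * Complex.exp (z * ξ)) atTop (𝓝 0) := by
    have t1 : Tendsto h atTop (𝓝 0) := (zero_at_infty h).mono_left atTop_le_cocompact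
    have t2 : Tendsto h₁ atTop (𝓝 0) := (zero_at_infty h₁).mono_left atTop_le_cocompact
    have t3 : Tendsto (fun ξ : ℝ => z * h ξ - h₁ ξ) atTop (𝓝 0) := by
      simpa using (t1.const_mul z).sub t2
    refine squeeze_zero_norm' ?_ (by simpa using t3.norm)
    filter_upwards [eventually_ge_atTop (0 : ℝ)] with ξ hξ
    rw [norm_mul]
    exact mul_le_of_le_one_right (norm_nonneg _) (norm_cexp_mul_le_one hz hξ)
  have key := integral_Ioi_of_hasDerivAt_of_tendsto (dΦ 0).continuousAt.continuousWithinAt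
    (fun x _ => dΦ x) ((i1.const_mul (z ^ 2)).sub i2) lim
  rw [integral_sub (i1.const_mul (z ^ 2)) i2, integral_const_mul] at key
  rw [h0] at key
  simp only [mul_zero, zero_sub, Complex.ofReal_zero, Complex.exp_zero, mul_one, neg_neg] at key
  linear_combination key

lemma lap_one_eq (F : ℝ → ℂ) (y x : ℝ) :
    lap 1 F y x = ∫ ξ in Ioi (0 : ℝ),
      (ξ * F ξ) * Complex.exp ((2 * π * (-y + x * Complex.I)) * ξ) := by
  rw [lap, lapInt]
  refine integral_congr_ae (.of_forall fun ξ => ?_)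
  simp only [ep, Real.rpow_one]
  push_cast
  have : Complex.exp ((2 * π * (-y + x * Complex.I)) * ξ) =
      Complex.exp (2 * π * (x * ξ) * Complex.I) * Complex.exp (-(2 * π * y * ξ)) := by
    rw [← Complex.exp_add]
    ring_nf
  rw [this]
  ring

/-- The derivative of a Schwartz function extends to the upper half plane with quadratic decay. -/
theorem exists_norm_lap_one_le (F : SchwartzMap ℝ ℂ) :
    ∃ C : ℝ, 0 ≤ C ∧ ∀ y, 0 ≤ y → ∀ x, ‖lap 1 F y x‖ ≤ C * (1 + (x ^ 2 + y ^ 2))⁻¹ := by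
  have hg : Function.HasTemperateGrowth fun ξ : ℝ => (ξ : ℂ) :=
    Complex.ofRealCLM.hasTemperateGrowth
  set h : SchwartzMap ℝ ℂ := SchwartzMap.smulLeftCLM ℂ (fun ξ : ℝ => (ξ : ℂ)) F with hh
  have hF : ∀ ξ, h ξ = ξ * F ξ := fun ξ => SchwartzMap.smulLeftCLM_apply_apply hg F ξ
  set h₁ := SchwartzMap.derivCLM ℂ ℂ h with hh₁
  set h₂ := SchwartzMap.derivCLM ℂ ℂ h₁ with hh₂
  have hI : ∀ k : SchwartzMap ℝ ℂ, 0 ≤ ∫ ξ, ‖k ξ‖ := fun k =>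
    integral_nonneg fun _ => norm_nonneg _
  refine ⟨(∫ ξ, ‖h ξ‖) + (‖h₁ 0‖ + ∫ ξ, ‖h₂ ξ‖), ?_, fun y hy x => ?_⟩
  · have := hI h; have := hI h₂; positivity
  set z : ℂ := 2 * π * (-y + x * Complex.I) with hz
  have hre : z.re ≤ 0 := by
    have : z.re = -(2 * π * y) := by simp [hz]
    rw [this]
    have := Real.pi_pos
    simp only [Left.neg_nonpos_iff]
    positivity
  have hn : x ^ 2 + y ^ 2 ≤ ‖z‖ ^ 2 := by
    have : ‖z‖ ^ 2 = (2 * π) ^ 2 * (x ^ 2 + y ^ 2) := by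
      rw [Complex.sq_norm, Complex.normSq_apply]
      simp [hz]
      ring
    rw [this]
    have h1 : 1 ≤ (2 * π) ^ 2 := by nlinarith [Real.pi_gt_three]
    nlinarith [sq_nonneg x, sq_nonneg y]
  have e : lap 1 F y x = ∫ ξ in Ioi (0 : ℝ), h ξ * Complex.exp (z * ξ) := by
    rw [lap_one_eq, hz]
    simp only [hF]
  have b1 : ‖lap 1 F y x‖ ≤ ∫ ξ, ‖h ξ‖ := e ▸ norm_integral_schwartz_mul_cexp_le h hre
  have b2 : ‖z‖ ^ 2 * ‖lap 1 F y x‖ ≤ ‖h₁ 0‖ + ∫ ξ, ‖h₂ ξ‖ := by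
    rw [← norm_pow, ← norm_mul, e, sq_mul_integral_schwartz_mul_cexp h (by simp [hF]) hre]
    exact (norm_add_le _ _).trans (add_le_add_right (norm_integral_schwartz_mul_cexp_le h₂ hre) _)
  rw [← div_eq_mul_inv, le_div_iff₀ (by positivity)]
  have := mul_le_mul_of_nonneg_left hn (norm_nonneg (lap 1 F y x))
  linarith

end Decay

section Schwartz

/-- The density `(ξ₁ + ξ₂)^s ξ₁ ξ₂ F(ξ₁) G(ξ₂)`. -/
def prodDensity (s : ℝ) (F G : ℝ → ℂ) (w : ℝ × ℝ) : ℂ :=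
  (((w.1 + w.2) ^ s * (w.1 * w.2) : ℝ) : ℂ) * (F w.1 * G w.2)

lemma measurable_prodDensity (s : ℝ) {F G : ℝ → ℂ} (hF : Measurable F) (hG : Measurable G) :
    Measurable (prodDensity s F G) := by
  unfold prodDensity
  have h1 : Measurable fun w : ℝ × ℝ => F w.1 := hF.comp measurable_fst
  have h2 : Measurable fun w : ℝ × ℝ => G w.2 := hG.comp measurable_snd
  have h3 : Measurable fun w : ℝ × ℝ => (w.1 + w.2) ^ s * (w.1 * w.2) := by fun_prop
  exact (Complex.measurable_ofReal.comp h3).mul (h1.mul h2)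

lemma rpow_le_one_add_inv {S s : ℝ} (hS : 0 < S) (hs : -1 ≤ s) (hs' : s ≤ 0) :
    S ^ s ≤ 1 + S⁻¹ := by
  have hi : 0 < S⁻¹ := inv_pos.2 hS
  rcases le_total 1 S with h | h
  · linarith [Real.rpow_le_one_of_one_le_of_nonpos h hs']
  · have := Real.rpow_le_rpow_of_exponent_ge hS h hs
    rw [Real.rpow_neg_one] at this
    linarith

lemma integrable_ofReal_mul_schwartz (F : SchwartzMap ℝ ℂ) :
    Integrable fun ξ : ℝ => (ξ : ℂ) * F ξ := by
  have hg : Function.HasTemperateGrowth fun ξ : ℝ => (ξ : ℂ) :=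
    Complex.ofRealCLM.hasTemperateGrowth
  have := (SchwartzMap.smulLeftCLM ℂ (fun ξ : ℝ => (ξ : ℂ)) F).integrable (μ := volume)
  rwa [SchwartzMap.smulLeftCLM_apply hg] at this

lemma integrable_prodDensity {s : ℝ} (hs : -1 ≤ s) (hs' : s ≤ 0) (F G : SchwartzMap ℝ ℂ) :
    Integrable (prodDensity s F G) quadrant := by
  have i1 := ((integrable_ofReal_mul_schwartz F).restrict (s := Ioi 0)).norm
  have i2 := ((integrable_ofReal_mul_schwartz G).restrict (s := Ioi 0)).norm
  have i3 := (G.integrable (μ := volume)).restrict (s := Ioi 0) |>.norm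
  refine (i1.mul_prod (i2.add i3)).mono' (measurable_prodDensity s F.continuous.measurable
    G.continuous.measurable).aestronglyMeasurable ?_
  filter_upwards [ae_quadrant] with w ⟨h1, h2⟩
  have hS : 0 < w.1 + w.2 := add_pos h1 h2
  have h : (w.1 + w.2) ^ s * (w.1 * w.2) ≤ w.1 * (w.2 + 1) := by
    have e : (w.1 + w.2)⁻¹ * w.2 ≤ 1 := by
      rw [inv_mul_le_iff₀ hS]; linarith
    calc (w.1 + w.2) ^ s * (w.1 * w.2) ≤ (1 + (w.1 + w.2)⁻¹) * (w.1 * w.2) :=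
          mul_le_mul_of_nonneg_right (rpow_le_one_add_inv hS hs hs') (by positivity)
      _ = w.1 * (w.2 + (w.1 + w.2)⁻¹ * w.2) := by ring
      _ ≤ _ := by gcongr
  have h0 : 0 ≤ (w.1 + w.2) ^ s * (w.1 * w.2) := by positivity
  simp only [prodDensity, norm_mul, Complex.norm_real, Pi.add_apply, Real.norm_of_nonneg h0,
    Real.norm_of_nonneg h1.le, Real.norm_of_nonneg h2.le]
  calc (w.1 + w.2) ^ s * (w.1 * w.2) * (‖F w.1‖ * ‖G w.2‖) ≤
        w.1 * (w.2 + 1) * (‖F w.1‖ * ‖G w.2‖) := by gcongr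
    _ = _ := by ring

lemma quadWave_congr {κ₁ κ₂ : ℝ × ℝ → ℂ} (h : ∀ w : ℝ × ℝ, 0 < w.1 → 0 < w.2 → κ₁ w = κ₂ w)
    (x : ℝ) : quadWave κ₁ x = quadWave κ₂ x := by
  refine integral_congr_ae ?_
  filter_upwards [ae_quadrant] with w hw
  rw [h w hw.1 hw.2]

lemma quadWave_const_mul (c : ℂ) (κ : ℝ × ℝ → ℂ) (x : ℝ) :
    quadWave (fun w => c * κ w) x = c * quadWave κ x := by
  rw [quadWave, quadWave, ← integral_const_mul]
  refine integral_congr_ae (.of_forall fun w => ?_)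
  ring

lemma lap_one_mul_lap_one (F G : ℝ → ℂ) (y x : ℝ) :
    lap 1 F y x * lap 1 G y x = ∫ w, ep (x * (w.1 + w.2)) *
      ((Real.exp (-(2 * π * y * (w.1 + w.2))) : ℂ) * prodDensity 0 F G w) ∂quadrant := by
  simp only [lap, lapInt]
  rw [← integral_prod_mul]
  refine integral_congr_ae (.of_forall fun w => ?_)
  simp only [prodDensity, Real.rpow_zero, Real.rpow_one, one_mul]
  rw [mul_add x, ep_add, mul_add, neg_add, Real.exp_add]
  push_cast
  ring

lemma lap_one_zero_mul_lap_one_zero (F G : ℝ → ℂ) (x : ℝ) :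
    lap 1 F 0 x * lap 1 G 0 x = quadWave (prodDensity 0 F G) x := by
  rw [lap_one_mul_lap_one, quadWave]
  simp

lemma measurable_lap_one {F : ℝ → ℂ} (hF : Measurable F) :
    Measurable (Function.uncurry fun y x => lap 1 F y x) :=
  measurable_lapInt (volume.restrict (Ioi (0 : ℝ))) (η := fun ξ : ℝ => ξ) measurable_id 1 hF

lemma integrable_quadWave_zero (F G : SchwartzMap ℝ ℂ) :
    Integrable (quadWave (prodDensity 0 F G)) := by
  obtain ⟨C, hC, h⟩ := exists_norm_lap_one_le F
  obtain ⟨D, hD, h'⟩ := exists_norm_lap_one_le G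
  have e : quadWave (prodDensity 0 F G) = fun x => lap 1 F 0 x * lap 1 G 0 x :=
    funext fun x => (lap_one_zero_mul_lap_one_zero F G x).symm
  rw [e]
  refine (integrable_inv_one_add_sq.const_mul (C * D)).mono'
    (((measurable_lap_one F.continuous.measurable).of_uncurry_left (x := 0)).mul
    ((measurable_lap_one G.continuous.measurable).of_uncurry_left (x := 0))).aestronglyMeasurable
    (.of_forall fun x => ?_)
  have h1 := h 0 le_rfl x
  have h2 := h' 0 le_rfl x
  have h3 : (1 + (x ^ 2 + 0 ^ 2))⁻¹ ≤ 1 := inv_le_one_of_one_le₀ (by nlinarith [sq_nonneg x])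
  rw [norm_mul]
  calc ‖lap 1 F 0 x‖ * ‖lap 1 G 0 x‖ ≤ (C * (1 + (x ^ 2 + 0 ^ 2))⁻¹) * (D * 1) := by
        refine mul_le_mul h1 (h2.trans (by gcongr)) (norm_nonneg _) (by positivity)
    _ = C * D * (1 + x ^ 2)⁻¹ := by ring_nf

lemma integral_two_pi_exp {S : ℝ} (hS : 0 < S) :
    ∫ y in Ioi (0 : ℝ), 2 * π * Real.exp (-(2 * π * y * S)) = S⁻¹ := by
  have hc : 0 < 2 * π * S := by positivity
  have := integral_exp_mul_Ioi (a := -(2 * π * S)) (by linarith) 0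
  rw [integral_const_mul]
  have e : ∀ y : ℝ, Real.exp (-(2 * π * y * S)) = Real.exp (-(2 * π * S) * y) := fun y => by
    ring_nf
  simp only [e, this]
  have := Real.pi_pos
  field_simp
  simp

lemma quadWave_neg_one_eq (F G : SchwartzMap ℝ ℂ) (x : ℝ) :
    quadWave (prodDensity (-1) F G) x =
      ∫ y in Ioi (0 : ℝ), 2 * π * (lap 1 F y x * lap 1 G y x) := by
  have hE := integrable_prodDensity (neg_one_lt_zero.le) le_rfl F G
  have hE1 := integrable_prodDensity le_rfl (neg_one_lt_zero.le) F G
  set Φ : (ℝ × ℝ) → ℝ → ℂ := fun w y => ep (x * (w.1 + w.2)) *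
      (((2 * π * Real.exp (-(2 * π * y * (w.1 + w.2))) : ℝ) : ℂ) * prodDensity 0 F G w) with hΦ
  have hm : AEStronglyMeasurable (Function.uncurry Φ)
      (quadrant.prod (volume.restrict (Ioi (0 : ℝ)))) := by
    have h1 : Measurable fun z : (ℝ × ℝ) × ℝ => prodDensity 0 F G z.1 :=
      (measurable_prodDensity 0 F.continuous.measurable G.continuous.measurable).comp measurable_fst
    have h2 : Continuous fun z : (ℝ × ℝ) × ℝ => ep (x * (z.1.1 + z.1.2)) :=
      continuous_ep.comp (by fun_prop)
    have h3 : Continuous fun z : (ℝ × ℝ) × ℝ =>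
        ((2 * π * Real.exp (-(2 * π * z.2 * (z.1.1 + z.1.2))) : ℝ) : ℂ) := by fun_prop
    exact (h2.measurable.mul (h3.measurable.mul h1)).aestronglyMeasurable
  have hinner : ∀ w : ℝ × ℝ, 0 < w.1 → 0 < w.2 →
      ∫ y in Ioi (0 : ℝ), Φ w y = ep (x * (w.1 + w.2)) * prodDensity (-1) F G w := by
    intro w h1 h2
    simp only [hΦ]
    rw [integral_const_mul, integral_mul_const, integral_complex_ofReal,
      integral_two_pi_exp (add_pos h1 h2)]
    simp only [prodDensity, Real.rpow_zero, Real.rpow_neg_one, one_mul]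
    push_cast
    ring
  have h_int : Integrable (Function.uncurry Φ) (quadrant.prod (volume.restrict (Ioi (0 : ℝ)))) := by
    refine (integrable_prod_iff hm).2 ⟨?_, ?_⟩
    · filter_upwards [ae_quadrant] with w ⟨h1, h2⟩
      have hc : 0 < 2 * π * (w.1 + w.2) := by have := add_pos h1 h2; positivity
      have i := (integrableOn_exp_mul_Ioi (a := -(2 * π * (w.1 + w.2))) (by linarith) 0).const_mul
        (2 * π)
      have i' : IntegrableOn (fun y => 2 * π * Real.exp (-(2 * π * y * (w.1 + w.2)))) (Ioi 0) :=
        i.congr (.of_forall fun y => by simp only; ring_nf)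
      have i'' := ((i'.ofReal (𝕜 := ℂ)).mul_const (prodDensity 0 F G w)).const_mul
        (ep (x * (w.1 + w.2)))
      exact i''
    · refine hE1.norm.congr ?_
      filter_upwards [ae_quadrant] with w ⟨h1, h2⟩
      have hS := add_pos h1 h2
      have e : ∀ y, ‖Function.uncurry Φ (w, y)‖ =
          2 * π * Real.exp (-(2 * π * y * (w.1 + w.2))) * ‖prodDensity 0 F G w‖ := fun y => by
        simp only [Function.uncurry, hΦ, norm_mul, norm_ep, Complex.norm_real, one_mul]
        simp [abs_of_pos Real.pi_pos]
      simp only [e]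
      rw [integral_mul_const, integral_two_pi_exp hS]
      simp only [prodDensity, Real.rpow_zero, Real.rpow_neg_one, one_mul, norm_mul,
        Complex.norm_real, Real.norm_of_nonneg (inv_pos.2 hS).le]
      ring
  have := integral_integral_swap h_int
  rw [quadWave]
  calc _ = ∫ w, (∫ y in Ioi (0 : ℝ), Φ w y) ∂quadrant := by
        refine integral_congr_ae ?_
        filter_upwards [ae_quadrant] with w ⟨h1, h2⟩
        rw [hinner w h1 h2]
    _ = ∫ y in Ioi (0 : ℝ), (∫ w, Φ w y ∂quadrant) := this
    _ = _ := by
        refine integral_congr_ae (.of_forall fun y => ?_)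
        simp only [hΦ]
        rw [lap_one_mul_lap_one, ← integral_const_mul]
        refine integral_congr_ae (.of_forall fun w => ?_)
        simp only
        push_cast
        ring

lemma integrable_quadWave_neg_one (F G : SchwartzMap ℝ ℂ) :
    Integrable (quadWave (prodDensity (-1) F G)) := by
  obtain ⟨C, hC, h⟩ := exists_norm_lap_one_le F
  obtain ⟨D, hD, h'⟩ := exists_norm_lap_one_le G
  have e : quadWave (prodDensity (-1) F G) =
      fun x => ∫ y in Ioi (0 : ℝ), 2 * π * (lap 1 F y x * lap 1 G y x) :=
    funext fun x => quadWave_neg_one_eq F G x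
  rw [e]
  have hm : ∀ K : SchwartzMap ℝ ℂ, Measurable fun z : ℝ × ℝ => lap 1 K z.2 z.1 := fun K => by
    have := (measurable_lap_one K.continuous.measurable).comp measurable_swap
    simpa only [Function.comp_def, Function.uncurry_def, Prod.fst_swap, Prod.snd_swap] using this
  have h_int : Integrable (fun z : ℝ × ℝ => 2 * π * (lap 1 F z.2 z.1 * lap 1 G z.2 z.1))
      (volume.prod (volume.restrict (Ioi (0 : ℝ)))) := by
    refine ((integrable_inv_one_add_sq.mul_prod
      (integrable_inv_one_add_sq.restrict (s := Ioi (0 : ℝ)))).const_mul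
      (2 * π * (C * D))).mono' (((hm F).mul (hm G)).const_mul _).aestronglyMeasurable ?_
    have hpos : ∀ᵐ z ∂((volume : Measure ℝ).prod (volume.restrict (Ioi (0 : ℝ)))), 0 < z.2 :=
      Measure.quasiMeasurePreserving_snd.ae ae_pos_Ioi
    filter_upwards [hpos] with z hz
    have h1 := h z.2 hz.le z.1
    have h2 := h' z.2 hz.le z.1
    have h3 : (1 + (z.1 ^ 2 + z.2 ^ 2))⁻¹ * (1 + (z.1 ^ 2 + z.2 ^ 2))⁻¹ ≤
        (1 + z.1 ^ 2)⁻¹ * (1 + z.2 ^ 2)⁻¹ := by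
      gcongr
      · nlinarith [sq_nonneg z.2]
      · nlinarith [sq_nonneg z.1]
    rw [norm_mul, norm_mul, norm_mul, Complex.norm_real, Complex.norm_ofNat,
      Real.norm_of_nonneg Real.pi_pos.le, mul_assoc (2 * π)]
    refine mul_le_mul_of_nonneg_left ?_ (by positivity)
    calc ‖lap 1 F z.2 z.1‖ * ‖lap 1 G z.2 z.1‖ ≤
          (C * (1 + (z.1 ^ 2 + z.2 ^ 2))⁻¹) * (D * (1 + (z.1 ^ 2 + z.2 ^ 2))⁻¹) :=
          mul_le_mul h1 h2 (norm_nonneg _) (by positivity)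
      _ = C * D * ((1 + (z.1 ^ 2 + z.2 ^ 2))⁻¹ * (1 + (z.1 ^ 2 + z.2 ^ 2))⁻¹) := by ring
      _ ≤ _ := by gcongr
  exact h_int.integral_prod_left

end Schwartz

section Multiplier

lemma wavePos_ofReal_mul (F : ℝ → ℂ) (y : ℝ) :
    ∫ v, ep (v * y) * ((if 0 ≤ v then 1 else 0) * (Complex.I * v * F v)) =
      Complex.I * lap 1 F 0 y := by
  rw [lap, lapInt, ← integral_Ici_eq_integral_Ioi, ← integral_indicator measurableSet_Ici,
    ← integral_const_mul]
  refine integral_congr_ae (.of_forall fun v => ?_)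
  simp only [indicator_apply, mem_Ici]
  split_ifs
  · simp [mul_comm v y]
    ring
  · simp

variable (φ ψ : SchwartzMap ℝ ℂ)

lemma fourier_Dx1 (ξ : ℝ) : 𝓕 (Dx1 φ) ξ = Complex.I * ξ * 𝓕 (φ : ℝ → ℂ) ξ := by
  have hg : Function.HasTemperateGrowth fun ξ : ℝ => Complex.I * (ξ : ℂ) :=
    (Complex.I • Complex.ofRealCLM).hasTemperateGrowth
  set h : SchwartzMap ℝ ℂ := SchwartzMap.smulLeftCLM ℂ (fun ξ : ℝ => Complex.I * (ξ : ℂ)) (𝓕 φ)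
    with hh
  have hF : ∀ ξ, h ξ = Complex.I * ξ * 𝓕 (φ : ℝ → ℂ) ξ := fun ξ =>
    SchwartzMap.smulLeftCLM_apply_apply hg (𝓕 φ) ξ
  have e : Dx1 φ = (𝓕⁻ h : SchwartzMap ℝ ℂ) := by
    rw [SchwartzMap.fourierInv_coe, Dx1, FMul]
    congr 1
    exact funext fun ξ => (hF ξ).symm
  rw [e, ← SchwartzMap.fourier_coe, FourierTransform.fourier_fourierInv_eq, hF]

lemma Pplus_Dx1 (y : ℝ) : Pplus (Dx1 φ) y = Complex.I * lap 1 (𝓕 φ : SchwartzMap ℝ ℂ) 0 y := by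
  rw [Pplus, FMul, fourierInv_eq_ep, ← wavePos_ofReal_mul]
  simp only [fourier_Dx1, SchwartzMap.fourier_coe]

lemma Pminus_Dx1 (y : ℝ) :
    Pminus (Dx1 φ) y = -(Complex.I * lap 1 (𝓕⁻ φ : SchwartzMap ℝ ℂ) 0 (-y)) := by
  rw [Pminus, FMul, fourierInv_eq_ep, ← wavePos_ofReal_mul, ← integral_neg_eq_self, ← integral_neg]
  refine integral_congr_ae (.of_forall fun v => ?_)
  simp only [fourier_Dx1, SchwartzMap.fourierInv_coe, fourierInv_eq_fourier_neg, neg_nonpos]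
  split_ifs
  · push_cast
    ring_nf
  · simp

/-- The operator `D^α G(φ, ψ)` as a two-sided superposition of plane waves. -/
theorem Dop_Gbil_eq {α : ℝ} (hα0 : 0 ≤ α) (hα1 : α ≤ 1) (x : ℝ) :
    Dop α (Gbil φ ψ) x =
      quadWave (prodDensity (α - 1) (𝓕 φ : SchwartzMap ℝ ℂ) (𝓕 ψ : SchwartzMap ℝ ℂ)) x +
        quadWave (prodDensity (α - 1) (𝓕⁻ φ : SchwartzMap ℝ ℂ) (𝓕⁻ ψ : SchwartzMap ℝ ℂ)) (-x) := by
  set F : SchwartzMap ℝ ℂ := 𝓕 φ with hF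
  set G : SchwartzMap ℝ ℂ := 𝓕 ψ with hG
  set F' : SchwartzMap ℝ ℂ := 𝓕⁻ φ with hF'
  set G' : SchwartzMap ℝ ℂ := 𝓕⁻ ψ with hG'
  set c₁ : ℝ × ℝ → ℂ := fun w => Complex.I * prodDensity 0 F G w with hc₁
  set c₂ : ℝ × ℝ → ℂ := fun w => -Complex.I * prodDensity 0 F' G' w with hc₂
  have hin : (fun y => -Complex.I * Pplus (Dx1 φ) y * Pplus (Dx1 ψ) y
      + Complex.I * Pminus (Dx1 φ) y * Pminus (Dx1 ψ) y) =
      fun y => quadWave c₁ y + quadWave c₂ (-y) := by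
    funext y
    rw [quadWave_const_mul, quadWave_const_mul, ← lap_one_zero_mul_lap_one_zero,
      ← lap_one_zero_mul_lap_one_zero, Pplus_Dx1, Pplus_Dx1, Pminus_Dx1, Pminus_Dx1]
    linear_combination (-Complex.I * lap 1 F 0 y * lap 1 G 0 y +
      Complex.I * lap 1 F' 0 (-y) * lap 1 G' 0 (-y)) * Complex.I_sq
  set m : ℝ → ℂ := fun ξ => if ξ = 0 then 0 else (Complex.I * ξ)⁻¹ with hm
  have hS : ∀ {w : ℝ × ℝ}, 0 < w.1 → 0 < w.2 → ((w.1 + w.2 : ℝ) : ℂ) ≠ 0 := fun h1 h2 =>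
    Complex.ofReal_ne_zero.2 (add_pos h1 h2).ne'
  have e₁ : ∀ w : ℝ × ℝ, 0 < w.1 → 0 < w.2 → m (w.1 + w.2) * c₁ w = prodDensity (-1) F G w := by
    intro w h1 h2
    have h0 := hS h1 h2
    simp only [hm, hc₁, (add_pos h1 h2).ne', if_false, prodDensity, Real.rpow_zero,
      Real.rpow_neg_one, one_mul, Complex.ofReal_mul, Complex.ofReal_inv]
    field_simp [Complex.I_ne_zero]
  have e₂ : ∀ w : ℝ × ℝ, 0 < w.1 → 0 < w.2 →
      m (-(w.1 + w.2)) * c₂ w = prodDensity (-1) F' G' w := by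
    intro w h1 h2
    have h0 := hS h1 h2
    simp only [hm, hc₂, neg_eq_zero, (add_pos h1 h2).ne', if_false, prodDensity, Real.rpow_zero,
      Real.rpow_neg_one, one_mul, Complex.ofReal_mul, Complex.ofReal_inv, Complex.ofReal_neg]
    field_simp [Complex.I_ne_zero]
  have hae : ∀ {κ₁ κ₂ : ℝ × ℝ → ℂ}, (∀ w : ℝ × ℝ, 0 < w.1 → 0 < w.2 → κ₁ w = κ₂ w) →
      Integrable κ₂ quadrant → Integrable κ₁ quadrant := fun h hi => by
    refine hi.congr ?_
    filter_upwards [ae_quadrant] with w hw using (h w hw.1 hw.2).symm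
  have i0 : ∀ F G : SchwartzMap ℝ ℂ, Integrable (prodDensity 0 F G) quadrant :=
    integrable_prodDensity neg_one_lt_zero.le le_rfl
  have i1 : ∀ F G : SchwartzMap ℝ ℂ, Integrable (prodDensity (-1) F G) quadrant :=
    integrable_prodDensity le_rfl neg_one_lt_zero.le
  have hW : ∀ (c : ℂ) (F G : SchwartzMap ℝ ℂ),
      Integrable (quadWave fun w => c * prodDensity 0 F G w) := fun c F G => by
    have : (quadWave fun w => c * prodDensity 0 F G w) =
        fun x => c * quadWave (prodDensity 0 F G) x := funext fun x => quadWave_const_mul _ _ x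
    rw [this]
    exact (integrable_quadWave_zero F G).const_mul c
  have hG1 : Gbil φ ψ = fun x => quadWave (prodDensity (-1) F G) x +
      quadWave (prodDensity (-1) F' G') (-x) := by
    funext x
    rw [Gbil, hin, FMul_quadWave_add m ((i0 F G).const_mul _) ((i0 F' G').const_mul _)
      (hae e₁ (i1 F G)) (hae e₂ (i1 F' G')) (hW _ F G) (hW _ F' G'), quadWave_congr e₁,
      quadWave_congr e₂]
  have e₃ : ∀ (F G : SchwartzMap ℝ ℂ) (w : ℝ × ℝ), 0 < w.1 → 0 < w.2 →
      ((|w.1 + w.2| ^ α : ℝ) : ℂ) * prodDensity (-1) F G w = prodDensity (α - 1) F G w := by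
    intro F G w h1 h2
    have hs := add_pos h1 h2
    simp only [prodDensity, abs_of_pos hs]
    rw [← mul_assoc, ← Complex.ofReal_mul, ← mul_assoc (_ ^ α), ← Real.rpow_add hs, sub_eq_add_neg]
  have e₄ : ∀ (F G : SchwartzMap ℝ ℂ) (w : ℝ × ℝ), 0 < w.1 → 0 < w.2 →
      ((|-(w.1 + w.2)| ^ α : ℝ) : ℂ) * prodDensity (-1) F G w = prodDensity (α - 1) F G w := by
    simpa only [abs_neg] using e₃
  have i2 : ∀ F G : SchwartzMap ℝ ℂ, Integrable (prodDensity (α - 1) F G) quadrant :=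
    integrable_prodDensity (by linarith) (by linarith)
  rw [Dop, hG1, FMul_quadWave_add _ (i1 F G) (i1 F' G') (hae (e₃ F G) (i2 F G))
    (hae (e₄ F' G') (i2 F' G')) (integrable_quadWave_neg_one F G)
    (integrable_quadWave_neg_one F' G'), quadWave_congr (e₃ F G), quadWave_congr (e₄ F' G')]

end Multiplier

section Slices

open scoped LineDeriv

/-- The slice of a Schwartz function of two variables at a fixed time. -/
def slice (f : SchwartzMap (ℝ × ℝ) ℂ) (t : ℝ) : SchwartzMap ℝ ℂ :=
  SchwartzMap.compCLM ℂ (g := fun y : ℝ => (y, t))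
    (by
      convert (ContinuousLinearMap.inl ℝ ℝ ℝ).hasTemperateGrowth.add (.const ((0, t) : ℝ × ℝ))
        using 1
      ext y <;> simp)
    ⟨1, 1, fun y => by
      have : ‖y‖ ≤ ‖(y, t)‖ := norm_fst_le (y, t)
      rw [one_mul, pow_one]
      linarith⟩ f

lemma slice_apply (f : SchwartzMap (ℝ × ℝ) ℂ) (t y : ℝ) : slice f t y = f (y, t) := rfl

lemma exists_norm_slice_le (f : SchwartzMap (ℝ × ℝ) ℂ) :
    ∃ C : ℝ, ∀ t y, ‖slice f t y‖ ≤ C * (1 + y ^ 2)⁻¹ := by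
  obtain ⟨C₀, -, h₀⟩ := f.decay 0 0
  obtain ⟨C₂, -, h₂⟩ := f.decay 2 0
  refine ⟨C₀ + C₂, fun t y => ?_⟩
  have e₀ := h₀ (y, t)
  have e₂ := h₂ (y, t)
  simp only [pow_zero, one_mul, norm_iteratedFDeriv_zero] at e₀ e₂
  have hy : y ^ 2 ≤ ‖(y, t)‖ ^ 2 := by
    rw [← sq_abs, ← Real.norm_eq_abs]
    exact pow_le_pow_left₀ (norm_nonneg _) (norm_fst_le (y, t)) 2
  rw [← div_eq_mul_inv, le_div_iff₀ (by positivity), slice_apply]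
  nlinarith [mul_le_mul_of_nonneg_right hy (norm_nonneg (f (y, t)))]

lemma deriv_slice (f : SchwartzMap (ℝ × ℝ) ℂ) (t : ℝ) :
    deriv (slice f t) = slice (∂_{((1, 0) : ℝ × ℝ)} f) t := by
  funext y
  rw [slice_apply, SchwartzMap.lineDerivOp_apply_eq_fderiv]
  have h1 : HasFDerivAt f (fderiv ℝ f (y, t)) (y, t) := f.differentiableAt.hasFDerivAt
  have h2 : HasDerivAt (fun y : ℝ => (y, t)) ((1, 0) : ℝ × ℝ) y :=
    (hasDerivAt_id y).prodMk (hasDerivAt_const y t)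
  exact (h1.comp_hasDerivAt y h2).deriv

lemma norm_fourier_le_integral (φ : SchwartzMap ℝ ℂ) (ξ : ℝ) :
    ‖𝓕 (φ : ℝ → ℂ) ξ‖ ≤ ∫ y, ‖φ y‖ := by
  rw [fourier_eq_ep]
  refine (norm_integral_le_integral_norm _).trans_eq ?_
  simp only [norm_mul, norm_ep, one_mul]

lemma exists_pow_mul_fourier_slice_le (k : ℕ) (f : SchwartzMap (ℝ × ℝ) ℂ) :
    ∃ C : ℝ, ∀ t ξ, |ξ| ^ k * ‖𝓕 (slice f t : ℝ → ℂ) ξ‖ ≤ C := by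
  induction k generalizing f with
  | zero =>
    obtain ⟨C, hC⟩ := exists_norm_slice_le f
    refine ⟨∫ y : ℝ, C * (1 + y ^ 2)⁻¹, fun t ξ => ?_⟩
    rw [pow_zero, one_mul]
    exact (norm_fourier_le_integral _ ξ).trans (integral_mono (slice f t).integrable.norm
      (integrable_inv_one_add_sq.const_mul C) (hC t))
  | succ k ih =>
    obtain ⟨C, hC⟩ := ih (∂_{((1, 0) : ℝ × ℝ)} f)
    refine ⟨C, fun t ξ => le_trans ?_ (hC t ξ)⟩
    rw [← deriv_slice, Real.fourier_deriv (slice f t).integrable (slice f t).differentiable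
      (by rw [deriv_slice]; exact (slice _ t).integrable), pow_succ, mul_assoc]
    refine mul_le_mul_of_nonneg_left ?_ (by positivity)
    simp only [smul_eq_mul, norm_mul, Complex.norm_ofNat, Complex.norm_real, Complex.norm_I,
      Real.norm_of_nonneg Real.pi_pos.le, mul_one, Real.norm_eq_abs]
    refine mul_le_mul_of_nonneg_right ?_ (norm_nonneg _)
    nlinarith [Real.pi_gt_three, abs_nonneg ξ]

lemma exists_fourier_slice_le (f : SchwartzMap (ℝ × ℝ) ℂ) :
    ∃ C : ℝ, ∀ t ξ, (1 + |ξ|) * ‖𝓕 (slice f t : ℝ → ℂ) ξ‖ ≤ C * (1 + ξ ^ 2)⁻¹ := by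
  choose C hC using fun k => exists_pow_mul_fourier_slice_le k f
  refine ⟨C 0 + C 1 + C 2 + C 3, fun t ξ => ?_⟩
  rw [← div_eq_mul_inv, le_div_iff₀ (by positivity), ← sq_abs]
  have h0 := hC 0 t ξ
  have h1 := hC 1 t ξ
  have h2 := hC 2 t ξ
  have h3 := hC 3 t ξ
  nlinarith

lemma measurable_fourier_slice (f : SchwartzMap (ℝ × ℝ) ℂ) :
    Measurable (Function.uncurry fun ξ t => 𝓕 (slice f t : ℝ → ℂ) ξ) := by
  have h : Continuous (Function.uncurry fun (p : ℝ × ℝ) (v : ℝ) =>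
      ep (-(v * p.1)) * f (v, p.2)) := by
    have h1 : Continuous fun z : (ℝ × ℝ) × ℝ => ep (-(z.2 * z.1.1)) :=
      continuous_ep.comp (by fun_prop)
    have h2 : Continuous fun z : (ℝ × ℝ) × ℝ => f (z.2, z.1.2) := f.continuous.comp (by fun_prop)
    exact h1.mul h2
  have hmeas := (h.measurable.stronglyMeasurable.integral_prod_right (ν := volume)).measurable
  have e : (Function.uncurry fun ξ t => 𝓕 (slice f t : ℝ → ℂ) ξ) =
      fun p : ℝ × ℝ => ∫ v, ep (-(v * p.1)) * f (v, p.2) := by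
    funext p
    simp only [Function.uncurry, fourier_eq_ep, slice_apply]
  rw [e]
  exact hmeas

/-- The density of `D^γ f(·, t)`. -/
def sliceDensity (γ : ℝ) (f : SchwartzMap (ℝ × ℝ) ℂ) (ξ t : ℝ) : ℂ :=
  ((|ξ| ^ γ : ℝ) : ℂ) * 𝓕 (slice f t : ℝ → ℂ) ξ

lemma abs_rpow_le_one_add {γ : ℝ} (h0 : 0 ≤ γ) (h1 : γ ≤ 1) (ξ : ℝ) : |ξ| ^ γ ≤ 1 + |ξ| := by
  rcases le_total |ξ| 1 with h | h
  · linarith [Real.rpow_le_one (abs_nonneg ξ) h h0, abs_nonneg ξ]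
  · have := Real.rpow_le_rpow_of_exponent_le h h1
    rw [Real.rpow_one] at this
    linarith

lemma exists_density_sliceDensity {γ : ℝ} (h0 : 0 ≤ γ) (h1 : γ ≤ 1)
    (f : SchwartzMap (ℝ × ℝ) ℂ) : ∃ M, Density (sliceDensity γ f) M := by
  obtain ⟨C, hC⟩ := exists_fourier_slice_le f
  have hm : Measurable (Function.uncurry (sliceDensity γ f)) := by
    have e : Measurable fun p : ℝ × ℝ => ((|p.1| ^ γ : ℝ) : ℂ) := by fun_prop
    exact e.mul (measurable_fourier_slice f)
  have hb : ∀ t ξ, ‖sliceDensity γ f ξ t‖ ≤ C * (1 + ξ ^ 2)⁻¹ := fun t ξ => by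
    refine le_trans ?_ (hC t ξ)
    rw [sliceDensity, norm_mul, Complex.norm_real, Real.norm_of_nonneg (by positivity)]
    exact mul_le_mul_of_nonneg_right (abs_rpow_le_one_add h0 h1 ξ) (norm_nonneg _)
  have hi : ∀ t, Integrable fun ξ => sliceDensity γ f ξ t := fun t =>
    (integrable_inv_one_add_sq.const_mul C).mono' hm.of_uncurry_right.aestronglyMeasurable
      (.of_forall (hb t))
  exact ⟨∫ ξ : ℝ, C * (1 + ξ ^ 2)⁻¹, hm, hi, fun t =>
    integral_mono (hi t).norm (integrable_inv_one_add_sq.const_mul C) (hb t)⟩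

lemma Density.comp_neg {τ : Type*} [MeasurableSpace τ] {k : ℝ → τ → ℂ} {M : ℝ}
    (hk : Density k M) : Density (fun ξ t => k (-ξ) t) M where
  meas := measurable_uncurry_comp hk.meas (by fun_prop) (by fun_prop)
  int t := (hk.int t).comp_neg
  bound t := by
    rw [integral_neg_eq_self (fun ξ => ‖k ξ t‖)]
    exact hk.bound t

lemma wave_sliceDensity (γ : ℝ) (f : SchwartzMap (ℝ × ℝ) ℂ) (x t : ℝ) :
    wave (fun ξ => sliceDensity γ f ξ t) x = Dop γ (slice f t) x := by
  rw [Dop, FMul, fourierInv_eq_ep, wave]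
  simp only [mul_comm _ x, sliceDensity]

lemma wave_comp_neg (k : ℝ → ℂ) (x : ℝ) : wave (fun ξ => k (-ξ)) x = wave k (-x) := by
  rw [wave, wave, ← integral_neg_eq_self]
  simp only [neg_neg, mul_neg, neg_mul]

lemma mixedNorm_comp_neg {τ : Type*} [MeasurableSpace τ] (p q : ℝ) (ν : Measure τ)
    (F : ℝ → τ → ℝ≥0∞) : mixedNorm p q ν (fun x t => F (-x) t) = mixedNorm p q ν F := by
  simp only [mixedNorm, Lnorm]
  rw [lintegral_neg_eq_self fun x => ((∫⁻ t, F x t ^ q ∂ν) ^ (1 / q)) ^ p]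

lemma measurable_bilWave {τ : Type*} [MeasurableSpace τ] (a b : ℝ) {k₁ k₂ : ℝ → τ → ℂ}
    (hk₁ : Measurable (Function.uncurry k₁)) (hk₂ : Measurable (Function.uncurry k₂)) :
    Measurable (Function.uncurry (bilWave a b k₁ k₂)) := by
  have := measurable_lapInt_slice quadrant (η := fun w : ℝ × ℝ => w.1 + w.2) (by fun_prop) 0 0
    (measurable_bilDensity a b hk₁ hk₂)
  simp only [lapInt_zero_zero] at this
  exact this

variable {α γ₁ γ₂ : ℝ}

lemma bilDensity_sliceDensity (hγ : γ₁ + γ₂ = α + 1) (t : ℝ)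
    {k₁ k₂ : ℝ → ℝ → ℂ} {F G : ℝ → ℂ} (h₁ : ∀ ξ, k₁ ξ t = ((|ξ| ^ γ₁ : ℝ) : ℂ) * F ξ)
    (h₂ : ∀ ξ, k₂ ξ t = ((|ξ| ^ γ₂ : ℝ) : ℂ) * G ξ) {w : ℝ × ℝ} (hw₁ : 0 < w.1) (hw₂ : 0 < w.2) :
    prodDensity (α - 1) F G w = bilDensity (1 - γ₁) (1 - γ₂) k₁ k₂ w t := by
  have e : ∀ {s γ : ℝ}, 0 < s → s ^ (1 - γ) * s ^ γ = s := fun hs => by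
    rw [← Real.rpow_add hs]; simp
  rw [prodDensity, bilDensity, h₁, h₂, abs_of_pos hw₁, abs_of_pos hw₂,
    show -(1 - γ₁ + (1 - γ₂)) = α - 1 by linarith]
  have h : w.1 * w.2 = w.1 ^ (1 - γ₁) * w.2 ^ (1 - γ₂) * (w.1 ^ γ₁ * w.2 ^ γ₂) := by
    rw [mul_mul_mul_comm, e hw₁, e hw₂]
  rw [h]
  push_cast
  ring

end Slices

section Final

variable {p q : ℝ≥0∞}

lemma eLpNorm_eq_Lnorm {X E : Type*} [MeasurableSpace X] [NormedAddCommGroup E] (hp : p ≠ 0)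
    (hp' : p ≠ ∞) (μ : Measure X) (F : X → E) :
    eLpNorm F p μ = Lnorm p.toReal μ (fun x => ‖F x‖ₑ) :=
  eLpNorm_eq_lintegral_rpow_enorm_toReal hp hp'

lemma LpLq_le_mixedNorm (hp : p ≠ 0) (hp' : p ≠ ∞) (hq : q ≠ 0) (hq' : q ≠ ∞) (T : ℝ)
    (F : ℝ → ℝ → ℂ) :
    LpLq p q T F ≤ mixedNorm p.toReal q.toReal (volume.restrict (Ioc (0 : ℝ) T))
      (fun x t => ‖F x t‖ₑ) := by
  rw [LpLq, eLpNorm_eq_Lnorm hp hp', mixedNorm]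
  refine Lnorm_mono (ENNReal.toReal_pos hp hp') fun x => ?_
  rw [Real.enorm_of_nonneg ENNReal.toReal_nonneg, eLpNorm_eq_Lnorm hq hq']
  exact ENNReal.ofReal_toReal_le

lemma mixedNorm_le_LpLq (hp : p ≠ 0) (hp' : p ≠ ∞) (hq : q ≠ 0) (hq' : q ≠ ∞) (T : ℝ)
    {F : ℝ → ℝ → ℂ} (hF : ∀ x, eLpNorm (F x) q (volume.restrict (Ioc (0 : ℝ) T)) ≠ ∞) :
    mixedNorm p.toReal q.toReal (volume.restrict (Ioc (0 : ℝ) T)) (fun x t => ‖F x t‖ₑ) ≤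
      LpLq p q T F := by
  rw [LpLq, eLpNorm_eq_Lnorm hp hp', mixedNorm]
  refine Lnorm_mono (ENNReal.toReal_pos hp hp') fun x => ?_
  rw [Real.enorm_of_nonneg ENNReal.toReal_nonneg, ENNReal.ofReal_toReal (hF x),
    eLpNorm_eq_Lnorm hq hq']

lemma one_div_toReal_add {p₁ p₂ : ℝ≥0∞} (hp₁ : 1 < p₁) (hp₂ : 1 < p₂)
    (h : 1 / p₁ + 1 / p₂ = 1 / p) : 1 / p₁.toReal + 1 / p₂.toReal = 1 / p.toReal := by
  have h' := congrArg ENNReal.toReal h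
  simp only [one_div] at h' ⊢
  rwa [ENNReal.toReal_add (ENNReal.inv_ne_top.2 (by positivity))
    (ENNReal.inv_ne_top.2 (by positivity)), ENNReal.toReal_inv, ENNReal.toReal_inv,
    ENNReal.toReal_inv] at h'

lemma one_lt_toReal (hp : 1 < p) (hp' : p ≠ ∞) : 1 < p.toReal := by
  rwa [← ENNReal.toReal_one, ENNReal.toReal_lt_toReal ENNReal.one_ne_top hp']

lemma eLpNorm_wave_ne_top {k : ℝ → ℝ → ℂ} {M : ℝ} (hk : Density k M) (q : ℝ≥0∞) (x : ℝ)
    (ν : Measure ℝ) [IsFiniteMeasure ν] :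
    eLpNorm (fun t => wave (fun ξ => k ξ t) x) q ν ≠ ∞ := by
  refine ne_top_of_le_ne_top ?_ (eLpNorm_le_of_ae_bound (p := q) (C := M)
    (.of_forall fun t => (norm_wave_le _ x).trans (hk.bound t)))
  exact ENNReal.mul_ne_top (ENNReal.rpow_ne_top_of_nonneg (by positivity)
    (measure_ne_top ν _)) ENNReal.ofReal_ne_top

variable {α γ₁ γ₂ : ℝ}

lemma Dop_Gbil_slice_eq (hα0 : 0 ≤ α) (hα1 : α ≤ 1) (hγ : γ₁ + γ₂ = α + 1)
    (f g : SchwartzMap (ℝ × ℝ) ℂ) (x t : ℝ) :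
    Dop α (Gbil (slice f t) (slice g t)) x =
      bilWave (1 - γ₁) (1 - γ₂) (sliceDensity γ₁ f) (sliceDensity γ₂ g) x t +
      bilWave (1 - γ₁) (1 - γ₂) (fun ξ t => sliceDensity γ₁ f (-ξ) t)
        (fun ξ t => sliceDensity γ₂ g (-ξ) t) (-x) t := by
  rw [Dop_Gbil_eq _ _ hα0 hα1]
  congr 1
  · refine quadWave_congr (fun w h₁ h₂ => ?_) x
    refine bilDensity_sliceDensity hγ t (fun ξ => ?_) (fun ξ => ?_) h₁ h₂ <;>
      rw [SchwartzMap.fourier_coe, sliceDensity]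
  · refine quadWave_congr (fun w h₁ h₂ => ?_) (-x)
    refine bilDensity_sliceDensity hγ t (fun ξ => ?_) (fun ξ => ?_) h₁ h₂ <;>
      rw [SchwartzMap.fourierInv_coe, sliceDensity, abs_neg, Real.fourierInv_eq_fourier_neg]

lemma mixedNorm_wave_comp_neg (p q : ℝ) (ν : Measure ℝ) (k : ℝ → ℝ → ℂ) :
    mixedNorm p q ν (fun x t => ‖wave (fun ξ => k (-ξ) t) x‖ₑ) =
      mixedNorm p q ν (fun x t => ‖wave (fun ξ => k ξ t) x‖ₑ) := by
  refine Eq.trans ?_ (mixedNorm_comp_neg p q ν fun x t => ‖wave (fun ξ => k ξ t) x‖ₑ)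
  congr with x t
  rw [wave_comp_neg fun ξ => k ξ t]

lemma mixedNorm_Dop_Gbil_le {p q p₁ q₁ p₂ q₂ : ℝ} (hα0 : 0 ≤ α) (hα1 : α ≤ 1) (hγ₁0 : 0 ≤ γ₁)
    (hγ₁1 : γ₁ ≤ 1) (hγ₂0 : 0 ≤ γ₂) (hγ₂1 : γ₂ ≤ 1) (hγ : γ₁ + γ₂ = α + 1)
    (hp : 1 < p) (hq : 1 < q) (hp₁ : 1 < p₁) (hq₁ : 1 < q₁) (hp₂ : 1 < p₂) (hq₂ : 1 < q₂)
    (hps : 1 / p₁ + 1 / p₂ = 1 / p) (hqs : 1 / q₁ + 1 / q₂ = 1 / q) :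
    ∃ C : ℝ≥0∞, C ≠ ∞ ∧ ∀ (ν : Measure ℝ) [IsFiniteMeasure ν] (f g : SchwartzMap (ℝ × ℝ) ℂ),
      mixedNorm p q ν (fun x t => ‖Dop α (Gbil (slice f t) (slice g t)) x‖ₑ) ≤
        C * (mixedNorm p₁ q₁ ν (fun x t => ‖Dop γ₁ (slice f t) x‖ₑ) *
          mixedNorm p₂ q₂ ν (fun x t => ‖Dop γ₂ (slice g t) x‖ₑ)) := by
  obtain ⟨C, hC, h⟩ := exists_mixedNorm_bilWave_le (τ := ℝ) (a := 1 - γ₁) (b := 1 - γ₂) hp hq hp₁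
    hq₁ hp₂ hq₂ hps hqs (by linarith) (by linarith) (by linarith)
  refine ⟨2 * C, ENNReal.mul_ne_top ENNReal.ofNat_ne_top hC, fun ν _ f g => ?_⟩
  obtain ⟨M₁, hM₁⟩ := exists_density_sliceDensity hγ₁0 hγ₁1 f
  obtain ⟨M₂, hM₂⟩ := exists_density_sliceDensity hγ₂0 hγ₂1 g
  have e₁ := h ν _ _ _ _ hM₁ hM₂
  have e₂ := h ν _ _ _ _ hM₁.comp_neg hM₂.comp_neg
  rw [mixedNorm_wave_comp_neg, mixedNorm_wave_comp_neg] at e₂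
  have m₁ := (measurable_bilWave (1 - γ₁) (1 - γ₂) hM₁.meas hM₂.meas).enorm
  have m₂ := (measurable_uncurry_comp (measurable_bilWave (1 - γ₁) (1 - γ₂) hM₁.comp_neg.meas
    hM₂.comp_neg.meas) (f := fun z : ℝ × ℝ => -z.1) (g := Prod.snd) (by fun_prop)
    (by fun_prop)).enorm
  rw [← mixedNorm_comp_neg] at e₂
  simp only [← wave_sliceDensity]
  refine (mixedNorm_mono (by linarith) (by linarith) fun x t => ?_).trans
    ((mixedNorm_add_le hp.le hq.le m₁ m₂).trans ((add_le_add e₁ e₂).trans_eq ?_))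
  · rw [Dop_Gbil_slice_eq hα0 hα1 hγ]
    exact enorm_add_le _ _
  · rw [two_mul, add_mul]

end Final

end MixedNorm

/-- **Bilinear estimate for the operator `G`** (Lemma 2.13 of the paper).
For `0 ≤ α ≤ 1`, `0 ≤ γ₁,γ₂ ≤ 1` with `γ₁ + γ₂ = α + 1`, `1 < p,q < ∞` and
Hölder-compatible exponents,
`‖D_x^α G(f,g)‖_{L^p_x L^q_T} ≲ ‖D_x^{γ₁} f‖_{L^{p₁}_x L^{q₁}_T}
  ‖D_x^{γ₂} g‖_{L^{p₂}_x L^{q₂}_T}`. -/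
theorem G_bilinear_estimate
    (α γ₁ γ₂ : ℝ) (hα0 : 0 ≤ α) (hα1 : α ≤ 1)
    (hγ₁0 : 0 ≤ γ₁) (hγ₁1 : γ₁ ≤ 1) (hγ₂0 : 0 ≤ γ₂) (hγ₂1 : γ₂ ≤ 1)
    (hγ : γ₁ + γ₂ = α + 1)
    (p q p₁ q₁ p₂ q₂ : ℝ≥0∞)
    (hp : 1 < p) (hp' : p ≠ ∞) (hq : 1 < q) (hq' : q ≠ ∞)
    (hp₁ : 1 < p₁) (hp₁' : p₁ ≠ ∞) (hq₁ : 1 < q₁) (hq₁' : q₁ ≠ ∞)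
    (hp₂ : 1 < p₂) (hp₂' : p₂ ≠ ∞) (hq₂ : 1 < q₂) (hq₂' : q₂ ≠ ∞)
    (hpsum : 1/p₁ + 1/p₂ = 1/p) (hqsum : 1/q₁ + 1/q₂ = 1/q) :
    ∃ C : ℝ≥0, 0 < C ∧ ∀ (T : ℝ), 0 < T → ∀ f g : SchwartzMap (ℝ × ℝ) ℂ,
      LpLq p q T (fun x t => Dop α (Gbil (fun y => f (y, t)) (fun y => g (y, t))) x)
        ≤ C * LpLq p₁ q₁ T (sliceOp (Dop γ₁) (fun x t => f (x, t)))
            * LpLq p₂ q₂ T (sliceOp (Dop γ₂) (fun x t => g (x, t))) := by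
  obtain ⟨C, hC, h⟩ := MixedNorm.mixedNorm_Dop_Gbil_le hα0 hα1 hγ₁0 hγ₁1 hγ₂0 hγ₂1 hγ
    (MixedNorm.one_lt_toReal hp hp') (MixedNorm.one_lt_toReal hq hq')
    (MixedNorm.one_lt_toReal hp₁ hp₁') (MixedNorm.one_lt_toReal hq₁ hq₁')
    (MixedNorm.one_lt_toReal hp₂ hp₂') (MixedNorm.one_lt_toReal hq₂ hq₂')
    (MixedNorm.one_div_toReal_add hp₁ hp₂ hpsum) (MixedNorm.one_div_toReal_add hq₁ hq₂ hqsum)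
  have nz : ∀ {r : ℝ≥0∞}, 1 < r → r ≠ 0 := fun hr => (zero_lt_one.trans hr).ne'
  have key : ∀ {γ : ℝ} {r s : ℝ≥0∞}, 0 ≤ γ → γ ≤ 1 → 1 < r → r ≠ ∞ → 1 < s → s ≠ ∞ →
      ∀ (T : ℝ) (f : SchwartzMap (ℝ × ℝ) ℂ),
      MixedNorm.mixedNorm r.toReal s.toReal (volume.restrict (Ioc (0 : ℝ) T))
        (fun x t => ‖Dop γ (MixedNorm.slice f t) x‖ₑ) ≤
        LpLq r s T (sliceOp (Dop γ) (fun x t => f (x, t))) := by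
    intro γ r s h0 h1 hr hr' hs hs' T f
    obtain ⟨M, hM⟩ := MixedNorm.exists_density_sliceDensity h0 h1 f
    refine MixedNorm.mixedNorm_le_LpLq (nz hr) hr' (nz hs) hs' T fun x => ?_
    have := MixedNorm.eLpNorm_wave_ne_top hM s x (volume.restrict (Ioc (0 : ℝ) T))
    simp only [MixedNorm.wave_sliceDensity] at this
    exact this
  refine ⟨C.toNNReal + 1, by positivity, fun T _ f g => ?_⟩
  refine (MixedNorm.LpLq_le_mixedNorm (nz hp) hp' (nz hq) hq' T _).trans ((h _ f g).trans ?_)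
  rw [mul_assoc]
  refine mul_le_mul' ?_ (mul_le_mul' (key hγ₁0 hγ₁1 hp₁ hp₁' hq₁ hq₁' T f)
    (key hγ₂0 hγ₂1 hp₂ hp₂' hq₂ hq₂' T g))
  rw [ENNReal.coe_add, ENNReal.coe_toNNReal hC]
  exact le_self_add

end
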